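/- Let d = 2 and let M be the global spherical maximal function on ℝ². Then M is bounded on the weighted space L^p(|x|^{-1}) (i.e., there is a constant C with ∫_{ℝ²} |Mf(x)|^p |x|^{-1} dx ≤ C ∫_{ℝ²} |f(x)|^p |x|^{-1} dx for all f) if and only if p > 2. -/

import Mathlib

open MeasureTheory Metric Complex Set Pointwise
open scoped FourierTransform ENNReal NNReal

noncomputable section

/-- The (unnormalized) surface measure on the unit sphere `S^{d-1} ⊆ ℝ^d`. -/
def sphereMeasure (d : ℕ) : Measure (Metric.sphere (0 : EuclideanSpace ℝ (Fin d)) 1) :=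
  (volume : Measure (EuclideanSpace ℝ (Fin d))).toSphere

/-- Spherical average `A_t f(x) = ∫_{S^{d-1}} f(x - ty) dσ(y)`, where `dσ` is the
normalized surface measure on the unit sphere. -/
def sphAvg (d : ℕ) (f : EuclideanSpace ℝ (Fin d) → ℂ) (t : ℝ)
    (x : EuclideanSpace ℝ (Fin d)) : ℂ :=
  ⨍ y, f (x - t • (y : EuclideanSpace ℝ (Fin d))) ∂(sphereMeasure d)

/-- Global spherical maximal function `Mf(x) = sup_{t>0} |A_t f(x)|`. -/
def sphMax (d : ℕ) (f : EuclideanSpace ℝ (Fin d) → ℂ)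
    (x : EuclideanSpace ℝ (Fin d)) : ℝ≥0∞ :=
  ⨆ (t : ℝ) (_ : 0 < t), (‖sphAvg d f t x‖₊ : ℝ≥0∞)

/-- Local spherical maximal function `M_c f(x) = sup_{1<t<2} |A_t f(x)|`. -/
def sphMaxLoc (d : ℕ) (f : EuclideanSpace ℝ (Fin d) → ℂ)
    (x : EuclideanSpace ℝ (Fin d)) : ℝ≥0∞ :=
  ⨆ (t : ℝ) (_ : t ∈ Ioo (1:ℝ) 2), (‖sphAvg d f t x‖₊ : ℝ≥0∞)

/-- Littlewood–Paley projection `P_j`, determined by `(P_j f)^(ξ) = χ(|ξ|/2^j) f̂(ξ)`. -/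
def proj (d : ℕ) (χ : ℝ → ℝ) (j : ℤ) (f : EuclideanSpace ℝ (Fin d) → ℂ) :
    EuclideanSpace ℝ (Fin d) → ℂ :=
  𝓕⁻ (fun ξ => (χ (‖ξ‖ / 2 ^ j) : ℂ) * 𝓕 f ξ)

/-- Projection `P_{<n}`, determined by `(P_{<n} f)^(ξ) = (Σ_{j<n} χ(|ξ|/2^j)) f̂(ξ)`. -/
def projLT (d : ℕ) (χ : ℝ → ℝ) (n : ℤ) (f : EuclideanSpace ℝ (Fin d) → ℂ) :
    EuclideanSpace ℝ (Fin d) → ℂ :=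
  𝓕⁻ (fun ξ => ((∑' j : ℤ, if j < n then χ (‖ξ‖ / 2 ^ j) else 0 : ℝ) : ℂ) * 𝓕 f ξ)

/-- The weight `|x|^{1-d}`, as an `ℝ≥0∞`-valued function. -/
def wt (d : ℕ) (x : EuclideanSpace ℝ (Fin d)) : ℝ≥0∞ :=
  ENNReal.ofReal (‖x‖ ^ ((1:ℝ) - d))

namespace SM

/-- mixed second difference of a product `ψ(r-s)χ(r+s)`. -/
lemma mixed_diff (ψ ψ1 ψ2 χ χ1 χ2 : ℝ → ℝ) (t t' δ M : ℝ) 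
    (hψ : ∀ r r', |r - t| ≤ δ → |r' - t'| ≤ δ → HasDerivAt ψ (ψ1 (r - r')) (r - r'))
    (hψ1 : ∀ r r', |r - t| ≤ δ → |r' - t'| ≤ δ → HasDerivAt ψ1 (ψ2 (r - r')) (r - r'))
    (hχ : ∀ r r', |r - t| ≤ δ → |r' - t'| ≤ δ → HasDerivAt χ (χ1 (r + r')) (r + r'))
    (hχ1 : ∀ r r', |r - t| ≤ δ → |r' - t'| ≤ δ → HasDerivAt χ1 (χ2 (r + r')) (r + r'))
    (hM : ∀ r r', |r - t| ≤ δ → |r' - t'| ≤ δ →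
      |-(ψ2 (r - r') * χ (r + r')) + ψ (r - r') * χ2 (r + r')| ≤ M)
    (r r' : ℝ) (hr : |r - t| ≤ δ) (hr' : |r' - t'| ≤ δ) :
    |ψ (r - r') * χ (r + r') - ψ (r - t') * χ (r + t') - ψ (t - r') * χ (t + r')
      + ψ (t - t') * χ (t + t')| ≤ M * δ ^ 2 := by
  have hδ : 0 ≤ δ := (abs_nonneg _).trans hr
  have hM0 : 0 ≤ M := (abs_nonneg _).trans (hM r r' hr hr')
  have hconv : ∀ a : ℝ, Convex ℝ {r : ℝ | |r - a| ≤ δ} := fun a => by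
    have : {r : ℝ | |r - a| ≤ δ} = closedBall a δ := by
      ext x; simp [Real.dist_eq]
    rw [this]; exact convex_closedBall a δ
  have h0 : ∀ a : ℝ, |a - a| ≤ δ := fun a => by simpa using hδ
  have key1 : ∀ x, |x - t| ≤ δ → 
      ‖(ψ1 (x - r') * χ (x + r') + ψ (x - r') * χ1 (x + r')) 
        - (ψ1 (x - t') * χ (x + t') + ψ (x - t') * χ1 (x + t'))‖ ≤ M * ‖r' - t'‖ := by
    intro x hx
    refine (hconv t').norm_image_sub_le_of_norm_hasDerivWithin_le 
      (f := fun s => ψ1 (x - s) * χ (x + s) + ψ (x - s) * χ1 (x + s))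
      (f' := fun s => -(ψ2 (x - s) * χ (x + s)) + ψ (x - s) * χ2 (x + s)) ?_ ?_ (h0 t') hr'
    · intro s hs
      have e1 : HasDerivAt (fun s => x - s) (-1) s := by simpa using (hasDerivAt_id s).const_sub x
      have e2 : HasDerivAt (fun s => x + s) 1 s := by simpa using (hasDerivAt_id s).const_add x
      have a1 := (hψ x s hx hs).comp s e1
      have a2 := (hψ1 x s hx hs).comp s e1
      have a3 := (hχ x s hx hs).comp s e2
      have a4 := (hχ1 x s hx hs).comp s e2
      have := ((a2.mul a3).add (a1.mul a4)).hasDerivWithinAt (s := {r : ℝ | |r - t'| ≤ δ})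
      refine this.congr_deriv ?_
      simp only [Function.comp]; ring
    · intro s hs; exact hM x s hx hs
  have key2 := (hconv t).norm_image_sub_le_of_norm_hasDerivWithin_le 
      (f := fun x => ψ (x - r') * χ (x + r') - ψ (x - t') * χ (x + t'))
      (f' := fun x => (ψ1 (x - r') * χ (x + r') + ψ (x - r') * χ1 (x + r')) 
        - (ψ1 (x - t') * χ (x + t') + ψ (x - t') * χ1 (x + t'))) 
      (C := M * ‖r' - t'‖) ?_ ?_ (h0 t) hr
  · have e : ψ (r - r') * χ (r + r') - ψ (r - t') * χ (r + t') - ψ (t - r') * χ (t + r')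
      + ψ (t - t') * χ (t + t') = ψ (r - r') * χ (r + r') - ψ (r - t') * χ (r + t') - 
        (ψ (t - r') * χ (t + r') - ψ (t - t') * χ (t + t')) := by ring
    rw [e]
    refine key2.trans ?_
    simp only [Real.norm_eq_abs]
    calc M * |r' - t'| * |r - t| ≤ M * δ * δ := by gcongr
      _ = _ := by ring
  · intro x hx
    have e1 : ∀ s, HasDerivAt (fun x => x - s) 1 x := fun s => (hasDerivAt_id x).sub_const s
    have e2 : ∀ s, HasDerivAt (fun x => x + s) 1 x := fun s => (hasDerivAt_id x).add_const s
    have a1 := (hψ x r' hx hr').comp x (e1 r')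
    have a3 := (hχ x r' hx hr').comp x (e2 r')
    have b1 := (hψ x t' hx (h0 t')).comp x (e1 t')
    have b3 := (hχ x t' hx (h0 t')).comp x (e2 t')
    have := ((a1.mul a3).sub (b1.mul b3)).hasDerivWithinAt (s := {r : ℝ | |r - t| ≤ δ})
    refine this.congr_deriv ?_
    simp only [Function.comp]; ring
  · exact key1

/-- derivatives of the elementary functions -/
lemma hd_g1 (τ p : ℝ) (h : 0 < τ ^ 2 - p ^ 2) :
    HasDerivAt (fun p : ℝ => (τ ^ 2 - p ^ 2) ^ (-(1/2) : ℝ)) (p * (τ ^ 2 - p ^ 2) ^ (-(3/2) : ℝ)) p := by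
  have h1 : HasDerivAt (fun p : ℝ => τ ^ 2 - p ^ 2) (-(2 * p)) p := by
    simpa using (hasDerivAt_pow 2 p).const_sub (τ ^ 2)
  refine (h1.rpow_const (p := -(1/2)) (Or.inl h.ne')).congr_deriv ?_
  rw [show (-(1/2) : ℝ) - 1 = -(3/2) by norm_num]; ring

lemma hd_g1' (τ p : ℝ) (h : 0 < τ ^ 2 - p ^ 2) :
    HasDerivAt (fun p : ℝ => p * (τ ^ 2 - p ^ 2) ^ (-(3/2) : ℝ)) 
      ((τ ^ 2 - p ^ 2) ^ (-(3/2) : ℝ) + 3 * p ^ 2 * (τ ^ 2 - p ^ 2) ^ (-(5/2) : ℝ)) p := by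
  have h1 : HasDerivAt (fun p : ℝ => τ ^ 2 - p ^ 2) (-(2 * p)) p := by
    simpa using (hasDerivAt_pow 2 p).const_sub (τ ^ 2)
  refine ((hasDerivAt_id p).mul (h1.rpow_const (p := -(3/2)) (Or.inl h.ne'))).congr_deriv ?_
  norm_num; ring

lemma hd_h1 (τ p : ℝ) (h : 0 < τ ^ 2 - p ^ 2) :
    HasDerivAt (fun p : ℝ => p * (τ ^ 2 - p ^ 2) ^ (-(1/2) : ℝ)) (τ ^ 2 * (τ ^ 2 - p ^ 2) ^ (-(3/2) : ℝ)) p := by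
  refine ((hasDerivAt_id p).mul (hd_g1 τ p h)).congr_deriv ?_
  have : (τ ^ 2 - p ^ 2) ^ (-(1/2) : ℝ) = (τ ^ 2 - p ^ 2) * (τ ^ 2 - p ^ 2) ^ (-(3/2) : ℝ) := by
    rw [← Real.rpow_one_add' h.le (by norm_num)]; norm_num
  rw [this]; simp only [id]; ring

lemma hd_h1' (τ p : ℝ) (h : 0 < τ ^ 2 - p ^ 2) :
    HasDerivAt (fun p : ℝ => τ ^ 2 * (τ ^ 2 - p ^ 2) ^ (-(3/2) : ℝ)) 
      (3 * τ ^ 2 * p * (τ ^ 2 - p ^ 2) ^ (-(5/2) : ℝ)) p := by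
  have h1 : HasDerivAt (fun p : ℝ => τ ^ 2 - p ^ 2) (-(2 * p)) p := by
    simpa using (hasDerivAt_pow 2 p).const_sub (τ ^ 2)
  refine ((h1.rpow_const (p := -(3/2)) (Or.inl h.ne')).const_mul (τ ^ 2)).congr_deriv ?_
  norm_num; ring

lemma hd_g2 (τ p : ℝ) (h : 0 < p ^ 2 - τ ^ 2) :
    HasDerivAt (fun p : ℝ => (p ^ 2 - τ ^ 2) ^ (-(1/2) : ℝ)) (-p * (p ^ 2 - τ ^ 2) ^ (-(3/2) : ℝ)) p := by
  have h1 : HasDerivAt (fun p : ℝ => p ^ 2 - τ ^ 2) (2 * p) p := by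
    simpa using (hasDerivAt_pow 2 p).sub_const (τ ^ 2)
  refine (h1.rpow_const (p := -(1/2)) (Or.inl h.ne')).congr_deriv ?_
  rw [show (-(1/2) : ℝ) - 1 = -(3/2) by norm_num]; ring

lemma hd_g2' (τ p : ℝ) (h : 0 < p ^ 2 - τ ^ 2) :
    HasDerivAt (fun p : ℝ => -p * (p ^ 2 - τ ^ 2) ^ (-(3/2) : ℝ)) 
      (-(p ^ 2 - τ ^ 2) ^ (-(3/2) : ℝ) + 3 * p ^ 2 * (p ^ 2 - τ ^ 2) ^ (-(5/2) : ℝ)) p := by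
  have h1 : HasDerivAt (fun p : ℝ => p ^ 2 - τ ^ 2) (2 * p) p := by
    simpa using (hasDerivAt_pow 2 p).sub_const (τ ^ 2)
  refine (((hasDerivAt_id p).neg).mul (h1.rpow_const (p := -(3/2)) (Or.inl h.ne'))).congr_deriv ?_
  norm_num; ring

lemma hd_h2 (τ p : ℝ) (h : 0 < p ^ 2 - τ ^ 2) :
    HasDerivAt (fun p : ℝ => p * (p ^ 2 - τ ^ 2) ^ (-(1/2) : ℝ)) (-τ ^ 2 * (p ^ 2 - τ ^ 2) ^ (-(3/2) : ℝ)) p := by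
  refine ((hasDerivAt_id p).mul (hd_g2 τ p h)).congr_deriv ?_
  have : (p ^ 2 - τ ^ 2) ^ (-(1/2) : ℝ) = (p ^ 2 - τ ^ 2) * (p ^ 2 - τ ^ 2) ^ (-(3/2) : ℝ) := by
    rw [← Real.rpow_one_add' h.le (by norm_num)]; norm_num
  rw [this]; simp only [id]; ring

lemma hd_h2' (τ p : ℝ) (h : 0 < p ^ 2 - τ ^ 2) :
    HasDerivAt (fun p : ℝ => -τ ^ 2 * (p ^ 2 - τ ^ 2) ^ (-(3/2) : ℝ)) 
      (3 * τ ^ 2 * p * (p ^ 2 - τ ^ 2) ^ (-(5/2) : ℝ)) p := by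
  have h1 : HasDerivAt (fun p : ℝ => p ^ 2 - τ ^ 2) (2 * p) p := by
    simpa using (hasDerivAt_pow 2 p).sub_const (τ ^ 2)
  refine ((h1.rpow_const (p := -(3/2)) (Or.inl h.ne')).const_mul (-τ ^ 2)).congr_deriv ?_
  norm_num; ring

end SM

namespace SM

/-- smooth weights: bounded by one, with a first order Taylor expansion with constants controlled by `L`. -/
structure TW (L : ℝ) (w : ℂ → ℝ) : Prop where
  bd : ∀ y, |w y| ≤ 1
  cont : Continuous w
  tay : ∀ y0, ∃ b1 b2 : ℝ, |b1| ≤ L ∧ |b2| ≤ L ∧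
    ∀ y, |w y - w y0 - b1 * (y - y0).re - b2 * (y - y0).im| ≤ L ^ 2 * ‖y - y0‖ ^ 2

/-- Coordinates. -/
def uu (τ r r' : ℝ) : ℝ := (r ^ 2 - r' ^ 2 + τ ^ 2) / (2 * τ)
def vv (τ r r' : ℝ) : ℝ := √((τ ^ 2 - (r - r') ^ 2) * ((r + r') ^ 2 - τ ^ 2)) / (2 * τ)
def NI (τ r r' : ℝ) : ℝ := 2 * ((τ ^ 2 - (r - r') ^ 2) ^ (-(1/2) : ℝ) * ((r + r') ^ 2 - τ ^ 2) ^ (-(1/2) : ℝ))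

/-- the standing geometric hypotheses -/
structure Geo (t t' δ τ : ℝ) : Prop where
  δ0 : 0 < δ
  δ1 : δ ≤ 1/8
  t1 : 1 ≤ t
  t2 : t ≤ 2
  t1' : 1 ≤ t'
  t2' : t' ≤ 2
  τ0 : 0 < τ
  τ1 : τ ≤ 1/2
  hΔ : 4 * δ ≤ τ - |t - t'|

lemma Geo.box {t t' δ τ r r' : ℝ} (h : Geo t t' δ τ) (hr : |r - t| ≤ δ) (hr' : |r' - t'| ≤ δ) :
    τ * (τ - |t - t'|) / 2 ≤ τ ^ 2 - (r - r') ^ 2 ∧ 1 ≤ (r + r') ^ 2 - τ ^ 2 ∧ (r + r') ≤ 17/4 ∧ 7/4 ≤ r + r'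
     ∧ |r - r'| ≤ τ := by
  obtain ⟨δ0, δ1, t1, t2, t1', t2', τ0, τ1, hΔ⟩ := h
  have hp : |r - r'| ≤ τ - (τ - |t - t'|) / 2 := by
    have : |r - r'| ≤ |r - t| + |t - t'| + |r' - t'| := by
      have e : r - r' = (r - t) + (t - t') - (r' - t') := by ring
      rw [e]; exact (abs_sub _ _).trans (by gcongr; exact abs_add_le _ _)
    linarith
  have hD : 0 < τ - |t - t'| := by linarith
  have h0 := abs_nonneg (r - r')
  have h0' := abs_nonneg (t - t')
  refine ⟨?_, ?_, ?_, ?_, by linarith⟩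
  · rw [← sq_abs (r - r')]
    nlinarith
  · rw [abs_le] at hr hr'
    nlinarith
  · rw [abs_le] at hr hr'
    linarith
  · rw [abs_le] at hr hr'
    linarith

lemma pw_bounds {S0 S τ : ℝ} (h0 : 0 < S0) (h : S0 ≤ S) (hτ : S ≤ τ ^ 2) :
    S ^ (-(5/2) : ℝ) ≤ S0 ^ (-(5/2) : ℝ) ∧ S ^ (-(3/2) : ℝ) ≤ τ ^ 2 * S0 ^ (-(5/2) : ℝ) ∧
    S ^ (-(1/2) : ℝ) ≤ τ ^ 4 * S0 ^ (-(5/2) : ℝ) ∧ 0 ≤ S ^ (-(5/2) : ℝ) ∧ 0 ≤ S ^ (-(3/2) : ℝ) ∧ 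
    0 ≤ S ^ (-(1/2) : ℝ) ∧ 0 ≤ S0 ^ (-(5/2) : ℝ) := by
  have hS : 0 < S := h0.trans_le h
  have a : S ^ (-(5/2) : ℝ) ≤ S0 ^ (-(5/2) : ℝ) :=
    Real.rpow_le_rpow_of_nonpos h0 h (by norm_num)
  have e1 : S ^ (-(3/2) : ℝ) = S * S ^ (-(5/2) : ℝ) := by
    rw [← Real.rpow_one_add' hS.le (by norm_num)]; norm_num
  have e2 : S ^ (-(1/2) : ℝ) = S ^ 2 * S ^ (-(5/2) : ℝ) := by
    rw [← Real.rpow_natCast S 2, ← Real.rpow_add hS]; norm_num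
  have p5 : 0 ≤ S ^ (-(5/2) : ℝ) := by positivity
  refine ⟨a, ?_, ?_, p5, by positivity, by positivity, by positivity⟩
  · rw [e1]; gcongr
  · rw [e2, show τ ^ 4 = (τ ^ 2) ^ 2 by ring]; gcongr

lemma pw_le_one {Q : ℝ} (h : 1 ≤ Q) (a : ℝ) (ha : a ≤ 0) : 0 ≤ Q ^ a ∧ Q ^ a ≤ 1 :=
  ⟨by positivity, Real.rpow_le_one_of_one_le_of_nonpos h ha⟩

lemma D_g {t t' δ τ r r' : ℝ} (h : Geo t t' δ τ) (hr : |r - t| ≤ δ) (hr' : |r' - t'| ≤ δ) :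
    |NI τ r r' - NI τ r t' - NI τ t r' + NI τ t t'| 
      ≤ 40 * τ ^ 2 * (τ * (τ - |t - t'|) / 2) ^ (-(5/2) : ℝ) * δ ^ 2 := by
  have hD : 0 < τ * (τ - |t - t'|) / 2 := by
    have := h.hΔ; have := h.δ0; have := h.τ0
    have : 0 < τ - |t - t'| := by linarith
    positivity
  set S0 := τ * (τ - |t - t'|) / 2 with hS0
  have := mixed_diff (fun p => (τ ^ 2 - p ^ 2) ^ (-(1/2) : ℝ)) (fun p => p * (τ ^ 2 - p ^ 2) ^ (-(3/2) : ℝ))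
    (fun p => (τ ^ 2 - p ^ 2) ^ (-(3/2) : ℝ) + 3 * p ^ 2 * (τ ^ 2 - p ^ 2) ^ (-(5/2) : ℝ))
    (fun p => (p ^ 2 - τ ^ 2) ^ (-(1/2) : ℝ)) (fun p => -p * (p ^ 2 - τ ^ 2) ^ (-(3/2) : ℝ))
    (fun p => -(p ^ 2 - τ ^ 2) ^ (-(3/2) : ℝ) + 3 * p ^ 2 * (p ^ 2 - τ ^ 2) ^ (-(5/2) : ℝ))
    t t' δ (20 * τ ^ 2 * S0 ^ (-(5/2) : ℝ))
    (fun r r' a b => hd_g1 τ _ (hD.trans_le (h.box a b).1))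
    (fun r r' a b => hd_g1' τ _ (hD.trans_le (h.box a b).1))
    (fun r r' a b => hd_g2 τ _ (zero_lt_one.trans_le (h.box a b).2.1))
    (fun r r' a b => hd_g2' τ _ (zero_lt_one.trans_le (h.box a b).2.1))
    ?_ r r' hr hr'
  · unfold NI
    rw [← mul_sub, ← mul_sub, ← mul_add, abs_mul, abs_two]
    linarith
  · intro r r' a b
    obtain ⟨h1, h2, h3, h3', h4⟩ := h.box a b
    set p := r - r'
    set q := r + r'
    have hp2 : p ^ 2 ≤ τ ^ 2 := by rw [← sq_abs p]; gcongr
    have hτ2 : τ ^ 2 ≤ 1/4 := by nlinarith [h.τ0, h.τ1]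
    obtain ⟨b5, b3, b1, n5, n3, n1, n0⟩ := pw_bounds (τ := τ) hD h1 (by nlinarith [sq_nonneg p])
    obtain ⟨c1, c1'⟩ := pw_le_one h2 (-(1/2)) (by norm_num)
    obtain ⟨c3, c3'⟩ := pw_le_one h2 (-(3/2)) (by norm_num)
    obtain ⟨c5, c5'⟩ := pw_le_one h2 (-(5/2)) (by norm_num)
    have hq2 : q ^ 2 ≤ 289/16 := by nlinarith
    have A1 : |((τ ^ 2 - p ^ 2) ^ (-(3/2) : ℝ) + 3 * p ^ 2 * (τ ^ 2 - p ^ 2) ^ (-(5/2) : ℝ))| ≤ 4 * τ ^ 2 * S0 ^ (-(5/2) : ℝ) := by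
      rw [abs_of_nonneg (by positivity)]
      have : p ^ 2 * (τ ^ 2 - p ^ 2) ^ (-(5/2) : ℝ) ≤ τ ^ 2 * S0 ^ (-(5/2) : ℝ) := by gcongr
      nlinarith
    have A2 : |-(q ^ 2 - τ ^ 2) ^ (-(3/2) : ℝ) + 3 * q ^ 2 * (q ^ 2 - τ ^ 2) ^ (-(5/2) : ℝ)| ≤ 60 := by
      have : 3 * q ^ 2 * (q ^ 2 - τ ^ 2) ^ (-(5/2) : ℝ) ≤ 3 * (289/16) * 1 := by gcongr
      have : 0 ≤ 3 * q ^ 2 * (q ^ 2 - τ ^ 2) ^ (-(5/2) : ℝ) := by positivity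
      rw [abs_le]; constructor <;> linarith
    have B1 : |(τ ^ 2 - p ^ 2) ^ (-(1/2) : ℝ)| ≤ (1/4) * τ ^ 2 * S0 ^ (-(5/2) : ℝ) := by
      rw [abs_of_nonneg n1]
      refine b1.trans ?_
      gcongr
      nlinarith [sq_nonneg τ]
    have B2 : |(q ^ 2 - τ ^ 2) ^ (-(1/2) : ℝ)| ≤ 1 := by rw [abs_of_nonneg c1]; exact c1'
    refine (abs_add_le _ _).trans ?_
    rw [abs_neg, abs_mul, abs_mul]
    have X1 := mul_le_mul A1 B2 (abs_nonneg _) (by positivity)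
    have X2 := mul_le_mul B1 A2 (abs_nonneg _) (by positivity)
    have : 0 ≤ τ ^ 2 * S0 ^ (-(5/2) : ℝ) := by positivity
    linarith

lemma D_h {t t' δ τ r r' : ℝ} (h : Geo t t' δ τ) (hr : |r - t| ≤ δ) (hr' : |r' - t'| ≤ δ) :
    |uu τ r r' * NI τ r r' - uu τ r t' * NI τ r t' - uu τ t r' * NI τ t r' + uu τ t t' * NI τ t t'| 
      ≤ 40 * τ ^ 2 * (τ * (τ - |t - t'|) / 2) ^ (-(5/2) : ℝ) * δ ^ 2 := by
  have hD : 0 < τ * (τ - |t - t'|) / 2 := by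
    have := h.hΔ; have := h.δ0; have := h.τ0
    have : 0 < τ - |t - t'| := by linarith
    positivity
  have h0 := D_g h hr hr'
  set S0 := τ * (τ - |t - t'|) / 2 with hS0
  have hτ := h.τ0
  have := mixed_diff (fun p => p * (τ ^ 2 - p ^ 2) ^ (-(1/2) : ℝ)) (fun p => τ ^ 2 * (τ ^ 2 - p ^ 2) ^ (-(3/2) : ℝ))
    (fun p => 3 * τ ^ 2 * p * (τ ^ 2 - p ^ 2) ^ (-(5/2) : ℝ))
    (fun p => p * (p ^ 2 - τ ^ 2) ^ (-(1/2) : ℝ)) (fun p => -τ ^ 2 * (p ^ 2 - τ ^ 2) ^ (-(3/2) : ℝ))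
    (fun p => 3 * τ ^ 2 * p * (p ^ 2 - τ ^ 2) ^ (-(5/2) : ℝ))
    t t' δ (14 * τ ^ 3 * S0 ^ (-(5/2) : ℝ))
    (fun r r' a b => hd_h1 τ _ (hD.trans_le (h.box a b).1))
    (fun r r' a b => hd_h1' τ _ (hD.trans_le (h.box a b).1))
    (fun r r' a b => hd_h2 τ _ (zero_lt_one.trans_le (h.box a b).2.1))
    (fun r r' a b => hd_h2' τ _ (zero_lt_one.trans_le (h.box a b).2.1))
    ?_ r r' hr hr'
  · have e : ∀ r r', uu τ r r' * NI τ r r' = τ⁻¹ * ((r - r') * (τ ^ 2 - (r - r') ^ 2) ^ (-(1/2) : ℝ) * ((r + r') * ((r + r') ^ 2 - τ ^ 2) ^ (-(1/2) : ℝ))) + τ / 2 * NI τ r r' := by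
      intro r r'
      unfold uu NI
      field_simp
      ring
    rw [e, e, e, e]
    have e2 : ∀ a b c d a' b' c' d' : ℝ, (τ⁻¹ * a + τ / 2 * a') - (τ⁻¹ * b + τ / 2 * b') - (τ⁻¹ * c + τ / 2 * c') + (τ⁻¹ * d + τ / 2 * d')
       = τ⁻¹ * (a - b - c + d) + τ / 2 * (a' - b' - c' + d') := by intros; ring
    rw [e2]
    refine (abs_add_le _ _).trans ?_
    rw [abs_mul, abs_mul, abs_of_pos (inv_pos.2 hτ), abs_of_pos (half_pos hτ)]
    have X1 : τ⁻¹ * _ ≤ τ⁻¹ * _ := mul_le_mul_of_nonneg_left this (inv_pos.2 hτ).le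
    have X2 : τ / 2 * _ ≤ (1/4) * _ := mul_le_mul (by linarith [h.τ1]) h0 (abs_nonneg _) (by norm_num)
    refine (add_le_add X1 X2).trans ?_
    have e3 : τ⁻¹ * (14 * τ ^ 3 * S0 ^ (-(5/2) : ℝ) * δ ^ 2) = 14 * τ ^ 2 * S0 ^ (-(5/2) : ℝ) * δ ^ 2 := by
      field_simp
    rw [e3]
    have : 0 ≤ τ ^ 2 * S0 ^ (-(5/2) : ℝ) * δ ^ 2 := by positivity
    linarith
  · intro r r' a b
    obtain ⟨h1, h2, h3, h3', h4⟩ := h.box a b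
    set p := r - r'
    set q := r + r'
    have hp2 : p ^ 2 ≤ τ ^ 2 := by rw [← sq_abs p]; gcongr
    have hτ2 : τ ^ 2 ≤ 1/4 := by nlinarith [h.τ0, h.τ1]
    obtain ⟨b5, b3, b1, n5, n3, n1, n0⟩ := pw_bounds (τ := τ) hD h1 (by nlinarith [sq_nonneg p])
    obtain ⟨c1, c1'⟩ := pw_le_one h2 (-(1/2)) (by norm_num)
    obtain ⟨c5, c5'⟩ := pw_le_one h2 (-(5/2)) (by norm_num)
    have hq0 : 0 ≤ q := by linarith
    refine (abs_add_le _ _).trans ?_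
    rw [abs_neg]
    have X1 : |3 * τ ^ 2 * p * (τ ^ 2 - p ^ 2) ^ (-(5/2) : ℝ) * (q * (q ^ 2 - τ ^ 2) ^ (-(1/2) : ℝ))| ≤
      3 * τ ^ 2 * τ * S0 ^ (-(5/2) : ℝ) * (17/4 * 1) := by
      rw [abs_mul, abs_mul, abs_mul, abs_mul q, abs_of_nonneg (by positivity : 0 ≤ 3 * τ ^ 2), abs_of_nonneg n5, abs_of_nonneg hq0, abs_of_nonneg c1]
      gcongr
    have X2 : |p * (τ ^ 2 - p ^ 2) ^ (-(1/2) : ℝ) * (3 * τ ^ 2 * q * (q ^ 2 - τ ^ 2) ^ (-(5/2) : ℝ))| ≤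
      τ * (τ ^ 4 * S0 ^ (-(5/2) : ℝ)) * (3 * (1/4) * (17/4) * 1) := by
      rw [abs_mul, abs_mul, abs_mul (3 * τ ^ 2 * q), abs_mul (3 * τ ^ 2), abs_of_nonneg (by positivity : 0 ≤ 3 * τ ^ 2), abs_of_nonneg n1, abs_of_nonneg hq0, abs_of_nonneg c5]
      gcongr
    have : τ * (τ ^ 4 * S0 ^ (-(5/2) : ℝ)) ≤ (1/4) * τ ^ 3 * S0 ^ (-(5/2) : ℝ) := by
      have : τ * (τ ^ 4 * S0 ^ (-(5/2) : ℝ)) = τ ^ 2 * τ ^ 3 * S0 ^ (-(5/2) : ℝ) := by ring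
      rw [this]; gcongr
    have : 0 ≤ τ ^ 3 * S0 ^ (-(5/2) : ℝ) := by positivity
    refine (add_le_add X1 X2).trans ?_
    nlinarith

end SM

namespace SM

lemma Geo.S0pos {t t' δ τ : ℝ} (h : Geo t t' δ τ) : 0 < τ * (τ - |t - t'|) / 2 := by
  have := h.hΔ; have := h.δ0; have := h.τ0
  have : 0 < τ - |t - t'| := by linarith
  positivity

lemma NI_eq {t t' δ τ r r' : ℝ} (h : Geo t t' δ τ) (hr : |r - t| ≤ δ) (hr' : |r' - t'| ≤ δ) :
    0 < vv τ r r' ∧ NI τ r r' = (τ * vv τ r r')⁻¹ := by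
  obtain ⟨h1, h2, h3, h3', h4⟩ := h.box hr hr'
  have hS := h.S0pos.trans_le h1
  have hQ : 0 < (r + r') ^ 2 - τ ^ 2 := zero_lt_one.trans_le h2
  have hτ := h.τ0
  refine ⟨by unfold vv; positivity, ?_⟩
  unfold NI vv
  rw [← Real.mul_rpow hS.le hQ.le, Real.rpow_neg (by positivity), ← Real.sqrt_eq_rpow]
  field_simp

lemma uv_sq {τ r r' : ℝ} (hτ : τ ≠ 0) (h : 0 ≤ (τ ^ 2 - (r - r') ^ 2) * ((r + r') ^ 2 - τ ^ 2)) :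
    uu τ r r' ^ 2 + vv τ r r' ^ 2 = r ^ 2 ∧ (uu τ r r' - τ) ^ 2 + vv τ r r' ^ 2 = r' ^ 2 := by
  unfold uu vv
  rw [div_pow, div_pow, Real.sq_sqrt h]
  constructor <;> field_simp <;> ring

lemma Y_diff {t t' δ τ r r' : ℝ} (h : Geo t t' δ τ) (hr : |r - t| ≤ δ) (hr' : |r' - t'| ≤ δ) :
    (uu τ r r' - uu τ t t') ^ 2 + (vv τ r r' - vv τ t t') ^ 2 ≤ 1500 * δ ^ 2 / (τ * (τ - |t - t'|) / 2) := by
  have hδ := h.δ0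
  have hδ1 := h.δ1
  have hτ := h.τ0
  have hτ1 := h.τ1
  have h00 : ∀ a : ℝ, |a - a| ≤ δ := fun a => by simpa using hδ.le
  obtain ⟨a1, a2, a3, a3', a4⟩ := h.box hr hr'
  obtain ⟨b1, b2, b3, b3', b4⟩ := h.box (h00 t) (h00 t')
  have hS0 := h.S0pos
  have hSτ : τ * (τ - |t - t'|) / 2 ≤ τ ^ 2 / 2 := by
    have := mul_nonneg hτ.le (abs_nonneg (t - t')); linarith only [this]
  have hD : 0 < τ - |t - t'| := by linarith [h.hΔ]
  set S0 := τ * (τ - |t - t'|) / 2 with hS0def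
  have hu : (uu τ r r' - uu τ t t') ^ 2 ≤ 50 * δ ^ 2 / S0 := by
    have e : uu τ r r' - uu τ t t' = ((r - t) * (r + t) - (r' - t') * (r' + t')) / (2 * τ) := by
      unfold uu; field_simp; ring
    have A : |r + t| ≤ 5 := by
      have := h.t1; have := h.t2; rw [abs_le] at hr ⊢; constructor <;> linarith
    have A' : |r' + t'| ≤ 5 := by
      have := h.t1'; have := h.t2'; rw [abs_le] at hr' ⊢; constructor <;> linarith
    have B : |(r - t) * (r + t) - (r' - t') * (r' + t')| ≤ 10 * δ := by
      refine (abs_sub _ _).trans ?_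
      rw [abs_mul, abs_mul]
      have := mul_le_mul hr A (abs_nonneg _) hδ.le
      have := mul_le_mul hr' A' (abs_nonneg _) hδ.le
      linarith
    rw [e, div_pow, ← sq_abs, div_le_div_iff₀ (by positivity) hS0]
    calc _ ≤ (10 * δ) ^ 2 * (τ ^ 2 / 2) := by gcongr
      _ ≤ _ := by have : 0 ≤ δ ^ 2 * τ ^ 2 := by positivity
                  linarith
  have hv : (vv τ r r' - vv τ t t') ^ 2 ≤ 1450 * δ ^ 2 / S0 := by
    set X := (τ ^ 2 - (r - r') ^ 2) * ((r + r') ^ 2 - τ ^ 2) with hX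
    set X0 := (τ ^ 2 - (t - t') ^ 2) * ((t + t') ^ 2 - τ ^ 2) with hX0
    have X1 : S0 ≤ X := by
      have := mul_le_mul a1 a2 zero_le_one (hS0.le.trans a1); linarith
    have Y1 : S0 ≤ X0 := by
      have := mul_le_mul b1 b2 zero_le_one (hS0.le.trans b1); linarith
    have hp : |(r - r') ^ 2 - (t - t') ^ 2| ≤ 4 * δ * τ := by
      have e : (r - r') ^ 2 - (t - t') ^ 2 = ((r - t) - (r' - t')) * ((r - r') + (t - t')) := by ring
      rw [e, abs_mul]
      have := (abs_sub (r - t) (r' - t'))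
      have := abs_add_le (r - r') (t - t')
      calc _ ≤ (2 * δ) * (2 * τ) := by gcongr <;> linarith
        _ = _ := by ring
    have hq : |(r + r') ^ 2 - (t + t') ^ 2| ≤ 17 * δ := by
      have e : (r + r') ^ 2 - (t + t') ^ 2 = ((r - t) + (r' - t')) * ((r + r') + (t + t')) := by ring
      rw [e, abs_mul]
      have := (abs_add_le (r - t) (r' - t'))
      have : |(r + r') + (t + t')| ≤ 17/2 := by rw [abs_le]; constructor <;> linarith
      calc _ ≤ (2 * δ) * (17/2) := by gcongr <;> linarith
        _ = _ := by ring
    have hXX : |X - X0| ≤ 90 * δ * τ := by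
      have e : X - X0 = -(((r - r') ^ 2 - (t - t') ^ 2) * ((r + r') ^ 2 - τ ^ 2)) + 
        (τ ^ 2 - (t - t') ^ 2) * ((r + r') ^ 2 - (t + t') ^ 2) := by rw [hX, hX0]; ring
      rw [e]
      refine (abs_add_le _ _).trans ?_
      rw [abs_neg, abs_mul, abs_mul]
      have c1 : |(r + r') ^ 2 - τ ^ 2| ≤ 19 := by
        have : (r + r') ^ 2 ≤ (17/4) ^ 2 := by gcongr
        have := sq_nonneg τ
        rw [abs_le]; constructor <;> linarith
      have c2 : |τ ^ 2 - (t - t') ^ 2| ≤ τ * (1/2) := by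
        have : τ ^ 2 ≤ τ * (1/2) := by rw [sq]; gcongr
        have := sq_nonneg (t - t')
        rw [abs_le]; constructor <;> linarith
      calc _ ≤ (4 * δ * τ) * 19 + (τ * (1/2)) * (17 * δ) := by gcongr
        _ ≤ _ := by have : 0 ≤ δ * τ := by positivity
                    linarith
    have hs : (√X - √X0) ^ 2 ≤ (90 * δ * τ) ^ 2 / (4 * S0) := by
      have e1 : (√X - √X0) * (√X + √X0) = X - X0 := by
        linear_combination Real.sq_sqrt (hS0.le.trans X1) - Real.sq_sqrt (hS0.le.trans Y1)
      have e2 : 4 * S0 ≤ (√X + √X0) ^ 2 := by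
        have i1 := Real.sqrt_le_sqrt X1
        have i2 := Real.sqrt_le_sqrt Y1
        calc 4 * S0 = (√S0 + √S0) ^ 2 := by rw [← two_mul, mul_pow, Real.sq_sqrt hS0.le]; norm_num
          _ ≤ _ := by gcongr
      rw [le_div_iff₀ (by positivity)]
      calc _ ≤ (√X - √X0) ^ 2 * (√X + √X0) ^ 2 := by gcongr
        _ = |X - X0| ^ 2 := by rw [← mul_pow, e1, sq_abs]
        _ ≤ _ := by gcongr
    have e : vv τ r r' - vv τ t t' = (√X - √X0) / (2 * τ) := by unfold vv; rw [hX, hX0]; ring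
    rw [e, div_pow, div_le_iff₀ (by positivity)]
    refine hs.trans ?_
    rw [div_mul_eq_mul_div, div_le_div_iff₀ (by positivity) hS0]
    have : 0 ≤ δ ^ 2 * τ ^ 2 * S0 := by positivity
    linarith
  have : 1500 * δ ^ 2 / S0 = 50 * δ ^ 2 / S0 + 1450 * δ ^ 2 / S0 := by ring
  linarith

lemma D_w {L t t' δ τ r r' : ℝ} {w : ℂ → ℝ} (hL : 1 ≤ L) (hw : TW L w) (h : Geo t t' δ τ)
    (hr : |r - t| ≤ δ) (hr' : |r' - t'| ≤ δ) :
    |w ⟨uu τ r r', vv τ r r'⟩ * NI τ r r' - w ⟨uu τ r t', vv τ r t'⟩ * NI τ r t'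
      - w ⟨uu τ t r', vv τ t r'⟩ * NI τ t r' + w ⟨uu τ t t', vv τ t t'⟩ * NI τ t t'| 
      ≤ 4800 * L ^ 2 * (τ ^ 2 * (τ * (τ - |t - t'|) / 2) ^ (-(5/2) : ℝ) * δ ^ 2) := by
  have hδ := h.δ0
  have hτ := h.τ0
  have h00 : ∀ a : ℝ, |a - a| ≤ δ := fun a => by simpa using hδ.le
  have dg := D_g h hr hr'
  have dh := D_h h hr hr'
  have hS0 := h.S0pos
  have hSτ : τ * (τ - |t - t'|) / 2 ≤ τ ^ 2 / 2 := by
    have := mul_nonneg hτ.le (abs_nonneg (t - t')); linarith only [this]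
  obtain ⟨b1, b2, hb1, hb2, hT⟩ := hw.tay ⟨uu τ t t', vv τ t t'⟩
  set u0 := uu τ t t' with hu0
  set v0 := vv τ t t' with hv0
  set S0 := τ * (τ - |t - t'|) / 2 with hS0def
  set E := τ ^ 2 * S0 ^ (-(5/2) : ℝ) * δ ^ 2 with hE
  have hE0 : 0 ≤ E := by positivity
  -- remainder
  let e : ℝ → ℝ → ℝ := fun r r' => w ⟨uu τ r r', vv τ r r'⟩ - w ⟨u0, v0⟩ - b1 * (uu τ r r' - u0) - b2 * (vv τ r r' - v0)
  have he : ∀ r r', |r - t| ≤ δ → |r' - t'| ≤ δ → |e r r' * NI τ r r'| ≤ 1500 * L ^ 2 * E := by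
    intro r r' hr hr'
    have h1 := hT ⟨uu τ r r', vv τ r r'⟩
    have h2 : ‖(⟨uu τ r r', vv τ r r'⟩ : ℂ) - ⟨u0, v0⟩‖ ^ 2 = (uu τ r r' - u0) ^ 2 + (vv τ r r' - v0) ^ 2 := by
      rw [← Complex.normSq_eq_norm_sq, Complex.normSq_apply]; simp; ring
    have h3 := Y_diff h hr hr'
    rw [h2] at h1
    have h1' : |e r r'| ≤ L ^ 2 * (1500 * δ ^ 2 / S0) := by
      refine le_trans h1 ?_
      gcongr
    obtain ⟨c1, c2, c3, c3', c4⟩ := h.box hr hr'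
    have h4 : |NI τ r r'| ≤ 2 * (S0 ^ 2 * S0 ^ (-(5/2) : ℝ)) := by
      unfold NI
      have e2 : S0 ^ (-(1/2) : ℝ) = S0 ^ 2 * S0 ^ (-(5/2) : ℝ) := by
        rw [← Real.rpow_natCast S0 2, ← Real.rpow_add hS0]; norm_num
      rw [← e2]
      have i1 : (τ ^ 2 - (r - r') ^ 2) ^ (-(1/2) : ℝ) ≤ S0 ^ (-(1/2) : ℝ) :=
        Real.rpow_le_rpow_of_nonpos hS0 c1 (by norm_num)
      obtain ⟨d1, d1'⟩ := pw_le_one c2 (-(1/2)) (by norm_num)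
      have d2 : 0 ≤ (τ ^ 2 - (r - r') ^ 2) ^ (-(1/2) : ℝ) := Real.rpow_nonneg (hS0.le.trans c1) _
      rw [abs_of_nonneg (by positivity)]
      have := mul_le_mul i1 d1' d1 (by positivity)
      linarith
    rw [abs_mul]
    refine (mul_le_mul h1' h4 (abs_nonneg _) (by positivity)).trans ?_
    have : L ^ 2 * (1500 * δ ^ 2 / S0) * (2 * (S0 ^ 2 * S0 ^ (-(5/2) : ℝ))) = 3000 * L ^ 2 * (S0 * S0 ^ (-(5/2) : ℝ) * δ ^ 2) := by
      field_simp; ring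
    rw [this, hE]
    calc _ ≤ 3000 * L ^ 2 * (τ ^ 2 / 2 * S0 ^ (-(5/2) : ℝ) * δ ^ 2) := by gcongr
      _ = _ := by ring
  have hv : ∀ r r', |r - t| ≤ δ → |r' - t'| ≤ δ → vv τ r r' * NI τ r r' = τ⁻¹ := by
    intro r r' hr hr'
    obtain ⟨a, b⟩ := NI_eq h hr hr'
    rw [b]; field_simp
  have hdec : ∀ r r', |r - t| ≤ δ → |r' - t'| ≤ δ → w ⟨uu τ r r', vv τ r r'⟩ * NI τ r r' = 
      (w ⟨u0, v0⟩ - b1 * u0 - b2 * v0) * NI τ r r' + b1 * (uu τ r r' * NI τ r r') + b2 * τ⁻¹ + e r r' * NI τ r r' := by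
    intro r r' hr hr'
    rw [← hv r r' hr hr']; simp only [e]; ring
  rw [hdec r r' hr hr', hdec r t' hr (h00 t'), hdec t r' (h00 t) hr', hdec t t' (h00 t) (h00 t')]
  have e0 : e t t' * NI τ t t' = 0 := by simp [e, hu0, hv0]
  rw [e0]
  set c0 := w ⟨u0, v0⟩ - b1 * u0 - b2 * v0 with hc0
  have hc : |c0| ≤ 5 * L := by
    have hnn : 0 ≤ (τ ^ 2 - (t - t') ^ 2) * ((t + t') ^ 2 - τ ^ 2) := by
      obtain ⟨c1, c2, _⟩ := h.box (h00 t) (h00 t')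
      exact mul_nonneg (hS0.le.trans c1) (zero_le_one.trans c2)
    have hs := (uv_sq hτ.ne' hnn).1
    rw [← hu0, ← hv0] at hs
    have ht2 : t ^ 2 ≤ 2 ^ 2 := by have := h.t1; have := h.t2; gcongr
    have hu : |u0| ≤ 2 := abs_le_of_sq_le_sq (by linarith [sq_nonneg v0]) (by norm_num)
    have hv : |v0| ≤ 2 := abs_le_of_sq_le_sq (by linarith [sq_nonneg u0]) (by norm_num)
    have hw0 := hw.bd ⟨u0, v0⟩
    calc |c0| ≤ |w ⟨u0, v0⟩ - b1 * u0| + |b2 * v0| := abs_sub _ _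
      _ ≤ |w ⟨u0, v0⟩| + |b1 * u0| + |b2 * v0| := by gcongr; exact abs_sub _ _
      _ ≤ 1 + L * 2 + L * 2 := by rw [abs_mul, abs_mul]; gcongr
      _ ≤ _ := by linarith
  have r1 := he r r' hr hr'
  have r2 := he r t' hr (h00 t')
  have r3 := he t r' (h00 t) hr'
  generalize e r r' * NI τ r r' = x1 at *
  generalize e r t' * NI τ r t' = x2 at *
  generalize e t r' * NI τ t r' = x3 at *
  have key : ∀ n1 n2 n3 n4 m1 m2 m3 m4 : ℝ, |n1 - n2 - n3 + n4| ≤ 40 * E → |m1 - m2 - m3 + m4| ≤ 40 * E →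
    |(c0 * n1 + b1 * m1 + b2 * τ⁻¹ + x1) - (c0 * n2 + b1 * m2 + b2 * τ⁻¹ + x2) - (c0 * n3 + b1 * m3 + b2 * τ⁻¹ + x3)
      + (c0 * n4 + b1 * m4 + b2 * τ⁻¹ + 0)| ≤ 4800 * L ^ 2 * E := by
    intro n1 n2 n3 n4 m1 m2 m3 m4 hn hm
    have e : (c0 * n1 + b1 * m1 + b2 * τ⁻¹ + x1) - (c0 * n2 + b1 * m2 + b2 * τ⁻¹ + x2) - (c0 * n3 + b1 * m3 + b2 * τ⁻¹ + x3)
      + (c0 * n4 + b1 * m4 + b2 * τ⁻¹ + 0) = c0 * (n1 - n2 - n3 + n4) + b1 * (m1 - m2 - m3 + m4) + (x1 - x2 - x3) := by ring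
    rw [e]
    have LE : L * E ≤ L ^ 2 * E := by gcongr; nlinarith only [hL]
    have i1 : |c0 * (n1 - n2 - n3 + n4)| ≤ 200 * (L * E) := by
      rw [abs_mul]
      calc _ ≤ (5 * L) * (40 * E) := by gcongr
        _ = _ := by ring
    have i2 : |b1 * (m1 - m2 - m3 + m4)| ≤ 40 * (L * E) := by
      rw [abs_mul]
      calc _ ≤ L * (40 * E) := by gcongr
        _ = _ := by ring
    have i3 : |x1 - x2 - x3| ≤ 4500 * (L ^ 2 * E) := by
      calc _ ≤ |x1 - x2| + |x3| := abs_sub _ _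
        _ ≤ |x1| + |x2| + |x3| := by gcongr; exact abs_sub _ _
        _ ≤ _ := by linarith
    refine (abs_add_le _ _).trans ?_
    have := abs_add_le (c0 * (n1 - n2 - n3 + n4)) (b1 * (m1 - m2 - m3 + m4))
    have : 0 ≤ L ^ 2 * E := by positivity
    linarith only [this, i1, i2, i3, LE, abs_add_le (c0 * (n1 - n2 - n3 + n4)) (b1 * (m1 - m2 - m3 + m4))]
  refine key _ _ _ _ _ _ _ _ (dg.trans (le_of_eq ?_)) (dh.trans (le_of_eq ?_)) <;> rw [hE] <;> ring

end SM

namespace SM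

/-- radial profiles -/
structure Prof (δ t : ℝ) (a : ℝ → ℝ) : Prop where
  cont : Continuous a
  supp : ∀ r, a r ≠ 0 → |r - t| ≤ δ
  bd : ∀ r, |a r| ≤ 1 / δ
  mean : ∫ r, r * a r = 0

def YY (τ : ℝ) (p : ℝ × ℝ) : ℝ × ℝ := (uu τ p.1 p.2, vv τ p.1 p.2)

def Xr (τ r r' : ℝ) : ℝ := -2 * (r - r') * ((r + r') ^ 2 - τ ^ 2) + (τ ^ 2 - (r - r') ^ 2) * (2 * (r + r'))
def Xr' (τ r r' : ℝ) : ℝ := 2 * (r - r') * ((r + r') ^ 2 - τ ^ 2) + (τ ^ 2 - (r - r') ^ 2) * (2 * (r + r'))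

def YD (τ : ℝ) (p : ℝ × ℝ) : ℝ × ℝ →L[ℝ] ℝ × ℝ :=
  LinearMap.toContinuousLinearMap (Matrix.toLin (.finTwoProd ℝ) (.finTwoProd ℝ)
    !![p.1 / τ, -p.2 / τ; 
      Xr τ p.1 p.2 / (4 * τ * √((τ ^ 2 - (p.1 - p.2) ^ 2) * ((p.1 + p.2) ^ 2 - τ ^ 2))), 
      Xr' τ p.1 p.2 / (4 * τ * √((τ ^ 2 - (p.1 - p.2) ^ 2) * ((p.1 + p.2) ^ 2 - τ ^ 2)))])

lemma hasFDerivAt_YY (τ : ℝ) (hτ : 0 < τ) (p : ℝ × ℝ)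
    (hX : 0 < (τ ^ 2 - (p.1 - p.2) ^ 2) * ((p.1 + p.2) ^ 2 - τ ^ 2)) :
    HasFDerivAt (YY τ) (YD τ p) p := by
  unfold YD
  rw [Matrix.toLin_finTwoProd_toContinuousLinearMap]
  have f1 : HasFDerivAt (fun p : ℝ × ℝ => p.1) (ContinuousLinearMap.fst ℝ ℝ ℝ) p := hasFDerivAt_fst
  have f2 : HasFDerivAt (fun p : ℝ × ℝ => p.2) (ContinuousLinearMap.snd ℝ ℝ ℝ) p := hasFDerivAt_snd
  refine HasFDerivAt.prodMk ?_ ?_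
  · unfold uu
    have := ((((f1.pow 2).sub (f2.pow 2)).add_const (τ ^ 2)).mul_const ((2 * τ)⁻¹))
    simp only [div_eq_mul_inv]
    refine this.congr_fderiv ?_
    ext <;> simp <;> field_simp
  · unfold vv
    have := ((((((f1.sub f2).pow 2).const_sub (τ ^ 2)).mul (((f1.add f2).pow 2).sub_const (τ ^ 2))).sqrt hX.ne').mul_const ((2 * τ)⁻¹))
    simp only [div_eq_mul_inv]
    refine this.congr_fderiv ?_
    have hs : √((τ ^ 2 - (p.1 - p.2) ^ 2) * ((p.1 + p.2) ^ 2 - τ ^ 2)) ≠ 0 := (Real.sqrt_pos.2 hX).ne'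
    ext <;> simp [Xr, Xr'] <;> ring

lemma det_YD (τ : ℝ) (hτ : 0 < τ) (p : ℝ × ℝ) (h1 : 0 < (τ ^ 2 - (p.1 - p.2) ^ 2)) (h2 : 0 < ((p.1 + p.2) ^ 2 - τ ^ 2)) :
    (YD τ p).det = p.1 * p.2 * NI τ p.1 p.2 := by
  unfold YD NI
  rw [LinearMap.det_toContinuousLinearMap, LinearMap.det_toLin, Matrix.det_fin_two_of]
  rw [← Real.mul_rpow h1.le h2.le, Real.rpow_neg (by positivity), ← Real.sqrt_eq_rpow]
  have hs : √((τ ^ 2 - (p.1 - p.2) ^ 2) * ((p.1 + p.2) ^ 2 - τ ^ 2)) ≠ 0 := (Real.sqrt_pos.2 (by positivity)).ne'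
  set s := √((τ ^ 2 - (p.1 - p.2) ^ 2) * ((p.1 + p.2) ^ 2 - τ ^ 2))
  unfold Xr Xr'
  field_simp
  ring

/-- the coordinate box -/
def Box (t t' δ : ℝ) : Set (ℝ × ℝ) := Icc (t - δ) (t + δ) ×ˢ Icc (t' - δ) (t' + δ)

lemma mem_Box {t t' δ : ℝ} {p : ℝ × ℝ} : p ∈ Box t t' δ ↔ |p.1 - t| ≤ δ ∧ |p.2 - t'| ≤ δ := by
  simp only [Box, mem_prod, mem_Icc, abs_le]
  constructor
  · rintro ⟨⟨a, b⟩, c, d⟩; refine ⟨⟨?_, ?_⟩, ?_, ?_⟩ <;> linarith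
  · rintro ⟨⟨a, b⟩, c, d⟩; refine ⟨⟨?_, ?_⟩, ?_, ?_⟩ <;> linarith

/-- bipolar change of variables for functions on the upper half plane. -/
lemma bipolar {t t' δ τ : ℝ} (h : Geo t t' δ τ) (g : ℂ → ℝ)
    (hg : ∀ y, g y ≠ 0 → |‖y‖ - t| ≤ δ ∧ |‖y - τ‖ - t'| ≤ δ) :
    ∫ y in {y : ℂ | 0 < y.im}, g y = 
      ∫ p in Box t t' δ, (p.1 * p.2 * NI τ p.1 p.2) * g ⟨uu τ p.1 p.2, vv τ p.1 p.2⟩ := by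
  have hτ := h.τ0
  have hbox : ∀ p ∈ Box t t' δ, 0 < (τ ^ 2 - (p.1 - p.2) ^ 2) ∧ 0 < ((p.1 + p.2) ^ 2 - τ ^ 2) ∧ 0 < p.1 ∧ 0 < p.2 := by
    intro p hp
    obtain ⟨a, b⟩ := mem_Box.1 hp
    obtain ⟨c1, c2, c3⟩ := h.box a b
    have := h.t1; have := h.t1'; have := h.δ1
    rw [abs_le] at a b
    exact ⟨h.S0pos.trans_le c1, by linarith, by linarith, by linarith⟩
  have hms : MeasurableSet (Box t t' δ) := measurableSet_Icc.prod measurableSet_Icc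
  have hinj : InjOn (YY τ) (Box t t' δ) := by
    intro p hp q hq hpq
    obtain ⟨p1, p2, p3, p4⟩ := hbox p hp
    obtain ⟨q1, q2, q3, q4⟩ := hbox q hq
    have e1 := uv_sq (r := p.1) (r' := p.2) hτ.ne' (mul_pos p1 p2).le
    have e2 := uv_sq (r := q.1) (r' := q.2) hτ.ne' (mul_pos q1 q2).le
    simp only [YY, Prod.mk.injEq] at hpq
    rw [hpq.1, hpq.2] at e1
    have i1 : p.1 ^ 2 = q.1 ^ 2 := e1.1.symm.trans e2.1
    have i2 : p.2 ^ 2 = q.2 ^ 2 := e1.2.symm.trans e2.2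
    ext
    · exact (pow_left_inj₀ p3.le q3.le two_ne_zero).1 i1
    · exact (pow_left_inj₀ p4.le q4.le two_ne_zero).1 i2
  have cv := integral_image_eq_integral_abs_det_fderiv_smul volume hms
    (fun p hp => (hasFDerivAt_YY τ hτ p (mul_pos (hbox p hp).1 (hbox p hp).2.1)).hasFDerivWithinAt) hinj
    (fun p => g ⟨p.1, p.2⟩)
  have e1 : ∫ y in {y : ℂ | 0 < y.im}, g y = ∫ p in {p : ℝ × ℝ | 0 < p.2}, g ⟨p.1, p.2⟩ := by
    have := (Complex.volume_preserving_equiv_real_prod.symm).setIntegral_preimage_emb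
      (Complex.measurableEquivRealProd.symm.measurableEmbedding) g {y : ℂ | 0 < y.im}
    rw [← this]
    rfl
  have e2 : ∫ p in {p : ℝ × ℝ | 0 < p.2}, g ⟨p.1, p.2⟩ = ∫ p in YY τ '' (Box t t' δ), g ⟨p.1, p.2⟩ := by
    refine setIntegral_eq_of_subset_of_forall_sdiff_eq_zero ?_ ?_ ?_
    · exact measurableSet_lt measurable_const measurable_snd
    · rintro _ ⟨p, hp, rfl⟩
      obtain ⟨p1, p2, p3, p4⟩ := hbox p hp
      simp only [YY, mem_setOf_eq, vv]; positivity
    · rintro p ⟨hp1, hp2⟩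
      by_contra hne
      obtain ⟨a, b⟩ := hg _ hne
      apply hp2
      set r := ‖(⟨p.1, p.2⟩ : ℂ)‖ with hr
      set r' := ‖(⟨p.1, p.2⟩ : ℂ) - τ‖ with hr'
      have hB : (r, r') ∈ Box t t' δ := mem_Box.2 ⟨a, b⟩
      refine ⟨(r, r'), hB, ?_⟩
      obtain ⟨c1, c2, c3, c4⟩ := hbox _ hB
      have s1 : r ^ 2 = p.1 ^ 2 + p.2 ^ 2 := by
        rw [hr, ← Complex.normSq_eq_norm_sq, Complex.normSq_apply]; ring
      have s2 : r' ^ 2 = (p.1 - τ) ^ 2 + p.2 ^ 2 := by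
        rw [hr', ← Complex.normSq_eq_norm_sq, Complex.normSq_apply]; simp; ring
      have u1 : uu τ r r' = p.1 := by
        unfold uu; rw [s1, s2]; field_simp; ring
      have v1 : vv τ r r' = p.2 := by
        have := (uv_sq (r := r) (r' := r') hτ.ne' (mul_pos c1 c2).le).1
        rw [u1, s1] at this
        have h3 : vv τ r r' ^ 2 = p.2 ^ 2 := by linarith
        have h4 : 0 ≤ vv τ r r' := by unfold vv; positivity
        exact (pow_left_inj₀ h4 (le_of_lt hp1) two_ne_zero).1 h3
      simp [YY, u1, v1]
  rw [e1, e2, cv]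
  refine setIntegral_congr_fun hms ?_
  intro p hp
  obtain ⟨p1, p2, p3, p4⟩ := hbox p hp
  simp only [smul_eq_mul, YY]
  rw [det_YD τ hτ p p1 p2, abs_of_nonneg]
  have : 0 ≤ NI τ p.1 p.2 := by unfold NI; positivity
  positivity

end SM

namespace SM

lemma TW.conj {L : ℝ} {w : ℂ → ℝ} (hw : TW L w) : TW L (fun y => w (starRingEnd ℂ y)) := by
  refine ⟨fun y => hw.bd _, hw.cont.comp Complex.continuous_conj, fun y0 => ?_⟩
  obtain ⟨b1, b2, h1, h2, h⟩ := hw.tay (starRingEnd ℂ y0)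
  refine ⟨b1, -b2, h1, by rwa [abs_neg], fun y => ?_⟩
  have := h (starRingEnd ℂ y)
  rw [← map_sub, Complex.conj_re, Complex.conj_im, RCLike.norm_conj] at this
  rw [neg_mul, ← mul_neg]
  exact this

lemma TW.rot {L : ℝ} {w : ℂ → ℝ} (hw : TW L w) (x ω : ℂ) (hω : ‖ω‖ = 1) :
    TW (2 * L) (fun y => w (x + ω * y)) := by
  refine ⟨fun y => hw.bd _, hw.cont.comp (by fun_prop), fun y0 => ?_⟩
  obtain ⟨b1, b2, h1, h2, h⟩ := hw.tay (x + ω * y0)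
  have r1 : |ω.re| ≤ 1 := hω ▸ Complex.abs_re_le_norm ω
  have r2 : |ω.im| ≤ 1 := hω ▸ Complex.abs_im_le_norm ω
  have hL : 0 ≤ L := (abs_nonneg _).trans h1
  refine ⟨b1 * ω.re + b2 * ω.im, -b1 * ω.im + b2 * ω.re, ?_, ?_, fun y => ?_⟩
  · refine (abs_add_le _ _).trans ?_
    rw [abs_mul, abs_mul]
    have := mul_le_mul h1 r1 (abs_nonneg _) hL
    have := mul_le_mul h2 r2 (abs_nonneg _) hL
    linarith
  · refine (abs_add_le _ _).trans ?_
    rw [abs_mul, abs_mul, abs_neg]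
    have := mul_le_mul h1 r2 (abs_nonneg _) hL
    have := mul_le_mul h2 r1 (abs_nonneg _) hL
    linarith
  · have := h (x + ω * y)
    have e : x + ω * y - (x + ω * y0) = ω * (y - y0) := by ring
    rw [e, Complex.mul_re, Complex.mul_im, norm_mul, hω, one_mul] at this
    have e2 : ∀ p q s u : ℝ, w (x + ω * y) - w (x + ω * y0) - (b1 * ω.re + b2 * ω.im) * p - (-b1 * ω.im + b2 * ω.re) * q
      = w (x + ω * y) - w (x + ω * y0) - b1 * (ω.re * p - ω.im * q) - b2 * (ω.re * q + ω.im * p) := by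
      intros; ring
    rw [e2 _ _ 0 0]
    refine this.trans ?_
    have : 0 ≤ L ^ 2 * ‖y - y0‖ ^ 2 := by positivity
    linarith

lemma TW.one {L : ℝ} (hL : 0 ≤ L) : TW L (fun _ => 1) :=
  ⟨fun _ => by simp, continuous_const, fun _ => ⟨0, 0, by simpa, by simpa, fun y => by simp; positivity⟩⟩

lemma Prof.int_Icc {δ t : ℝ} {a : ℝ → ℝ} (h : Prof δ t a) : ∫ r in Icc (t - δ) (t + δ), r * a r = 0 := by
  rw [setIntegral_eq_integral_of_forall_compl_eq_zero, h.mean]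
  intro r hr
  by_contra hne
  have := h.supp r (right_ne_zero_of_mul hne)
  rw [abs_le] at this
  exact hr ⟨by linarith, by linarith⟩

lemma half_bound {L t t' δ τ : ℝ} {w : ℂ → ℝ} {a a' : ℝ → ℝ} (hL : 1 ≤ L) (hw : TW L w) (h : Geo t t' δ τ)
    (ha : Prof δ t a) (ha' : Prof δ t' a') :
    |∫ y in {y : ℂ | 0 < y.im}, w y * (a ‖y‖ * a' ‖y - τ‖)| ≤ 
      172800 * L ^ 2 * (τ ^ 2 * (τ * (τ - |t - t'|) / 2) ^ (-(5/2) : ℝ) * δ ^ 2) := by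
  have hδ := h.δ0
  have hτ := h.τ0
  have h00 : ∀ a : ℝ, |a - a| ≤ δ := fun a => by simpa using hδ.le
  rw [bipolar h _ (by
    intro y hy
    exact ⟨ha.supp _ (left_ne_zero_of_mul (right_ne_zero_of_mul hy)), ha'.supp _ (right_ne_zero_of_mul (right_ne_zero_of_mul hy))⟩)]
  have hms : MeasurableSet (Box t t' δ) := measurableSet_Icc.prod measurableSet_Icc
  have hcomp : IsCompact (Box t t' δ) := isCompact_Icc.prod isCompact_Icc
  let G : ℝ → ℝ → ℝ := fun r r' => w ⟨uu τ r r', vv τ r r'⟩ * NI τ r r'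
  have hbox : ∀ p ∈ Box t t' δ, 0 < (τ ^ 2 - (p.1 - p.2) ^ 2) ∧ 0 < ((p.1 + p.2) ^ 2 - τ ^ 2) ∧ 0 < p.1 ∧ 0 < p.2 
      ∧ p.1 ≤ 3 ∧ p.2 ≤ 3 := by
    intro p hp
    obtain ⟨a, b⟩ := mem_Box.1 hp
    obtain ⟨c1, c2, c3⟩ := h.box a b
    have := h.t1; have := h.t1'; have := h.δ1; have := h.t2; have := h.t2'
    rw [abs_le] at a b
    exact ⟨h.S0pos.trans_le c1, by linarith, by linarith, by linarith, by linarith, by linarith⟩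
  have hG : ContinuousOn (fun p : ℝ × ℝ => G p.1 p.2) (Box t t' δ) := by
    refine ContinuousOn.mul ?_ ?_
    · refine Continuous.continuousOn ?_
      have c1 : Continuous fun p : ℝ × ℝ => uu τ p.1 p.2 := by unfold uu; fun_prop
      have c2 : Continuous fun p : ℝ × ℝ => vv τ p.1 p.2 := by unfold vv; fun_prop
      have : Continuous fun p : ℝ × ℝ => (⟨uu τ p.1 p.2, vv τ p.1 p.2⟩ : ℂ) := by
        have := (Complex.continuous_ofReal.comp c1).add ((Complex.continuous_ofReal.comp c2).mul (continuous_const (y := Complex.I)))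
        refine this.congr ?_
        intro p
        simp [Complex.mk_eq_add_mul_I]
      exact hw.cont.comp this
    · unfold NI
      refine continuousOn_const.mul (ContinuousOn.mul ?_ ?_)
      · exact ContinuousOn.rpow_const (by fun_prop) (fun p hp => Or.inl (hbox p hp).1.ne')
      · exact ContinuousOn.rpow_const (by fun_prop) (fun p hp => Or.inl (hbox p hp).2.1.ne')
  have hm1 : MapsTo (fun p : ℝ × ℝ => (p.1, t')) (Box t t' δ) (Box t t' δ) := fun p hp => 
    mem_Box.2 ⟨(mem_Box.1 hp).1, h00 t'⟩
  have hm2 : MapsTo (fun p : ℝ × ℝ => (t, p.2)) (Box t t' δ) (Box t t' δ) := fun p hp => 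
    mem_Box.2 ⟨h00 t, (mem_Box.1 hp).2⟩
  have hG1 : ContinuousOn (fun p : ℝ × ℝ => G p.1 t') (Box t t' δ) := 
    hG.comp (f := fun p : ℝ × ℝ => (p.1, t')) (by fun_prop) hm1
  have hG2 : ContinuousOn (fun p : ℝ × ℝ => G t p.2) (Box t t' δ) := 
    hG.comp (f := fun p : ℝ × ℝ => (t, p.2)) (by fun_prop) hm2
  have hac := ha.cont
  have hac' := ha'.cont
  let A : ℝ × ℝ → ℝ := fun p => (p.1 * a p.1) * (p.2 * a' p.2)
  have hA : ContinuousOn A (Box t t' δ) := by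
    refine Continuous.continuousOn ?_
    simp only [A]; fun_prop
  have e1 : ∫ p in Box t t' δ, (p.1 * p.2 * NI τ p.1 p.2) * 
      (w ⟨uu τ p.1 p.2, vv τ p.1 p.2⟩ * (a ‖(⟨uu τ p.1 p.2, vv τ p.1 p.2⟩ : ℂ)‖ * a' ‖(⟨uu τ p.1 p.2, vv τ p.1 p.2⟩ : ℂ) - τ‖))
      = ∫ p in Box t t' δ, A p * G p.1 p.2 := by
    refine setIntegral_congr_fun hms ?_
    intro p hp
    obtain ⟨c1, c2, c3, c4, c5⟩ := hbox p hp
    obtain ⟨s1, s2⟩ := uv_sq (r := p.1) (r' := p.2) hτ.ne' (mul_pos c1 c2).le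
    have n1 : ‖(⟨uu τ p.1 p.2, vv τ p.1 p.2⟩ : ℂ)‖ = p.1 := by
      rw [← pow_left_inj₀ (norm_nonneg _) c3.le two_ne_zero, ← Complex.normSq_eq_norm_sq, Complex.normSq_apply, ← s1]; ring
    have n2 : ‖(⟨uu τ p.1 p.2, vv τ p.1 p.2⟩ : ℂ) - τ‖ = p.2 := by
      rw [← pow_left_inj₀ (norm_nonneg _) c4.le two_ne_zero, ← Complex.normSq_eq_norm_sq, Complex.normSq_apply, ← s2]; simp; ring
    simp only [n1, n2, A, G]; ring
  rw [e1]
  have z1 : ∫ p in Box t t' δ, A p * G p.1 t' = 0 := by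
    have := setIntegral_prod_mul (μ := volume) (ν := volume) (fun r => r * a r * G r t') (fun r' => r' * a' r') (Icc (t - δ) (t + δ)) (Icc (t' - δ) (t' + δ))
    rw [ha'.int_Icc, mul_zero] at this
    rw [← this]
    refine setIntegral_congr_fun hms (fun p hp => ?_)
    simp only [A]; ring
  have z2 : ∫ p in Box t t' δ, A p * G t p.2 = 0 := by
    have := setIntegral_prod_mul (μ := volume) (ν := volume) (fun r => r * a r) (fun r' => r' * a' r' * G t r') (Icc (t - δ) (t + δ)) (Icc (t' - δ) (t' + δ))
    rw [ha.int_Icc, zero_mul] at this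
    rw [← this]
    refine setIntegral_congr_fun hms (fun p hp => ?_)
    simp only [A]; ring
  have z3 : ∫ p in Box t t' δ, A p * G t t' = 0 := by
    have := setIntegral_prod_mul (μ := volume) (ν := volume) (fun r => r * a r) (fun r' => r' * a' r' * G t t') (Icc (t - δ) (t + δ)) (Icc (t' - δ) (t' + δ))
    rw [ha.int_Icc, zero_mul] at this
    rw [← this]
    refine setIntegral_congr_fun hms (fun p hp => ?_)
    simp only [A]; ring
  have i0 : IntegrableOn (fun p => A p * G p.1 p.2) (Box t t' δ) := (hA.mul hG).integrableOn_compact hcomp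
  have i1 : IntegrableOn (fun p => A p * G p.1 t') (Box t t' δ) := (hA.mul hG1).integrableOn_compact hcomp
  have i2 : IntegrableOn (fun p => A p * G t p.2) (Box t t' δ) := (hA.mul hG2).integrableOn_compact hcomp
  have i3 : IntegrableOn (fun p => A p * G t t') (Box t t' δ) := (hA.mul continuousOn_const).integrableOn_compact hcomp
  have e2 : ∫ p in Box t t' δ, A p * G p.1 p.2 = ∫ p in Box t t' δ, 
      (A p * G p.1 p.2 - A p * G p.1 t' - A p * G t p.2 + A p * G t t') := by
    have j1 : IntegrableOn (fun p => A p * G p.1 p.2 - A p * G p.1 t') (Box t t' δ) := i0.sub i1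
    have j2 : IntegrableOn (fun p => A p * G p.1 p.2 - A p * G p.1 t' - A p * G t p.2) (Box t t' δ) := j1.sub i2
    rw [integral_add j2 i3, integral_sub j1 i2, integral_sub i0 i1, z1, z2, z3]; ring
  rw [e2]
  set E := (τ ^ 2 * (τ * (τ - |t - t'|) / 2) ^ (-(5/2) : ℝ) * δ ^ 2) with hE
  have hE0 : 0 ≤ E := by have := h.S0pos; positivity
  have hvol : volume.real (Box t t' δ) = 4 * δ ^ 2 := by
    rw [Measure.real, Box, Measure.volume_eq_prod, Measure.prod_prod, Real.volume_Icc, Real.volume_Icc, ← ENNReal.ofReal_mul (by linarith),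
      ENNReal.toReal_ofReal (by ring_nf; positivity)]; ring
  have hfin : volume (Box t t' δ) < ⊤ := hcomp.measure_lt_top
  have := norm_setIntegral_le_of_norm_le_const (μ := volume) (C := (9 / δ ^ 2) * (4800 * L ^ 2 * E)) hfin 
    (f := fun p => (A p * G p.1 p.2 - A p * G p.1 t' - A p * G t p.2 + A p * G t t')) ?_
  · rw [Real.norm_eq_abs] at this
    refine this.trans (le_of_eq ?_)
    rw [hvol]; field_simp; ring
  · intro p hp
    obtain ⟨c1, c2, c3, c4, c5, c6⟩ := hbox p hp
    obtain ⟨d1, d2⟩ := mem_Box.1 hp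
    have hD := D_w hL hw h d1 d2
    have e : A p * G p.1 p.2 - A p * G p.1 t' - A p * G t p.2 + A p * G t t' = A p * (G p.1 p.2 - G p.1 t' - G t p.2 + G t t') := by ring
    rw [e, Real.norm_eq_abs, abs_mul]
    refine mul_le_mul ?_ hD (abs_nonneg _) (by positivity)
    simp only [A]
    rw [abs_mul, abs_mul, abs_mul, abs_of_pos c3, abs_of_pos c4]
    calc p.1 * |a p.1| * (p.2 * |a' p.2|) ≤ 3 * (1 / δ) * (3 * (1 / δ)) := by
          gcongr
          · exact ha.bd _
          · exact ha'.bd _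
      _ = _ := by field_simp; norm_num

/-- The interaction kernel. -/
def KK (w : ℂ → ℝ) (a a' : ℝ → ℝ) (x x' : ℂ) : ℝ := ∫ y, w y * (a ‖y - x‖ * a' ‖y - x'‖)

lemma integral_im_split (g : ℂ → ℝ) (hg : Integrable g) :
    ∫ y, g y = (∫ y in {y : ℂ | 0 < y.im}, g y) + ∫ y in {y : ℂ | 0 < y.im}, g (starRingEnd ℂ y) := by
  have hms : MeasurableSet {y : ℂ | 0 < y.im} := measurableSet_lt measurable_const Complex.measurable_im
  rw [← integral_add_compl hms hg]
  congr 1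
  have hmp : MeasurePreserving (starRingEnd ℂ : ℂ → ℂ) volume volume := Complex.conjLIE.measurePreserving
  have hemb : MeasurableEmbedding (starRingEnd ℂ : ℂ → ℂ) := Complex.conjLIE.toHomeomorph.measurableEmbedding
  have := hmp.setIntegral_preimage_emb hemb (fun y => g (starRingEnd ℂ y)) {y : ℂ | 0 < y.im}
  simp only [Complex.conj_conj] at this
  rw [← this]
  refine setIntegral_congr_set ?_
  have hnull : volume {y : ℂ | y.im = 0} = 0 := by
    have := Complex.volume_preserving_equiv_real_prod.measure_preimage (s := univ ×ˢ {(0:ℝ)}) (by measurability)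
    rw [Measure.volume_eq_prod, Measure.prod_prod] at this
    simp at this
    rw [← this]
    congr 1
    ext y; simp [Complex.measurableEquivRealProd_apply]
  have h2 : ∀ᵐ y : ℂ, y.im ≠ 0 := by rw [ae_iff]; simpa using hnull
  filter_upwards [h2] with y hy
  apply propext
  show ¬ (0 < y.im) ↔ 0 < ((starRingEnd ℂ) y).im
  rw [Complex.conj_im]
  constructor
  · intro h; have := lt_of_le_of_ne (not_lt.1 h) hy; linarith
  · intro h; linarith

lemma KK_integrable {δ t t' : ℝ} {w : ℂ → ℝ} {a a' : ℝ → ℝ} (hw : Continuous w) 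
    (ha : Prof δ t a) (ha' : Prof δ t' a') (x x' : ℂ) :
    Integrable (fun y => w y * (a ‖y - x‖ * a' ‖y - x'‖)) := by
  have c1 := ha.cont
  have c2 := ha'.cont
  refine Continuous.integrable_of_hasCompactSupport (by fun_prop) ?_
  refine HasCompactSupport.of_support_subset_isCompact (isCompact_closedBall x (t + δ)) ?_
  intro y hy
  have := ha.supp _ (left_ne_zero_of_mul (right_ne_zero_of_mul (Function.mem_support.1 hy)))
  rw [mem_closedBall, dist_eq_norm]
  rw [abs_le] at this; linarith

lemma KK_bound3 {L t t' δ : ℝ} {w : ℂ → ℝ} {a a' : ℝ → ℝ} (hL : 1 ≤ L) (hw : TW L w) (x x' : ℂ) (h : Geo t t' δ ‖x - x'‖)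
    (ha : Prof δ t a) (ha' : Prof δ t' a') :
    |KK w a a' x x'| ≤ 1382400 * L ^ 2 * (‖x - x'‖ ^ 2 * (‖x - x'‖ * (‖x - x'‖ - |t - t'|) / 2) ^ (-(5/2) : ℝ) * δ ^ 2) := by
  set τ := ‖x - x'‖ with hτd
  have hτ := h.τ0
  set ω : ℂ := (x' - x) / τ with hωd
  have hω : ‖ω‖ = 1 := by
    rw [hωd, norm_div, norm_sub_rev, ← hτd, Complex.norm_real, Real.norm_of_nonneg hτ.le, div_self hτ.ne']
  have hxω : x' = x + ω * τ := by
    rw [hωd, div_mul_cancel₀]; · ring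
    · exact_mod_cast hτ.ne'
  let w' : ℂ → ℝ := fun y => w (x + ω * y)
  have hw' : TW (2 * L) w' := hw.rot x ω hω
  have hK : KK w a a' x x' = ∫ y, w' y * (a ‖y‖ * a' ‖y - τ‖) := by
    unfold KK
    rw [← integral_add_left_eq_self _ x]
    let c : Circle := ⟨ω, by simp [Submonoid.unitSphere, hω]⟩
    have hmp := (rotation c).measurePreserving
    rw [← hmp.integral_comp (rotation c).toHomeomorph.measurableEmbedding]
    congr 1
    ext y
    have e : (rotation c) y = ω * y := rotation_apply c y
    rw [e]
    simp only [w']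
    congr 3
    · rw [add_sub_cancel_left, norm_mul, hω, one_mul]
    · rw [hxω, add_sub_add_left_eq_sub, ← mul_sub, norm_mul, hω, one_mul]
  rw [hK]
  have hintg : Integrable (fun y => w' y * (a ‖y‖ * a' ‖y - τ‖)) := by
    have := KK_integrable hw'.cont ha ha' 0 τ
    simpa using this
  rw [integral_im_split _ hintg]
  have b1 := half_bound (L := 2 * L) (by linarith) hw' h ha ha'
  have b2 := half_bound (L := 2 * L) (by linarith) hw'.conj h ha ha'
  have e : ∀ y : ℂ, ‖(starRingEnd ℂ) y - τ‖ = ‖y - τ‖ := by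
    intro y
    rw [← RCLike.norm_conj (y - (τ:ℂ)), map_sub, Complex.conj_ofReal]
  simp only [e, RCLike.norm_conj] at b2 ⊢
  refine (abs_add_le _ _).trans ?_
  refine (add_le_add b1 b2).trans (le_of_eq ?_)
  ring

end SM

namespace SM

lemma cos_diam {a b d : ℝ} (ha : 0 ≤ a) (hab : a ≤ b) (hb : b ≤ Real.pi) (h : Real.cos a - Real.cos b ≤ d) :
    b - a ≤ 3 * √d := by
  have hpi := Real.pi_pos
  have hpi2 := Real.pi_lt_d2
  have e : Real.cos a - Real.cos b = 2 * Real.sin ((a + b) / 2) * Real.sin ((b - a) / 2) := by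
    rw [Real.cos_sub_cos, show (a - b) / 2 = -((b - a) / 2) by ring, Real.sin_neg]; ring
  have h1 : (b - a) / Real.pi ≤ Real.sin ((b - a) / 2) := by
    have := Real.mul_le_sin (x := (b - a) / 2) (by linarith) (by linarith)
    refine le_trans (le_of_eq ?_) this
    field_simp
  have h2 : (b - a) / Real.pi ≤ Real.sin ((a + b) / 2) := by
    rcases le_total ((a + b) / 2) (Real.pi / 2) with h3 | h3
    · have := Real.mul_le_sin (x := (a + b) / 2) (by linarith) h3
      refine le_trans ?_ this
      rw [div_le_iff₀ hpi]
      have : 2 / Real.pi * ((a + b) / 2) * Real.pi = a + b := by field_simp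
      linarith
    · have := Real.mul_le_sin (x := Real.pi - (a + b) / 2) (by linarith) (by linarith)
      rw [Real.sin_pi_sub] at this
      refine le_trans ?_ this
      rw [div_le_iff₀ hpi]
      have : 2 / Real.pi * (Real.pi - (a + b) / 2) * Real.pi = 2 * Real.pi - (a + b) := by field_simp
      linarith
  have h0 : 0 ≤ (b - a) / Real.pi := by have : 0 ≤ b - a := by linarith
                                        positivity
  have h4 : (b - a) / Real.pi * ((b - a) / Real.pi) ≤ Real.sin ((a + b) / 2) * Real.sin ((b - a) / 2) :=
    mul_le_mul h2 h1 h0 (h0.trans h2)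
  have h5 : (b - a) ^ 2 ≤ 9 * d := by
    have : (b - a) / Real.pi * ((b - a) / Real.pi) = (b - a) ^ 2 / Real.pi ^ 2 := by field_simp
    rw [this, div_le_iff₀ (by positivity)] at h4
    have h6 : Real.pi ^ 2 ≤ 18 := by nlinarith only [hpi, hpi2]
    have h7 : 0 ≤ Real.sin ((a + b) / 2) * Real.sin ((b - a) / 2) := mul_nonneg (h0.trans h2) (h0.trans h1)
    have h8 := mul_le_mul_of_nonneg_left h6 h7
    linarith
  calc b - a = √((b - a) ^ 2) := (Real.sqrt_sq (by linarith)).symm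
    _ ≤ √(3 ^ 2 * d) := Real.sqrt_le_sqrt (by linarith)
    _ = 3 * √d := by rw [Real.sqrt_mul (by norm_num), Real.sqrt_sq (by norm_num)]

lemma cos_diam' {a b d : ℝ} (ha : 0 ≤ a) (ha' : a ≤ Real.pi) (hb0 : 0 ≤ b) (hb : b ≤ Real.pi) 
    (h : |Real.cos a - Real.cos b| ≤ d) : |b - a| ≤ 3 * √d := by
  rcases le_total a b with hab | hab
  · rw [abs_of_nonneg (by linarith)]
    exact cos_diam ha hab hb ((le_abs_self _).trans h)
  · rw [abs_of_nonpos (by linarith), neg_sub]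
    exact cos_diam hb0 hab ha' (((le_abs_self _).trans (abs_sub_comm _ _).le).trans h)

lemma vol_le_of_dist {S : Set ℝ} {D : ℝ} (h : ∀ a ∈ S, ∀ b ∈ S, |b - a| ≤ D) : volume S ≤ ENNReal.ofReal D := by
  refine (Real.volume_le_diam S).trans (Metric.ediam_le fun a ha b hb => ?_)
  rw [edist_dist, Real.dist_eq]
  exact ENNReal.ofReal_le_ofReal (h b hb a ha)

lemma arc_cos {φ a d : ℝ} (hφ : φ ∈ Icc (-Real.pi) Real.pi) :
    volume {θ : ℝ | θ ∈ Ioo (-Real.pi) Real.pi ∧ Real.cos (θ - φ) ∈ Icc a (a + d)} ≤ ENNReal.ofReal (12 * √d) := by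
  let P : ℤ → Set ℝ := fun k => {θ : ℝ | θ - φ - k * Real.pi ∈ Icc 0 Real.pi ∧ Real.cos (θ - φ) ∈ Icc a (a + d)}
  have hP : ∀ k, volume (P k) ≤ ENNReal.ofReal (3 * √d) := by
    intro k
    refine vol_le_of_dist fun θ hθ θ' hθ' => ?_
    have := cos_diam' (d := d) hθ.1.1 hθ.1.2 hθ'.1.1 hθ'.1.2 ?_
    · convert this using 2; ring
    · have h1 := hθ.2; have h2 := hθ'.2
      rw [Real.cos_sub_int_mul_pi, Real.cos_sub_int_mul_pi, ← mul_sub, abs_mul]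
      rw [abs_zpow, abs_neg, abs_one, one_zpow, one_mul, abs_le]
      constructor <;> linarith [h1.1, h1.2, h2.1, h2.2]
  have hsub : {θ : ℝ | θ ∈ Ioo (-Real.pi) Real.pi ∧ Real.cos (θ - φ) ∈ Icc a (a + d)} ⊆ ((P (-2) ∪ P (-1)) ∪ (P 0 ∪ P 1)) := by
    rintro θ ⟨⟨h1, h2⟩, h3⟩
    obtain ⟨h4, h5⟩ := hφ
    rcases le_total (θ - φ) 0 with h0 | h0
    · left
      rcases le_total (θ - φ) (-Real.pi) with h6 | h6
      · left; refine ⟨⟨?_, ?_⟩, h3⟩ <;> push_cast <;> linarith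
      · right; refine ⟨⟨?_, ?_⟩, h3⟩ <;> push_cast <;> linarith
    · right
      rcases le_total (θ - φ) (Real.pi) with h6 | h6
      · left; refine ⟨⟨?_, ?_⟩, h3⟩ <;> push_cast <;> linarith
      · right; refine ⟨⟨?_, ?_⟩, h3⟩ <;> push_cast <;> linarith
  refine (measure_mono hsub).trans ((measure_union_le _ _).trans ?_)
  refine (add_le_add ((measure_union_le _ _).trans (add_le_add (hP _) (hP _))) ((measure_union_le _ _).trans (add_le_add (hP _) (hP _)))).trans ?_
  rw [← ENNReal.ofReal_add (by positivity) (by positivity), ← ENNReal.ofReal_add (by positivity) (by positivity)]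
  exact ENNReal.ofReal_le_ofReal (by linarith)

lemma ring_vol {t δ α : ℝ} {S : Set ℂ} (hS : MeasurableSet S) (ht : 0 ≤ t) (hδ : 0 ≤ δ) (hα : 0 ≤ α)
    (hsub : ∀ y ∈ S, |‖y‖ - t| ≤ δ)
    (harc : ∀ r : ℝ, 0 < r → |r - t| ≤ δ → volume {θ : ℝ | θ ∈ Ioo (-Real.pi) Real.pi ∧ (r * (Real.cos θ + Real.sin θ * Complex.I) : ℂ) ∈ S} ≤ ENNReal.ofReal α) :
    volume S ≤ ENNReal.ofReal (2 * δ * (t + δ) * α) := by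
  have h1 := Complex.lintegral_comp_polarCoord_symm (S.indicator 1)
  rw [lintegral_indicator_one hS] at h1
  rw [← h1]
  have hm : Measurable fun p : ℝ × ℝ => (p.1 * (Real.cos p.2 + Real.sin p.2 * Complex.I) : ℂ) := by fun_prop
  have e1 : polarCoord.target = Ioi (0:ℝ) ×ˢ Ioo (-Real.pi) Real.pi := rfl
  rw [e1, Measure.volume_eq_prod, setLIntegral_prod]
  rotate_left
  · refine Measurable.aemeasurable ?_
    simp only [Complex.polarCoord_symm_apply]
    refine (measurable_fst.ennreal_ofReal).smul ?_
    exact ((measurable_one.indicator hS).comp hm)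
  calc ∫⁻ r in Ioi (0:ℝ), ∫⁻ θ in Ioo (-Real.pi) Real.pi, ENNReal.ofReal r • S.indicator 1 (Complex.polarCoord.symm (r, θ)) 
      ≤ ∫⁻ r in Ioi (0:ℝ), (Icc (t - δ) (t + δ)).indicator (fun _ => ENNReal.ofReal ((t + δ) * α)) r := by
        refine setLIntegral_mono ?_ ?_
        · exact measurable_const.indicator measurableSet_Icc
        · intro r hr
          by_cases hrt : r ∈ Icc (t - δ) (t + δ)
          · rw [indicator_of_mem hrt]
            have hset : MeasurableSet {θ : ℝ | (r * (Real.cos θ + Real.sin θ * Complex.I) : ℂ) ∈ S} := by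
              refine measurableSet_preimage (f := fun θ : ℝ => (r * (Real.cos θ + Real.sin θ * Complex.I) : ℂ)) ?_ hS
              fun_prop
            have e2 : ∀ θ, ENNReal.ofReal r • S.indicator (1 : ℂ → ℝ≥0∞) (Complex.polarCoord.symm (r, θ)) = 
                ENNReal.ofReal r * {θ : ℝ | (r * (Real.cos θ + Real.sin θ * Complex.I) : ℂ) ∈ S}.indicator 1 θ := by
              intro θ
              rw [Complex.polarCoord_symm_apply, smul_eq_mul]
              by_cases hh : (r * (Real.cos θ + Real.sin θ * Complex.I) : ℂ) ∈ S
              · rw [indicator_of_mem hh, indicator_of_mem (s := {θ : ℝ | (r * (Real.cos θ + Real.sin θ * Complex.I) : ℂ) ∈ S}) hh]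
                rfl
              · rw [indicator_of_notMem hh, indicator_of_notMem (s := {θ : ℝ | (r * (Real.cos θ + Real.sin θ * Complex.I) : ℂ) ∈ S}) hh]
            simp only [e2]
            rw [lintegral_const_mul _ (measurable_one.indicator hset), lintegral_indicator_one hset, Measure.restrict_apply hset]
            rw [ENNReal.ofReal_mul (by linarith)]
            refine mul_le_mul' (ENNReal.ofReal_le_ofReal hrt.2) ?_
            refine le_trans (measure_mono ?_) (harc r hr (by rw [abs_le]; constructor <;> linarith [hrt.1, hrt.2]))
            rintro θ ⟨h1, h2⟩
            exact ⟨h2, h1⟩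
          · rw [indicator_of_notMem hrt]
            have e2 : ∀ θ, ENNReal.ofReal r • S.indicator (1 : ℂ → ℝ≥0∞) (Complex.polarCoord.symm (r, θ)) = 0 := by
              intro θ
              rw [indicator_of_notMem, smul_zero]
              intro hmem
              apply hrt
              have := hsub _ hmem
              rw [Complex.norm_polarCoord_symm, abs_of_pos (show 0 < (r, θ).1 from hr), abs_le] at this
              constructor <;> linarith [this.1, this.2]
            simp only [e2]; simp
    _ ≤ ∫⁻ r, (Icc (t - δ) (t + δ)).indicator (fun _ => ENNReal.ofReal ((t + δ) * α)) r := setLIntegral_le_lintegral _ _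
    _ = ENNReal.ofReal (2 * δ * (t + δ) * α) := by
        rw [lintegral_indicator measurableSet_Icc, setLIntegral_const, Real.volume_Icc, ← ENNReal.ofReal_mul (by positivity)]
        congr 1; ring

lemma norm_sq_polar (r θ : ℝ) (u : ℂ) :
    ‖(r * (Real.cos θ + Real.sin θ * Complex.I) : ℂ) - u‖ ^ 2 = r ^ 2 + ‖u‖ ^ 2 - 2 * r * ‖u‖ * Real.cos (θ - u.arg) := by
  have h1 : u.re = ‖u‖ * Real.cos u.arg := by
    rw [Complex.norm_mul_cos_arg]
  have h2 : u.im = ‖u‖ * Real.sin u.arg := by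
    rw [Complex.norm_mul_sin_arg]
  rw [← Complex.normSq_eq_norm_sq, Complex.normSq_apply, Real.cos_sub]
  have c1 := Real.cos_sq_add_sin_sq u.arg
  have c2 := Real.cos_sq_add_sin_sq θ
  simp only [Complex.sub_re, Complex.mul_re, Complex.ofReal_re, Complex.add_re, Complex.I_re, Complex.ofReal_im, Complex.I_im, Complex.sub_im, Complex.mul_im, Complex.add_im]
  rw [h1, h2]
  linear_combination r ^ 2 * c2 + ‖u‖ ^ 2 * c1

lemma vol_translate (S : Set ℂ) (x : ℂ) : volume S = volume {y | y + x ∈ S} :=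
  (measure_preimage_add_right volume x S).symm

lemma vol_two {t t' δ : ℝ} {x x' : ℂ} (hδ : 0 < δ) (hδ1 : δ ≤ 1/8) (t1 : 1 ≤ t) (t2 : t ≤ 2) (t1' : 1 ≤ t') (t2' : t' ≤ 2) (hx : 0 < ‖x - x'‖) :
    volume {y : ℂ | |‖y - x‖ - t| ≤ δ ∧ |‖y - x'‖ - t'| ≤ δ} ≤ ENNReal.ofReal (115 * δ * √(δ / ‖x - x'‖)) := by
  rw [vol_translate _ x]
  set τ := ‖x - x'‖ with hτ
  set u := x' - x with hu
  have huτ : ‖u‖ = τ := by rw [hu, hτ, norm_sub_rev]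
  have e : {y : ℂ | y + x ∈ {y : ℂ | |‖y - x‖ - t| ≤ δ ∧ |‖y - x'‖ - t'| ≤ δ}} = {y : ℂ | |‖y‖ - t| ≤ δ ∧ |‖y - u‖ - t'| ≤ δ} := by
    ext y
    simp only [Set.mem_ofPred_eq, add_sub_cancel_right]
    rw [show y + x - x' = y - u by rw [hu]; ring]
  rw [e]
  refine (ring_vol (t := t) (δ := δ) (α := 12 * √(5 * δ / τ)) ?_ (by linarith) hδ.le (by positivity) (fun y hy => hy.1) ?_).trans ?_
  · exact (measurableSet_le (f := fun y : ℂ => |‖y‖ - t|) (by fun_prop) measurable_const).inter (measurableSet_le (f := fun y : ℂ => |‖y - u‖ - t'|) (by fun_prop) measurable_const)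
  · intro r hr hrt
    refine (measure_mono ?_).trans (arc_cos (φ := u.arg) (a := (r ^ 2 + τ ^ 2 - (t' + δ) ^ 2) / (2 * r * τ)) ⟨(Complex.neg_pi_lt_arg u).le, Complex.arg_le_pi u⟩)
    rintro θ ⟨h1, -, h2⟩
    refine ⟨h1, ?_⟩
    have hn := norm_sq_polar r θ u
    set N := ‖(r * (Real.cos θ + Real.sin θ * Complex.I) : ℂ) - u‖
    have hN : 0 ≤ N := norm_nonneg _
    rw [huτ] at hn
    rw [abs_le] at h2 hrt
    have hr1 : 7/8 ≤ r := by linarith [hrt.1]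
    have b1 : N ^ 2 ≤ (t' + δ) ^ 2 := pow_le_pow_left₀ hN (by linarith) 2
    have b2 : (t' - δ) ^ 2 ≤ N ^ 2 := pow_le_pow_left₀ (by linarith) (by linarith) 2
    have hrτ : 0 < 2 * r * τ := by positivity
    have hc : Real.cos (θ - u.arg) = (r ^ 2 + τ ^ 2 - N ^ 2) / (2 * r * τ) := by
      rw [eq_div_iff hrτ.ne']; linarith
    rw [hc]
    constructor
    · gcongr
    · have : 5 * δ / τ = (10 * r * δ) / (2 * r * τ) := by field_simp; ring
      rw [this, ← add_div]
      gcongr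
      have h3 : (t' + δ) ^ 2 - (t' - δ) ^ 2 ≤ 8 * δ := by
        have : (t' + δ) ^ 2 - (t' - δ) ^ 2 = 4 * t' * δ := by ring
        rw [this]; nlinarith only [t2', hδ]
      have h4 : 8 * δ ≤ 10 * r * δ := by nlinarith only [hr1, hδ]
      linarith
  · apply ENNReal.ofReal_le_ofReal
    have h5 : √(5 * δ / τ) ≤ 2.24 * √(δ / τ) := by
      rw [mul_div_assoc, Real.sqrt_mul (by norm_num)]
      gcongr
      rw [Real.sqrt_le_left (by norm_num)]; norm_num
    calc 2 * δ * (t + δ) * (12 * √(5 * δ / τ)) ≤ 2 * δ * (2 + 1/8) * (12 * (2.24 * √(δ / τ))) := by gcongr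
      _ = 114.24 * (δ * √(δ / τ)) := by ring
      _ ≤ 115 * (δ * √(δ / τ)) := by gcongr; norm_num
      _ = _ := by ring

lemma vol_loc {t δ R : ℝ} {x y0 : ℂ} (hδ : 0 < δ) (hδ1 : δ ≤ 1/8) (t1 : 1 ≤ t) (t2 : t ≤ 2) (hR : 0 ≤ R) (hR1 : R ≤ 1/4) :
    volume {y : ℂ | |‖y - x‖ - t| ≤ δ ∧ ‖y - y0‖ ≤ R} ≤ ENNReal.ofReal (62 * δ * R) := by
  rw [vol_translate _ x]
  set u := y0 - x with hu
  have e : {y : ℂ | y + x ∈ {y : ℂ | |‖y - x‖ - t| ≤ δ ∧ ‖y - y0‖ ≤ R}} = {y : ℂ | |‖y‖ - t| ≤ δ ∧ ‖y - u‖ ≤ R} := by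
    ext y
    simp only [Set.mem_ofPred_eq, add_sub_cancel_right]
    rw [show y + x - y0 = y - u by rw [hu]; ring]
  rw [e]
  refine (ring_vol (t := t) (δ := δ) (α := 14.4 * R) ?_ (by linarith) hδ.le (by positivity) (fun y hy => hy.1) ?_).trans ?_
  · exact (measurableSet_le (f := fun y : ℂ => |‖y‖ - t|) (by fun_prop) measurable_const).inter (measurableSet_le (f := fun y : ℂ => ‖y - u‖) (by fun_prop) measurable_const)
  · intro r hr hrt
    have e3 : ENNReal.ofReal (14.4 * R) = ENNReal.ofReal (12 * √((1.2 * R) ^ 2)) := by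
      rw [Real.sqrt_sq (by positivity)]; congr 1; ring
    rw [e3]
    refine (measure_mono ?_).trans (arc_cos (φ := u.arg) (a := 1 - (1.2 * R) ^ 2) ⟨(Complex.neg_pi_lt_arg u).le, Complex.arg_le_pi u⟩)
    rintro θ ⟨h1, -, h2⟩
    refine ⟨h1, ?_⟩
    have hn := norm_sq_polar r θ u
    have hnn : ‖(r * (Real.cos θ + Real.sin θ * Complex.I) : ℂ)‖ = r := by
      have := norm_sq_polar r θ 0
      simp only [sub_zero, norm_zero] at this
      rw [← pow_left_inj₀ (norm_nonneg _) hr.le two_ne_zero, this]; ring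
    have hs : r ≤ ‖u‖ + R := by
      have := norm_sub_norm_le (r * (Real.cos θ + Real.sin θ * Complex.I) : ℂ) u
      rw [hnn] at this; linarith
    set N := ‖(r * (Real.cos θ + Real.sin θ * Complex.I) : ℂ) - u‖
    have hN : 0 ≤ N := norm_nonneg _
    rw [abs_le] at hrt
    have hr1 : 7/8 ≤ r := by linarith [hrt.1]
    have hu1 : 5/8 ≤ ‖u‖ := by linarith
    have b1 : N ^ 2 ≤ R ^ 2 := pow_le_pow_left₀ hN (by linarith) 2
    have hc1 := Real.cos_le_one (θ - u.arg)
    set c := Real.cos (θ - u.arg)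
    refine ⟨?_, by linarith⟩
    have h6 : 2 * (r * ‖u‖) * (1 - c) ≤ R ^ 2 := by nlinarith only [hn, b1, sq_nonneg (r - ‖u‖)]
    have h7 : 35/64 ≤ r * ‖u‖ := by nlinarith only [hr1, hu1]
    have h8 : 35/32 * (1 - c) ≤ R ^ 2 := by nlinarith only [h6, h7, hc1]
    nlinarith only [h8, sq_nonneg R]
  · apply ENNReal.ofReal_le_ofReal
    calc 2 * δ * (t + δ) * (14.4 * R) ≤ 2 * δ * (2 + 1/8) * (14.4 * R) := by gcongr
      _ = 61.2 * (δ * R) := by ring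
      _ ≤ 62 * (δ * R) := by gcongr; norm_num
      _ = _ := by ring

lemma vol_ring {t δ : ℝ} {x : ℂ} (hδ : 0 < δ) (hδ1 : δ ≤ 1/8) (t1 : 1 ≤ t) (t2 : t ≤ 2) :
    volume {y : ℂ | |‖y - x‖ - t| ≤ δ} ≤ ENNReal.ofReal (27 * δ) := by
  rw [vol_translate _ x]
  simp only [Set.mem_ofPred_eq, add_sub_cancel_right]
  refine (ring_vol (t := t) (δ := δ) (α := 2 * Real.pi) (measurableSet_le (f := fun y : ℂ => |‖y‖ - t|) (by fun_prop) measurable_const) (by linarith) hδ.le (by positivity) (fun y hy => hy) ?_).trans ?_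
  · intro r hr hrt
    refine (measure_mono (t := Ioo (-Real.pi) Real.pi) (fun θ h => h.1)).trans ?_
    rw [Real.volume_Ioo]
    exact ENNReal.ofReal_le_ofReal (by linarith)
  · apply ENNReal.ofReal_le_ofReal
    have := Real.pi_lt_d2
    calc 2 * δ * (t + δ) * (2 * Real.pi) ≤ 2 * δ * (2 + 1/8) * (2 * 3.15) := by gcongr
      _ ≤ _ := by linarith

lemma KK_le_vol {t t' δ V : ℝ} {w : ℂ → ℝ} {a a' : ℝ → ℝ} (hδ : 0 < δ) (hw : ∀ y, |w y| ≤ 1) (x x' : ℂ)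
    (ha : Prof δ t a) (ha' : Prof δ t' a') (hV0 : 0 ≤ V)
    (hV : volume {y : ℂ | |‖y - x‖ - t| ≤ δ ∧ |‖y - x'‖ - t'| ≤ δ} ≤ ENNReal.ofReal V) :
    |KK w a a' x x'| ≤ V / δ ^ 2 := by
  unfold KK
  set S := {y : ℂ | |‖y - x‖ - t| ≤ δ ∧ |‖y - x'‖ - t'| ≤ δ}
  have e : ∫ y, w y * (a ‖y - x‖ * a' ‖y - x'‖) = ∫ y in S, w y * (a ‖y - x‖ * a' ‖y - x'‖) := by
    rw [setIntegral_eq_integral_of_forall_compl_eq_zero]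
    intro y hy
    by_contra hne
    exact hy ⟨ha.supp _ (left_ne_zero_of_mul (right_ne_zero_of_mul hne)), ha'.supp _ (right_ne_zero_of_mul (right_ne_zero_of_mul hne))⟩
  rw [e, ← Real.norm_eq_abs]
  refine (norm_setIntegral_le_of_norm_le_const (C := 1 / δ ^ 2) (hV.trans_lt ENNReal.ofReal_lt_top) ?_).trans ?_
  · intro y _
    rw [Real.norm_eq_abs, abs_mul, abs_mul]
    calc |w y| * (|a ‖y - x‖| * |a' ‖y - x'‖|) ≤ 1 * (1 / δ * (1 / δ)) := by
          gcongr
          · exact hw y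
          · exact ha.bd _
          · exact ha'.bd _
      _ = _ := by field_simp
  · have : volume.real S ≤ V := ENNReal.toReal_le_of_le_ofReal hV0 hV
    rw [div_mul_eq_mul_div, one_mul]
    gcongr

lemma KK_bound1 {t t' δ : ℝ} {w : ℂ → ℝ} {a a' : ℝ → ℝ} (hδ : 0 < δ) (hδ1 : δ ≤ 1/8) (t1 : 1 ≤ t) (t2 : t ≤ 2) (hw : ∀ y, |w y| ≤ 1) (x x' : ℂ)
    (ha : Prof δ t a) (ha' : Prof δ t' a') : |KK w a a' x x'| ≤ 27 / δ := by
  refine (KK_le_vol (V := 27 * δ) hδ hw x x' ha ha' (by positivity) ?_).trans ?_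
  · exact (measure_mono fun y hy => hy.1).trans (vol_ring hδ hδ1 t1 t2)
  · apply le_of_eq; field_simp

lemma KK_bound2 {t t' δ : ℝ} {w : ℂ → ℝ} {a a' : ℝ → ℝ} (hδ : 0 < δ) (hδ1 : δ ≤ 1/8) (t1 : 1 ≤ t) (t2 : t ≤ 2) 
    (t1' : 1 ≤ t') (t2' : t' ≤ 2) (hw : ∀ y, |w y| ≤ 1) (x x' : ℂ) (hx : 0 < ‖x - x'‖)
    (ha : Prof δ t a) (ha' : Prof δ t' a') : |KK w a a' x x'| ≤ 115 / √(δ * ‖x - x'‖) := by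
  refine (KK_le_vol (V := 115 * δ * √(δ / ‖x - x'‖)) hδ hw x x' ha ha' (by positivity) (vol_two hδ hδ1 t1 t2 t1' t2' hx)).trans ?_
  apply le_of_eq
  rw [Real.sqrt_div hδ.le, Real.sqrt_mul hδ.le]
  have h1 : √δ ≠ 0 := (Real.sqrt_pos.2 hδ).ne'
  have h2 : √‖x - x'‖ ≠ 0 := (Real.sqrt_pos.2 hx).ne'
  field_simp
  rw [Real.sq_sqrt hδ.le]

lemma KK_bound4 {t t' δ : ℝ} {w : ℂ → ℝ} {a a' : ℝ → ℝ} (x x' : ℂ)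
    (ha : Prof δ t a) (ha' : Prof δ t' a') (h : ‖x - x'‖ + 2 * δ < |t - t'|) : KK w a a' x x' = 0 := by
  unfold KK
  convert integral_zero ℂ ℝ with y
  by_contra hne
  have h1 := ha.supp _ (left_ne_zero_of_mul (right_ne_zero_of_mul hne))
  have h2 := ha'.supp _ (right_ne_zero_of_mul (right_ne_zero_of_mul hne))
  have h3 : |‖y - x‖ - ‖y - x'‖| ≤ ‖x - x'‖ := by
    have := abs_norm_sub_norm_le (y - x) (y - x')
    rwa [sub_sub_sub_cancel_left, norm_sub_rev x'] at this
  rw [abs_le] at h1 h2 h3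
  rcases lt_abs.1 h with h4 | h4 <;> linarith [h1.1, h1.2, h2.1, h2.2, h3.1, h3.2]

lemma mass_loc {t δ R : ℝ} {x y0 : ℂ} {a : ℝ → ℝ} (hδ : 0 < δ) (hδ1 : δ ≤ 1/8) (t1 : 1 ≤ t) (t2 : t ≤ 2) (hR : 0 ≤ R) (hR1 : R ≤ 1/4)
    (ha : Prof δ t a) {g : ℂ → ℝ} (hg : ∀ y, |g y| ≤ 1) (hg0 : ∀ y, g y ≠ 0 → ‖y - y0‖ ≤ R) :
    |∫ y, g y * a ‖y - x‖| ≤ 62 * R := by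
  set S := {y : ℂ | |‖y - x‖ - t| ≤ δ ∧ ‖y - y0‖ ≤ R}
  have hV : volume S ≤ _ := vol_loc hδ hδ1 t1 t2 hR hR1
  have e : ∫ y, g y * a ‖y - x‖ = ∫ y in S, g y * a ‖y - x‖ := by
    rw [setIntegral_eq_integral_of_forall_compl_eq_zero]
    intro y hy
    by_contra hne
    exact hy ⟨ha.supp _ (right_ne_zero_of_mul hne), hg0 _ (left_ne_zero_of_mul hne)⟩
  rw [e, ← Real.norm_eq_abs]
  refine (norm_setIntegral_le_of_norm_le_const (C := 1 / δ) (hV.trans_lt ENNReal.ofReal_lt_top) ?_).trans ?_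
  · intro y _
    rw [Real.norm_eq_abs, abs_mul]
    calc |g y| * |a ‖y - x‖| ≤ 1 * (1 / δ) := by
          gcongr
          · exact hg y
          · exact ha.bd _
      _ = _ := by field_simp
  · have : volume.real S ≤ _ := ENNReal.toReal_le_of_le_ofReal (by positivity) hV
    calc 1 / δ * volume.real S ≤ 1 / δ * (62 * δ * R) := by gcongr
      _ = _ := by field_simp

end SM

namespace SM

/-- Bounded measurable kernel. -/
structure BK (D : ℝ) (G : ℂ → ℂ → ℝ) : Prop where
  meas : Measurable (Function.uncurry G)
  bd : ∀ x y, |G x y| ≤ D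

lemma integrable_bdd {X : Type*} [MeasurableSpace X] {μ : Measure X} [IsFiniteMeasure μ] {g : X → ℝ} (hg : Measurable g) {D : ℝ} (hD : ∀ x, |g x| ≤ D) :
    Integrable g μ :=
  Integrable.of_bound hg.aestronglyMeasurable D (Filter.Eventually.of_forall hD)

lemma abs_setInt_le {X : Type*} [MeasurableSpace X] {μ : Measure X} [IsFiniteMeasure μ] {g : X → ℝ} {B : Set X} {D : ℝ} (hD : ∀ x ∈ B, |g x| ≤ D) :
    |∫ x in B, g x ∂μ| ≤ D * μ.real B := by
  rw [← Real.norm_eq_abs]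
  exact norm_setIntegral_le_of_norm_le_const (measure_lt_top _ _) hD

lemma abs_int_le {X : Type*} [MeasurableSpace X] {μ : Measure X} [IsFiniteMeasure μ] {g : X → ℝ} {D : ℝ} (hD : ∀ x, |g x| ≤ D) :
    |∫ x, g x ∂μ| ≤ D * μ.real univ := by
  rw [← Real.norm_eq_abs]
  exact norm_integral_le_of_norm_le_const (Filter.Eventually.of_forall hD)

def Gam (ν : Measure ℂ) (G : ℂ → ℂ → ℝ) (B : Set ℂ) (y : ℂ) : ℝ := ∫ x in B, G x y ∂ν

def KG (κ : Measure ℂ) (G : ℂ → ℂ → ℝ) (x x' : ℂ) : ℝ := ∫ y, G x y * G x' y ∂κ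

section
variable {ν κ : Measure ℂ} [IsFiniteMeasure ν] [IsFiniteMeasure κ] {G : ℂ → ℂ → ℝ} {D : ℝ}

lemma Gam_meas (hG : BK D G) (B : Set ℂ) : Measurable (Gam ν G B) := by
  have : StronglyMeasurable (fun p : ℂ × ℂ => G p.2 p.1) := (hG.meas.comp measurable_swap).stronglyMeasurable
  exact (this.integral_prod_right (ν := ν.restrict B)).measurable

lemma BK.sw (hG : BK D G) (y : ℂ) : Measurable (fun x => G x y) := 
  hG.meas.comp (measurable_id.prodMk measurable_const)

lemma BK.sw' (hG : BK D G) (x : ℂ) : Measurable (fun y => G x y) := 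
  hG.meas.comp (measurable_const.prodMk measurable_id)

lemma Gam_bd (hG : BK D G) (B : Set ℂ) (y : ℂ) : |Gam ν G B y| ≤ D * ν.real B :=
  abs_setInt_le (fun x _ => hG.bd x y)

lemma KG_meas (hG : BK D G) : Measurable (Function.uncurry (KG κ G)) := by
  have h1 : Measurable fun q : (ℂ × ℂ) × ℂ => G q.1.1 q.2 * G q.1.2 q.2 :=
    (hG.meas.comp (measurable_fst.fst.prodMk measurable_snd)).mul (hG.meas.comp (measurable_fst.snd.prodMk measurable_snd))
  exact (h1.stronglyMeasurable.integral_prod_right (ν := κ)).measurable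

lemma KG_bd (hG : BK D G) (x x' : ℂ) : |KG κ G x x'| ≤ D * D * κ.real univ := by
  refine abs_int_le (fun y => ?_)
  rw [abs_mul]
  exact mul_le_mul (hG.bd _ _) (hG.bd _ _) (abs_nonneg _) ((abs_nonneg _).trans (hG.bd x y))

lemma Gam_mul_int (hG : BK D G) (B B' : Set ℂ) : Integrable (fun y => Gam ν G B y * Gam ν G B' y) κ := by
  refine integrable_bdd ((Gam_meas hG B).mul (Gam_meas hG B')) (D := (D * ν.real B) * (D * ν.real B')) (fun y => ?_)
  rw [abs_mul]
  exact mul_le_mul (Gam_bd hG B y) (Gam_bd hG B' y) (abs_nonneg _) ((abs_nonneg _).trans (Gam_bd hG B y))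

lemma Gam_pair (hG : BK D G) (B B' : Set ℂ) :
    ∫ y, Gam ν G B y * Gam ν G B' y ∂κ = ∫ x in B, ∫ x' in B', KG κ G x x' ∂ν ∂ν := by
  have e1 : ∀ y, Gam ν G B y * Gam ν G B' y = ∫ x in B, G x y * Gam ν G B' y ∂ν := by
    intro y; rw [integral_mul_const]; rfl
  simp only [e1]
  rw [integral_integral_swap]
  · congr 1; ext x
    have e2 : ∀ y, G x y * Gam ν G B' y = ∫ x' in B', G x y * G x' y ∂ν := by
      intro y; rw [integral_const_mul]; rfl
    simp only [e2]
    rw [integral_integral_swap]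
    · rfl
    · refine integrable_bdd (D := D * D) ?_ ?_
      · exact ((hG.sw' x).comp measurable_fst).mul (hG.meas.comp measurable_swap)
      · intro p
        simp only [Function.uncurry, abs_mul]
        exact mul_le_mul (hG.bd _ _) (hG.bd _ _) (abs_nonneg _) ((abs_nonneg _).trans (hG.bd x 0))
  · refine integrable_bdd (D := D * (D * ν.real B')) ?_ ?_
    · exact (hG.meas.comp measurable_swap).mul ((Gam_meas hG B').comp measurable_fst)
    · intro p
      simp only [Function.uncurry, abs_mul]
      exact mul_le_mul (hG.bd _ _) (Gam_bd hG _ _) (abs_nonneg _) ((abs_nonneg _).trans (hG.bd 0 0))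

/-- energy -/
def En (ν κ : Measure ℂ) (G : ℂ → ℂ → ℝ) (B : Set ℂ) : ℝ := ∫ y, Gam ν G B y ^ 2 ∂κ

lemma En_eq (hG : BK D G) (B : Set ℂ) : En ν κ G B = ∫ x in B, ∫ x' in B, KG κ G x x' ∂ν ∂ν := by
  rw [← Gam_pair hG]; simp only [En, sq]

lemma En_nonneg (B : Set ℂ) : 0 ≤ En ν κ G B := integral_nonneg fun _ => sq_nonneg _

lemma En_le (hG : BK D G) {B : Set ℂ} (hB : MeasurableSet B) {c : ℝ} (h : ∀ x ∈ B, |∫ x' in B, KG κ G x x' ∂ν| ≤ c) :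
    En ν κ G B ≤ c * ν.real B := by
  rw [En_eq hG]
  refine (le_abs_self _).trans ?_
  exact abs_setInt_le h

lemma cs_int {X : Type*} [MeasurableSpace X] {μ : Measure X} {f g : X → ℝ} (hf : Integrable (fun x => f x ^ 2) μ) (hg : Integrable (fun x => g x ^ 2) μ)
    (hfg : Integrable (fun x => f x * g x) μ) :
    (∫ x, f x * g x ∂μ) ^ 2 ≤ (∫ x, f x ^ 2 ∂μ) * ∫ x, g x ^ 2 ∂μ := by
  have key : ∀ s : ℝ, 0 ≤ (∫ x, g x ^ 2 ∂μ) * (s * s) + (-2 * ∫ x, f x * g x ∂μ) * s + ∫ x, f x ^ 2 ∂μ := by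
    intro s
    have : 0 ≤ ∫ x, (f x - s * g x) ^ 2 ∂μ := integral_nonneg fun _ => sq_nonneg _
    have e : ∫ x, (f x - s * g x) ^ 2 ∂μ = (∫ x, g x ^ 2 ∂μ) * (s * s) + (-2 * ∫ x, f x * g x ∂μ) * s + ∫ x, f x ^ 2 ∂μ := by
      have : ∀ x, (f x - s * g x) ^ 2 = (s * s) * g x ^ 2 + (-2 * s) * (f x * g x) + f x ^ 2 := by intro x; ring
      simp only [this]
      have i1 : Integrable (fun x => (s * s) * g x ^ 2) μ := hg.const_mul _
      have i2 : Integrable (fun x => (-2 * s) * (f x * g x)) μ := hfg.const_mul _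
      have i3 : Integrable (fun x => (s * s) * g x ^ 2 + (-2 * s) * (f x * g x)) μ := i1.add i2
      rw [integral_add i3 hf, integral_add i1 i2, integral_const_mul, integral_const_mul]
      ring
    rwa [e] at this
  have := discrim_le_zero key
  rw [discrim] at this
  nlinarith only [this]

lemma TT (hG : BK D G) {f : ℂ → ℝ} (hf : Measurable f) (hf1 : ∀ y, |f y| ≤ 1) {B : Set ℂ} (hB : MeasurableSet B) {l : ℝ} (hl : 0 ≤ l)
    (h : ∀ x ∈ B, l ≤ ∫ y, f y * G x y ∂κ) :
    (l * ν.real B) ^ 2 ≤ (∫ y, f y ^ 2 ∂κ) * En ν κ G B := by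
  have hD : 0 ≤ D := (abs_nonneg _).trans (hG.bd 0 0)
  have hfG : Measurable (fun p : ℂ × ℂ => f p.2 * G p.1 p.2) := (hf.comp measurable_snd).mul hG.meas
  have hfGb : ∀ x y, |f y * G x y| ≤ D := by
    intro x y; rw [abs_mul]
    calc |f y| * |G x y| ≤ 1 * D := mul_le_mul (hf1 y) (hG.bd _ _) (abs_nonneg _) zero_le_one
      _ = D := one_mul D
  have h1 : l * ν.real B ≤ ∫ x in B, ∫ y, f y * G x y ∂κ ∂ν := by
    have : ∫ x in B, l ∂ν = l * ν.real B := by rw [setIntegral_const, smul_eq_mul, mul_comm]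
    rw [← this]
    refine setIntegral_mono_on (integrable_const _) ?_ hB h
    refine integrable_bdd (hfG.stronglyMeasurable.integral_prod_right (ν := κ)).measurable (D := D * κ.real univ) (fun x => ?_)
    exact abs_int_le (fun y => hfGb x y)
  have h2 : ∫ x in B, ∫ y, f y * G x y ∂κ ∂ν = ∫ y, f y * Gam ν G B y ∂κ := by
    rw [integral_integral_swap]
    · congr 1; ext y; rw [integral_const_mul]; rfl
    · exact integrable_bdd hfG (D := D) (fun p => hfGb _ _)
  rw [h2] at h1
  have h0 : 0 ≤ l * ν.real B := mul_nonneg hl measureReal_nonneg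
  refine (pow_le_pow_left₀ h0 h1 2).trans ?_
  refine cs_int ?_ ?_ ?_
  · refine integrable_bdd (hf.pow_const 2) (D := 1) (fun y => ?_)
    rw [abs_pow]; exact pow_le_one₀ (abs_nonneg _) (hf1 y)
  · have := Gam_mul_int (ν := ν) (κ := κ) hG B B
    simpa only [sq] using this
  · refine integrable_bdd (hf.mul (Gam_meas hG B)) (D := 1 * (D * ν.real B)) (fun y => ?_)
    rw [abs_mul]
    exact mul_le_mul (hf1 y) (Gam_bd hG B y) (abs_nonneg _) zero_le_one

lemma split_int {B : Set ℂ} (hB : MeasurableSet B) {idx : ℂ → ℕ} (hi : Measurable idx) {N : ℕ} (hN : ∀ x ∈ B, idx x < N) {g : ℂ → ℝ} (hg : IntegrableOn g B ν) :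
    ∫ x in B, g x ∂ν = ∑ k ∈ Finset.range N, ∫ x in B ∩ idx ⁻¹' {k}, g x ∂ν := by
  have e : B = ⋃ k ∈ Finset.range N, B ∩ idx ⁻¹' {k} := by
    ext x
    simp only [Finset.mem_range, mem_iUnion, mem_inter_iff, mem_preimage, mem_singleton_iff, exists_prop]
    constructor
    · intro hx; exact ⟨idx x, hN x hx, hx, rfl⟩
    · rintro ⟨k, -, hx, -⟩; exact hx
  conv_lhs => rw [e]
  refine integral_biUnion_finset _ (fun k _ => hB.inter (hi (measurableSet_singleton k))) ?_ (fun k _ => hg.mono_set inter_subset_left)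
  intro k _ l _ hkl
  rw [Function.onFun, Set.disjoint_left]
  rintro x ⟨-, hx⟩ ⟨-, hx'⟩
  exact hkl (hx.symm.trans hx')

lemma split_real {B : Set ℂ} (hB : MeasurableSet B) {idx : ℂ → ℕ} (hi : Measurable idx) {N : ℕ} (hN : ∀ x ∈ B, idx x < N) :
    ν.real B = ∑ k ∈ Finset.range N, ν.real (B ∩ idx ⁻¹' {k}) := by
  have := split_int (ν := ν) hB hi hN (g := fun _ => 1) (integrable_const _)
  simpa using this

lemma Gam_split (hG : BK D G) {B : Set ℂ} (hB : MeasurableSet B) {idx : ℂ → ℕ} (hi : Measurable idx) {N : ℕ} (hN : ∀ x ∈ B, idx x < N) (y : ℂ) :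
    Gam ν G B y = ∑ k ∈ Finset.range N, Gam ν G (B ∩ idx ⁻¹' {k}) y :=
  split_int hB hi hN (integrable_bdd (hG.sw y) (fun x => hG.bd x y))

lemma En_split (hG : BK D G) {B : Set ℂ} (hB : MeasurableSet B) {idx : ℂ → ℕ} (hi : Measurable idx) {N : ℕ} (hN : ∀ x ∈ B, idx x < N) :
    En ν κ G B ≤ N * ∑ k ∈ Finset.range N, En ν κ G (B ∩ idx ⁻¹' {k}) := by
  have hI : ∀ B, Integrable (fun y => Gam ν G B y ^ 2) κ := fun B => by
    have := Gam_mul_int (ν := ν) (κ := κ) hG B B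
    simpa only [sq] using this
  unfold En
  rw [← integral_finset_sum _ (fun k _ => hI _), ← integral_const_mul]
  refine integral_mono (hI _) ((integrable_finset_sum _ fun k _ => hI _).const_mul _) (fun y => ?_)
  simp only
  rw [Gam_split hG hB hi hN]
  have := sq_sum_le_card_mul_sum_sq (s := Finset.range N) (f := fun k => Gam ν G (B ∩ idx ⁻¹' {k}) y)
  rwa [Finset.card_range] at this

lemma sum_sq_near (N : ℕ) (a : ℕ → ℝ) :
    (∑ k ∈ Finset.range N, a k) ^ 2 ≤ 3 * ∑ k ∈ Finset.range N, a k ^ 2 + 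
      ∑ k ∈ Finset.range N, ∑ l ∈ Finset.range N, if k + 1 < l ∨ l + 1 < k then a k * a l else 0 := by
  have e : (∑ k ∈ Finset.range N, a k) ^ 2 = ∑ k ∈ Finset.range N, ∑ l ∈ Finset.range N, a k * a l := by
    rw [sq, Finset.sum_mul_sum]
  have h1 : ∀ k l, a k * a l ≤ (if k + 1 < l ∨ l + 1 < k then a k * a l else 0) + 
      ((if k = l then a k ^ 2 else 0) + ((if l = k + 1 then (a k ^ 2 + a l ^ 2) / 2 else 0) + (if k = l + 1 then (a k ^ 2 + a l ^ 2) / 2 else 0))) := by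
    intro k l
    have h2 := two_mul_le_add_sq (a k) (a l)
    rcases lt_trichotomy k l with h | h | h
    · rcases Nat.lt_or_ge (k + 1) l with h' | h'
      · rw [if_pos (Or.inl h'), if_neg (by omega), if_neg (by omega), if_neg (by omega)]; linarith
      · rw [if_neg (by omega), if_neg (by omega), if_pos (by omega), if_neg (by omega)]; linarith
    · subst h
      rw [if_neg (by omega), if_pos rfl, if_neg (by omega)]; linarith
    · rcases Nat.lt_or_ge (l + 1) k with h' | h'
      · rw [if_pos (Or.inr h'), if_neg (by omega), if_neg (by omega), if_neg (by omega)]; linarith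
      · rw [if_neg (by omega), if_neg (by omega), if_neg (by omega), if_pos (by omega)]; linarith
  have s0 : ∀ (b : ℕ → ℝ), (∀ k, 0 ≤ b k) → ∀ j, (∑ l ∈ Finset.range N, if l = j then b l else 0) ≤ b j := by
    intro b hb j
    rw [Finset.sum_ite_eq' (Finset.range N) j b]
    split_ifs
    · exact le_rfl
    · exact hb j
  have s1 : ∑ k ∈ Finset.range N, ∑ l ∈ Finset.range N, (if k = l then a k ^ 2 else 0) = ∑ k ∈ Finset.range N, a k ^ 2 := by
    refine Finset.sum_congr rfl fun k hk => ?_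
    rw [Finset.sum_ite_eq, if_pos hk]
  have s2 : ∑ k ∈ Finset.range N, ∑ l ∈ Finset.range N, (if l = k + 1 then (a k ^ 2 + a l ^ 2) / 2 else 0) ≤ ∑ k ∈ Finset.range N, a k ^ 2 := by
    have e1 : ∀ k l, (if l = k + 1 then (a k ^ 2 + a l ^ 2) / 2 else 0) = (if l = k + 1 then a k ^ 2 / 2 else 0) + (if l = k + 1 then a l ^ 2 / 2 else 0) := by
      intro k l; split_ifs <;> ring
    simp only [e1, Finset.sum_add_distrib]
    have t1 : ∑ k ∈ Finset.range N, ∑ l ∈ Finset.range N, (if l = k + 1 then a k ^ 2 / 2 else 0) ≤ ∑ k ∈ Finset.range N, a k ^ 2 / 2 := by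
      refine Finset.sum_le_sum fun k _ => ?_
      exact s0 (fun _ => a k ^ 2 / 2) (fun _ => by positivity) (k + 1)
    have t2 : ∑ k ∈ Finset.range N, ∑ l ∈ Finset.range N, (if l = k + 1 then a l ^ 2 / 2 else 0) ≤ ∑ k ∈ Finset.range N, a k ^ 2 / 2 := by
      rw [Finset.sum_comm]
      refine Finset.sum_le_sum fun l _ => ?_
      rcases l with _ | l
      · simp; positivity
      · have e2 : ∀ k, (l + 1 = k + 1) = (k = l) := by intro k; apply propext; omega
        simp only [e2]
        exact s0 (fun _ => a (l + 1) ^ 2 / 2) (fun _ => by positivity) l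
    rw [← Finset.sum_div] at t1 t2
    linarith
  have s3 : ∑ k ∈ Finset.range N, ∑ l ∈ Finset.range N, (if k = l + 1 then (a k ^ 2 + a l ^ 2) / 2 else 0) ≤ ∑ k ∈ Finset.range N, a k ^ 2 := by
    rw [Finset.sum_comm]
    refine le_trans (le_of_eq ?_) s2
    refine Finset.sum_congr rfl fun k _ => Finset.sum_congr rfl fun l _ => ?_
    split_ifs <;> ring
  rw [e]
  refine (Finset.sum_le_sum fun k _ => Finset.sum_le_sum fun l _ => h1 k l).trans ?_
  simp only [Finset.sum_add_distrib]
  linarith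

lemma En_near (hG : BK D G) {B : Set ℂ} (hB : MeasurableSet B) {idx : ℂ → ℕ} (hi : Measurable idx) {N : ℕ} (hN : ∀ x ∈ B, idx x < N)
    {H : ℂ → ℂ → ℝ} {D' : ℝ} (hH : BK D' H) (hH0 : ∀ x x', 0 ≤ H x x')
    (hKH : ∀ x ∈ B, ∀ x' ∈ B, (idx x + 1 < idx x' ∨ idx x' + 1 < idx x) → KG κ G x x' ≤ H x x') :
    En ν κ G B ≤ 3 * ∑ k ∈ Finset.range N, En ν κ G (B ∩ idx ⁻¹' {k}) + ∫ x in B, ∫ x' in B, H x x' ∂ν ∂ν := by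
  have hms : ∀ k, MeasurableSet (B ∩ idx ⁻¹' {k}) := fun k => hB.inter (hi (measurableSet_singleton k))
  have hI : ∀ B, Integrable (fun y => Gam ν G B y ^ 2) κ := fun B => by
    have := Gam_mul_int (ν := ν) (κ := κ) hG B B
    simpa only [sq] using this
  have hJ : ∀ k l, Integrable (fun y => if k + 1 < l ∨ l + 1 < k then Gam ν G (B ∩ idx ⁻¹' {k}) y * Gam ν G (B ∩ idx ⁻¹' {l}) y else 0) κ := by
    intro k l
    split_ifs
    · exact Gam_mul_int hG _ _
    · exact integrable_zero _ _ _
  have h1 : En ν κ G B ≤ 3 * ∑ k ∈ Finset.range N, En ν κ G (B ∩ idx ⁻¹' {k}) + 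
      ∑ k ∈ Finset.range N, ∑ l ∈ Finset.range N, ∫ y, (if k + 1 < l ∨ l + 1 < k then Gam ν G (B ∩ idx ⁻¹' {k}) y * Gam ν G (B ∩ idx ⁻¹' {l}) y else 0) ∂κ := by
    unfold En
    rw [← integral_finset_sum _ (fun k _ => hI _), ← integral_const_mul]
    have e : ∀ k ∈ Finset.range N, ∑ l ∈ Finset.range N, ∫ y, (if k + 1 < l ∨ l + 1 < k then Gam ν G (B ∩ idx ⁻¹' {k}) y * Gam ν G (B ∩ idx ⁻¹' {l}) y else 0) ∂κ
        = ∫ y, ∑ l ∈ Finset.range N, (if k + 1 < l ∨ l + 1 < k then Gam ν G (B ∩ idx ⁻¹' {k}) y * Gam ν G (B ∩ idx ⁻¹' {l}) y else 0) ∂κ :=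
      fun k _ => (integral_finset_sum _ (fun l _ => hJ k l)).symm
    have i1 : ∀ k ∈ Finset.range N, Integrable (fun y => ∑ l ∈ Finset.range N, (if k + 1 < l ∨ l + 1 < k then Gam ν G (B ∩ idx ⁻¹' {k}) y * Gam ν G (B ∩ idx ⁻¹' {l}) y else 0)) κ :=
      fun k _ => integrable_finset_sum _ (fun l _ => hJ k l)
    have i2 := (integrable_finset_sum (Finset.range N) (fun k (_ : k ∈ Finset.range N) => hI (B ∩ idx ⁻¹' {k}))).const_mul 3
    rw [Finset.sum_congr rfl e, ← integral_finset_sum _ i1, ← integral_add i2 (integrable_finset_sum _ i1)]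
    refine integral_mono (hI _) (i2.add (integrable_finset_sum _ i1)) (fun y => ?_)
    simp only
    rw [Gam_split hG hB hi hN]
    exact sum_sq_near N _
  refine h1.trans (add_le_add le_rfl ?_)
  have hHx : ∀ (x : ℂ) (B : Set ℂ), IntegrableOn (H x) B ν := fun x B => integrable_bdd (hH.sw' x) (hH.bd x)
  have hHB : ∀ (B B' : Set ℂ), IntegrableOn (fun x => ∫ x' in B', H x x' ∂ν) B ν := by
    intro B B'
    refine integrable_bdd ((hH.meas.stronglyMeasurable.integral_prod_right (ν := ν.restrict B')).measurable) (D := D' * ν.real B') (fun x => ?_)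
    exact abs_setInt_le (fun x' _ => hH.bd x x')
  have e2 : ∫ x in B, ∫ x' in B, H x x' ∂ν ∂ν = ∑ k ∈ Finset.range N, ∑ l ∈ Finset.range N, ∫ x in B ∩ idx ⁻¹' {k}, ∫ x' in B ∩ idx ⁻¹' {l}, H x x' ∂ν ∂ν := by
    rw [split_int hB hi hN (hHB B B)]
    refine Finset.sum_congr rfl fun k _ => ?_
    rw [← integral_finset_sum _ (fun l _ => hHB _ _)]
    refine setIntegral_congr_fun (hms k) (fun x _ => ?_)
    exact split_int hB hi hN (hHx x B)
  rw [e2]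
  refine Finset.sum_le_sum fun k _ => Finset.sum_le_sum fun l _ => ?_
  split_ifs with h
  · rw [Gam_pair hG]
    refine setIntegral_mono_on ?_ (hHB _ _) (hms k) ?_
    · refine integrable_bdd (((KG_meas hG).stronglyMeasurable.integral_prod_right (ν := ν.restrict _)).measurable) (D := D * D * κ.real univ * ν.real (B ∩ idx ⁻¹' {l})) (fun x => ?_)
      exact abs_setInt_le (fun x' _ => KG_bd hG x x')
    · intro x hx
      refine setIntegral_mono_on (integrable_bdd ((KG_meas hG).comp (measurable_const.prodMk measurable_id)) (KG_bd hG x)) (hHx x _) (hms l) ?_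
      intro x' hx'
      refine hKH x hx.1 x' hx'.1 ?_
      have : idx x = k := hx.2
      have : idx x' = l := hx'.2
      simp_all
  · rw [integral_zero]
    exact integral_nonneg fun x => integral_nonneg fun x' => hH0 x x'

end

end SM

namespace SM

structure AP (δ : ℝ) (A : ℝ → ℝ → ℝ) : Prop where
  cont : Continuous (Function.uncurry A)
  prof : ∀ t, 1 ≤ t → t ≤ 2 → Prof δ t (A t)

lemma TW.trans {L : ℝ} {w : ℂ → ℝ} (hw : TW L w) (x : ℂ) : TW L (fun y => w (y - x)) := by
  refine ⟨fun y => hw.bd _, hw.cont.comp (by fun_prop), fun y0 => ?_⟩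
  obtain ⟨b1, b2, h1, h2, h⟩ := hw.tay (y0 - x)
  refine ⟨b1, b2, h1, h2, fun y => ?_⟩
  have := h (y - x)
  rwa [sub_sub_sub_cancel_right] at this

lemma TW.lip {L : ℝ} {w : ℂ → ℝ} (hL : 0 ≤ L) (hw : TW L w) (y y0 : ℂ) : |w y - w y0| ≤ 3 * (L * ‖y - y0‖) := by
  obtain ⟨b1, b2, h1, h2, h⟩ := hw.tay y0
  set d := ‖y - y0‖ with hd
  have hd0 : 0 ≤ d := norm_nonneg _
  rcases le_total (L * d) 1 with h3 | h3
  · have h4 := h y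
    have e : w y - w y0 = (w y - w y0 - b1 * (y - y0).re - b2 * (y - y0).im) + b1 * (y - y0).re + b2 * (y - y0).im := by ring
    have h5 : |b1 * (y - y0).re| ≤ L * d := by rw [abs_mul]; exact mul_le_mul h1 (Complex.abs_re_le_norm _) (abs_nonneg _) hL
    have h6 : |b2 * (y - y0).im| ≤ L * d := by rw [abs_mul]; exact mul_le_mul h2 (Complex.abs_im_le_norm _) (abs_nonneg _) hL
    have h7 : L ^ 2 * d ^ 2 ≤ L * d := by
      have : 0 ≤ L * d := by positivity
      nlinarith only [this, h3]
    rw [e]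
    refine (abs_add_three _ _ _).trans ?_
    linarith
  · have h4 := hw.bd y; have h5 := hw.bd y0
    refine (abs_sub _ _).trans ?_
    linarith

lemma TW.mul {L : ℝ} {w v : ℂ → ℝ} (hL : 0 ≤ L) (hw : TW L w) (hv : TW L v) : TW (4 * L) (fun y => w y * v y) := by
  refine ⟨fun y => ?_, hw.cont.mul hv.cont, fun y0 => ?_⟩
  · rw [abs_mul]; exact mul_le_one₀ (hw.bd y) (abs_nonneg _) (hv.bd y)
  obtain ⟨b1, b2, h1, h2, h⟩ := hw.tay y0
  obtain ⟨c1, c2, k1, k2, k⟩ := hv.tay y0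
  have hb := hw.bd y0; have hc := hv.bd y0
  have aux : ∀ p q r s : ℝ, |p| ≤ 1 → |q| ≤ L → |r| ≤ 1 → |s| ≤ L → |p * q + r * s| ≤ 4 * L := by
    intro p q r s h1 h2 h3 h4
    refine (abs_add_le _ _).trans ?_
    rw [abs_mul, abs_mul]
    have := mul_le_mul h1 h2 (abs_nonneg _) zero_le_one
    have := mul_le_mul h3 h4 (abs_nonneg _) zero_le_one
    linarith
  refine ⟨w y0 * c1 + v y0 * b1, w y0 * c2 + v y0 * b2, aux _ _ _ _ hb k1 hc h1, aux _ _ _ _ hb k2 hc h2, fun y => ?_⟩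
  have e : w y * v y - w y0 * v y0 - (w y0 * c1 + v y0 * b1) * (y - y0).re - (w y0 * c2 + v y0 * b2) * (y - y0).im
    = w y0 * (v y - v y0 - c1 * (y - y0).re - c2 * (y - y0).im) + v y0 * (w y - w y0 - b1 * (y - y0).re - b2 * (y - y0).im)
      + (w y - w y0) * (v y - v y0) := by ring
  rw [e]
  refine (abs_add_three _ _ _).trans ?_
  rw [abs_mul, abs_mul, abs_mul]
  have m1 := mul_le_mul hb (k y) (abs_nonneg _) zero_le_one
  have m2 := mul_le_mul hc (h y) (abs_nonneg _) zero_le_one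
  have m3 := mul_le_mul (hw.lip hL y y0) (hv.lip hL y y0) (abs_nonneg _) (by positivity)
  have : 0 ≤ L ^ 2 * ‖y - y0‖ ^ 2 := by positivity
  linarith

def Gk (η : ℂ → ℝ) (A : ℝ → ℝ → ℝ) (t : ℂ → ℝ) (x y : ℂ) : ℝ := η (y - x) * A (t x) ‖y - x‖

lemma Gk_BK {L δ : ℝ} {η : ℂ → ℝ} {A : ℝ → ℝ → ℝ} {t : ℂ → ℝ} (hη : TW L η) (hA : AP δ A) 
    (ht : Measurable t) (ht1 : ∀ x, 1 ≤ t x) (ht2 : ∀ x, t x ≤ 2) : BK (1 / δ) (Gk η A t) := by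
  constructor
  · refine Measurable.mul (hη.cont.measurable.comp (by fun_prop)) (hA.cont.measurable.comp (f := fun p : ℂ × ℂ => (t p.1, ‖p.2 - p.1‖)) (by fun_prop))
  · intro x y
    unfold Gk
    rw [abs_mul]
    calc |η (y - x)| * |A (t x) ‖y - x‖| ≤ 1 * (1 / δ) := mul_le_mul (hη.bd _) ((hA.prof _ (ht1 x) (ht2 x)).bd _) (abs_nonneg _) zero_le_one
      _ = _ := one_mul _

lemma KG_eq {L δ : ℝ} {η : ℂ → ℝ} {A : ℝ → ℝ → ℝ} {t : ℂ → ℝ} (hη : TW L η) (hA : AP δ A) (hδ1 : δ ≤ 1/8)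
    (ht1 : ∀ x, 1 ≤ t x) (ht2 : ∀ x, t x ≤ 2) {c x : ℂ} (hx : ‖x - c‖ ≤ 1) (x' : ℂ) :
    KG (volume.restrict (closedBall c 4)) (Gk η A t) x x' = KK (fun y => η (y - x) * η (y - x')) (A (t x)) (A (t x')) x x' := by
  unfold KG KK
  rw [setIntegral_eq_integral_of_forall_compl_eq_zero]
  · congr 1; ext y; unfold Gk; ring
  · intro y hy
    by_contra hne
    apply hy
    have h1 := (hA.prof _ (ht1 x) (ht2 x)).supp _ (right_ne_zero_of_mul (left_ne_zero_of_mul hne))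
    rw [mem_closedBall, dist_eq_norm]
    have h2 : ‖y - c‖ ≤ ‖y - x‖ + ‖x - c‖ := norm_sub_le_norm_sub_add_norm_sub y x c
    rw [abs_le] at h1
    have := ht2 x
    linarith [h1.2]

def CS : ℝ := 2 * 10 ^ 9 * ∫ z : ℂ, (1 + ‖z‖) ^ (-3 : ℝ)

lemma CS_nonneg : 0 ≤ CS := mul_nonneg (by norm_num) (integral_nonneg fun z => by positivity)

lemma int3 : Integrable (fun z : ℂ => (1 + ‖z‖) ^ (-3 : ℝ)) := 
  integrable_one_add_norm (by rw [Complex.finrank_real_complex]; norm_num)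

lemma int3s {δ : ℝ} (hδ : 0 < δ) (x : ℂ) : Integrable (fun z : ℂ => (1 + ‖x - z‖ / δ) ^ (-3 : ℝ)) := by
  have h1 := (int3.comp_smul (inv_ne_zero hδ.ne')).comp_sub_left x
  refine h1.congr (Filter.Eventually.of_forall fun z => ?_)
  simp only [norm_smul, norm_inv, Real.norm_of_nonneg hδ.le]
  rw [inv_mul_eq_div]

lemma int3s_eq {δ : ℝ} (hδ : 0 < δ) (x : ℂ) : ∫ z : ℂ, (1 + ‖x - z‖ / δ) ^ (-3 : ℝ) = δ ^ 2 * ∫ z : ℂ, (1 + ‖z‖) ^ (-3 : ℝ) := by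
  rw [integral_sub_left_eq_self (fun z : ℂ => (1 + ‖z‖ / δ) ^ (-3 : ℝ)) volume x]
  have := Measure.integral_comp_inv_smul_of_nonneg volume (fun z : ℂ => (1 + ‖z‖) ^ (-3 : ℝ)) hδ.le
  rw [Complex.finrank_real_complex, smul_eq_mul] at this
  rw [← this]
  congr 1; ext z
  rw [norm_smul, norm_inv, Real.norm_of_nonneg hδ.le, inv_mul_eq_div]

lemma pow_cmp {q s : ℝ} (hq : 0 < q) (hs : 0 ≤ s) (h : 1 + s ≤ q) : 1 ≤ q ^ 3 * (1 + s) ^ (-3 : ℝ) := by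
  rw [Real.rpow_neg (by positivity), show (3:ℝ) = ((3:ℕ):ℝ) by norm_num, Real.rpow_natCast, ← div_eq_mul_inv, le_div_iff₀ (by positivity), one_mul]
  exact pow_le_pow_left₀ (by positivity) h 3

lemma KK_near {L t t' δ : ℝ} {w : ℂ → ℝ} {a a' : ℝ → ℝ} (hL : 1 ≤ L) (hw : TW (4 * L) w) (x x' : ℂ) (hδ : 0 < δ) (hδ1 : δ ≤ 1/8)
    (t1 : 1 ≤ t) (t2 : t ≤ 2) (t1' : 1 ≤ t') (t2' : t' ≤ 2) (htt : |t - t'| ≤ δ) (hx : ‖x - x'‖ ≤ 1/2)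
    (ha : Prof δ t a) (ha' : Prof δ t' a') :
    |KK w a a' x x'| ≤ 2 * 10 ^ 9 * L ^ 2 * δ⁻¹ * (1 + ‖x - x'‖ / δ) ^ (-3 : ℝ) := by
  set τ := ‖x - x'‖ with hτ
  have hτ0 : 0 ≤ τ := norm_nonneg _
  have hL2 : 1 ≤ L ^ 2 := by nlinarith only [hL]
  set P := (1 + τ / δ) ^ (-3 : ℝ) with hP
  have hP0 : 0 ≤ P := by positivity
  rcases lt_or_ge τ (8 * δ) with h8 | h8
  · refine (KK_bound1 hδ hδ1 t1 t2 hw.bd x x' ha ha').trans ?_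
    have h1 : 1 ≤ 9 ^ 3 * P := by
      refine pow_cmp (by norm_num) (by positivity) ?_
      have : τ / δ ≤ 8 := by rw [div_le_iff₀ hδ]; exact h8.le
      linarith
    calc 27 / δ = 27 * δ⁻¹ * 1 := by rw [div_eq_mul_inv]; ring
      _ ≤ 27 * δ⁻¹ * (9 ^ 3 * P) := by gcongr
      _ = (19683 * 1) * δ⁻¹ * P := by ring
      _ ≤ (2 * 10 ^ 9 * L ^ 2) * δ⁻¹ * P := by gcongr; norm_num
      _ = _ := by ring
  · have hτp : 0 < τ := by linarith
    have hgeo : Geo t t' δ τ := ⟨hδ, hδ1, t1, t2, t1', t2', hτp, hx, by linarith⟩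
    refine (KK_bound3 (by linarith : 1 ≤ 4 * L) hw x x' hgeo ha ha').trans ?_
    rw [← hτ]
    have h1 : (τ * (τ - |t - t'|) / 2) ^ (-(5/2) : ℝ) ≤ ((τ / 2) ^ 2) ^ (-(5/2) : ℝ) := by
      refine Real.rpow_le_rpow_of_nonpos (by positivity) ?_ (by norm_num)
      nlinarith only [htt, h8, hτp]
    have h2 : ((τ / 2) ^ 2) ^ (-(5/2) : ℝ) = 32 / τ ^ 5 := by
      rw [← Real.rpow_natCast, ← Real.rpow_mul (by positivity), show ((2:ℕ):ℝ) * (-(5/2)) = -((5:ℕ):ℝ) by norm_num, Real.rpow_neg (by positivity), Real.rpow_natCast]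
      field_simp; norm_num
    rw [h2] at h1
    have h3 : 1 ≤ (9 / 8 * (τ / δ)) ^ 3 * P := by
      refine pow_cmp (by positivity) (by positivity) ?_
      have : 8 ≤ τ / δ := by rw [le_div_iff₀ hδ]; exact h8
      linarith
    calc 1382400 * (4 * L) ^ 2 * (τ ^ 2 * (τ * (τ - |t - t'|) / 2) ^ (-(5/2) : ℝ) * δ ^ 2) 
        ≤ 1382400 * (4 * L) ^ 2 * (τ ^ 2 * (32 / τ ^ 5) * δ ^ 2) := by gcongr
      _ = 1382400 * 512 * L ^ 2 * (δ ^ 2 / τ ^ 3) * 1 := by field_simp; norm_num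
      _ ≤ 1382400 * 512 * L ^ 2 * (δ ^ 2 / τ ^ 3) * ((9 / 8 * (τ / δ)) ^ 3 * P) := by gcongr
      _ = 1382400 * 512 * (9 / 8) ^ 3 * L ^ 2 * δ⁻¹ * P := by field_simp
      _ ≤ 2 * 10 ^ 9 * L ^ 2 * δ⁻¹ * P := mul_le_mul_of_nonneg_right (mul_le_mul_of_nonneg_right (mul_le_mul_of_nonneg_right (by norm_num) (by positivity)) (by positivity)) hP0

/-- Data for a cell. -/
structure Cell (L δ ρ : ℝ) (η : ℂ → ℝ) (A : ℝ → ℝ → ℝ) (t : ℂ → ℝ) : Prop where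
  L1 : 1 ≤ L
  δ0 : 0 < δ
  δ1 : δ ≤ 1/8
  ρ0 : 0 < ρ
  ρ1 : ρ ≤ 1/4
  hη : TW L η
  hA : AP δ A
  ht : Measurable t
  t1 : ∀ x, 1 ≤ t x
  t2 : ∀ x, t x ≤ 2

section
variable {L δ ρ : ℝ} {η : ℂ → ℝ} {A : ℝ → ℝ → ℝ} {t : ℂ → ℝ}

lemma Cell.bk (h : Cell L δ ρ η A t) : BK (1 / δ) (Gk η A t) := Gk_BK h.hη h.hA h.ht h.t1 h.t2

instance fin_ball (c : ℂ) (ρ : ℝ) : IsFiniteMeasure (volume.restrict (closedBall c ρ)) :=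
  ⟨by rw [Measure.restrict_apply_univ]; exact measure_closedBall_lt_top⟩

lemma Cell.tw (h : Cell L δ ρ η A t) (x x' : ℂ) : TW (4 * L) (fun y => η (y - x) * η (y - x')) :=
  (h.hη.trans x).mul (by linarith [h.L1]) (h.hη.trans x')

lemma Cell.kg (h : Cell L δ ρ η A t) {c x : ℂ} (hx : x ∈ closedBall c ρ) (x' : ℂ) :
    KG (volume.restrict (closedBall c 4)) (Gk η A t) x x' = KK (fun y => η (y - x) * η (y - x')) (A (t x)) (A (t x')) x x' :=
  KG_eq h.hη h.hA h.δ1 h.t1 h.t2 (by rw [mem_closedBall, dist_eq_norm] at hx; linarith [h.ρ1]) x'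

lemma cell_dist {c x x' : ℂ} {ρ : ℝ} (hx : x ∈ closedBall c ρ) (hx' : x' ∈ closedBall c ρ) : ‖x - x'‖ ≤ 2 * ρ := by
  rw [← dist_eq_norm]
  have := dist_triangle_right x x' c
  rw [mem_closedBall] at hx hx'
  linarith

lemma Cell.schur (h : Cell L δ ρ η A t) {c : ℂ} {B : Set ℂ} (hB : MeasurableSet B) (hBc : B ⊆ closedBall c ρ)
    (hBt : ∀ x ∈ B, ∀ x' ∈ B, |t x - t x'| ≤ δ) :
    En (volume.restrict (closedBall c ρ)) (volume.restrict (closedBall c 4)) (Gk η A t) B ≤ CS * L ^ 2 * δ * (volume.restrict (closedBall c ρ)).real B := by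
  refine En_le h.bk hB fun x hx => ?_
  have hδ := h.δ0
  refine abs_integral_le_integral_abs.trans ?_
  calc ∫ x' in B, |KG (volume.restrict (closedBall c 4)) (Gk η A t) x x'| ∂(volume.restrict (closedBall c ρ))
      ≤ ∫ x' in B, 2 * 10 ^ 9 * L ^ 2 * δ⁻¹ * (1 + ‖x - x'‖ / δ) ^ (-3 : ℝ) ∂(volume.restrict (closedBall c ρ)) := by
        refine setIntegral_mono_on ?_ ?_ hB ?_
        · refine (integrable_bdd ((KG_meas h.bk).comp (measurable_const.prodMk measurable_id)) (KG_bd h.bk x)).abs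
        · exact (((int3s hδ x).const_mul _).restrict (s := closedBall c ρ)).restrict (s := B)
        · intro x' hx'
          rw [h.kg (hBc hx)]
          refine KK_near h.L1 (h.tw x x') x x' hδ h.δ1 (h.t1 x) (h.t2 x) (h.t1 x') (h.t2 x') (hBt x hx x' hx') ?_ (h.hA.prof _ (h.t1 x) (h.t2 x)) (h.hA.prof _ (h.t1 x') (h.t2 x'))
          have := cell_dist (hBc hx) (hBc hx')
          have := h.ρ1
          linarith
    _ ≤ ∫ x', 2 * 10 ^ 9 * L ^ 2 * δ⁻¹ * (1 + ‖x - x'‖ / δ) ^ (-3 : ℝ) := by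
        rw [Measure.restrict_restrict hB]
        refine setIntegral_le_integral ((int3s hδ x).const_mul _) (Filter.Eventually.of_forall fun x' => ?_)
        simp only [Pi.zero_apply]; positivity
    _ = CS * L ^ 2 * δ := by
        rw [integral_const_mul, int3s_eq hδ, CS]
        field_simp

/-- block estimate -/
lemma Cell.block (h : Cell L δ ρ η A t) {c : ℂ} {B : Set ℂ} (hB : MeasurableSet B) (hBc : B ⊆ closedBall c ρ)
    {s r : ℝ} (hr : δ ≤ r) (hBs : ∀ x ∈ B, t x ∈ Icc s (s + r)) :
    En (volume.restrict (closedBall c ρ)) (volume.restrict (closedBall c 4)) (Gk η A t) B ≤ 2 * CS * L ^ 2 * r * (volume.restrict (closedBall c ρ)).real B := by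
  have hδ := h.δ0
  let idx : ℂ → ℕ := fun x => ⌊(t x - s) / δ⌋₊
  have hi : Measurable idx := Nat.measurable_floor.comp ((h.ht.sub_const s).div_const δ)
  let N := ⌊r / δ⌋₊ + 1
  have hN : ∀ x ∈ B, idx x < N := by
    intro x hx
    refine Nat.lt_succ_of_le (Nat.floor_mono ?_)
    have := (hBs x hx).2
    gcongr; linarith
  have hNδ : N * δ ≤ 2 * r := by
    have : (⌊r / δ⌋₊ : ℝ) ≤ r / δ := Nat.floor_le (by have := hδ.le.trans hr; positivity)
    rw [le_div_iff₀ hδ] at this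
    simp only [N]; push_cast; linarith
  refine (En_split h.bk hB hi hN).trans ?_
  have h1 : ∀ k ∈ Finset.range N, En (volume.restrict (closedBall c ρ)) (volume.restrict (closedBall c 4)) (Gk η A t) (B ∩ idx ⁻¹' {k}) 
      ≤ CS * L ^ 2 * δ * (volume.restrict (closedBall c ρ)).real (B ∩ idx ⁻¹' {k}) := by
    intro k _
    refine h.schur (hB.inter (hi (measurableSet_singleton k))) (inter_subset_left.trans hBc) ?_
    have key : ∀ x ∈ B ∩ idx ⁻¹' {k}, (k:ℝ) ≤ (t x - s) / δ ∧ (t x - s) / δ < k + 1 := by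
      rintro x ⟨hx, hxk⟩
      have h0 : 0 ≤ (t x - s) / δ := div_nonneg (by linarith [(hBs x hx).1]) hδ.le
      have : ⌊(t x - s) / δ⌋₊ = k := hxk
      exact (Nat.floor_eq_iff h0).1 this
    intro x hx x' hx'
    obtain ⟨a1, a2⟩ := key x hx
    obtain ⟨b1, b2⟩ := key x' hx'
    rw [le_div_iff₀ hδ] at a1 b1
    rw [div_lt_iff₀ hδ] at a2 b2
    rw [abs_le]; constructor <;> linarith
  have hC := CS_nonneg
  have hL := h.L1
  calc (N:ℝ) * ∑ k ∈ Finset.range N, En (volume.restrict (closedBall c ρ)) (volume.restrict (closedBall c 4)) (Gk η A t) (B ∩ idx ⁻¹' {k}) 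
      ≤ N * ∑ k ∈ Finset.range N, CS * L ^ 2 * δ * (volume.restrict (closedBall c ρ)).real (B ∩ idx ⁻¹' {k}) := by
          gcongr with k hk
          exact h1 k hk
    _ = CS * L ^ 2 * (N * δ) * (volume.restrict (closedBall c ρ)).real B := by
        rw [split_real hB hi hN, ← Finset.mul_sum]; ring
    _ ≤ CS * L ^ 2 * (2 * r) * (volume.restrict (closedBall c ρ)).real B := by gcongr
    _ = _ := by ring

lemma Cell.nf (h : Cell L δ ρ η A t) {c : ℂ} {B : Set ℂ} (hB : MeasurableSet B) (hBc : B ⊆ closedBall c ρ)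
    {s r ℓ : ℝ} (hr : δ ≤ r) (hBs : ∀ x ∈ B, t x ∈ Icc s (s + ℓ))
    {H : ℂ → ℂ → ℝ} {D' : ℝ} (hH : BK D' H) (hH0 : ∀ x x', 0 ≤ H x x')
    (hKH : ∀ x ∈ B, ∀ x' ∈ B, r ≤ |t x - t x'| → KG (volume.restrict (closedBall c 4)) (Gk η A t) x x' ≤ H x x') :
    En (volume.restrict (closedBall c ρ)) (volume.restrict (closedBall c 4)) (Gk η A t) B ≤ 6 * CS * L ^ 2 * r * (volume.restrict (closedBall c ρ)).real B
      + ∫ x in B, ∫ x' in B, H x x' ∂(volume.restrict (closedBall c ρ)) ∂(volume.restrict (closedBall c ρ)) := by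
  have hδ := h.δ0
  have hr0 : 0 < r := hδ.trans_le hr
  let idx : ℂ → ℕ := fun x => ⌊(t x - s) / r⌋₊
  have hi : Measurable idx := Nat.measurable_floor.comp ((h.ht.sub_const s).div_const r)
  let N := ⌊ℓ / r⌋₊ + 1
  have hN : ∀ x ∈ B, idx x < N := by
    intro x hx
    refine Nat.lt_succ_of_le (Nat.floor_mono ?_)
    have := (hBs x hx).2
    gcongr; linarith
  have key : ∀ x ∈ B, idx x * r ≤ t x - s ∧ t x - s < (idx x + 1) * r := by
    intro x hx
    have h0 : 0 ≤ (t x - s) / r := div_nonneg (by linarith [(hBs x hx).1]) hr0.le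
    have := (Nat.floor_eq_iff h0).1 (rfl : ⌊(t x - s) / r⌋₊ = idx x)
    rwa [le_div_iff₀ hr0, div_lt_iff₀ hr0] at this
  refine (En_near h.bk hB hi hN hH hH0 ?_).trans (add_le_add ?_ le_rfl)
  · intro x hx x' hx' hor
    refine hKH x hx x' hx' ?_
    obtain ⟨a1, a2⟩ := key x hx
    obtain ⟨b1, b2⟩ := key x' hx'
    rcases hor with h1 | h1
    · have h2 : (idx x + 1 + 1 : ℝ) ≤ idx x' := by exact_mod_cast h1
      have := mul_le_mul_of_nonneg_right h2 hr0.le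
      rw [abs_sub_comm]
      refine le_trans ?_ (le_abs_self _)
      linarith
    · have h2 : (idx x' + 1 + 1 : ℝ) ≤ idx x := by exact_mod_cast h1
      have := mul_le_mul_of_nonneg_right h2 hr0.le
      refine le_trans ?_ (le_abs_self _)
      linarith
  · have h1 : ∀ k ∈ Finset.range N, En (volume.restrict (closedBall c ρ)) (volume.restrict (closedBall c 4)) (Gk η A t) (B ∩ idx ⁻¹' {k}) 
      ≤ 2 * CS * L ^ 2 * r * (volume.restrict (closedBall c ρ)).real (B ∩ idx ⁻¹' {k}) := by
      intro k _
      refine h.block (s := s + k * r) (hB.inter (hi (measurableSet_singleton k))) (inter_subset_left.trans hBc) hr ?_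
      rintro x ⟨hx, hxk⟩
      obtain ⟨a1, a2⟩ := key x hx
      have : idx x = k := hxk
      rw [this] at a1 a2
      constructor <;> linarith
    calc 3 * ∑ k ∈ Finset.range N, En (volume.restrict (closedBall c ρ)) (volume.restrict (closedBall c 4)) (Gk η A t) (B ∩ idx ⁻¹' {k}) 
      ≤ 3 * ∑ k ∈ Finset.range N, 2 * CS * L ^ 2 * r * (volume.restrict (closedBall c ρ)).real (B ∩ idx ⁻¹' {k}) := by
          gcongr with k hk
          exact h1 k hk
      _ = _ := by
        rw [split_real hB hi hN, ← Finset.mul_sum]; ring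

end

end SM

namespace SM

section
variable {L δ ρ : ℝ} {η : ℂ → ℝ} {A : ℝ → ℝ → ℝ} {t : ℂ → ℝ}

lemma nu_real {c : ℂ} {ρ : ℝ} {B : Set ℂ} (hBc : B ⊆ closedBall c ρ) :
    (volume.restrict (closedBall c ρ)).real B = volume.real B := by
  rw [Measure.real, Measure.real, Measure.restrict_eq_self _ hBc]

lemma nu_real_le {c : ℂ} {ρ : ℝ} (hρ : 0 ≤ ρ) (B : Set ℂ) :
    (volume.restrict (closedBall c ρ)).real B ≤ 4 * ρ ^ 2 := by
  refine (measureReal_mono (subset_univ B)).trans ?_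
  rw [Measure.real, Measure.restrict_apply_univ, Complex.volume_closedBall]
  have := Real.pi_lt_d2
  rw [ENNReal.toReal_mul, ENNReal.toReal_pow, ENNReal.toReal_ofReal hρ, ENNReal.coe_toReal]
  have : ((NNReal.pi : ℝ≥0) : ℝ) = Real.pi := rfl
  rw [this, mul_comm]
  gcongr; linarith

lemma div_sq {l v F E : ℝ} (hv : 0 ≤ v) (hF : 0 ≤ F) (hE : 0 ≤ E) (h : (l * v) ^ 2 ≤ F * (E * v)) : l ^ 2 * v ≤ F * E := by
  rcases hv.eq_or_lt with h0 | h0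
  · rw [← h0, mul_zero]; positivity
  · have : (l ^ 2 * v) * v ≤ (F * E) * v := by nlinarith only [h]
    exact le_of_mul_le_mul_right this h0

lemma Cell.w1 (h : Cell L δ ρ η A t) {c : ℂ} {B : Set ℂ} (hB : MeasurableSet B) (hBc : B ⊆ closedBall c ρ)
    {s r : ℝ} (hr : δ ≤ r) (hBs : ∀ x ∈ B, t x ∈ Icc s (s + r)) {f : ℂ → ℝ} (hf : Measurable f) (hf1 : ∀ y, |f y| ≤ 1) {l : ℝ} (hl : 0 ≤ l)
    (hFl : ∀ x ∈ B, l ≤ ∫ y in closedBall c 4, f y * Gk η A t x y) :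
    l ^ 2 * volume.real B ≤ (∫ y in closedBall c 4, f y ^ 2) * (2 * CS * L ^ 2 * r) := by
  have hr0 : 0 < r := h.δ0.trans_le hr
  have hC := CS_nonneg
  have h1 := TT (ν := volume.restrict (closedBall c ρ)) h.bk hf hf1 hB hl hFl
  rw [← nu_real hBc]
  refine div_sq measureReal_nonneg (integral_nonneg fun _ => sq_nonneg _) (by positivity) (h1.trans ?_)
  exact mul_le_mul_of_nonneg_left (h.block hB hBc hr hBs) (integral_nonneg fun _ => sq_nonneg _)

lemma Cell.w1' (h : Cell L δ ρ η A t) {c : ℂ} {B : Set ℂ} (hB : MeasurableSet B) (hBc : B ⊆ closedBall c ρ)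
    {f : ℂ → ℝ} (hf : Measurable f) (hf1 : ∀ y, |f y| ≤ 1) {l : ℝ} (hl : 0 ≤ l)
    (hFl : ∀ x ∈ B, l ≤ ∫ y in closedBall c 4, f y * Gk η A t x y) :
    l ^ 2 * volume.real B ≤ (∫ y in closedBall c 4, f y ^ 2) * (108 * ρ ^ 2 / δ) := by
  have hδ := h.δ0
  have h1 := TT (ν := volume.restrict (closedBall c ρ)) h.bk hf hf1 hB hl hFl
  rw [← nu_real hBc]
  refine div_sq measureReal_nonneg (integral_nonneg fun _ => sq_nonneg _) (by positivity) (h1.trans ?_)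
  refine mul_le_mul_of_nonneg_left ?_ (integral_nonneg fun _ => sq_nonneg _)
  refine En_le h.bk hB fun x hx => ?_
  refine (abs_setInt_le (D := 27 / δ) fun x' _ => ?_).trans ?_
  · rw [h.kg (hBc hx)]
    exact KK_bound1 hδ h.δ1 (h.t1 x) (h.t2 x) (h.tw x x').bd x x' (h.hA.prof _ (h.t1 x) (h.t2 x)) (h.hA.prof _ (h.t1 x') (h.t2 x'))
  · calc 27 / δ * (volume.restrict (closedBall c ρ)).real B ≤ 27 / δ * (4 * ρ ^ 2) := by
          gcongr; exact nu_real_le h.ρ0.le B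
      _ = _ := by ring

/-- signed tangency relation -/
def RelS (t : ℂ → ℝ) (r ε ℓ : ℝ) (e : ℂ) (s : ℝ) (x x' : ℂ) : Prop :=
  r ≤ s * (t x' - t x) ∧ |‖x - x'‖ - s * (t x' - t x)| ≤ ε ∧ ‖(s:ℂ) * (x - x') - ‖x - x'‖ * e‖ ≤ ℓ * ‖x - x'‖

def Rel (t : ℂ → ℝ) (r ε ℓ : ℝ) (e : ℂ) (x x' : ℂ) : Prop :=
  RelS t r ε ℓ e 1 x x' ∨ RelS t r ε ℓ e (-1) x x'

lemma RelS_meas (ht : Measurable t) (r ε ℓ : ℝ) (e : ℂ) (s : ℝ) : MeasurableSet {p : ℂ × ℂ | RelS t r ε ℓ e s p.1 p.2} := by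
  have m1 : Measurable fun p : ℂ × ℂ => s * (t p.2 - t p.1) := by fun_prop
  refine (measurableSet_le measurable_const m1).inter ((measurableSet_le (f := fun p : ℂ × ℂ => |‖p.1 - p.2‖ - s * (t p.2 - t p.1)|) ?_ measurable_const).inter 
    (measurableSet_le (f := fun p : ℂ × ℂ => ‖(s:ℂ) * (p.1 - p.2) - ‖p.1 - p.2‖ * e‖) (g := fun p : ℂ × ℂ => ℓ * ‖p.1 - p.2‖) ?_ ?_)) <;> fun_prop

lemma Rel_meas (ht : Measurable t) (r ε ℓ : ℝ) (e : ℂ) : MeasurableSet {p : ℂ × ℂ | Rel t r ε ℓ e p.1 p.2} :=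
  (RelS_meas ht r ε ℓ e 1).union (RelS_meas ht r ε ℓ e (-1))

lemma dir_aux {p q : ℂ} {ε : ℝ} (hp : 7/8 ≤ ‖p‖) (hq : 0 < ‖q‖) (hq2 : ‖q‖ ≤ 1/2) 
    (hε : ε ≤ 2 * ‖q‖) (hε0 : 0 ≤ ε)
    (h : ‖p‖ + ‖q‖ - ε ≤ ‖p + q‖ ∨ ‖p - q‖ ≤ ‖p‖ - ‖q‖ + ε) :
    ‖‖p‖ * q - ‖q‖ * p‖ ^ 2 ≤ 4 * ε * ‖q‖ * ‖p‖ ^ 2 := by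
  set P := ‖p‖ with hP
  set Q := ‖q‖ with hQ
  have a1 : p.re ^ 2 + p.im ^ 2 = P ^ 2 := by rw [hP, ← Complex.normSq_eq_norm_sq, Complex.normSq_apply]; ring
  have a2 : q.re ^ 2 + q.im ^ 2 = Q ^ 2 := by rw [hQ, ← Complex.normSq_eq_norm_sq, Complex.normSq_apply]; ring
  have a3 : ‖p + q‖ ^ 2 = P ^ 2 + Q ^ 2 + 2 * (p.re * q.re + p.im * q.im) := by
    rw [← Complex.normSq_eq_norm_sq, Complex.normSq_apply, Complex.add_re, Complex.add_im]; linear_combination a1 + a2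
  have a4 : ‖p - q‖ ^ 2 = P ^ 2 + Q ^ 2 - 2 * (p.re * q.re + p.im * q.im) := by
    rw [← Complex.normSq_eq_norm_sq, Complex.normSq_apply, Complex.sub_re, Complex.sub_im]; linear_combination a1 + a2
  have a5 : ‖P * q - Q * p‖ ^ 2 = 2 * P * Q * (P * Q - (p.re * q.re + p.im * q.im)) := by
    rw [← Complex.normSq_eq_norm_sq, Complex.normSq_apply]
    simp only [Complex.sub_re, Complex.sub_im, Complex.mul_re, Complex.mul_im, Complex.ofReal_re, Complex.ofReal_im]
    linear_combination Q ^ 2 * a1 + P ^ 2 * a2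
  set I := p.re * q.re + p.im * q.im
  have key : 2 * (P * Q - I) ≤ 2 * ε * (P + Q) := by
    rcases h with h | h
    · have h1 : (P + Q - ε) ^ 2 ≤ ‖p + q‖ ^ 2 := pow_le_pow_left₀ (by linarith) h 2
      rw [a3] at h1
      nlinarith only [h1, sq_nonneg ε]
    · have h1 : ‖p - q‖ ^ 2 ≤ (P - Q + ε) ^ 2 := pow_le_pow_left₀ (norm_nonneg _) h 2
      rw [a4] at h1
      nlinarith only [h1, mul_nonneg hε0 (sub_nonneg.2 hε)]
  rw [a5]
  have hPQ : 0 ≤ P * Q := by positivity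
  have h3 : P + Q ≤ 2 * P := by linarith
  calc 2 * P * Q * (P * Q - I) = (P * Q) * (2 * (P * Q - I)) := by ring
    _ ≤ (P * Q) * (2 * ε * (2 * P)) := by
        refine mul_le_mul_of_nonneg_left (key.trans ?_) hPQ
        gcongr
    _ = _ := by ring

/-- direction hypothesis on a weight -/
def Dir (η : ℂ → ℝ) (e : ℂ) (ℓ : ℝ) : Prop := ∀ z, η z ≠ 0 → 7/8 ≤ ‖z‖ → ‖z - ‖z‖ * e‖ ≤ ℓ * ‖z‖

lemma Cell.rel (h : Cell L δ ρ η A t) {e : ℂ} {ℓ r ε : ℝ} (hdir : Dir η e ℓ) (hℓ : 0 ≤ ℓ) (hε : 4 * δ ≤ ε) (hεr : 2 * ε ≤ r) (hεℓ : 16 * ε ≤ ℓ ^ 2 * r)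
    {x x' : ℂ} (hxx : ‖x - x'‖ ≤ 1/2) (hfar : r ≤ |t x - t x'|) (hΔ : abs (‖x - x'‖ - |t x - t x'|) ≤ ε) 
    (hK : KK (fun y => η (y - x) * η (y - x')) (A (t x)) (A (t x')) x x' ≠ 0) :
    Rel t r ε (2 * ℓ) e x x' := by
  have hδ := h.δ0
  obtain ⟨y, hy⟩ : ∃ y, (η (y - x) * η (y - x')) * (A (t x) ‖y - x‖ * A (t x') ‖y - x'‖) ≠ 0 := by
    by_contra hcon
    push Not at hcon
    apply hK
    unfold KK
    simp only [hcon, integral_zero]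
  have hη := left_ne_zero_of_mul (left_ne_zero_of_mul hy)
  have s1 := (h.hA.prof _ (h.t1 x) (h.t2 x)).supp _ (left_ne_zero_of_mul (right_ne_zero_of_mul hy))
  have s2 := (h.hA.prof _ (h.t1 x') (h.t2 x')).supp _ (right_ne_zero_of_mul (right_ne_zero_of_mul hy))
  have hx1 := h.t1 x
  have hδ1 := h.δ1
  set τ := ‖x - x'‖ with hτ
  rw [abs_le] at s1 s2
  have hp : 7/8 ≤ ‖y - x‖ := by linarith [s1.1]
  have hr0 : 0 < r := by linarith
  have hτr : r / 2 ≤ τ := by rw [abs_le] at hΔ; linarith [hΔ.1]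
  have hτ0 : 0 < τ := by linarith
  have main : ∀ s : ℝ, (s = 1 ∨ s = -1) → r ≤ s * (t x' - t x) → |τ - s * (t x' - t x)| ≤ ε → RelS t r ε (2 * ℓ) e s x x' := by
    intro s hs h1 h2
    refine ⟨h1, h2, ?_⟩
    rw [← hτ]
    have hq : ‖(s:ℂ) * (x - x')‖ = τ := by
      rw [norm_mul, ← hτ]; rcases hs with rfl | rfl <;> simp
    have haux := dir_aux (p := y - x) (q := (s:ℂ) * (x - x')) (ε := 2 * ε) hp (by rw [hq]; exact hτ0) (by rw [hq]; exact hxx)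
      (by rw [hq]; linarith) (by linarith) ?_
    · rw [hq] at haux
      set P := ‖y - x‖
      set q := (s:ℂ) * (x - x')
      have hP0 : 0 < P := by linarith
      have h5 : ‖P * q - τ * (y - x)‖ ≤ ℓ * τ * P := by
        refine abs_le_of_sq_le_sq' ?_ (by positivity) |>.2
        refine haux.trans ?_
        have : 8 * ε ≤ ℓ ^ 2 * τ := by nlinarith only [hεℓ, hτr, sq_nonneg ℓ]
        calc 4 * (2 * ε) * τ * P ^ 2 = (8 * ε) * (τ * P ^ 2) := by ring
          _ ≤ (ℓ ^ 2 * τ) * (τ * P ^ 2) := by gcongr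
          _ = _ := by ring
      have h6 := hdir _ hη hp
      have h7 : ‖(P:ℂ) * (q - τ * e)‖ ≤ 2 * ℓ * τ * P := by
        have e1 : (P:ℂ) * (q - τ * e) = (P * q - τ * (y - x)) + τ * ((y - x) - P * e) := by ring
        rw [e1]
        refine (norm_add_le _ _).trans ?_
        rw [norm_mul, Complex.norm_real, Real.norm_of_nonneg hτ0.le]
        have := mul_le_mul_of_nonneg_left h6 hτ0.le
        linarith
      rw [norm_mul, Complex.norm_real, Real.norm_of_nonneg hP0.le, mul_comm] at h7
      exact le_of_mul_le_mul_right h7 hP0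
    · rw [hq]
      rw [abs_le] at h2
      rcases hs with rfl | rfl
      · left
        have : y - x + ((1:ℝ):ℂ) * (x - x') = y - x' := by push_cast; ring
        rw [this]; linarith [s2.1, s1.2, h2.2]
      · right
        have : y - x - ((-1:ℝ):ℂ) * (x - x') = y - x' := by push_cast; ring
        rw [this]; linarith [s2.2, s1.1, h2.2]
  rcases le_total (t x) (t x') with h0 | h0
  · left
    rw [abs_sub_comm (t x), abs_of_nonneg (by linarith : 0 ≤ t x' - t x)] at hfar hΔ
    exact main 1 (Or.inl rfl) (by linarith) (by rw [one_mul]; exact hΔ)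
  · right
    rw [abs_of_nonneg (by linarith : 0 ≤ t x - t x')] at hfar hΔ
    exact main (-1) (Or.inr rfl) (by linarith) (by rw [show -1 * (t x' - t x) = t x - t x' by ring]; exact hΔ)

def k2 (L δ r ε : ℝ) : ℝ := 1382400 * 96 * L ^ 2 * δ ^ 2 / √(r * ε ^ 5)
def k1 (δ r : ℝ) : ℝ := 115 / √(δ * (r / 2))

lemma Cell.kbound (h : Cell L δ ρ η A t) {e : ℂ} {ℓ r ε : ℝ} (hdir : Dir η e ℓ) (hℓ : 0 ≤ ℓ) (hε : 4 * δ ≤ ε) (hεr : 2 * ε ≤ r) (hεℓ : 16 * ε ≤ ℓ ^ 2 * r)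
    {x x' : ℂ} (hxx : ‖x - x'‖ ≤ 1/2) (hfar : r ≤ |t x - t x'|) :
    KK (fun y => η (y - x) * η (y - x')) (A (t x)) (A (t x')) x x' ≤ 
      {p : ℂ × ℂ | Rel t r ε (2 * ℓ) e p.1 p.2}.indicator (fun _ => k1 δ r) (x, x') + k2 L δ r ε := by
  have hδ := h.δ0
  have hε0 : 0 < ε := by linarith
  have hr0 : 0 < r := by linarith
  have hk2 : 0 ≤ k2 L δ r ε := by unfold k2; positivity
  have hk1 : 0 ≤ k1 δ r := by unfold k1; positivity
  have hind : 0 ≤ {p : ℂ × ℂ | Rel t r ε (2 * ℓ) e p.1 p.2}.indicator (fun _ => k1 δ r) (x, x') := indicator_nonneg (fun _ _ => hk1) _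
  have pa := h.hA.prof _ (h.t1 x) (h.t2 x)
  have pb := h.hA.prof _ (h.t1 x') (h.t2 x')
  by_cases hK : KK (fun y => η (y - x) * η (y - x')) (A (t x)) (A (t x')) x x' = 0
  · rw [hK]; linarith
  rcases lt_or_ge ε (‖x - x'‖ - |t x - t x'|) with h1 | h1
  · set τ := ‖x - x'‖ with hτ
    set Δ := τ - |t x - t x'| with hΔ
    have hτr : r ≤ τ := by linarith
    have hτ0 : 0 < τ := by linarith
    have hΔ0 : 0 < Δ := by linarith
    have hgeo : Geo (t x) (t x') δ τ := ⟨hδ, h.δ1, h.t1 x, h.t2 x, h.t1 x', h.t2 x', hτ0, hxx, by linarith⟩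
    have h2 := KK_bound3 (by linarith [h.L1] : 1 ≤ 4 * L) (h.tw x x') x x' hgeo pa pb
    refine (le_abs_self _).trans (h2.trans ?_)
    refine le_trans ?_ (le_add_of_nonneg_left hind)
    rw [← hτ, ← hΔ]
    have h3 : τ ^ 2 * (τ * Δ / 2) ^ (-(5/2) : ℝ) ≤ 6 / √(r * ε ^ 5) := by
      have e1 : (τ * Δ / 2) ^ (-(5/2) : ℝ) = 1 / √((τ * Δ / 2) ^ 5) := by
        rw [Real.sqrt_eq_rpow, ← Real.rpow_natCast, ← Real.rpow_mul (by positivity), Real.rpow_neg (by positivity), one_div]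
        norm_num
      rw [e1, mul_one_div, div_le_div_iff₀ (by positivity) (by positivity)]
      have e2 : τ ^ 2 = √(τ ^ 4) := by rw [show τ ^ 4 = (τ ^ 2) ^ 2 by ring, Real.sqrt_sq (by positivity)]
      have e3 : (6:ℝ) = √36 := by rw [show (36:ℝ) = 6 ^ 2 by norm_num, Real.sqrt_sq (by norm_num)]
      rw [e2, e3, ← Real.sqrt_mul (by positivity), ← Real.sqrt_mul (by positivity)]
      apply Real.sqrt_le_sqrt
      calc τ ^ 4 * (r * ε ^ 5) ≤ τ ^ 4 * (τ * Δ ^ 5) := by gcongr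
        _ = τ ^ 5 * Δ ^ 5 := by ring
        _ ≤ 36 * (τ * Δ / 2) ^ 5 := by
          have : 0 ≤ τ ^ 5 * Δ ^ 5 := by positivity
          calc τ ^ 5 * Δ ^ 5 ≤ 36 / 32 * (τ ^ 5 * Δ ^ 5) := by linarith
            _ = _ := by ring
    calc 1382400 * (4 * L) ^ 2 * (τ ^ 2 * (τ * Δ / 2) ^ (-(5/2) : ℝ) * δ ^ 2) 
        ≤ 1382400 * (4 * L) ^ 2 * (6 / √(r * ε ^ 5) * δ ^ 2) := by
          refine mul_le_mul_of_nonneg_left (mul_le_mul_of_nonneg_right h3 (by positivity)) (by positivity)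
      _ = _ := by unfold k2; ring
  · rcases lt_or_ge (ε) (|t x - t x'| - ‖x - x'‖) with h2 | h2
    · exact absurd (KK_bound4 x x' pa pb (by linarith)) hK
    · have hΔ : abs (‖x - x'‖ - |t x - t x'|) ≤ ε := by rw [abs_le]; constructor <;> linarith
      have hrel := h.rel hdir hℓ hε hεr hεℓ hxx hfar hΔ hK
      have : (x, x') ∈ {p : ℂ × ℂ | Rel t r ε (2 * ℓ) e p.1 p.2} := hrel
      rw [indicator_of_mem this]
      have hτ2 : r / 2 ≤ ‖x - x'‖ := by linarith
      refine (le_abs_self _).trans ((KK_bound2 hδ h.δ1 (h.t1 x) (h.t2 x) (h.t1 x') (h.t2 x') (h.tw x x').bd x x' (by linarith) pa pb).trans ?_)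
      refine le_add_of_le_of_nonneg ?_ hk2
      unfold k1
      gcongr

/-- Estimate for the bad set. -/
lemma Cell.bad (h : Cell L δ ρ η A t) {e : ℂ} {ℓ r ε m : ℝ} (hdir : Dir η e ℓ) (hℓ : 0 ≤ ℓ) (hε : 4 * δ ≤ ε) (hεr : 2 * ε ≤ r) (hεℓ : 16 * ε ≤ ℓ ^ 2 * r)
    {c : ℂ} {B : Set ℂ} (hB : MeasurableSet B) (hBc : B ⊆ closedBall c ρ) (hm0 : 0 ≤ m)
    {s r' : ℝ} (hBs : ∀ x ∈ B, t x ∈ Icc s (s + r')) {f : ℂ → ℝ} (hf : Measurable f) (hf1 : ∀ y, |f y| ≤ 1) {l : ℝ} (hl : 0 ≤ l)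
    (hFl : ∀ x ∈ B, l ≤ ∫ y in closedBall c 4, f y * Gk η A t x y)
    (hm : ∀ x ∈ B, volume.real {x' ∈ B | Rel t r ε (2 * ℓ) e x x'} ≤ m) :
    l ^ 2 * volume.real B ≤ (∫ y in closedBall c 4, f y ^ 2) * (6 * CS * L ^ 2 * r + k1 δ r * m + k2 L δ r ε * (4 * ρ ^ 2)) := by
  have hδ := h.δ0
  have hε0 : 0 < ε := by linarith
  have hr0 : 0 < r := by linarith
  have hk2 : 0 ≤ k2 L δ r ε := by unfold k2; positivity
  have hk1 : 0 ≤ k1 δ r := by unfold k1; positivity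
  have hC := CS_nonneg
  have h1 := TT (ν := volume.restrict (closedBall c ρ)) h.bk hf hf1 hB hl hFl
  set ν := volume.restrict (closedBall c ρ) with hν
  have hRm := Rel_meas h.ht r ε (2 * ℓ) e
  set RR := {p : ℂ × ℂ | Rel t r ε (2 * ℓ) e p.1 p.2} with hRR
  rw [← nu_real hBc]
  refine div_sq measureReal_nonneg (integral_nonneg fun _ => sq_nonneg _) (by positivity) (h1.trans ?_)
  refine mul_le_mul_of_nonneg_left ?_ (integral_nonneg fun _ => sq_nonneg _)
  let H : ℂ → ℂ → ℝ := fun x x' => RR.indicator (fun _ => k1 δ r) (x, x') + k2 L δ r ε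
  have hHk : BK (k1 δ r + k2 L δ r ε) H := by
    constructor
    · exact (measurable_const.indicator hRm).add_const _
    · intro x x'
      have i0 : 0 ≤ RR.indicator (fun _ => k1 δ r) (x, x') := indicator_nonneg (fun _ _ => hk1) _
      rw [abs_of_nonneg (add_nonneg i0 hk2)]
      refine add_le_add ?_ le_rfl
      exact indicator_le_self' (fun _ _ => hk1) _
  have hH0 : ∀ x x', 0 ≤ H x x' := fun x x' => add_nonneg (indicator_nonneg (fun _ _ => hk1) _) hk2
  refine (h.nf hB hBc (r := r) (by linarith) hBs hHk hH0 ?_).trans ?_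
  · intro x hx x' hx' hfar
    rw [h.kg (hBc hx)]
    refine h.kbound hdir hℓ hε hεr hεℓ ?_ hfar
    have := cell_dist (hBc hx) (hBc hx')
    have := h.ρ1
    linarith
  · have hin : ∀ x ∈ B, |∫ x' in B, H x x' ∂ν| ≤ k1 δ r * m + k2 L δ r ε * (4 * ρ ^ 2) := by
      intro x hx
      rw [abs_of_nonneg (integral_nonneg fun x' => hH0 x x')]
      have hsec : MeasurableSet {x' | (x, x') ∈ RR} := measurable_prodMk_left hRm
      have e1 : ∀ x', H x x' = {x' | (x, x') ∈ RR}.indicator (fun _ => k1 δ r) x' + k2 L δ r ε := by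
        intro x'
        rfl
      simp only [e1]
      rw [integral_add ((integrable_const _).indicator hsec) (integrable_const _), integral_indicator_const _ hsec, integral_const, smul_eq_mul, smul_eq_mul,
        measureReal_restrict_apply hsec, measureReal_restrict_apply_univ, mul_comm (k1 δ r), mul_comm (k2 L δ r ε)]
      gcongr
      · have e2 : {x' | (x, x') ∈ RR} ∩ B = {x' ∈ B | Rel t r ε (2 * ℓ) e x x'} := by
          ext x'; constructor
          · rintro ⟨a, b⟩; exact ⟨b, a⟩
          · rintro ⟨a, b⟩; exact ⟨b, a⟩
        rw [e2, nu_real ((sep_subset _ _).trans hBc)]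
        exact hm x hx
      · exact nu_real_le h.ρ0.le B
    have := (le_abs_self _).trans (abs_setInt_le (μ := ν) (B := B) hin)
    calc _ ≤ 6 * CS * L ^ 2 * r * ν.real B + (k1 δ r * m + k2 L δ r ε * (4 * ρ ^ 2)) * ν.real B := add_le_add le_rfl this
      _ = _ := by ring

end

end SM

namespace SM

def qp (x : ℝ) : ℝ := (max x 0) ^ 2
def sst (x : ℝ) : ℝ := 2 * qp x - 4 * qp (x - 1/2) + 2 * qp (x - 1)
def sstd (x : ℝ) : ℝ := 4 * max x 0 - 8 * max (x - 1/2) 0 + 4 * max (x - 1) 0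
def bet (x : ℝ) : ℝ := sst (x + 1) - sst x

lemma qp_tay (x y : ℝ) : |qp x - qp y - 2 * max y 0 * (x - y)| ≤ (x - y) ^ 2 := by
  unfold qp
  rw [abs_le]
  rcases le_total x 0 with hx | hx <;> rcases le_total y 0 with hy | hy
  · simp only [max_eq_right hx, max_eq_right hy]
    constructor <;> nlinarith only [sq_nonneg (x - y)]
  · simp only [max_eq_right hx, max_eq_left hy]
    constructor <;> nlinarith only [sq_nonneg (x - y), sq_nonneg x, sq_nonneg y, mul_nonneg hy (neg_nonneg.2 hx)]
  · simp only [max_eq_left hx, max_eq_right hy]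
    constructor <;> nlinarith only [sq_nonneg (x - y), sq_nonneg x, sq_nonneg y, mul_nonneg hx (neg_nonneg.2 hy)]
  · simp only [max_eq_left hx, max_eq_left hy]
    constructor <;> nlinarith only [sq_nonneg (x - y)]

lemma sst_tay (x y : ℝ) : |sst x - sst y - sstd y * (x - y)| ≤ 8 * (x - y) ^ 2 := by
  have h1 := qp_tay x y
  have h2 := qp_tay (x - 1/2) (y - 1/2)
  have h3 := qp_tay (x - 1) (y - 1)
  rw [sub_sub_sub_cancel_right] at h2 h3
  rw [abs_le] at *
  unfold sst sstd
  constructor <;> linarith [h1.1, h1.2, h2.1, h2.2, h3.1, h3.2]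

lemma sstd_bd (x : ℝ) : |sstd x| ≤ 2 := by
  unfold sstd
  rw [abs_le]
  rcases le_total x 0 with hx | hx <;> rcases le_total (x - 1/2) 0 with h2 | h2 <;> rcases le_total (x - 1) 0 with h3 | h3 <;>
    simp only [max_eq_left, max_eq_right, hx, h2, h3] <;> constructor <;> linarith

lemma sst_zero {x : ℝ} (hx : x ≤ 0) : sst x = 0 := by
  unfold sst qp
  rw [max_eq_right hx, max_eq_right (by linarith), max_eq_right (by linarith)]; ring

lemma sst_one {x : ℝ} (hx : 1 ≤ x) : sst x = 1 := by
  unfold sst qp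
  rw [max_eq_left (by linarith), max_eq_left (by linarith), max_eq_left (by linarith)]; ring

lemma sst_lo {x : ℝ} (hx : 0 ≤ x) (h : x ≤ 1/2) : sst x = 2 * x ^ 2 := by
  unfold sst qp
  rw [max_eq_left hx, max_eq_right (by linarith), max_eq_right (by linarith)]; ring

lemma sst_hi {x : ℝ} (hx : 1/2 ≤ x) (h : x ≤ 1) : sst x = 1 - 2 * (1 - x) ^ 2 := by
  unfold sst qp
  rw [max_eq_left (by linarith), max_eq_left (by linarith), max_eq_right (by linarith)]; ring

lemma sst_mem (x : ℝ) : 0 ≤ sst x ∧ sst x ≤ 1 := by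
  rcases le_total x 0 with h | h
  · rw [sst_zero h]; norm_num
  rcases le_total 1 x with h1 | h1
  · rw [sst_one h1]; norm_num
  rcases le_total x (1/2) with h2 | h2
  · rw [sst_lo h h2]; constructor <;> nlinarith only [h, h2]
  · rw [sst_hi h2 h1]; constructor <;> nlinarith only [h1, h2]

lemma bet_nonneg (x : ℝ) : 0 ≤ bet x := by
  unfold bet
  rcases le_total x 0 with h | h
  · rw [sst_zero h]; linarith [(sst_mem (x + 1)).1]
  · rw [sst_one (by linarith : 1 ≤ x + 1)]; linarith [(sst_mem x).2]

lemma bet_le (x : ℝ) : bet x ≤ 1 := by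
  unfold bet; linarith [(sst_mem (x+1)).2, (sst_mem x).1]

lemma bet_supp {x : ℝ} (h : bet x ≠ 0) : |x| ≤ 1 := by
  rw [abs_le]
  by_contra hc
  apply h
  unfold bet
  rw [not_and_or, not_le, not_le] at hc
  rcases hc with hc | hc
  · rw [sst_zero (by linarith), sst_zero (by linarith)]; ring
  · rw [sst_one (by linarith), sst_one (by linarith)]; ring

lemma sst_cont : Continuous sst := by unfold sst qp; fun_prop
lemma bet_cont : Continuous bet := by unfold bet; exact (sst_cont.comp (by fun_prop)).sub sst_cont

lemma bet_tay (x y : ℝ) : |bet x - bet y - (sstd (y + 1) - sstd y) * (x - y)| ≤ 16 * (x - y) ^ 2 := by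
  have h1 := sst_tay (x + 1) (y + 1)
  have h2 := sst_tay x y
  rw [add_sub_add_right_eq_sub] at h1
  rw [abs_le] at *
  unfold bet
  constructor <;> linarith [h1.1, h1.2, h2.1, h2.2]

lemma bet_tay' {ℓ : ℝ} (hℓ : 0 < ℓ) (a u u0 d : ℝ) (hd : |u - u0| ≤ d) : 
    |bet (u / ℓ - a) - bet (u0 / ℓ - a) - ((sstd (u0 / ℓ - a + 1) - sstd (u0 / ℓ - a)) / ℓ) * (u - u0)| ≤ (4 / ℓ) ^ 2 * d ^ 2 := by
  have h := bet_tay (u / ℓ - a) (u0 / ℓ - a)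
  have e1 : u / ℓ - a - (u0 / ℓ - a) = (u - u0) / ℓ := by ring
  rw [e1] at h
  have h2 : (u - u0) ^ 2 ≤ d ^ 2 := by rw [← sq_abs (u - u0)]; exact pow_le_pow_left₀ (abs_nonneg _) hd 2
  calc _ = |bet (u / ℓ - a) - bet (u0 / ℓ - a) - (sstd (u0 / ℓ - a + 1) - sstd (u0 / ℓ - a)) * ((u - u0) / ℓ)| := by congr 1; ring
    _ ≤ 16 * ((u - u0) / ℓ) ^ 2 := h
    _ = (4 / ℓ) ^ 2 * (u - u0) ^ 2 := by ring
    _ ≤ _ := by gcongr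

lemma bet_der {ℓ : ℝ} (hℓ : 0 < ℓ) (v : ℝ) : |(sstd (v + 1) - sstd v) / ℓ| ≤ 4 / ℓ := by
  rw [abs_div, abs_of_pos hℓ]
  gcongr
  have h1 := sstd_bd (v + 1)
  have h2 := sstd_bd v
  rw [abs_le] at *
  constructor <;> linarith [h1.1, h1.2, h2.1, h2.2]

lemma bet_TWre {ℓ : ℝ} (hℓ : 0 < ℓ) (a : ℝ) : TW (4 / ℓ) (fun y => bet (y.re / ℓ - a)) := by
  refine ⟨fun y => ?_, bet_cont.comp (by fun_prop), fun y0 => ⟨(sstd (y0.re / ℓ - a + 1) - sstd (y0.re / ℓ - a)) / ℓ, 0, bet_der hℓ _, by simp; positivity, fun y => ?_⟩⟩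
  · rw [abs_of_nonneg (bet_nonneg _)]; exact bet_le _
  · rw [zero_mul, sub_zero, Complex.sub_re]
    exact bet_tay' hℓ a _ _ _ (by rw [← Complex.sub_re]; exact Complex.abs_re_le_norm _)

lemma bet_TWim {ℓ : ℝ} (hℓ : 0 < ℓ) (a : ℝ) : TW (4 / ℓ) (fun y => bet (y.im / ℓ - a)) := by
  refine ⟨fun y => ?_, bet_cont.comp (by fun_prop), fun y0 => ⟨0, (sstd (y0.im / ℓ - a + 1) - sstd (y0.im / ℓ - a)) / ℓ, by simp; positivity, bet_der hℓ _, fun y => ?_⟩⟩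
  · rw [abs_of_nonneg (bet_nonneg _)]; exact bet_le _
  · rw [zero_mul, sub_zero, Complex.sub_im]
    exact bet_tay' hℓ a _ _ _ (by rw [← Complex.sub_im]; exact Complex.abs_im_le_norm _)

/-- one-dimensional partition of unity -/
lemma bet_sum {M : ℕ} {v : ℝ} (hv : |v| ≤ M) : ∑ a ∈ Finset.range (2 * M + 2), bet (v - ((a:ℝ) - M)) = 1 := by
  have := Finset.sum_range_sub' (fun a : ℕ => sst (v - ((a:ℝ) - M) + 1)) (2 * M + 2)
  rw [abs_le] at hv
  rw [sst_one (by push_cast; linarith), sst_zero (by push_cast; linarith), sub_zero] at this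
  rw [← this]
  refine Finset.sum_congr rfl fun a _ => ?_
  unfold bet
  push_cast
  congr 2; ring

/-- index set of squares -/
def IQ (M : ℕ) : Finset (ℕ × ℕ) := Finset.range (2 * M + 2) ×ˢ Finset.range (2 * M + 2)
def zQ (ℓ : ℝ) (M : ℕ) (q : ℕ × ℕ) : ℂ := ⟨ℓ * (q.1 - M), ℓ * (q.2 - M)⟩
def eQ (ℓ : ℝ) (M : ℕ) (q : ℕ × ℕ) (z : ℂ) : ℝ := bet (z.re / ℓ - (q.1 - M)) * bet (z.im / ℓ - (q.2 - M))

lemma eQ_TW {ℓ : ℝ} (hℓ : 0 < ℓ) (M : ℕ) (q : ℕ × ℕ) : TW (16 / ℓ) (eQ ℓ M q) := by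
  have := (bet_TWre hℓ ((q.1:ℝ) - M)).mul (by positivity) (bet_TWim hℓ ((q.2:ℝ) - M))
  rwa [show 4 * (4 / ℓ) = 16 / ℓ by ring] at this

lemma eQ_nonneg (ℓ : ℝ) (M : ℕ) (q : ℕ × ℕ) (z : ℂ) : 0 ≤ eQ ℓ M q z := mul_nonneg (bet_nonneg _) (bet_nonneg _)

lemma eQ_sum {ℓ : ℝ} (hℓ : 0 < ℓ) {M : ℕ} (z : ℂ) (hz : ‖z‖ ≤ ℓ * M) : ∑ q ∈ IQ M, eQ ℓ M q z = 1 := by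
  unfold IQ eQ
  rw [Finset.sum_product]
  simp only
  rw [← Finset.sum_mul_sum, bet_sum, bet_sum, one_mul]
  · rw [abs_div, abs_of_pos hℓ, div_le_iff₀ hℓ, mul_comm]; exact (Complex.abs_im_le_norm z).trans hz
  · rw [abs_div, abs_of_pos hℓ, div_le_iff₀ hℓ, mul_comm]; exact (Complex.abs_re_le_norm z).trans hz

lemma eQ_supp {ℓ : ℝ} (hℓ : 0 < ℓ) {M : ℕ} {q : ℕ × ℕ} {z : ℂ} (h : eQ ℓ M q z ≠ 0) : ‖z - zQ ℓ M q‖ ≤ 2 * ℓ := by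
  have h1 := bet_supp (left_ne_zero_of_mul h)
  have h2 := bet_supp (right_ne_zero_of_mul h)
  refine (Complex.norm_le_abs_re_add_abs_im _).trans ?_
  have e1 : (z - zQ ℓ M q).re = ℓ * (z.re / ℓ - (q.1 - M)) := by simp only [zQ, Complex.sub_re]; field_simp
  have e2 : (z - zQ ℓ M q).im = ℓ * (z.im / ℓ - (q.2 - M)) := by simp only [zQ, Complex.sub_im]; field_simp
  rw [e1, e2, abs_mul, abs_mul, abs_of_pos hℓ]
  nlinarith only [h1, h2, hℓ]

lemma IQ_card (M : ℕ) : (IQ M).card = (2 * M + 2) ^ 2 := by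
  unfold IQ; rw [Finset.card_product, Finset.card_range]; ring

/-- partial sums of the partition have mass at most one; here `T ⊆ IQ`. -/
lemma eQ_partial {ℓ : ℝ} (hℓ : 0 < ℓ) {M : ℕ} {T : Finset (ℕ × ℕ)} (hT : T ⊆ IQ M) (z : ℂ) (hz : ‖z‖ ≤ ℓ * M) :
    |∑ q ∈ T, eQ ℓ M q z| ≤ 1 := by
  rw [abs_of_nonneg (Finset.sum_nonneg fun q _ => eQ_nonneg _ _ _ _), ← eQ_sum hℓ z hz]
  exact Finset.sum_le_sum_of_subset_of_nonneg hT fun q _ _ => eQ_nonneg _ _ _ _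

lemma eQ_dir {ℓ : ℝ} (hℓ : 0 < ℓ) (hℓ1 : ℓ ≤ 1/100) {M : ℕ} (q : ℕ × ℕ) : 
    Dir (eQ ℓ M q) (zQ ℓ M q / ‖zQ ℓ M q‖) (5 * ℓ) := by
  intro z hz hz1
  have h := eQ_supp hℓ hz
  set w := zQ ℓ M q
  have hw : 1/2 ≤ ‖w‖ := by have := norm_sub_norm_le z w; linarith
  have hw0 : (‖w‖ : ℂ) ≠ 0 := by exact_mod_cast (by linarith : ‖w‖ ≠ 0)
  have e : z - ‖z‖ * (w / ‖w‖) = (z - w) + ((‖w‖ - ‖z‖ : ℝ) : ℂ) * (w / ‖w‖) := by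
    push_cast; field_simp; ring
  rw [e]
  refine (norm_add_le _ _).trans ?_
  rw [norm_mul, norm_div, Complex.norm_real, Complex.norm_real, norm_norm, div_self (by linarith), mul_one, Real.norm_eq_abs]
  have h2 := abs_norm_sub_norm_le w z
  rw [norm_sub_rev] at h2
  nlinarith only [h, h2, hz1, hℓ]

end SM

namespace SM

/-- real inner product on ℂ -/
def ip (a b : ℂ) : ℝ := a.re * b.re + a.im * b.im

lemma ip_le (a b : ℂ) : |ip a b| ≤ ‖a‖ * ‖b‖ := by
  have : ip a b = (starRingEnd ℂ a * b).re := by simp [ip]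
  rw [this]
  refine (Complex.abs_re_le_norm _).trans ?_
  rw [norm_mul, Complex.norm_conj]

lemma ip_add_left (a b c : ℂ) : ip (a + b) c = ip a c + ip b c := by simp [ip]; ring
lemma ip_sub_left (a b c : ℂ) : ip (a - b) c = ip a c - ip b c := by simp [ip]; ring
lemma ip_real_mul (r : ℝ) (b c : ℂ) : ip ((r:ℂ) * b) c = r * ip b c := by simp [ip]; ring

/-- determinant of the three unit vectors -/
lemma det_three {e₁ e₂ e₃ : ℂ} (h₁ : ‖e₁‖ = 1) (h₂ : ‖e₂‖ = 1) (h₃ : ‖e₃‖ = 1) :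
    2 * |(starRingEnd ℂ (e₁ - e₂) * (e₁ - e₃)).im| = ‖e₁ - e₂‖ * ‖e₁ - e₃‖ * ‖e₂ - e₃‖ := by
  have c : ∀ e : ℂ, ‖e‖ = 1 → starRingEnd ℂ e = e⁻¹ := fun e he => by
    rw [Complex.inv_def, Complex.normSq_eq_norm_sq, he]; simp
  have n : ∀ e : ℂ, ‖e‖ = 1 → e ≠ 0 := fun e he => by rw [← norm_ne_zero_iff, he]; norm_num
  have key : (starRingEnd ℂ (e₁ - e₂) * (e₁ - e₃)) - starRingEnd ℂ (starRingEnd ℂ (e₁ - e₂) * (e₁ - e₃)) 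
      = (e₂ - e₁) * (e₁ - e₃) * (e₃ - e₂) * (e₁⁻¹ * e₂⁻¹ * e₃⁻¹) := by
    rw [map_mul, Complex.conj_conj, map_sub, map_sub, c _ h₁, c _ h₂, c _ h₃]
    have := n _ h₁; have := n _ h₂; have := n _ h₃
    field_simp
    ring
  rw [Complex.sub_conj] at key
  have := congrArg norm key
  simp only [norm_mul, norm_inv, h₁, h₂, h₃, Complex.norm_I, Complex.norm_real, Real.norm_eq_abs] at this
  rw [norm_sub_rev e₂ e₁, norm_sub_rev e₃ e₂] at this
  rw [abs_two] at this
  linarith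

lemma solve2 (p q v : ℂ) : ‖v‖ * |(starRingEnd ℂ p * q).im| ≤ ‖p‖ * |ip q v| + ‖q‖ * |ip p v| := by
  have e1 : (((starRingEnd ℂ p * q).im : ℝ) : ℂ) * v = Complex.I * (p * ((ip q v : ℝ):ℂ) - q * ((ip p v : ℝ):ℂ)) := by
    apply Complex.ext <;> simp [ip] <;> ring
  have := congrArg norm e1
  rw [norm_mul, Complex.norm_real, Real.norm_eq_abs] at this
  rw [mul_comm, this, norm_mul, Complex.norm_I, one_mul]
  refine (norm_sub_le _ _).trans ?_
  rw [norm_mul, norm_mul, Complex.norm_real, Complex.norm_real]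
  rfl

/-- linearised relation -/
lemma rel_lin {t : ℂ → ℝ} {r ε ℓ : ℝ} {e : ℂ} {s : ℝ} (hs : s = 1 ∨ s = -1) (hr : 0 < r) (hε : 2 * ε ≤ r) {x z x' : ℂ} 
    (hx : RelS t r ε ℓ e s x x') (hz : RelS t r ε ℓ e s z x') :
    |ip e (x - z) + (t x - t z)| ≤ 2 * ε + ℓ * ‖x - z‖ := by
  obtain ⟨a1, a2, a3⟩ := hx
  obtain ⟨b1, b2, b3⟩ := hz
  set a := x - x'
  set b := z - x'
  have hab : x - z = a - b := by simp [a, b]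
  have ha0 : 0 < ‖a‖ := by rw [abs_le] at a2; linarith
  have hb0 : 0 < ‖b‖ := by rw [abs_le] at b2; linarith
  set S := ‖a‖ + ‖b‖ with hS
  have hS0 : 0 < S := by positivity
  have h1 : ip (a + b) (a - b) = S * (‖a‖ - ‖b‖) := by
    have n1 : ‖a‖ ^ 2 = a.re ^ 2 + a.im ^ 2 := by rw [← Complex.normSq_eq_norm_sq, Complex.normSq_apply]; ring
    have n2 : ‖b‖ ^ 2 = b.re ^ 2 + b.im ^ 2 := by rw [← Complex.normSq_eq_norm_sq, Complex.normSq_apply]; ring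
    simp only [ip, Complex.add_re, Complex.add_im, Complex.sub_re, Complex.sub_im]
    linear_combination n2 - n1
  have hss : s * s = 1 := by rcases hs with rfl | rfl <;> norm_num
  have h2 : ‖(s:ℂ) * (a + b) - S * e‖ ≤ ℓ * S := by
    have : (s:ℂ) * (a + b) - S * e = ((s:ℂ) * a - ‖a‖ * e) + ((s:ℂ) * b - ‖b‖ * e) := by rw [hS]; push_cast; ring
    rw [this]; refine (norm_add_le _ _).trans ?_
    linarith
  have h3 := (ip_le ((s:ℂ) * (a + b) - S * e) (a - b)).trans (mul_le_mul_of_nonneg_right h2 (norm_nonneg _))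
  rw [ip_sub_left, ip_real_mul, ip_real_mul, h1] at h3
  have h4 : s * (S * (‖a‖ - ‖b‖)) - S * ip e (a - b) = S * (s * (‖a‖ - ‖b‖) - ip e (a - b)) := by ring
  rw [h4, abs_mul, abs_of_pos hS0, show ℓ * S * ‖a - b‖ = S * (ℓ * ‖a - b‖) by ring] at h3
  have h5 := le_of_mul_le_mul_left h3 hS0
  have h6 : |s * (‖a‖ - ‖b‖) + (t x - t z)| ≤ 2 * ε := by
    have : s * (‖a‖ - ‖b‖) + (t x - t z) = s * ((‖a‖ - s * (t x' - t x)) - (‖b‖ - s * (t x' - t z))) := by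
      linear_combination (t x - t z) * (-hss) 
    rw [this, abs_mul]
    have h7 : |s| = 1 := by rcases hs with rfl | rfl <;> simp
    rw [h7, one_mul]
    refine (abs_sub _ _).trans ?_
    linarith
  rw [hab]
  rw [abs_le] at *
  constructor <;> linarith [h5.1, h5.2, h6.1, h6.2]

/-- the three-circle lemma -/
lemma three_circle {t : ℂ → ℝ} {r ε ℓ κ : ℝ} {e₁ e₂ e₃ : ℂ} {s₁ s₂ s₃ : ℝ} (hs₁ : s₁ = 1 ∨ s₁ = -1) (hs₂ : s₂ = 1 ∨ s₂ = -1) (hs₃ : s₃ = 1 ∨ s₃ = -1)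
    (hr : 0 < r) (hε : 2 * ε ≤ r) (hκ : 0 < κ) (hℓκ : 16 * ℓ ≤ κ) (n₁ : ‖e₁‖ = 1) (n₂ : ‖e₂‖ = 1) (n₃ : ‖e₃‖ = 1)
    (hdet : 2 * κ ≤ ‖e₁ - e₂‖ * ‖e₁ - e₃‖ * ‖e₂ - e₃‖)
    {x₁ x₂ x₃ x z : ℂ} (hx₁ : RelS t r ε ℓ e₁ s₁ x x₁) (hx₂ : RelS t r ε ℓ e₂ s₂ x x₂) (hx₃ : RelS t r ε ℓ e₃ s₃ x x₃)
    (hz₁ : RelS t r ε ℓ e₁ s₁ z x₁) (hz₂ : RelS t r ε ℓ e₂ s₂ z x₂) (hz₃ : RelS t r ε ℓ e₃ s₃ z x₃) :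
    ‖x - z‖ ≤ 32 * ε / κ := by
  have l₁ := rel_lin hs₁ hr hε hx₁ hz₁
  have l₂ := rel_lin hs₂ hr hε hx₂ hz₂
  have l₃ := rel_lin hs₃ hr hε hx₃ hz₃
  set v := x - z
  have m₂ : |ip (e₁ - e₂) v| ≤ 4 * ε + 2 * ℓ * ‖v‖ := by
    rw [ip_sub_left]; rw [abs_le] at *; constructor <;> linarith [l₁.1, l₁.2, l₂.1, l₂.2]
  have m₃ : |ip (e₁ - e₃) v| ≤ 4 * ε + 2 * ℓ * ‖v‖ := by
    rw [ip_sub_left]; rw [abs_le] at *; constructor <;> linarith [l₁.1, l₁.2, l₃.1, l₃.2]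
  have p₂ : ‖e₁ - e₂‖ ≤ 2 := (norm_sub_le _ _).trans (by linarith)
  have p₃ : ‖e₁ - e₃‖ ≤ 2 := (norm_sub_le _ _).trans (by linarith)
  have hs := solve2 (e₁ - e₂) (e₁ - e₃) v
  have hd := det_three n₁ n₂ n₃
  have hD : κ ≤ |(starRingEnd ℂ (e₁ - e₂) * (e₁ - e₃)).im| := by linarith
  have h1 : ‖v‖ * κ ≤ 2 * (4 * ε + 2 * ℓ * ‖v‖) + 2 * (4 * ε + 2 * ℓ * ‖v‖) := 
    calc ‖v‖ * κ ≤ ‖v‖ * |(starRingEnd ℂ (e₁ - e₂) * (e₁ - e₃)).im| := by gcongr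
      _ ≤ _ := hs
      _ ≤ _ := add_le_add (mul_le_mul p₂ m₃ (abs_nonneg _) (by norm_num)) (mul_le_mul p₃ m₂ (abs_nonneg _) (by norm_num))
  rw [le_div_iff₀ hκ]
  have := mul_le_mul_of_nonneg_left hℓκ (norm_nonneg v)
  linarith

lemma vol_small {S : Set ℂ} {D : ℝ} (hD : 0 ≤ D) (h : ∀ x ∈ S, ∀ z ∈ S, ‖x - z‖ ≤ D) : volume.real S ≤ 4 * D ^ 2 := by
  rcases S.eq_empty_or_nonempty with rfl | ⟨z, hz⟩
  · simp; positivity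
  · have hS : S ⊆ closedBall z D := fun x hx => by rw [mem_closedBall, dist_eq_norm]; exact h x hx z hz
    rw [← nu_real hS]
    exact nu_real_le hD S

/-- pigeonhole -/
lemma pigeon {t : ℂ → ℝ} (ht : Measurable t) {r ε ℓ m q : ℝ} {e : ℂ} {c : ℂ} {ρ : ℝ} {Ω G : Set ℂ} (hG : MeasurableSet G)
    (hΩc : Ω ⊆ closedBall c ρ) (hGc : G ⊆ closedBall c ρ)
    (h : ∀ x ∈ G, m ≤ volume.real {x' ∈ Ω | Rel t r ε ℓ e x x'})
    (hq : ∀ x', ∀ s : ℝ, s = 1 ∨ s = -1 → volume.real {x ∈ G | RelS t r ε ℓ e s x x'} ≤ q) :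
    m * volume.real G ≤ 2 * q * volume.real Ω := by
  have hq0 : 0 ≤ q := measureReal_nonneg.trans (hq 0 1 (Or.inl rfl))
  set ν := volume.restrict (closedBall c ρ) with hν
  let H : ℂ → ℂ → ℝ := fun x x' => {p : ℂ × ℂ | RelS t r ε ℓ e 1 p.1 p.2}.indicator (fun _ => 1) (x, x') + {p : ℂ × ℂ | RelS t r ε ℓ e (-1) p.1 p.2}.indicator (fun _ => 1) (x, x')
  have hm1 := RelS_meas ht r ε ℓ e 1
  have hm2 := RelS_meas ht r ε ℓ e (-1)
  have hHm : Measurable (Function.uncurry H) := (measurable_const.indicator hm1).add (measurable_const.indicator hm2)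
  have hi : Integrable (Function.uncurry H) ((ν.restrict G).prod (ν.restrict Ω)) := by
    refine integrable_bdd hHm (D := 2) fun p => ?_
    have b : ∀ s : ℝ, 0 ≤ {p : ℂ × ℂ | RelS t r ε ℓ e s p.1 p.2}.indicator (fun _ => (1:ℝ)) p ∧ {p : ℂ × ℂ | RelS t r ε ℓ e s p.1 p.2}.indicator (fun _ => (1:ℝ)) p ≤ 1 := fun s =>
      ⟨indicator_nonneg (fun _ _ => zero_le_one) _, indicator_le_self' (fun _ _ => zero_le_one) _⟩
    have h1 := b 1
    have h2 := b (-1)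
    show |_ + _| ≤ 2
    rw [abs_of_nonneg (add_nonneg h1.1 h2.1)]
    linarith [h1.2, h2.2]
  have hsw := integral_integral_swap hi
  have s1 : ∀ (s : ℝ) (x : ℂ), MeasurableSet {x' | RelS t r ε ℓ e s x x'} := fun s x => measurable_prodMk_left (RelS_meas ht r ε ℓ e s)
  have s2 : ∀ (s : ℝ) (x' : ℂ), MeasurableSet {x | RelS t r ε ℓ e s x x'} := fun s x' => measurable_prodMk_right (RelS_meas ht r ε ℓ e s)
  have I1 : ∀ x, ∫ x' in Ω, H x x' ∂ν = volume.real {x' ∈ Ω | RelS t r ε ℓ e 1 x x'} + volume.real {x' ∈ Ω | RelS t r ε ℓ e (-1) x x'} := by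
    intro x
    have : ∀ x', H x x' = {x' | RelS t r ε ℓ e 1 x x'}.indicator (fun _ => 1) x' + {x' | RelS t r ε ℓ e (-1) x x'}.indicator (fun _ => 1) x' := fun x' => rfl
    simp only [this]
    rw [integral_add ((integrable_const _).indicator (s1 _ _)) ((integrable_const _).indicator (s1 _ _)), integral_indicator_const _ (s1 _ _), integral_indicator_const _ (s1 _ _),
      smul_eq_mul, smul_eq_mul, mul_one, mul_one, measureReal_restrict_apply (s1 _ _), measureReal_restrict_apply (s1 _ _),
      nu_real (inter_subset_right.trans hΩc), nu_real (inter_subset_right.trans hΩc), inter_comm, inter_comm _ Ω]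
    rfl
  have I2 : ∀ x', ∫ x in G, H x x' ∂ν = volume.real {x ∈ G | RelS t r ε ℓ e 1 x x'} + volume.real {x ∈ G | RelS t r ε ℓ e (-1) x x'} := by
    intro x'
    have : ∀ x, H x x' = {x | RelS t r ε ℓ e 1 x x'}.indicator (fun _ => 1) x + {x | RelS t r ε ℓ e (-1) x x'}.indicator (fun _ => 1) x := fun x => rfl
    simp only [this]
    rw [integral_add ((integrable_const _).indicator (s2 _ _)) ((integrable_const _).indicator (s2 _ _)), integral_indicator_const _ (s2 _ _), integral_indicator_const _ (s2 _ _),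
      smul_eq_mul, smul_eq_mul, mul_one, mul_one, measureReal_restrict_apply (s2 _ _), measureReal_restrict_apply (s2 _ _),
      nu_real (inter_subset_right.trans hGc), nu_real (inter_subset_right.trans hGc), inter_comm, inter_comm _ G]
    rfl
  have L1 : m * volume.real G ≤ ∫ x in G, ∫ x' in Ω, H x x' ∂ν ∂ν := by
    rw [← nu_real hGc]
    have : ∫ x in G, m ∂ν = m * ν.real G := by rw [integral_const, measureReal_restrict_apply_univ, smul_eq_mul, mul_comm]
    rw [← this]
    refine setIntegral_mono_on (integrable_const _) hi.integral_prod_left hG fun x hx => ?_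
    rw [I1]
    refine (h x hx).trans ?_
    refine (measureReal_mono ?_ ?_).trans (measureReal_union_le _ _)
    · rintro x' ⟨hx', h1 | h1⟩
      · exact Or.inl ⟨hx', h1⟩
      · exact Or.inr ⟨hx', h1⟩
    · exact ((measure_mono (union_subset (sep_subset _ _) (sep_subset _ _))).trans_lt ((measure_mono hΩc).trans_lt measure_closedBall_lt_top)).ne
  rw [hsw] at L1
  refine L1.trans ((le_abs_self _).trans ?_)
  rw [← nu_real hΩc]
  refine abs_setInt_le fun x' _ => ?_
  rw [I2, abs_of_nonneg (add_nonneg measureReal_nonneg measureReal_nonneg)]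
  linarith [hq x' 1 (Or.inl rfl), hq x' (-1) (Or.inr rfl)]

end SM

namespace SM

lemma exists_big {ι : Type*} {S : Finset ι} {F : ι → ℝ} {l N : ℝ} (hl : 0 < l) (hN : (S.card : ℝ) ≤ N) (hS : l / 2 ≤ ∑ q ∈ S, F q) :
    ∃ q ∈ S, l / (2 * N) ≤ F q := by
  have hne : S.Nonempty := by
    rw [Finset.nonempty_iff_ne_empty]; rintro rfl
    rw [Finset.sum_empty] at hS; linarith
  have hN0 : 0 < N := lt_of_lt_of_le (by exact_mod_cast hne.card_pos) hN
  obtain ⟨q, hq, h⟩ := Finset.exists_le_of_sum_le (f := fun _ => l / (2 * N)) (g := F) hne (by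
    rw [Finset.sum_const, nsmul_eq_mul]
    refine le_trans ?_ hS
    calc (S.card : ℝ) * (l / (2 * N)) ≤ N * (l / (2 * N)) := by gcongr
      _ = l / 2 := by field_simp)
  exact ⟨q, hq, h⟩

lemma select3 {ι : Type*} [DecidableEq ι] {I : Finset ι} {F : ι → ℝ} {z : ι → ℂ} {l d N : ℝ} (hl : 0 < l) (hN : (I.card : ℝ) ≤ N)
    (hI : l ≤ ∑ q ∈ I, F q) (hnear : ∀ z0 : ℂ, ∀ T ⊆ I, (∀ q ∈ T, ‖z q - z0‖ ≤ d) → |∑ q ∈ T, F q| ≤ l / 8) :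
    ∃ q₁ ∈ I, ∃ q₂ ∈ I, ∃ q₃ ∈ I, d < ‖z q₁ - z q₂‖ ∧ d < ‖z q₁ - z q₃‖ ∧ d < ‖z q₂ - z q₃‖ ∧
      l / (2 * N) ≤ F q₁ ∧ l / (2 * N) ≤ F q₂ ∧ l / (2 * N) ≤ F q₃ := by
  obtain ⟨q₁, h₁, f₁⟩ := exists_big (F := F) hl hN (by linarith)
  have s1 := Finset.sum_filter_add_sum_filter_not I (fun q => ‖z q - z q₁‖ ≤ d) F
  have a1 := hnear (z q₁) _ (Finset.filter_subset (fun q => ‖z q - z q₁‖ ≤ d) I) (fun q hq => (Finset.mem_filter.1 hq).2)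
  set I₂ := I.filter (fun q => ¬ ‖z q - z q₁‖ ≤ d) with hI₂
  have c2 : (I₂.card : ℝ) ≤ N := le_trans (by exact_mod_cast Finset.card_filter_le _ _) hN
  rw [abs_le] at a1
  obtain ⟨q₂, h₂, f₂⟩ := exists_big (S := I₂) (F := F) hl c2 (by linarith [a1.2])
  have s2 := Finset.sum_filter_add_sum_filter_not I₂ (fun q => ‖z q - z q₂‖ ≤ d) F
  have a2 := hnear (z q₂) _ ((Finset.filter_subset (fun q => ‖z q - z q₂‖ ≤ d) I₂).trans (Finset.filter_subset _ I)) (fun q hq => (Finset.mem_filter.1 hq).2)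
  rw [abs_le] at a2
  obtain ⟨q₃, h₃, f₃⟩ := exists_big (S := I₂.filter (fun q => ¬ ‖z q - z q₂‖ ≤ d)) (F := F) hl (le_trans (by exact_mod_cast Finset.card_filter_le _ _) c2) (by linarith [a1.2, a2.2])
  rw [Finset.mem_filter, not_le] at h₃
  have h3' := h₃.1
  rw [hI₂, Finset.mem_filter, not_le] at h₂ h3'
  refine ⟨q₁, h₁, q₂, h₂.1, q₃, h3'.1, ?_, ?_, ?_, f₁, f₂, f₃⟩
  · rw [norm_sub_rev]; exact h₂.2
  · rw [norm_sub_rev]; exact h3'.2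
  · rw [norm_sub_rev]; exact h₃.2

def FQ (c : ℂ) (f : ℂ → ℝ) (η : ℂ → ℝ) (A : ℝ → ℝ → ℝ) (t : ℂ → ℝ) (x : ℂ) : ℝ := ∫ y in closedBall c 4, f y * Gk η A t x y

section
variable {δ ρ ℓ : ℝ} {A : ℝ → ℝ → ℝ} {t : ℂ → ℝ} {c : ℂ} {f : ℂ → ℝ} {M : ℕ}

lemma FQ_int {L : ℝ} {η : ℂ → ℝ} (hη : TW L η) (hA : AP δ A) (ht : Measurable t) (t1 : ∀ x, 1 ≤ t x) (t2 : ∀ x, t x ≤ 2) (hf : Measurable f) (hf1 : ∀ y, |f y| ≤ 1) (x : ℂ) :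
    Integrable (fun y => f y * Gk η A t x y) (volume.restrict (closedBall c 4)) := by
  have hb := Gk_BK hη hA ht t1 t2
  refine integrable_bdd (D := 1 / δ) (hf.mul (hb.meas.comp (measurable_const.prodMk measurable_id))) fun y => ?_
  rw [abs_mul]
  exact (mul_le_mul (hf1 y) (hb.bd x y) (abs_nonneg _) zero_le_one).trans (by rw [one_mul])

lemma FQ_meas {L : ℝ} {η : ℂ → ℝ} (hη : TW L η) (hA : AP δ A) (ht : Measurable t) (t1 : ∀ x, 1 ≤ t x) (t2 : ∀ x, t x ≤ 2) (hf : Measurable f) :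
    Measurable (FQ c f η A t) := by
  have hb := Gk_BK hη hA ht t1 t2
  have : StronglyMeasurable (fun p : ℂ × ℂ => f p.2 * Gk η A t p.1 p.2) := ((hf.comp measurable_snd).mul hb.meas).stronglyMeasurable
  exact (this.integral_prod_right (ν := volume.restrict (closedBall c 4))).measurable

lemma FQ_sum (hℓ : 0 < ℓ) (hA : AP δ A) (ht : Measurable t) (t1 : ∀ x, 1 ≤ t x) (t2 : ∀ x, t x ≤ 2) (hf : Measurable f) (hf1 : ∀ y, |f y| ≤ 1) (T : Finset (ℕ × ℕ)) (x : ℂ) :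
    ∑ q ∈ T, FQ c f (eQ ℓ M q) A t x = ∫ y, ((closedBall c 4).indicator f y * ∑ q ∈ T, eQ ℓ M q (y - x)) * A (t x) ‖y - x‖ := by
  unfold FQ
  rw [← integral_finsetSum _ fun q _ => FQ_int (eQ_TW hℓ M q) hA ht t1 t2 hf hf1 x, ← integral_indicator measurableSet_closedBall]
  congr 1; ext y
  by_cases hy : y ∈ closedBall c 4
  · rw [indicator_of_mem hy, indicator_of_mem hy, Finset.mul_sum, Finset.sum_mul]
    refine Finset.sum_congr rfl fun q _ => ?_
    unfold Gk; ring
  · rw [indicator_of_notMem hy, indicator_of_notMem hy]; ring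

lemma FQ_near (hℓ : 0 < ℓ) (hM : 5 ≤ ℓ * M) (hδ : 0 < δ) (hδ1 : δ ≤ 1/8) (hA : AP δ A) (ht : Measurable t) (t1 : ∀ x, 1 ≤ t x) (t2 : ∀ x, t x ≤ 2) (hf : Measurable f) (hf1 : ∀ y, |f y| ≤ 1)
    {x : ℂ} (hx : ‖x - c‖ ≤ 1) {T : Finset (ℕ × ℕ)} (hT : T ⊆ IQ M) {z0 : ℂ} {d : ℝ} (hd : 0 ≤ d) (hdR : d + 2 * ℓ ≤ 1/4) (hTd : ∀ q ∈ T, ‖zQ ℓ M q - z0‖ ≤ d) :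
    |∑ q ∈ T, FQ c f (eQ ℓ M q) A t x| ≤ 62 * (d + 2 * ℓ) := by
  rw [FQ_sum hℓ hA ht t1 t2 hf hf1]
  refine mass_loc (y0 := x + z0) hδ hδ1 (t1 x) (t2 x) (by positivity) hdR (hA.prof _ (t1 x) (t2 x)) ?_ ?_
  · intro y
    by_cases hy : y ∈ closedBall c 4
    · rw [indicator_of_mem hy, abs_mul]
      refine mul_le_one₀ (hf1 y) (abs_nonneg _) (eQ_partial hℓ hT _ ?_)
      rw [mem_closedBall, dist_eq_norm] at hy
      have := norm_sub_le_norm_sub_add_norm_sub y c x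
      rw [norm_sub_rev c x] at this
      linarith
    · rw [indicator_of_notMem hy, zero_mul, abs_zero]; norm_num
  · intro y hy
    obtain ⟨q, hq, hne⟩ := Finset.exists_ne_zero_of_sum_ne_zero (right_ne_zero_of_mul hy)
    have h1 := eQ_supp hℓ hne
    have h2 := hTd q hq
    have e : y - (x + z0) = (y - x - zQ ℓ M q) + (zQ ℓ M q - z0) := by ring
    rw [e]
    exact (norm_add_le _ _).trans (by linarith)

lemma FQ_all (hℓ : 0 < ℓ) (hM : 5 ≤ ℓ * M) (hA : AP δ A) (ht : Measurable t) (t1 : ∀ x, 1 ≤ t x) (t2 : ∀ x, t x ≤ 2) (hf : Measurable f) (hf1 : ∀ y, |f y| ≤ 1)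
    {x : ℂ} (hx : ‖x - c‖ ≤ 1) :
    ∑ q ∈ IQ M, FQ c f (eQ ℓ M q) A t x = FQ c f (fun _ => 1) A t x := by
  rw [FQ_sum hℓ hA ht t1 t2 hf hf1]
  unfold FQ
  rw [← integral_indicator measurableSet_closedBall]
  congr 1; ext y
  by_cases hy : y ∈ closedBall c 4
  · rw [indicator_of_mem hy, indicator_of_mem hy, eQ_sum hℓ]
    · unfold Gk; ring
    · rw [mem_closedBall, dist_eq_norm] at hy
      have := norm_sub_le_norm_sub_add_norm_sub y c x
      rw [norm_sub_rev c x] at this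
      linarith
  · rw [indicator_of_notMem hy, indicator_of_notMem hy]; ring

/-- if the local piece is nonzero then the square is near the circle -/
lemma FQ_ne (hℓ : 0 < ℓ) (hA : AP δ A) (t1 : ∀ x, 1 ≤ t x) (t2 : ∀ x, t x ≤ 2) {q : ℕ × ℕ} {x : ℂ}
    (h : FQ c f (eQ ℓ M q) A t x ≠ 0) : |‖zQ ℓ M q‖ - t x| ≤ δ + 2 * ℓ := by
  obtain ⟨y, hy⟩ : ∃ y, f y * Gk (eQ ℓ M q) A t x y ≠ 0 := by
    by_contra hcon
    push Not at hcon
    apply h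
    unfold FQ
    simp only [hcon, integral_zero]
  have h1 := eQ_supp hℓ (left_ne_zero_of_mul (right_ne_zero_of_mul hy))
  have h2 := (hA.prof _ (t1 x) (t2 x)).supp _ (right_ne_zero_of_mul (right_ne_zero_of_mul hy))
  have h3 := abs_norm_sub_norm_le (y - x) (zQ ℓ M q)
  rw [abs_le] at *
  constructor <;> linarith [h2.1, h2.2, h3.1, h3.2]

lemma dir_sep {z w : ℂ} {d h : ℝ} (hd : d < ‖z - w‖) (hz : 1/2 ≤ ‖z‖) (hw : 1/2 ≤ ‖w‖) (hw2 : ‖w‖ ≤ 5/2) (hzw : |‖z‖ - ‖w‖| ≤ h) (hh : 2 * h ≤ d) :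
    d / 5 ≤ ‖z / ‖z‖ - w / ‖w‖‖ := by
  have hz0 : (‖z‖ : ℂ) ≠ 0 := by exact_mod_cast (by linarith : ‖z‖ ≠ 0)
  have hw0 : (‖w‖ : ℂ) ≠ 0 := by exact_mod_cast (by linarith : ‖w‖ ≠ 0)
  have e : z - w = ((‖z‖ - ‖w‖ : ℝ) : ℂ) * (z / ‖z‖) + ‖w‖ * (z / ‖z‖ - w / ‖w‖) := by
    push_cast; field_simp; ring
  have h1 : ‖z - w‖ ≤ h + ‖w‖ * ‖z / ‖z‖ - w / ‖w‖‖ := by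
    conv_lhs => rw [e]
    refine (norm_add_le _ _).trans ?_
    rw [norm_mul, norm_mul, norm_div, Complex.norm_real, Complex.norm_real, norm_norm, div_self (by linarith), mul_one, Real.norm_eq_abs, show ‖(‖w‖:ℂ)‖ = ‖w‖ by simp]
    linarith
  have := mul_le_mul_of_nonneg_right hw2 (norm_nonneg (z / ‖z‖ - w / ‖w‖))
  linarith

lemma unit_dir {z : ℂ} (hz : 1/2 ≤ ‖z‖) : ‖z / ‖z‖‖ = 1 := by
  rw [norm_div, Complex.norm_real, norm_norm, div_self (by linarith)]

end

end SM

namespace SM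

lemma relvol_meas {t : ℂ → ℝ} (ht : Measurable t) {r ε ℓ : ℝ} {e : ℂ} {W : Set ℂ} (hW : MeasurableSet W) :
    Measurable fun x => volume.real {x' ∈ W | Rel t r ε ℓ e x x'} := by
  have h : MeasurableSet {p : ℂ × ℂ | p.2 ∈ W ∧ Rel t r ε ℓ e p.1 p.2} := (measurable_snd hW).inter (Rel_meas ht r ε ℓ e)
  exact (measurable_measure_prodMk_left (ν := (volume : Measure ℂ)) h).ennreal_toReal

lemma W2core {L δ ρ : ℝ} {η₁ η₂ η₃ : ℂ → ℝ} {A : ℝ → ℝ → ℝ} {t : ℂ → ℝ} (h₁ : Cell L δ ρ η₁ A t) (h₂ : Cell L δ ρ η₂ A t) (h₃ : Cell L δ ρ η₃ A t)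
    {e₁ e₂ e₃ : ℂ} {ℓ r ε m κ : ℝ} (d₁ : Dir η₁ e₁ ℓ) (d₂ : Dir η₂ e₂ ℓ) (d₃ : Dir η₃ e₃ ℓ) (hℓ : 0 ≤ ℓ) (hε : 4 * δ ≤ ε) (hεr : 2 * ε ≤ r) (hεℓ : 16 * ε ≤ ℓ ^ 2 * r)
    (n₁ : ‖e₁‖ = 1) (n₂ : ‖e₂‖ = 1) (n₃ : ‖e₃‖ = 1) (hκ : 0 < κ) (hℓκ : 32 * ℓ ≤ κ)
    (hdet : 2 * κ ≤ ‖e₁ - e₂‖ * ‖e₁ - e₃‖ * ‖e₂ - e₃‖)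
    {c : ℂ} {W : Set ℂ} (hW : MeasurableSet W) (hWc : W ⊆ closedBall c ρ) (hm0 : 0 < m) (hm : m ^ 3 = 2048 * (32 * ε / κ) ^ 2 * ρ ^ 4)
    {s r' : ℝ} (hWs : ∀ x ∈ W, t x ∈ Icc s (s + r')) {f : ℂ → ℝ} (hf : Measurable f) (hf1 : ∀ y, |f y| ≤ 1) {l : ℝ} (hl : 0 ≤ l)
    (f₁ : ∀ x ∈ W, l ≤ FQ c f η₁ A t x) (f₂ : ∀ x ∈ W, l ≤ FQ c f η₂ A t x) (f₃ : ∀ x ∈ W, l ≤ FQ c f η₃ A t x) :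
    l ^ 2 * volume.real W ≤ 4 * ((∫ y in closedBall c 4, f y ^ 2) * (6 * CS * L ^ 2 * r + k1 δ r * m + k2 L δ r ε * (4 * ρ ^ 2))) := by
  have hδ := h₁.δ0
  have hε0 : 0 < ε := by linarith
  have hr0 : 0 < r := by linarith
  set V := volume.real W with hV
  set X := (∫ y in closedBall c 4, f y ^ 2) * (6 * CS * L ^ 2 * r + k1 δ r * m + k2 L δ r ε * (4 * ρ ^ 2)) with hX
  have hWfin : volume W ≠ ∞ := ((measure_mono hWc).trans_lt measure_closedBall_lt_top).ne
  let B : ℂ → Set ℂ := fun e => {x ∈ W | volume.real {x' ∈ W | Rel t r ε (2 * ℓ) e x x'} < m}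
  have hBm : ∀ e, MeasurableSet (B e) := fun e => hW.inter (measurableSet_lt (relvol_meas h₁.ht hW) measurable_const)
  have hBW : ∀ e, B e ⊆ W := fun e => sep_subset _ _
  have bad : ∀ (η : ℂ → ℝ) (e : ℂ), Cell L δ ρ η A t → Dir η e ℓ → (∀ x ∈ W, l ≤ FQ c f η A t x) → l ^ 2 * volume.real (B e) ≤ X := by
    intro η e h d hF
    refine h.bad d hℓ hε hεr hεℓ (hBm e) ((hBW e).trans hWc) hm0.le (fun x hx => hWs x hx.1) hf hf1 hl (fun x hx => hF x hx.1) ?_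
    intro x hx
    refine (measureReal_mono ?_ ?_).trans hx.2.le
    · rintro x' ⟨h1, h2⟩; exact ⟨hBW e h1, h2⟩
    exact ((measure_mono (sep_subset _ _)).trans_lt hWfin.lt_top).ne
  have b₁ := bad _ _ h₁ d₁ f₁
  have b₂ := bad _ _ h₂ d₂ f₂
  have b₃ := bad _ _ h₃ d₃ f₃
  have big : ∀ e, l ^ 2 * volume.real (B e) ≤ X → V / 4 ≤ volume.real (B e) → l ^ 2 * V ≤ 4 * X := by
    intro e h1 h2
    have := mul_le_mul_of_nonneg_left h2 (sq_nonneg l)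
    linarith
  rcases le_or_gt (V / 4) (volume.real (B e₁)) with c₁ | c₁
  · exact big _ b₁ c₁
  rcases le_or_gt (V / 4) (volume.real (B e₂)) with c₂ | c₂
  · exact big _ b₂ c₂
  rcases le_or_gt (V / 4) (volume.real (B e₃)) with c₃ | c₃
  · exact big _ b₃ c₃
  exfalso
  let G := W \ (B e₁ ∪ B e₂ ∪ B e₃)
  have hGm : MeasurableSet G := hW.diff (((hBm _).union (hBm _)).union (hBm _))
  have hGW : G ⊆ W := sdiff_subset
  have hGV : V / 4 < volume.real G := by
    have u1 : V ≤ volume.real (G ∪ ((B e₁ ∪ B e₂) ∪ B e₃)) := by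
      refine measureReal_mono (fun x hx => ?_) ?_
      · by_cases h : x ∈ B e₁ ∪ B e₂ ∪ B e₃
        · exact Or.inr h
        · exact Or.inl ⟨hx, h⟩
      · exact ((measure_mono (union_subset hGW (union_subset (union_subset (hBW _) (hBW _)) (hBW _)))).trans_lt hWfin.lt_top).ne
    have u2 := measureReal_union_le (μ := (volume : Measure ℂ)) G ((B e₁ ∪ B e₂) ∪ B e₃)
    have u3 := measureReal_union_le (μ := (volume : Measure ℂ)) (B e₁ ∪ B e₂) (B e₃)
    have u4 := measureReal_union_le (μ := (volume : Measure ℂ)) (B e₁) (B e₂)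
    linarith
  have gd : ∀ e, B e ⊆ B e₁ ∪ B e₂ ∪ B e₃ → ∀ x ∈ G, m ≤ volume.real {x' ∈ W | Rel t r ε (2 * ℓ) e x x'} := by
    intro e he x hx
    by_contra hc
    exact hx.2 (he ⟨hx.1, not_le.1 hc⟩)
  have g₁ := gd e₁ (subset_union_left.trans subset_union_left)
  have g₂ := gd e₂ (subset_union_right.trans subset_union_left)
  have g₃ := gd e₃ subset_union_right
  set D := 32 * ε / κ with hD
  have hD0 : 0 ≤ D := by positivity
  have hV0 : 0 ≤ V := measureReal_nonneg
  have rm : ∀ (e : ℂ) (s : ℝ) (x' : ℂ), MeasurableSet {x | RelS t r ε (2 * ℓ) e s x x'} := fun e s x' => measurable_prodMk_right (RelS_meas h₁.ht r ε (2 * ℓ) e s)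
  have key : m * volume.real G ≤ 2 * (2 * (2 * (4 * D ^ 2) * V / m) * V / m) * V := by
    refine pigeon h₁.ht (e := e₁) hGm hWc (hGW.trans hWc) g₁ fun x₁ s₁ hs₁ => ?_
    set G1 := {x ∈ G | RelS t r ε (2 * ℓ) e₁ s₁ x x₁} with hG1
    have hG1m : MeasurableSet G1 := hGm.inter (rm _ _ _)
    have hG1G : G1 ⊆ G := sep_subset _ _
    rw [le_div_iff₀ hm0, mul_comm]
    refine pigeon h₁.ht (e := e₂) hG1m hWc ((hG1G.trans hGW).trans hWc) (fun x hx => g₂ x (hG1G hx)) fun x₂ s₂ hs₂ => ?_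
    set G2 := {x ∈ G1 | RelS t r ε (2 * ℓ) e₂ s₂ x x₂} with hG2
    have hG2m : MeasurableSet G2 := hG1m.inter (rm _ _ _)
    have hG2G : G2 ⊆ G1 := sep_subset _ _
    rw [le_div_iff₀ hm0, mul_comm]
    refine pigeon h₁.ht (e := e₃) hG2m hWc (((hG2G.trans hG1G).trans hGW).trans hWc) (fun x hx => g₃ x (hG1G (hG2G hx))) fun x₃ s₃ hs₃ => ?_
    refine vol_small hD0 fun x hx z hz => ?_
    exact three_circle hs₁ hs₂ hs₃ hr0 hεr hκ (by linarith) n₁ n₂ n₃ hdet hx.1.1.2 hx.1.2 hx.2 hz.1.1.2 hz.1.2 hz.2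
  have hV4 : V ≤ 4 * ρ ^ 2 := by rw [hV, ← nu_real hWc]; exact nu_real_le h₁.ρ0.le W
  have k3 : m ^ 3 * volume.real G ≤ 32 * D ^ 2 * V ^ 3 := by
    have := mul_le_mul_of_nonneg_left key (sq_nonneg m)
    calc m ^ 3 * volume.real G = m ^ 2 * (m * volume.real G) := by ring
      _ ≤ _ := this
      _ = 32 * D ^ 2 * V ^ 3 := by field_simp; ring
  have k4 : 32 * D ^ 2 * V ^ 3 ≤ 32 * D ^ 2 * ((4 * ρ ^ 2) ^ 2 * V) := by
    have : V ^ 3 = V ^ 2 * V := by ring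
    rw [this]; gcongr
  have k5 : m ^ 3 * volume.real G ≤ m ^ 3 * (V / 4) := by
    rw [hm] at k3 ⊢
    linarith
  exact absurd (le_of_mul_le_mul_left k5 (by positivity)) (not_le.2 hGV)

end SM

namespace SM

/-- data of a cell -/
structure CellD (δ ρ : ℝ) (A : ℝ → ℝ → ℝ) (t : ℂ → ℝ) (c : ℂ) (s : ℝ) (f : ℂ → ℝ) (Ω : Set ℂ) (l : ℝ) : Prop where
  δ0 : 0 < δ
  δ1 : δ ≤ 1/8
  ρ0 : 0 < ρ
  ρ1 : ρ ≤ 1/4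
  hA : AP δ A
  ht : Measurable t
  t1 : ∀ x, 1 ≤ t x
  t2 : ∀ x, t x ≤ 2
  hf : Measurable f
  hf1 : ∀ y, |f y| ≤ 1
  hΩ : MeasurableSet Ω
  hΩc : Ω ⊆ closedBall c ρ
  hs : ∀ x ∈ Ω, t x ∈ Icc s (s + ρ)
  l0 : 0 < l
  l1 : l ≤ 1
  hl : ∀ x ∈ Ω, l ≤ FQ c f (fun _ => 1) A t x

lemma CellD.cell {δ ρ : ℝ} {A : ℝ → ℝ → ℝ} {t : ℂ → ℝ} {c : ℂ} {s : ℝ} {f : ℂ → ℝ} {Ω : Set ℂ} {l : ℝ} (h : CellD δ ρ A t c s f Ω l)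
    {L : ℝ} (hL : 1 ≤ L) {η : ℂ → ℝ} (hη : TW L η) : Cell L δ ρ η A t :=
  ⟨hL, h.δ0, h.δ1, h.ρ0, h.ρ1, hη, h.hA, h.ht, h.t1, h.t2⟩

def K1 : ℝ := 6 * CS * 256 + 230 * 51200000000 + 1382400 * 96 * 256 * 4

lemma W2_para {ρ σ δ ℓ l : ℝ} (hρ : 0 < ρ) (hσ : 0 < σ) (hσ1 : σ ≤ 1) (hδ : δ = ρ * σ ^ 100) (hℓ : 0 < ℓ) (hl : 0 < l) (hℓl : ℓ ≤ l) :
    6 * CS * (16 / ℓ) ^ 2 * (ρ * σ ^ 2) + k1 δ (ρ * σ ^ 2) * (51200000000 * ρ ^ 2 * σ ^ 52 / l ^ 2) + k2 (16 / ℓ) δ (ρ * σ ^ 2) (ρ * σ ^ 78) * (4 * ρ ^ 2) 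
      ≤ K1 / ℓ ^ 2 * (ρ * σ) := by
  have hC := CS_nonneg
  have s2 : σ ^ 2 ≤ σ := by nlinarith only [hσ, hσ1]
  have s4 : σ ^ 4 ≤ σ := by
    calc σ ^ 4 = σ ^ 2 * σ ^ 2 := by ring
      _ ≤ 1 * σ := mul_le_mul (pow_le_one₀ hσ.le hσ1) s2 (by positivity) (by norm_num)
      _ = σ := one_mul _
  have a1 : 6 * CS * (16 / ℓ) ^ 2 * (ρ * σ ^ 2) ≤ 6 * CS * 256 / ℓ ^ 2 * (ρ * σ) := by
    calc 6 * CS * (16 / ℓ) ^ 2 * (ρ * σ ^ 2) = 6 * CS * 256 / ℓ ^ 2 * (ρ * σ ^ 2) := by ring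
      _ ≤ _ := by gcongr
  have hk1 : k1 δ (ρ * σ ^ 2) ≤ 230 / (ρ * σ ^ 51) := by
    unfold k1
    rw [div_le_div_iff₀ (by rw [hδ]; positivity) (by positivity)]
    have : ρ * σ ^ 51 / 2 ≤ √(δ * (ρ * σ ^ 2 / 2)) := by
      apply Real.le_sqrt_of_sq_le
      rw [hδ]
      have : 0 ≤ ρ ^ 2 * σ ^ 102 := by positivity
      nlinarith only [this]
    linarith
  have a2 : k1 δ (ρ * σ ^ 2) * (51200000000 * ρ ^ 2 * σ ^ 52 / l ^ 2) ≤ 230 * 51200000000 / ℓ ^ 2 * (ρ * σ) := by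
    calc k1 δ (ρ * σ ^ 2) * (51200000000 * ρ ^ 2 * σ ^ 52 / l ^ 2) ≤ 230 / (ρ * σ ^ 51) * (51200000000 * ρ ^ 2 * σ ^ 52 / ℓ ^ 2) := by gcongr
      _ = _ := by field_simp
  have hq : √(ρ * σ ^ 2 * (ρ * σ ^ 78) ^ 5) = ρ ^ 3 * σ ^ 196 := by
    rw [show ρ * σ ^ 2 * (ρ * σ ^ 78) ^ 5 = (ρ ^ 3 * σ ^ 196) ^ 2 by ring, Real.sqrt_sq (by positivity)]
  have a3 : k2 (16 / ℓ) δ (ρ * σ ^ 2) (ρ * σ ^ 78) * (4 * ρ ^ 2) ≤ 1382400 * 96 * 256 * 4 / ℓ ^ 2 * (ρ * σ) := by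
    unfold k2
    rw [hq, hδ]
    calc 1382400 * 96 * (16 / ℓ) ^ 2 * (ρ * σ ^ 100) ^ 2 / (ρ ^ 3 * σ ^ 196) * (4 * ρ ^ 2) = 1382400 * 96 * 256 * 4 / ℓ ^ 2 * (ρ * σ ^ 4) := by field_simp; ring
      _ ≤ _ := by gcongr
  calc _ ≤ 6 * CS * 256 / ℓ ^ 2 * (ρ * σ) + 230 * 51200000000 / ℓ ^ 2 * (ρ * σ) + 1382400 * 96 * 256 * 4 / ℓ ^ 2 * (ρ * σ) := add_le_add (add_le_add a1 a2) a3
    _ = _ := by unfold K1; ring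

section
variable {δ ρ : ℝ} {A : ℝ → ℝ → ℝ} {t : ℂ → ℝ} {c : ℂ} {s : ℝ} {f : ℂ → ℝ} {Ω : Set ℂ} {l : ℝ}

lemma CellD.W1 (h : CellD δ ρ A t c s f Ω l) (hδρ : δ ≤ ρ) : l ^ 2 * volume.real Ω ≤ (∫ y in closedBall c 4, f y ^ 2) * (2 * CS * ρ) := by
  have := (h.cell le_rfl (TW.one zero_le_one)).w1 h.hΩ h.hΩc hδρ h.hs h.hf h.hf1 h.l0.le h.hl
  linarith

lemma CellD.triple (h : CellD δ ρ A t c s f Ω l) {σ ℓ : ℝ} {M : ℕ} (hσ : 0 < σ) (hσ1 : σ ≤ ℓ / 2) (hδσ : δ = ρ * σ ^ 100) (hℓ : ℓ = l ^ 3 / 10 ^ 16)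
    {q₁ q₂ q₃ : ℕ × ℕ} (h₁₂ : l / 2000 < ‖zQ ℓ M q₁ - zQ ℓ M q₂‖) (h₁₃ : l / 2000 < ‖zQ ℓ M q₁ - zQ ℓ M q₃‖) (h₂₃ : l / 2000 < ‖zQ ℓ M q₂ - zQ ℓ M q₃‖)
    {W : Set ℂ} (hW : MeasurableSet W) (hWΩ : W ⊆ Ω) {l' : ℝ} (hl' : 0 < l') (f₁ : ∀ x ∈ W, l' ≤ FQ c f (eQ ℓ M q₁) A t x) (f₂ : ∀ x ∈ W, l' ≤ FQ c f (eQ ℓ M q₂) A t x) 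
    (f₃ : ∀ x ∈ W, l' ≤ FQ c f (eQ ℓ M q₃) A t x) :
    l' ^ 2 * volume.real W ≤ 4 * ((∫ y in closedBall c 4, f y ^ 2) * (K1 / ℓ ^ 2 * (ρ * σ))) := by
  have hl0 := h.l0
  have hl1 := h.l1
  have hl3 : l ^ 3 ≤ l := by
    have := pow_le_one₀ (n := 2) hl0.le hl1
    nlinarith only [this, hl0]
  have hℓ0 : 0 < ℓ := by rw [hℓ]; positivity
  have hℓl : ℓ ≤ l / 10 ^ 16 := by rw [hℓ]; gcongr
  have hρ := h.ρ0
  have hρ1 := h.ρ1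
  have hσ2 : σ ≤ 1 / 4 := by linarith
  have hintg : 0 ≤ ∫ y in closedBall c 4, f y ^ 2 := integral_nonneg fun _ => sq_nonneg _
  have hK : 0 ≤ K1 := by unfold K1; have := CS_nonneg; positivity
  rcases W.eq_empty_or_nonempty with rfl | ⟨x, hx⟩
  · simp; positivity
  have c1 : 1 ≤ 16 / ℓ := by rw [le_div_iff₀ hℓ0]; linarith
  have hδℓ : δ ≤ ℓ := by
    rw [hδσ]
    calc ρ * σ ^ 100 ≤ 1 * σ := mul_le_mul (by linarith) (pow_le_of_le_one hσ.le (by linarith) (by norm_num)) (by positivity) (by norm_num)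
      _ ≤ ℓ := by linarith
  have z₁ := FQ_ne hℓ0 h.hA h.t1 h.t2 (hl'.trans_le (f₁ x hx)).ne'
  have z₂ := FQ_ne hℓ0 h.hA h.t1 h.t2 (hl'.trans_le (f₂ x hx)).ne'
  have z₃ := FQ_ne hℓ0 h.hA h.t1 h.t2 (hl'.trans_le (f₃ x hx)).ne'
  have htx1 := h.t1 x
  have htx2 := h.t2 x
  have rng : ∀ z : ℂ, |‖z‖ - t x| ≤ δ + 2 * ℓ → 1/2 ≤ ‖z‖ ∧ ‖z‖ ≤ 5/2 := by
    intro z hz; rw [abs_le] at hz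
    constructor <;> linarith [hz.1, hz.2]
  have dif : ∀ z w : ℂ, |‖z‖ - t x| ≤ δ + 2 * ℓ → |‖w‖ - t x| ≤ δ + 2 * ℓ → |‖z‖ - ‖w‖| ≤ 6 * ℓ := by
    intro z w hz hw; rw [abs_le] at *
    constructor <;> linarith [hz.1, hz.2, hw.1, hw.2]
  have d₁₂ := dir_sep h₁₂ (rng _ z₁).1 (rng _ z₂).1 (rng _ z₂).2 (dif _ _ z₁ z₂) (by linarith)
  have d₁₃ := dir_sep h₁₃ (rng _ z₁).1 (rng _ z₃).1 (rng _ z₃).2 (dif _ _ z₁ z₃) (by linarith)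
  have d₂₃ := dir_sep h₂₃ (rng _ z₂).1 (rng _ z₃).1 (rng _ z₃).2 (dif _ _ z₂ z₃) (by linarith)
  have hσp : ∀ n : ℕ, 1 ≤ n → σ ^ n ≤ 1 / 4 := fun n hn => (pow_le_of_le_one hσ.le (by linarith) (by omega)).trans hσ2
  refine (W2core (ℓ := 5 * ℓ) (r := ρ * σ ^ 2) (ε := ρ * σ ^ 78) (κ := (l / 20000) ^ 3) (m := 51200000000 * ρ ^ 2 * σ ^ 52 / l ^ 2)
    (h.cell c1 (eQ_TW hℓ0 M q₁)) (h.cell c1 (eQ_TW hℓ0 M q₂)) (h.cell c1 (eQ_TW hℓ0 M q₃)) 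
    (eQ_dir hℓ0 (by linarith) q₁) (eQ_dir hℓ0 (by linarith) q₂) (eQ_dir hℓ0 (by linarith) q₃) (by positivity) ?_ ?_ ?_ (unit_dir (rng _ z₁).1) (unit_dir (rng _ z₂).1) (unit_dir (rng _ z₃).1)
    (by positivity) ?_ ?_ hW (hWΩ.trans h.hΩc) (by positivity) ?_ (fun x hx => h.hs x (hWΩ hx)) h.hf h.hf1 hl'.le f₁ f₂ f₃).trans ?_
  · rw [hδσ]
    calc 4 * (ρ * σ ^ 100) = ρ * σ ^ 78 * (4 * σ ^ 22) := by ring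
      _ ≤ ρ * σ ^ 78 * 1 := by gcongr; linarith [hσp 22 (by norm_num)]
      _ = _ := mul_one _
  · calc 2 * (ρ * σ ^ 78) = ρ * σ ^ 2 * (2 * σ ^ 76) := by ring
      _ ≤ ρ * σ ^ 2 * 1 := by gcongr; linarith [hσp 76 (by norm_num)]
      _ = _ := mul_one _
  · calc 16 * (ρ * σ ^ 78) = ρ * σ ^ 2 * (16 * (σ ^ 74 * σ ^ 2)) := by ring
      _ ≤ ρ * σ ^ 2 * (16 * (1 / 4 * (ℓ / 2) ^ 2)) := by gcongr; exact hσp 74 (by norm_num)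
      _ ≤ (5 * ℓ) ^ 2 * (ρ * σ ^ 2) := by
        have : 0 ≤ ρ * σ ^ 2 * ℓ ^ 2 := by positivity
        linarith
  · rw [hℓ]
    have : 0 < l ^ 3 := by positivity
    linarith
  · have e : l / 2000 / 5 = 2 * (l / 20000) := by ring
    rw [e] at d₁₂ d₁₃ d₂₃
    have b0 : 0 ≤ 2 * (l / 20000) := by positivity
    calc 2 * (l / 20000) ^ 3 ≤ (2 * (l / 20000)) * (2 * (l / 20000)) * (2 * (l / 20000)) := by
          have : 0 < (l / 20000) ^ 3 := by positivity
          linarith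
      _ ≤ _ := by gcongr
  · field_simp; ring
  · gcongr
    exact W2_para hρ hσ (by linarith) hδσ hℓ0 hl0 (by linarith)

def K2 : ℝ := (14 ^ 2) ^ 3 * (4 * 392 ^ 2 * K1) + 4 * CS

lemma CellD.W2' (h : CellD δ ρ A t c s f Ω l) {σ ℓ : ℝ} (hσ : 0 < σ) (hσ1 : σ ≤ 1) (hδσ : δ = ρ * σ ^ 100) (hℓ : ℓ = l ^ 3 / 10 ^ 16) :
    l ^ 2 * ℓ ^ 12 * volume.real Ω ≤ K2 * ((∫ y in closedBall c 4, f y ^ 2) * (ρ * σ)) := by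
  have hl0 := h.l0
  have hl1 := h.l1
  have hl3 : l ^ 3 ≤ l := by
    have := pow_le_one₀ (n := 2) hl0.le hl1
    nlinarith only [this, hl0]
  have hℓ0 : 0 < ℓ := by rw [hℓ]; positivity
  have hℓl : ℓ ≤ l / 10 ^ 16 := by rw [hℓ]; gcongr
  have hρ := h.ρ0
  have hC := CS_nonneg
  have hintg : 0 ≤ ∫ y in closedBall c 4, f y ^ 2 := integral_nonneg fun _ => sq_nonneg _
  have hK : 0 ≤ K1 := by unfold K1; have := CS_nonneg; positivity
  rcases lt_or_ge (ℓ / 2) σ with hc | hc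
  · have hδρ : δ ≤ ρ := by
      rw [hδσ]; exact mul_le_of_le_one_right hρ.le (pow_le_one₀ hσ.le hσ1)
    have h1 := h.W1 hδρ
    have h2 : ℓ ^ 12 ≤ 2 * σ := (pow_le_of_le_one hℓ0.le (by linarith) (by norm_num)).trans (by linarith)
    set Φ := ∫ y in closedBall c 4, f y ^ 2
    calc l ^ 2 * ℓ ^ 12 * volume.real Ω = ℓ ^ 12 * (l ^ 2 * volume.real Ω) := by ring
      _ ≤ (2 * σ) * (Φ * (2 * CS * ρ)) := mul_le_mul h2 h1 (by positivity) (by positivity)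
      _ = 4 * CS * (Φ * (ρ * σ)) := by ring
      _ ≤ K2 * (Φ * (ρ * σ)) := by
        refine mul_le_mul_of_nonneg_right ?_ (by positivity)
        unfold K2
        have : 0 ≤ ((14:ℝ) ^ 2) ^ 3 * (4 * 392 ^ 2 * K1) := by positivity
        linarith
  · let M := ⌈5 / ℓ⌉₊
    have hM : 5 ≤ ℓ * M := by
      have := Nat.le_ceil (5 / ℓ)
      rw [div_le_iff₀ hℓ0] at this
      linarith
    have hM2 : (M : ℝ) ≤ 5 / ℓ + 1 := (Nat.ceil_lt_add_one (by positivity)).le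
    have hiℓ : 1 ≤ 1 / ℓ := by rw [le_div_iff₀ hℓ0]; linarith
    have hcard : ((IQ M).card : ℝ) ≤ (14 / ℓ) ^ 2 := by
      rw [IQ_card]; push_cast
      refine pow_le_pow_left₀ (by positivity) ?_ 2
      have : 14 / ℓ = 2 * (5 / ℓ) + 4 * (1 / ℓ) := by ring
      rw [this]; linarith
    set N := (14 / ℓ) ^ 2 with hN
    set l' := l / (2 * N) with hl'
    have hl'0 : 0 < l' := by positivity
    let z := zQ ℓ M
    let WT : (ℕ × ℕ) × (ℕ × ℕ) × (ℕ × ℕ) → Set ℂ := fun T => {x ∈ Ω | l' ≤ FQ c f (eQ ℓ M T.1) A t x ∧ l' ≤ FQ c f (eQ ℓ M T.2.1) A t x ∧ l' ≤ FQ c f (eQ ℓ M T.2.2) A t x}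
    have Fm : ∀ q, Measurable (FQ c f (eQ ℓ M q) A t) := fun q => FQ_meas (eQ_TW hℓ0 M q) h.hA h.ht h.t1 h.t2 h.hf
    have WTm : ∀ T, MeasurableSet (WT T) := fun T => h.hΩ.inter ((measurableSet_le measurable_const (Fm _)).inter ((measurableSet_le measurable_const (Fm _)).inter (measurableSet_le measurable_const (Fm _))))
    set Φ := ∫ y in closedBall c 4, f y ^ 2 with hΦ
    let I3 := (IQ M ×ˢ IQ M ×ˢ IQ M).filter (fun T => l / 2000 < ‖z T.1 - z T.2.1‖ ∧ l / 2000 < ‖z T.1 - z T.2.2‖ ∧ l / 2000 < ‖z T.2.1 - z T.2.2‖)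
    have hcov : Ω ⊆ ⋃ T ∈ I3, WT T := by
      intro x hx
      have hxc : ‖x - c‖ ≤ 1 := by
        have := h.hΩc hx
        rw [mem_closedBall, dist_eq_norm] at this
        linarith [h.ρ1]
      obtain ⟨q₁, i₁, q₂, i₂, q₃, i₃, a, b, d, g₁, g₂, g₃⟩ := select3 (I := IQ M) (F := fun q => FQ c f (eQ ℓ M q) A t x) (z := z) (d := l / 2000) hl0 hcard
        (by rw [FQ_all hℓ0 hM h.hA h.ht h.t1 h.t2 h.hf h.hf1 hxc]; exact h.hl x hx)
        (fun z0 T hT hTd => (FQ_near hℓ0 hM h.δ0 h.δ1 h.hA h.ht h.t1 h.t2 h.hf h.hf1 hxc hT (by positivity) (by linarith) hTd).trans (by linarith))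
      refine mem_biUnion (x := (q₁, q₂, q₃)) ?_ ⟨hx, g₁, g₂, g₃⟩
      simp only [I3, Finset.coe_filter, Finset.mem_product, Set.mem_ofPred_eq]
      exact ⟨⟨i₁, i₂, i₃⟩, a, b, d⟩
    set X := 4 * (Φ * (K1 / ℓ ^ 2 * (ρ * σ))) with hX
    have hX0 : 0 ≤ X := by positivity
    have hT : ∀ T ∈ I3, volume.real (WT T) ≤ X / l' ^ 2 := by
      intro T hT
      rw [Finset.mem_filter] at hT
      rw [le_div_iff₀ (by positivity), mul_comm]
      exact h.triple hσ hc hδσ hℓ hT.2.1 hT.2.2.1 hT.2.2.2 (WTm T) (sep_subset _ _) hl'0 (fun x hx => hx.2.1) (fun x hx => hx.2.2.1) (fun x hx => hx.2.2.2)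
    have hΩfin : volume Ω ≠ ∞ := ((measure_mono h.hΩc).trans_lt measure_closedBall_lt_top).ne
    have hfin : volume (⋃ T ∈ I3, WT T) ≠ ∞ := ((measure_mono (iUnion₂_subset fun T _ => sep_subset _ _)).trans_lt hΩfin.lt_top).ne
    have hcard3 : (I3.card : ℝ) ≤ N ^ 3 := by
      have : I3.card ≤ (IQ M).card ^ 3 := by
        refine (Finset.card_filter_le _ _).trans ?_
        rw [Finset.card_product, Finset.card_product]
        exact (by ring : _ = _).le
      calc (I3.card : ℝ) ≤ ((IQ M).card : ℝ) ^ 3 := by exact_mod_cast this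
        _ ≤ _ := by gcongr
    have hv : volume.real Ω ≤ N ^ 3 * (X / l' ^ 2) := 
      calc volume.real Ω ≤ volume.real (⋃ T ∈ I3, WT T) := measureReal_mono hcov hfin
        _ ≤ ∑ T ∈ I3, volume.real (WT T) := measureReal_biUnion_finset_le _ _
        _ ≤ ∑ T ∈ I3, X / l' ^ 2 := Finset.sum_le_sum hT
        _ = I3.card * (X / l' ^ 2) := by rw [Finset.sum_const, nsmul_eq_mul]
        _ ≤ _ := by gcongr
    calc l ^ 2 * ℓ ^ 12 * volume.real Ω ≤ l ^ 2 * ℓ ^ 12 * (N ^ 3 * (X / l' ^ 2)) := by gcongr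
      _ = (14 ^ 2) ^ 3 * (4 * 392 ^ 2 * K1) * (Φ * (ρ * σ)) := by
        rw [hX, hl', hN]; field_simp; ring
      _ ≤ K2 * (Φ * (ρ * σ)) := by
        refine mul_le_mul_of_nonneg_right ?_ (by positivity)
        unfold K2
        linarith

end

end SM

namespace SM

def FS (c : ℂ) (f : ℂ → ℝ) (A : ℝ → ℝ → ℝ) (τ : ℝ) (x : ℂ) : ℝ := ∫ y in closedBall c 4, f y * A τ ‖y - x‖

lemma FS_cont (c : ℂ) {f : ℂ → ℝ} (hf : Continuous f) {A : ℝ → ℝ → ℝ} (hA : Continuous (Function.uncurry A)) :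
    Continuous (fun p : ℝ × ℂ => FS c f A p.1 p.2) := by
  unfold FS
  refine continuous_parametric_integral_of_continuous (f := fun (p : ℝ × ℂ) (y : ℂ) => f y * A p.1 ‖y - p.2‖) ?_ (isCompact_closedBall c 4)
  have h1 : Continuous (fun q : (ℝ × ℂ) × ℂ => A q.1.1 ‖q.2 - q.1.2‖) :=
    hA.comp (f := fun q : (ℝ × ℂ) × ℂ => (q.1.1, ‖q.2 - q.1.2‖)) (by fun_prop)
  exact (hf.comp continuous_snd).mul h1

/-- measurable choice of the time -/
lemma time_sel {F : ℝ × ℂ → ℝ} (hF : Continuous F) {a b : ℝ} (hab : a ≤ b) (l : ℝ) :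
    ∃ t : ℂ → ℝ, Measurable t ∧ (∀ x, t x ∈ Icc a b) ∧ ∀ x, (∃ τ ∈ Icc a b, l < F (τ, x)) → l < F (t x, x) := by
  classical
  haveI : Nonempty (Icc a b) := ⟨⟨a, left_mem_Icc.2 hab⟩⟩
  let q : ℕ → Icc a b := TopologicalSpace.denseSeq (Icc a b)
  let P : ℂ → ℕ → Prop := fun x N => l < F (q N, x) ∨ ∀ M, ¬ l < F (q M, x)
  have hP : ∀ x, ∃ N, P x N := by
    intro x
    by_cases h : ∃ N, l < F (q N, x)
    · obtain ⟨N, hN⟩ := h; exact ⟨N, Or.inl hN⟩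
    · push Not at h; exact ⟨0, Or.inr fun M => not_lt.2 (h M)⟩
  have hm0 : ∀ N, MeasurableSet {x | l < F (q N, x)} := fun N =>
    (isOpen_lt continuous_const (hF.comp (Continuous.prodMk continuous_const continuous_id))).measurableSet
  have hm : ∀ N, MeasurableSet {x | P x N} := by
    intro N
    refine (hm0 N).union ?_
    have : {x | ∀ M, ¬ l < F (q M, x)} = ⋂ M, {x | l < F (q M, x)}ᶜ := by ext x; simp
    show MeasurableSet {x | ∀ M, ¬ l < F (q M, x)}
    rw [this]
    exact MeasurableSet.iInter fun M => (hm0 M).compl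
  refine ⟨fun x => q (Nat.find (hP x)), ?_, fun x => (q _).2, ?_⟩
  · have := measurable_find hP hm
    exact (measurable_from_nat (f := fun n => (q n : ℝ))).comp this
  · rintro x ⟨τ, hτ, hl⟩
    have ho : IsOpen {τ : Icc a b | l < F (τ, x)} := 
      isOpen_lt continuous_const (hF.comp (Continuous.prodMk continuous_subtype_val continuous_const))
    obtain ⟨N, hN⟩ := (TopologicalSpace.denseRange_denseSeq (Icc a b)).exists_mem_open ho ⟨⟨τ, hτ⟩, hl⟩
    rcases Nat.find_spec (hP x) with h | h
    · exact h
    · exact absurd hN (h N)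

def OmS (c : ℂ) (ρ : ℝ) (f : ℂ → ℝ) (A : ℝ → ℝ → ℝ) (J : Set ℝ) (l : ℝ) : Set ℂ := {x ∈ closedBall c ρ | ∃ τ ∈ J, l < FS c f A τ x}

lemma OmS_meas (c : ℂ) (ρ : ℝ) {f : ℂ → ℝ} (hf : Continuous f) {A : ℝ → ℝ → ℝ} (hA : Continuous (Function.uncurry A)) (J : Set ℝ) (l : ℝ) :
    MeasurableSet (OmS c ρ f A J l) := by
  have : OmS c ρ f A J l = closedBall c ρ ∩ ⋃ τ ∈ J, {x | l < FS c f A τ x} := by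
    ext x; simp [OmS]
  rw [this]
  refine measurableSet_closedBall.inter (IsOpen.measurableSet ?_)
  refine isOpen_biUnion fun τ _ => isOpen_lt continuous_const ((FS_cont c hf hA).comp (Continuous.prodMk continuous_const continuous_id))

lemma FQ_one (c : ℂ) (f : ℂ → ℝ) (A : ℝ → ℝ → ℝ) (t : ℂ → ℝ) (x : ℂ) : FQ c f (fun _ => 1) A t x = FS c f A (t x) x := by
  simp [FQ, FS, Gk]

section
variable {δ ρ : ℝ} {A : ℝ → ℝ → ℝ} {c : ℂ} {f : ℂ → ℝ} {l : ℝ}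

def ann (c : ℂ) (s ρ : ℝ) : Set ℂ := {y | |‖y - c‖ - s| ≤ 3 * ρ}

lemma ann_meas (c : ℂ) (s ρ : ℝ) : MeasurableSet (ann c s ρ) := 
  (isClosed_le (f := fun y : ℂ => |‖y - c‖ - s|) (by fun_prop) continuous_const).measurableSet

lemma cellD_of (δ0 : 0 < δ) (δ1 : δ ≤ 1/8) (ρ0 : 0 < ρ) (ρ1 : ρ ≤ 1/4) (hδρ : δ ≤ ρ) (hA : AP δ A) (hf : Continuous f) (hf1 : ∀ y, |f y| ≤ 1)
    (l0 : 0 < l) (l1 : l ≤ 1) {s : ℝ} (hs1 : 1 ≤ s) (hs2 : s ≤ 2) :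
    ∃ t, CellD δ ρ A t c s ((ann c s ρ).indicator f) (OmS c ρ f A (Icc s (min (s+ρ) 2)) l) l := by
  have hab : s ≤ min (s + ρ) 2 := le_min (by linarith) hs2
  obtain ⟨t, ht, htJ, hl⟩ := time_sel (FS_cont c hf hA.cont) hab l
  refine ⟨t, δ0, δ1, ρ0, ρ1, hA, ht, fun x => hs1.trans (htJ x).1, fun x => (htJ x).2.trans (min_le_right _ _), 
    hf.measurable.indicator (ann_meas _ _ _), ?_, OmS_meas _ _ hf hA.cont _ _, fun x hx => hx.1, fun x _ => ⟨(htJ x).1, (htJ x).2.trans (min_le_left _ _)⟩, l0, l1, ?_⟩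
  · intro y
    classical
    rw [indicator_apply]
    split_ifs
    · exact hf1 y
    · simp
  · rintro x ⟨hx, hxt⟩
    rw [FQ_one]
    have := hl x hxt
    refine this.le.trans (le_of_eq ?_)
    unfold FS
    congr 1; ext y
    by_cases hy : y ∈ ann c s ρ
    · rw [indicator_of_mem hy]
    · rw [indicator_of_notMem hy, zero_mul]
      have hz : A (t x) ‖y - x‖ = 0 := by
        by_contra hne
        have h1 := (hA.prof (t x) (hs1.trans (htJ x).1) ((htJ x).2.trans (min_le_right _ _))).supp _ hne
        apply hy
        have h2 := (htJ x).1
        have h3 := (htJ x).2.trans (min_le_left _ _)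
        rw [mem_closedBall, dist_eq_norm] at hx
        have h4 := norm_sub_norm_le (y - c) (y - x)
        have h5 := norm_sub_norm_le (y - x) (y - c)
        rw [show y - c - (y - x) = x - c by ring] at h4
        rw [show y - x - (y - c) = -(x - c) by ring, norm_neg] at h5
        rw [abs_le] at h1
        simp only [ann, Set.mem_ofPred_eq, abs_le]
        constructor <;> linarith
      simp [hz]

/-- sum over time intervals -/
lemma sum_ann (ρ0 : 0 < ρ) (ρ1 : ρ ≤ 1/4) (hf : Continuous f) (N : ℕ) :
    ∑ n ∈ Finset.range N, ∫ y in closedBall c 4, ((ann c (1 + n * ρ) ρ).indicator f y) ^ 2 ≤ 7 * ∫ y in closedBall c 4, f y ^ 2 := by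
  classical
  have hi : IntegrableOn (fun y => f y ^ 2) (closedBall c 4) := (hf.pow 2).continuousOn.integrableOn_compact (isCompact_closedBall c 4)
  have hi2 : ∀ n : ℕ, IntegrableOn (fun y => ((ann c (1 + n * ρ) ρ).indicator f y) ^ 2) (closedBall c 4) := by
    intro n
    have := hi.indicator (ann_meas c (1 + n * ρ) ρ)
    refine this.congr (Filter.Eventually.of_forall fun y => ?_)
    simp only [indicator_apply]
    split_ifs <;> simp
  rw [← integral_finsetSum _ fun n _ => hi2 n, ← integral_const_mul]
  refine integral_mono (integrable_finset_sum _ fun n _ => hi2 n) (hi.const_mul 7) fun y => ?_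
  simp only
  have e : ∀ n : ℕ, (ann c (1 + n * ρ) ρ).indicator f y ^ 2 = if y ∈ ann c (1 + n * ρ) ρ then f y ^ 2 else 0 := by
    intro n; simp only [indicator_apply]; split_ifs <;> simp
  simp_rw [e]
  rw [← Finset.sum_filter, Finset.sum_const, nsmul_eq_mul]
  refine mul_le_mul_of_nonneg_right ?_ (sq_nonneg _)
  set v : ℝ := (‖y - c‖ - 1) / ρ with hv
  have hsub : ((Finset.range N).filter fun n : ℕ => y ∈ ann c (1 + n * ρ) ρ).map Nat.castEmbedding ⊆ Finset.Icc (⌈v - 3⌉) (⌊v + 3⌋) := by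
    intro m hm
    obtain ⟨n, hn', rfl⟩ := Finset.mem_map.1 hm
    have hn : |‖y - c‖ - (1 + n * ρ)| ≤ 3 * ρ := (Finset.mem_filter.1 hn').2
    rw [abs_le] at hn
    rw [Nat.castEmbedding_apply]
    have h1 : v * ρ = ‖y - c‖ - 1 := by rw [hv]; field_simp
    rw [Finset.mem_Icc, Int.ceil_le, Int.le_floor]
    push_cast
    constructor
    · nlinarith only [h1, hn.1, hn.2, ρ0]
    · nlinarith only [h1, hn.1, hn.2, ρ0]
  have hc := Finset.card_le_card hsub
  rw [Finset.card_map, Int.card_Icc] at hc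
  have h6 : ⌊v + 3⌋ + 1 - ⌈v - 3⌉ ≤ 7 := by
    have : ((⌊v + 3⌋ : ℤ) : ℝ) + 1 - ⌈v - 3⌉ ≤ 7 := by linarith [Int.floor_le (v + 3), Int.le_ceil (v - 3)]
    exact_mod_cast this
  have : Finset.card ((Finset.range N).filter fun n : ℕ => y ∈ ann c (1 + n * ρ) ρ) ≤ 7 := by omega
  exact_mod_cast this

lemma OmS_cover (ρ0 : 0 < ρ) {N : ℕ} (hN : 1 ≤ N * ρ) :
    OmS c ρ f A (Icc 1 2) l ⊆ ⋃ n ∈ (Finset.range (N + 1)).filter (fun n : ℕ => 1 + n * ρ ≤ 2), OmS c ρ f A (Icc (1 + n * ρ) (min (1 + n * ρ + ρ) 2)) l := by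
  rintro x ⟨hx, τ, hτ, hl⟩
  have h0 : 0 ≤ (τ - 1) / ρ := div_nonneg (by linarith [hτ.1]) ρ0.le
  have h1 := Nat.floor_le h0
  have h2 := Nat.lt_floor_add_one ((τ - 1) / ρ)
  rw [le_div_iff₀ ρ0] at h1
  rw [div_lt_iff₀ ρ0] at h2
  have hτ2 := hτ.2
  simp only [mem_iUnion, Finset.mem_filter, Finset.mem_range]
  refine ⟨⌊(τ - 1) / ρ⌋₊, ⟨?_, by linarith⟩, hx, τ, ⟨by linarith, le_min (by linarith) hτ2⟩, hl⟩
  rw [Nat.lt_succ_iff]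
  refine Nat.floor_le_of_le ?_
  rw [div_le_iff₀ ρ0]; linarith

lemma OmS_sum (δ0 : 0 < δ) (δ1 : δ ≤ 1/8) (ρ0 : 0 < ρ) (ρ1 : ρ ≤ 1/4) (hδρ : δ ≤ ρ) (hA : AP δ A) (hf : Continuous f) (hf1 : ∀ y, |f y| ≤ 1)
    (l0 : 0 < l) (l1 : l ≤ 1) {K : ℝ} (hK : 0 ≤ K) (h : ∀ (t : ℂ → ℝ) (s : ℝ) (g : ℂ → ℝ) (Ω : Set ℂ), CellD δ ρ A t c s g Ω l → volume.real Ω ≤ K * ∫ y in closedBall c 4, g y ^ 2) :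
    volume.real (OmS c ρ f A (Icc 1 2) l) ≤ 7 * K * ∫ y in closedBall c 4, f y ^ 2 := by
  obtain ⟨N, hN⟩ := exists_nat_ge (1 / ρ)
  rw [div_le_iff₀ ρ0] at hN
  have hfin : volume (⋃ n ∈ (Finset.range (N + 1)).filter (fun n : ℕ => 1 + n * ρ ≤ 2), OmS c ρ f A (Icc (1 + n * ρ) (min (1 + n * ρ + ρ) 2)) l) ≠ ⊤ := by
    refine ((measure_mono (t := closedBall c ρ) ?_).trans_lt measure_closedBall_lt_top).ne
    exact iUnion₂_subset fun n _ x hx => hx.1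
  calc volume.real (OmS c ρ f A (Icc 1 2) l) ≤ _ := measureReal_mono (OmS_cover ρ0 hN) hfin
    _ ≤ ∑ n ∈ (Finset.range (N + 1)).filter (fun n : ℕ => 1 + n * ρ ≤ 2), volume.real (OmS c ρ f A (Icc (1 + n * ρ) (min (1 + n * ρ + ρ) 2)) l) := measureReal_biUnion_finset_le _ _
    _ ≤ ∑ n ∈ (Finset.range (N + 1)).filter (fun n : ℕ => 1 + n * ρ ≤ 2), K * ∫ y in closedBall c 4, ((ann c (1 + n * ρ) ρ).indicator f y) ^ 2 := by
        refine Finset.sum_le_sum fun n hn => ?_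
        have h2 := (Finset.mem_filter.1 hn).2
        obtain ⟨t, ht⟩ := cellD_of (c := c) δ0 δ1 ρ0 ρ1 hδρ hA hf hf1 l0 l1 (s := 1 + n * ρ) (le_add_of_nonneg_right (by positivity)) h2
        exact h _ _ _ _ ht
    _ ≤ ∑ n ∈ Finset.range (N + 1), K * ∫ y in closedBall c 4, ((ann c (1 + n * ρ) ρ).indicator f y) ^ 2 := by
        refine Finset.sum_le_sum_of_subset_of_nonneg (Finset.filter_subset _ _) fun n _ _ => mul_nonneg hK (integral_nonneg fun y => sq_nonneg _)
    _ = K * ∑ n ∈ Finset.range (N + 1), ∫ y in closedBall c 4, ((ann c (1 + n * ρ) ρ).indicator f y) ^ 2 := by rw [Finset.mul_sum]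
    _ ≤ K * (7 * ∫ y in closedBall c 4, f y ^ 2) := mul_le_mul_of_nonneg_left (sum_ann ρ0 ρ1 hf _) hK
    _ = _ := by ring

def KW : ℝ := max (2 * CS) (K2 * 10 ^ 192)

/-- interpolation between the two bounds -/
lemma CellD.W {t : ℂ → ℝ} {s : ℝ} {Ω : Set ℂ} (h : CellD δ ρ A t c s f Ω l) (hδρ : δ ≤ ρ) {η : ℝ} (η0 : 0 < η) (η1 : η ≤ 1) :
    volume.real Ω ≤ (KW * (l ^ (-2 - η) * ρ * (δ / ρ) ^ (η / 7200))) * ∫ y in closedBall c 4, f y ^ 2 := by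
  have hl0 := h.l0
  have hl1 := h.l1
  have hρ := h.ρ0
  have hδ := h.δ0
  set E := ∫ y in closedBall c 4, f y ^ 2 with hE
  have hE0 : 0 ≤ E := integral_nonneg fun y => sq_nonneg _
  have hr0 : 0 < δ / ρ := div_pos hδ hρ
  have hr1 : δ / ρ ≤ 1 := (div_le_one hρ).2 hδρ
  set σ : ℝ := (δ / ρ) ^ ((1:ℝ)/100) with hσ
  have hσ0 : 0 < σ := Real.rpow_pos_of_pos hr0 _
  have hσ1 : σ ≤ 1 := Real.rpow_le_one hr0.le hr1 (by norm_num)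
  have hσ100 : σ ^ 100 = δ / ρ := by
    rw [hσ, ← Real.rpow_natCast, ← Real.rpow_mul hr0.le]; norm_num
  have hση : (δ / ρ) ^ (η / 7200) = σ ^ (η / 72) := by
    rw [hσ, ← Real.rpow_mul hr0.le]; congr 1; ring
  rw [hση]
  have hll : l ^ (-2 - η) * (l ^ 2 * l ^ η) = 1 := by
    rw [← Real.rpow_natCast, ← Real.rpow_add hl0, ← Real.rpow_add hl0]
    norm_num
  have hlη : 0 < l ^ η := Real.rpow_pos_of_pos hl0 _
  have hlη1 : l ^ η ≤ 1 := Real.rpow_le_one hl0.le hl1 η0.le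
  have hση0 : 0 < σ ^ (η / 72) := Real.rpow_pos_of_pos hσ0 _
  have hm : 0 < l ^ (-2 - η) := Real.rpow_pos_of_pos hl0 _
  suffices hh : l ^ 2 * l ^ η * volume.real Ω ≤ KW * (ρ * σ ^ (η / 72)) * E by
    calc volume.real Ω = l ^ (-2 - η) * (l ^ 2 * l ^ η) * volume.real Ω := by rw [hll, one_mul]
      _ = l ^ (-2 - η) * (l ^ 2 * l ^ η * volume.real Ω) := by ring
      _ ≤ l ^ (-2 - η) * (KW * (ρ * σ ^ (η / 72)) * E) := mul_le_mul_of_nonneg_left hh hm.le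
      _ = _ := by ring
  have hV : 0 ≤ volume.real Ω := measureReal_nonneg
  have hKW : 0 ≤ KW := le_max_of_le_left (mul_nonneg two_pos.le CS_nonneg)
  rcases le_or_gt (l ^ 72) σ with hc | hc
  · have h1 := h.W1 hδρ
    have h2 : l ^ η ≤ σ ^ (η / 72) := by
      calc l ^ η = (l ^ 72) ^ (η / 72) := by
            rw [← Real.rpow_natCast, ← Real.rpow_mul hl0.le]; congr 1; push_cast; ring
        _ ≤ _ := Real.rpow_le_rpow (by positivity) hc (by positivity)
    calc l ^ 2 * l ^ η * volume.real Ω = l ^ η * (l ^ 2 * volume.real Ω) := by ring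
      _ ≤ σ ^ (η / 72) * (E * (2 * CS * ρ)) := mul_le_mul h2 h1 (by positivity) hση0.le
      _ = 2 * CS * (ρ * σ ^ (η / 72) * E) := by ring
      _ ≤ KW * (ρ * σ ^ (η / 72) * E) := mul_le_mul_of_nonneg_right (le_max_left _ _) (by positivity)
      _ = _ := by ring
  · have h1 := h.W2' hσ0 hσ1 (by rw [hσ100]; field_simp) rfl
    have h3 : σ ^ ((1:ℝ)/2) ≤ l ^ 36 := by
      calc σ ^ ((1:ℝ)/2) ≤ (l ^ 72) ^ ((1:ℝ)/2) := Real.rpow_le_rpow hσ0.le hc.le (by norm_num)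
        _ = l ^ 36 := by
            rw [← Real.rpow_natCast, ← Real.rpow_mul hl0.le, ← Real.rpow_natCast]; norm_num
    have h4 : σ ≤ l ^ 36 * σ ^ (η / 72) := by
      calc σ = σ ^ ((1:ℝ)/2) * σ ^ ((1:ℝ)/2) := by rw [← Real.rpow_add hσ0]; norm_num
        _ ≤ l ^ 36 * σ ^ (η / 72) := by
            refine mul_le_mul h3 ?_ (by positivity) (by positivity)
            exact Real.rpow_le_rpow_of_exponent_ge hσ0 hσ1 (by linarith)
    have hK2 : 0 ≤ K2 * (E * ρ * σ) := by
      refine le_trans ?_ (h1.trans (le_of_eq (by ring)))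
      positivity
    have h5 : l ^ 36 * (l ^ 2 * volume.real Ω) ≤ l ^ 36 * (KW * (ρ * σ ^ (η / 72)) * E) := by
      rcases lt_or_ge K2 0 with hneg | hpos
      · have : l ^ 36 * (l ^ 2 * volume.real Ω) = 10 ^ 192 * (l ^ 2 * (l ^ 3 / 10 ^ 16) ^ 12 * volume.real Ω) := by ring
        have h6 : K2 * (E * (ρ * σ)) ≤ 0 := mul_nonpos_of_nonpos_of_nonneg hneg.le (by positivity)
        rw [this]
        refine le_trans (by linarith [h1.trans h6]) (show (0:ℝ) ≤ _ by positivity)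
      · calc l ^ 36 * (l ^ 2 * volume.real Ω) = 10 ^ 192 * (l ^ 2 * (l ^ 3 / 10 ^ 16) ^ 12 * volume.real Ω) := by ring
          _ ≤ 10 ^ 192 * (K2 * (E * (ρ * σ))) := mul_le_mul_of_nonneg_left h1 (by positivity)
          _ = (K2 * 10 ^ 192) * (E * ρ * σ) := by ring
          _ ≤ KW * (E * ρ * (l ^ 36 * σ ^ (η / 72))) := by
              refine mul_le_mul (le_max_right _ _) (mul_le_mul_of_nonneg_left h4 (by positivity)) (by positivity) hKW
          _ = _ := by ring
    have h7 := le_of_mul_le_mul_left h5 (by positivity)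
    calc l ^ 2 * l ^ η * volume.real Ω = l ^ η * (l ^ 2 * volume.real Ω) := by ring
      _ ≤ 1 * (l ^ 2 * volume.real Ω) := mul_le_mul_of_nonneg_right hlη1 (by positivity)
      _ ≤ _ := by rw [one_mul]; exact h7

lemma KW_nonneg : 0 ≤ KW := le_max_of_le_left (mul_nonneg two_pos.le CS_nonneg)

/-- gain factor -/
def gn (η δ ρ : ℝ) : ℝ := if δ ≤ ρ then (δ / ρ) ^ (η / 7200) else ρ / δ

lemma Wloc (δ0 : 0 < δ) (δ1 : δ ≤ 1/8) (ρ0 : 0 < ρ) (ρ1 : ρ ≤ 1/4) (hA : AP δ A) (hf : Continuous f) (hf1 : ∀ y, |f y| ≤ 1)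
    (l0 : 0 < l) (l1 : l ≤ 1) {η : ℝ} (η0 : 0 < η) (η1 : η ≤ 1) :
    volume.real (OmS c ρ f A (Icc 1 2) l) ≤ (7 * KW + 108) * (l ^ (-2 - η) * ρ * gn η δ ρ) * ∫ y in closedBall c 4, f y ^ 2 := by
  have hE0 : 0 ≤ ∫ y in closedBall c 4, f y ^ 2 := integral_nonneg fun y => sq_nonneg _
  have hm : 0 < l ^ (-2 - η) := Real.rpow_pos_of_pos l0 _
  have hKW := KW_nonneg
  unfold gn
  split_ifs with hδρ
  · have hg : 0 ≤ (δ / ρ) ^ (η / 7200) := by positivity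
    have := OmS_sum (c := c) δ0 δ1 ρ0 ρ1 hδρ hA hf hf1 l0 l1 (K := KW * (l ^ (-2 - η) * ρ * (δ / ρ) ^ (η / 7200))) (by positivity) 
      (fun t s g Ω h => h.W hδρ η0 η1)
    refine this.trans (mul_le_mul_of_nonneg_right ?_ hE0)
    rw [← mul_assoc]
    exact mul_le_mul_of_nonneg_right (by linarith) (by positivity)
  · push Not at hδρ
    obtain ⟨t, ht, htJ, hl⟩ := time_sel (FS_cont c hf hA.cont) (a := 1) (b := 2) (by norm_num) l
    have hcell : Cell 1 δ ρ (fun _ => 1) A t := ⟨le_rfl, δ0, δ1, ρ0, ρ1, TW.one zero_le_one, hA, ht, fun x => (htJ x).1, fun x => (htJ x).2⟩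
    have h1 := hcell.w1' (c := c) (l := l) (f := f) (B := OmS c ρ f A (Icc 1 2) l) (OmS_meas _ _ hf hA.cont _ _) (fun x hx => hx.1) hf.measurable hf1 l0.le 
      (fun x hx => by have := hl x hx.2
                      rw [← FQ_one] at this; exact this.le)
    have hll : l ^ (-2 - η) * l ^ η * l ^ 2 = 1 := by
      rw [← Real.rpow_natCast, ← Real.rpow_add l0, ← Real.rpow_add l0]
      norm_num
    have hlη1 : l ^ η ≤ 1 := Real.rpow_le_one l0.le l1 η0.le
    have hlη : 0 ≤ l ^ η := Real.rpow_nonneg l0.le _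
    set V := volume.real (OmS c ρ f A (Icc 1 2) l)
    calc V = l ^ (-2 - η) * l ^ η * l ^ 2 * V := by rw [hll, one_mul]
      _ = l ^ (-2 - η) * l ^ η * (l ^ 2 * V) := by ring
      _ ≤ l ^ (-2 - η) * 1 * ((∫ y in closedBall c 4, f y ^ 2) * (108 * ρ ^ 2 / δ)) := by gcongr
      _ = 108 * (l ^ (-2 - η) * ρ * (ρ / δ)) * (∫ y in closedBall c 4, f y ^ 2) := by ring
      _ ≤ _ := by gcongr; linarith

end
end SM

namespace SM

def FG (f : ℂ → ℝ) (A : ℝ → ℝ → ℝ) (τ : ℝ) (x : ℂ) : ℝ := ∫ y, f y * A τ ‖y - x‖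

/-- squared norm -/
def N2 (f : ℂ → ℝ) : ℝ≥0∞ := ∫⁻ y, ENNReal.ofReal (f y ^ 2)

section
variable {δ ρ : ℝ} {A : ℝ → ℝ → ℝ} {c : ℂ} {f : ℂ → ℝ} {l : ℝ}

lemma FG_eq (δ1 : δ ≤ 1/8) (hA : AP δ A) {x : ℂ} (hx : x ∈ closedBall c 1) {τ : ℝ} (hτ : τ ∈ Icc (1:ℝ) 2) :
    FG f A τ x = FS c f A τ x := by
  unfold FG FS
  refine (setIntegral_eq_integral_of_forall_compl_eq_zero fun y hy => ?_).symm
  suffices A τ ‖y - x‖ = 0 by rw [this, mul_zero]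
  by_contra hne
  have h1 := (hA.prof τ hτ.1 hτ.2).supp _ hne
  apply hy
  have h2 := hτ.2
  rw [mem_closedBall, dist_eq_norm] at hx ⊢
  rw [abs_le] at h1
  have := norm_add_le (y - x) (x - c)
  rw [sub_add_sub_cancel] at this
  linarith

lemma OmS_lint (δ0 : 0 < δ) (δ1 : δ ≤ 1/8) (ρ0 : 0 < ρ) (ρ1 : ρ ≤ 1/4) (hA : AP δ A) (hf : Continuous f) (hf1 : ∀ y, |f y| ≤ 1)
    (l0 : 0 < l) (l1 : l ≤ 1) {η : ℝ} (η0 : 0 < η) (η1 : η ≤ 1) (c : ℂ) :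
    volume {x ∈ closedBall c ρ | ∃ τ ∈ Icc (1:ℝ) 2, l < FG f A τ x} ≤ ENNReal.ofReal ((7 * KW + 108) * (l ^ (-2 - η) * ρ * gn η δ ρ)) * ∫⁻ y in closedBall c 4, ENNReal.ofReal (f y ^ 2) := by
  have e : {x ∈ closedBall c ρ | ∃ τ ∈ Icc (1:ℝ) 2, l < FG f A τ x} = OmS c ρ f A (Icc 1 2) l := by
    ext x
    refine and_congr_right fun hx => exists_congr fun τ => and_congr_right fun hτ => ?_
    rw [FG_eq δ1 hA (closedBall_subset_closedBall (by linarith) hx) hτ]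
  have hi : IntegrableOn (fun y => f y ^ 2) (closedBall c 4) := (hf.pow 2).continuousOn.integrableOn_compact (isCompact_closedBall c 4)
  have hfin : volume (OmS c ρ f A (Icc 1 2) l) ≠ ⊤ := ((measure_mono (t := closedBall c ρ) fun x hx => hx.1).trans_lt measure_closedBall_lt_top).ne
  rw [e, ← ofReal_measureReal hfin, ← ofReal_integral_eq_lintegral_ofReal hi (Filter.Eventually.of_forall fun y => sq_nonneg _), ← ENNReal.ofReal_mul']
  · exact ENNReal.ofReal_le_ofReal (Wloc δ0 δ1 ρ0 ρ1 hA hf hf1 l0 l1 η0 η1)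
  · exact integral_nonneg fun y => sq_nonneg _

lemma avg_ball {g : ℂ → ℝ≥0∞} (hg : Measurable g) (r : ℝ) :
    ∫⁻ c, ∫⁻ y in closedBall c r, g y = volume (closedBall (0:ℂ) r) * ∫⁻ y, g y := by
  have hm : MeasurableSet {p : ℂ × ℂ | dist p.2 p.1 ≤ r} := (isClosed_le (f := fun p : ℂ × ℂ => dist p.2 p.1) (by fun_prop) continuous_const).measurableSet
  have e1 : ∀ c, ∫⁻ y in closedBall c r, g y = ∫⁻ y, {p : ℂ × ℂ | dist p.2 p.1 ≤ r}.indicator (fun p => g p.2) (c, y) := by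
    intro c
    rw [← lintegral_indicator measurableSet_closedBall]
    rfl
  simp_rw [e1]
  rw [lintegral_lintegral_swap]
  · rw [← lintegral_const_mul _ hg]
    congr 1; ext y
    have : (fun c => {p : ℂ × ℂ | dist p.2 p.1 ≤ r}.indicator (fun p => g p.2) (c, y)) = (closedBall y r).indicator (fun _ => g y) := by
      ext c
      simp only [indicator, Set.mem_ofPred_eq, mem_closedBall, dist_comm c y]
    rw [this, lintegral_indicator_const measurableSet_closedBall, mul_comm]
    congr 1
    rw [Complex.volume_closedBall, Complex.volume_closedBall]
  · exact ((hg.comp measurable_snd).indicator hm).aemeasurable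

lemma FG_meas (hf : Continuous f) (hA : AP δ A) (δ1 : δ ≤ 1/8) : MeasurableSet {x | ∃ τ ∈ Icc (1:ℝ) 2, l < FG f A τ x} := by
  refine IsOpen.measurableSet ?_
  rw [isOpen_iff_mem_nhds]
  rintro x ⟨τ, hτ, h⟩
  rw [FG_eq δ1 hA (mem_closedBall_self zero_le_one) hτ] at h
  have hc : Continuous (FS x f A τ) := (FS_cont x hf hA.cont).comp (Continuous.prodMk continuous_const continuous_id)
  filter_upwards [hc.continuousAt.eventually_const_lt h, closedBall_mem_nhds x zero_lt_one] with z hz hzx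
  refine ⟨τ, hτ, ?_⟩
  rwa [FG_eq δ1 hA hzx hτ]

lemma Wc0 (δ0 : 0 < δ) (δ1 : δ ≤ 1/8) (ρ0 : 0 < ρ) (ρ1 : ρ ≤ 1/4) (hA : AP δ A) (hf : Continuous f) (hf1 : ∀ y, |f y| ≤ 1)
    (l0 : 0 < l) (l1 : l ≤ 1) {η : ℝ} (η0 : 0 < η) (η1 : η ≤ 1) :
    volume {x ∈ closedBall (0:ℂ) ρ | ∃ τ ∈ Icc (1:ℝ) 2, l < FG f A τ x} ≤ ENNReal.ofReal ((7 * KW + 108) * (l ^ (-2 - η) * ρ * gn η δ ρ)) * N2 f := by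
  refine (OmS_lint δ0 δ1 ρ0 ρ1 hA hf hf1 l0 l1 η0 η1 0).trans ?_
  gcongr
  exact setLIntegral_le_lintegral _ _

lemma Wa0 (δ0 : 0 < δ) (δ1 : δ ≤ 1/8) (hA : AP δ A) (hf : Continuous f) (hf1 : ∀ y, |f y| ≤ 1)
    (l0 : 0 < l) (l1 : l ≤ 1) {η : ℝ} (η0 : 0 < η) (η1 : η ≤ 1) :
    volume {x | ∃ τ ∈ Icc (1:ℝ) 2, l < FG f A τ x} ≤ ENNReal.ofReal (256 * (7 * KW + 108) * (l ^ (-2 - η) * δ ^ (η / 7200))) * N2 f := by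
  set Ω := {x | ∃ τ ∈ Icc (1:ℝ) 2, l < FG f A τ x} with hΩ
  have hm : MeasurableSet Ω := FG_meas hf hA δ1
  have hKW := KW_nonneg
  have h1 := avg_ball (g := Ω.indicator fun _ => 1) (measurable_const.indicator hm) (1/4)
  have h2 := avg_ball (g := fun y => ENNReal.ofReal (f y ^ 2)) (by have := hf.measurable; fun_prop) 4
  rw [lintegral_indicator_const hm, one_mul] at h1
  obtain ⟨K, hK⟩ : ∃ K, K = (7 * KW + 108) * (l ^ (-2 - η) * (1/4) * gn η δ (1/4)) := ⟨_, rfl⟩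
  have hlp : 0 < l ^ (-2 - η) := Real.rpow_pos_of_pos l0 _
  have hgn : 0 ≤ gn η δ (1/4) := by
    unfold gn; split_ifs <;> positivity
  have hK0 : 0 ≤ K := by rw [hK]; positivity
  have h3 : volume (closedBall (0:ℂ) (1/4)) * volume Ω ≤ ENNReal.ofReal K * (volume (closedBall (0:ℂ) 4) * N2 f) := by
    unfold N2
    rw [← h1, ← h2, ← lintegral_const_mul']
    · refine lintegral_mono fun c => ?_
      rw [hK]
      refine le_trans (le_of_eq ?_) (OmS_lint δ0 δ1 (by norm_num) le_rfl hA hf hf1 l0 l1 η0 η1 c)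
      rw [lintegral_indicator_const hm, one_mul, Measure.restrict_apply hm]
      congr 1
      ext x; rw [mem_inter_iff, and_comm]; rfl
    · exact ENNReal.ofReal_ne_top
  rw [Complex.volume_closedBall, Complex.volume_closedBall] at h3
  have hpi : (NNReal.pi : ℝ≥0∞) ≠ 0 := by simpa using NNReal.pi_pos.ne'
  have e1 : ENNReal.ofReal 4 ^ 2 = 16 := by rw [← ENNReal.ofReal_pow (by norm_num)]; norm_num
  have e2 : ENNReal.ofReal 16 * ENNReal.ofReal (1/4) ^ 2 = 1 := by rw [← ENNReal.ofReal_pow (by norm_num), ← ENNReal.ofReal_mul (by norm_num)]; norm_num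
  have e3 : ENNReal.ofReal 16 = 16 := by norm_num
  have h4 : volume Ω ≤ ENNReal.ofReal (256 * K) * N2 f := by
    have h5 : (NNReal.pi : ℝ≥0∞) * volume Ω ≤ NNReal.pi * (ENNReal.ofReal (256 * K) * N2 f) := by
      calc (NNReal.pi : ℝ≥0∞) * volume Ω = (ENNReal.ofReal 16 * ENNReal.ofReal (1/4) ^ 2) * NNReal.pi * volume Ω := by rw [e2, one_mul]
        _ = ENNReal.ofReal 16 * (ENNReal.ofReal (1/4) ^ 2 * NNReal.pi * volume Ω) := by ring
        _ ≤ ENNReal.ofReal 16 * (ENNReal.ofReal K * (ENNReal.ofReal 4 ^ 2 * NNReal.pi * N2 f)) := by gcongr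
        _ = NNReal.pi * (256 * ENNReal.ofReal K * N2 f) := by rw [e1, e3]; ring
        _ = _ := by rw [ENNReal.ofReal_mul (p := 256) (q := K) (by norm_num), ENNReal.ofReal_ofNat]
    exact (ENNReal.mul_le_mul_iff_right hpi ENNReal.coe_ne_top).1 h5
  refine h4.trans (mul_le_mul_left (ENNReal.ofReal_le_ofReal ?_) _)
  have hg : gn η δ (1/4) ≤ 4 * δ ^ (η / 7200) := by
    unfold gn
    rw [if_pos (by linarith), show δ / (1/4) = 4 * δ by ring, Real.mul_rpow (by norm_num) δ0.le]
    refine mul_le_mul_of_nonneg_right ?_ (by positivity)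
    calc (4:ℝ) ^ (η / 7200) ≤ 4 ^ (1:ℝ) := Real.rpow_le_rpow_of_exponent_le (by norm_num) (by linarith)
      _ = 4 := by norm_num
  calc 256 * K ≤ 256 * ((7 * KW + 108) * (l ^ (-2 - η) * (1/4) * (4 * δ ^ (η / 7200)))) := by rw [hK]; gcongr
    _ = _ := by ring
end
end SM

namespace SM

/-- continuous functions supported in the ball of radius r -/
structure CC (r : ℝ) (f : ℂ → ℝ) : Prop where
  cont : Continuous f
  supp : ∀ z, f z ≠ 0 → ‖z‖ ≤ r

lemma CC.hcs {r : ℝ} {f : ℂ → ℝ} (h : CC r f) : HasCompactSupport f := 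
  HasCompactSupport.intro (isCompact_closedBall 0 r) fun z hz => by
    by_contra hne; exact hz (by simpa using h.supp z hne)

lemma CC.int {r : ℝ} {f : ℂ → ℝ} (h : CC r f) : Integrable f := h.cont.integrable_of_hasCompactSupport h.hcs

lemma CC.mono {r s : ℝ} {f : ℂ → ℝ} (h : CC r f) (hrs : r ≤ s) : CC s f := ⟨h.cont, fun z hz => (h.supp z hz).trans hrs⟩

lemma CC.bdd {r : ℝ} {f : ℂ → ℝ} (h : CC r f) : ∃ B : ℝ, 0 < B ∧ ∀ z, |f z| ≤ B := by
  obtain ⟨B, hB⟩ := h.hcs.exists_bound_of_continuous h.cont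
  exact ⟨max B 1, lt_max_of_lt_right one_pos, fun z => (hB z).trans (le_max_left _ _)⟩

lemma CC.add {r : ℝ} {f g : ℂ → ℝ} (hf : CC r f) (hg : CC r g) : CC r (f + g) := 
  ⟨hf.cont.add hg.cont, fun z hz => by
    by_cases h : f z = 0
    · exact hg.supp z (by simpa [h] using hz)
    · exact hf.supp z h⟩

lemma CC.smul {r : ℝ} {f : ℂ → ℝ} (hf : CC r f) (c : ℝ) : CC r (c • f) := 
  ⟨hf.cont.const_smul c, fun z hz => hf.supp z fun h => hz (by simp [h])⟩

lemma CC.sub {r : ℝ} {f g : ℂ → ℝ} (hf : CC r f) (hg : CC r g) : CC r (f - g) := by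
  have := hf.add (hg.smul (-1)); rwa [neg_one_smul, ← sub_eq_add_neg] at this

lemma CC.abs {r : ℝ} {f : ℂ → ℝ} (hf : CC r f) : CC r (fun z => |f z|) := ⟨hf.cont.abs, fun z hz => hf.supp z (by simpa using hz)⟩
lemma CC.mul {r : ℝ} {f g : ℂ → ℝ} (hf : CC r f) (hg : Continuous g) : CC r (fun z => f z * g z) := 
  ⟨hf.cont.mul hg, fun z hz => hf.supp z (left_ne_zero_of_mul hz)⟩
lemma CC.sq {r : ℝ} {f : ℂ → ℝ} (hf : CC r f) : CC r (fun z => f z ^ 2) := ⟨hf.cont.pow 2, fun z hz => hf.supp z (by simpa using hz)⟩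

def cv (f g : ℂ → ℝ) : ℂ → ℝ := convolution f g (ContinuousLinearMap.mul ℝ ℝ) volume

lemma cv_def (f g : ℂ → ℝ) (x : ℂ) : cv f g x = ∫ t, f t * g (x - t) := rfl

section
variable {r s u : ℝ} {f g k : ℂ → ℝ}

lemma cv_comm (f g : ℂ → ℝ) : cv f g = cv g f := by
  ext x
  unfold cv
  rw [convolution_mul_swap, convolution_mul]
  congr 1; ext t; ring

lemma cv_swap (f g : ℂ → ℝ) (x : ℂ) : cv f g x = ∫ y, g y * f (x - y) := by rw [cv_comm, cv_def]

lemma CC.cv (hf : CC r f) (hg : CC s g) : CC (r + s) (cv f g) := by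
  refine ⟨hg.hcs.continuous_convolution_right _ hf.int.locallyIntegrable hg.cont, fun z hz => ?_⟩
  obtain ⟨a, ha, b, hb, rfl⟩ := Set.mem_add.1 (support_convolution_subset _ (Function.mem_support.2 hz))
  exact (norm_add_le a b).trans (add_le_add (hf.supp a ha) (hg.supp b hb))

lemma CC.ex (hf : CC r f) (hg : Continuous g) : ConvolutionExists f g (ContinuousLinearMap.mul ℝ ℝ) volume :=
  hf.hcs.convolutionExists_left _ hf.cont hg.locallyIntegrable

lemma CC.exi (hf : CC r f) (hg : Continuous g) (x : ℂ) : Integrable (fun t => f t * g (x - t)) := hf.ex hg x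

lemma cv_add (hf : CC r f) (hg : CC s g) (hk : CC u k) : cv f (g + k) = cv f g + cv f k := (hf.ex hg.cont).distrib_add (hf.ex hk.cont)
lemma add_cv (hf : CC r f) (hg : CC s g) (hk : CC u k) : cv (f + g) k = cv f k + cv g k := (hf.ex hk.cont).add_distrib (hg.ex hk.cont)
lemma cv_smul (c : ℝ) (f g : ℂ → ℝ) : cv f (c • g) = c • cv f g := convolution_smul
lemma smul_cv (c : ℝ) (f g : ℂ → ℝ) : cv (c • f) g = c • cv f g := smul_convolution
lemma cv_sub (hf : CC r f) (hg : CC s g) (hk : CC u k) : cv f (g - k) = cv f g - cv f k := by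
  have := cv_add hf hg (hk.smul (-1)); rw [cv_smul] at this; simpa [sub_eq_add_neg] using this
lemma sub_cv (hf : CC r f) (hg : CC s g) (hk : CC u k) : cv (f - g) k = cv f k - cv g k := by
  rw [cv_comm, cv_sub hk hf hg, cv_comm k f, cv_comm k g]

lemma cv_assoc (hf : CC r f) (hg : CC s g) (hk : CC u k) : cv (cv f g) k = cv f (cv g k) := by
  ext x
  refine convolution_assoc (ContinuousLinearMap.mul ℝ ℝ) (ContinuousLinearMap.mul ℝ ℝ) (ContinuousLinearMap.mul ℝ ℝ) (ContinuousLinearMap.mul ℝ ℝ) 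
    (fun x y z => mul_assoc x y z) hf.cont.aestronglyMeasurable hg.cont.aestronglyMeasurable hk.cont.aestronglyMeasurable
    (Filter.Eventually.of_forall fun y => hf.ex hg.cont y) (Filter.Eventually.of_forall fun y => hg.abs.ex hk.abs.cont y) (hf.abs.ex (hg.abs.cv hk.abs).cont x)

lemma int_cv (hf : CC r f) (hg : CC s g) : ∫ x, cv f g x = (∫ x, f x) * ∫ x, g x := 
  integral_convolution (ContinuousLinearMap.mul ℝ ℝ) hf.int hg.int

/-- self-adjointness -/
lemma adj (hf : CC r f) (hg : CC s g) (hk : CC u k) (he : ∀ z, k (-z) = k z) : ∫ x, cv k f x * g x = ∫ x, f x * cv k g x := by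
  have hg' : CC s (fun z => g (-z)) := ⟨hg.cont.comp continuous_neg, fun z hz => by simpa using hg.supp _ hz⟩
  have h1 : ∫ x, cv k f x * g x = cv (cv k f) (fun z => g (-z)) 0 := by
    rw [cv_def]; congr 1; ext t; simp
  have h2 : cv f (cv k (fun z => g (-z))) 0 = ∫ x, f x * cv k g x := by
    rw [cv_def]; congr 1; ext t
    congr 1
    rw [cv_def, cv_def, ← integral_neg_eq_self]
    congr 1; ext y
    rw [he]; congr 2; ring
  rw [h1, ← h2, cv_comm k f, cv_assoc hf hk hg']

/-- integral of square -/
def nn (f : ℂ → ℝ) : ℝ := ∫ x, f x ^ 2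

lemma nn_nonneg (f : ℂ → ℝ) : 0 ≤ nn f := integral_nonneg fun _ => sq_nonneg _

lemma young (hk : CC u k) (hf : CC r f) : nn (cv k f) ≤ (∫ z, |k z|) ^ 2 * nn f := by
  have hp : ∀ x, cv k f x ^ 2 ≤ (∫ z, |k z|) * cv (fun z => |k z|) (fun z => f z ^ 2) x := by
    intro x
    have := cs_int (μ := (volume : Measure ℂ)) (f := fun t => √|k t|) (g := fun t => (k t / √|k t|) * f (x - t)) ?_ ?_ ?_
    · refine le_trans (le_of_eq ?_) (this.trans (le_of_eq ?_))
      · rw [cv_def]; congr 2; ext t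
        by_cases h : k t = 0
        · simp [h]
        · have : √|k t| ≠ 0 := (Real.sqrt_pos.2 (abs_pos.2 h)).ne'
          field_simp
      · rw [cv_def]
        congr 2
        · ext t; exact Real.sq_sqrt (abs_nonneg _)
        · ext t
          rw [mul_pow, div_pow, Real.sq_sqrt (abs_nonneg _), ← sq_abs (k t)]
          by_cases h : k t = 0
          · simp [h]
          · have : |k t| ≠ 0 := abs_ne_zero.2 h
            field_simp
    · simp_rw [Real.sq_sqrt (abs_nonneg _)]; exact hk.int.abs
    · refine (hk.abs.exi hf.sq.cont x).congr (Filter.Eventually.of_forall fun t => ?_)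
      simp only
      rw [mul_pow, div_pow, Real.sq_sqrt (abs_nonneg _), ← sq_abs (k t)]
      by_cases h : k t = 0
      · simp [h]
      · have : |k t| ≠ 0 := abs_ne_zero.2 h
        field_simp
    · refine (hk.exi hf.cont x).congr (Filter.Eventually.of_forall fun t => ?_)
      simp only
      by_cases h : k t = 0
      · simp [h]
      · have : √|k t| ≠ 0 := (Real.sqrt_pos.2 (abs_pos.2 h)).ne'
        field_simp
  calc nn (cv k f) ≤ ∫ x, (∫ z, |k z|) * cv (fun z => |k z|) (fun z => f z ^ 2) x := 
        integral_mono (hk.cv hf).sq.int ((hk.abs.cv hf.sq).int.const_mul _) hp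
    _ = _ := by rw [integral_const_mul, int_cv hk.abs hf.sq]; unfold nn; ring

lemma pair_le (hf : CC r f) (hg : CC s g) {κ : ℝ} (hκ : 0 < κ) (h : nn f ≤ κ ^ 2 * nn k) : ∫ x, f x * g x ≤ κ / 2 * (nn k + nn g) := by
  calc ∫ x, f x * g x ≤ ∫ x, ((2 * κ)⁻¹ * f x ^ 2 + κ / 2 * g x ^ 2) := by
        refine integral_mono (hf.mul hg.cont).int ((hf.sq.int.const_mul _).add (hg.sq.int.const_mul _)) fun x => ?_
        have : (2 * κ)⁻¹ * f x ^ 2 + κ / 2 * g x ^ 2 - f x * g x = (2 * κ)⁻¹ * (f x - κ * g x) ^ 2 := by field_simp; ring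
        have h2 : 0 ≤ (2 * κ)⁻¹ * (f x - κ * g x) ^ 2 := by positivity
        simp only
        linarith
    _ = (2 * κ)⁻¹ * nn f + κ / 2 * nn g := by
        rw [integral_add (hf.sq.int.const_mul _) (hg.sq.int.const_mul _), integral_const_mul, integral_const_mul]; rfl
    _ ≤ (2 * κ)⁻¹ * (κ ^ 2 * nn k) + κ / 2 * nn g := by gcongr
    _ = _ := by field_simp

/-- dilation -/
def dl (m : ℤ) (f : ℂ → ℝ) (z : ℂ) : ℝ := ((2:ℝ) ^ m) ^ 2 * f ((2:ℝ) ^ m • z)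

lemma p2 (m : ℤ) : (0:ℝ) < 2 ^ m := zpow_pos (by norm_num) _

lemma CC.dl (hf : CC r f) (m : ℤ) : CC (r * 2 ^ (-m)) (dl m f) := by
  refine ⟨by unfold SM.dl; have := hf.cont; fun_prop, fun z hz => ?_⟩
  have := hf.supp _ (right_ne_zero_of_mul hz)
  rw [norm_smul, Real.norm_eq_abs, abs_of_pos (p2 m)] at this
  rwa [zpow_neg, ← div_eq_mul_inv, le_div_iff₀ (p2 m), mul_comm]

lemma int_scale (f : ℂ → ℝ) (m : ℤ) : ∫ z, f ((2:ℝ) ^ m • z) = (((2:ℝ) ^ m) ^ 2)⁻¹ * ∫ z, f z := by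
  rw [Measure.integral_comp_smul, Complex.finrank_real_complex, abs_of_pos (inv_pos.2 (pow_pos (p2 m) 2)), smul_eq_mul]

lemma int_dl (f : ℂ → ℝ) (m : ℤ) : ∫ z, dl m f z = ∫ z, f z := by
  unfold dl
  rw [integral_const_mul, int_scale, mul_inv_cancel_left₀ (pow_pos (p2 m) 2).ne']

lemma dl_abs (f : ℂ → ℝ) (m : ℤ) (z : ℂ) : |dl m f z| = dl m (fun z => |f z|) z := by
  unfold dl; rw [abs_mul, abs_of_pos (pow_pos (p2 m) 2)]

lemma int_abs_dl (f : ℂ → ℝ) (m : ℤ) : ∫ z, |dl m f z| = ∫ z, |f z| := by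
  simp_rw [dl_abs]; exact int_dl _ m

lemma dl_cv (f g : ℂ → ℝ) (m : ℤ) : dl m (cv f g) = cv (dl m f) (dl m g) := by
  ext z
  rw [cv_def]
  have := int_scale (fun t => f t * g ((2:ℝ) ^ m • z - t)) m
  unfold dl
  rw [cv_def]
  simp only [smul_sub]
  have e : ∀ t, ((2:ℝ) ^ m) ^ 2 * f ((2:ℝ) ^ m • t) * (((2:ℝ) ^ m) ^ 2 * g ((2:ℝ) ^ m • z - (2:ℝ) ^ m • t)) = (((2:ℝ) ^ m) ^ 2 * ((2:ℝ) ^ m) ^ 2) * (f ((2:ℝ) ^ m • t) * g ((2:ℝ) ^ m • z - (2:ℝ) ^ m • t)) := fun t => by ring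
  simp_rw [e]
  rw [integral_const_mul, this, mul_assoc, mul_inv_cancel_left₀ (pow_pos (p2 m) 2).ne']

lemma dl_dl (f : ℂ → ℝ) (m n : ℤ) : dl m (dl n f) = dl (m + n) f := by
  ext z; unfold dl; rw [smul_smul, ← zpow_add₀ (by norm_num), add_comm n m, zpow_add₀ (by norm_num) m n]; ring

lemma dl_add (f g : ℂ → ℝ) (m : ℤ) : dl m (f + g) = dl m f + dl m g := by ext z; simp [dl, mul_add]
lemma dl_sub (f g : ℂ → ℝ) (m : ℤ) : dl m (f - g) = dl m f - dl m g := by ext z; simp [dl, mul_sub]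
lemma dl_smul (f : ℂ → ℝ) (c : ℝ) (m : ℤ) : dl m (c • f) = c • dl m f := by ext z; simp [dl]; ring

end
end SM

namespace SM

def pre (z : ℂ) : ℝ := max 0 (1 - ‖z‖)

lemma pre_CC : CC 1 pre := ⟨by unfold pre; fun_prop, fun z hz => by
  by_contra h; push Not at h; exact hz (max_eq_left (by linarith))⟩

lemma pre_int : 0 < ∫ z, pre z := 
  pre_CC.cont.integral_pos_of_hasCompactSupport_nonneg_nonzero pre_CC.hcs (fun z => le_max_left _ _) (x := 0) (by simp [pre])

lemma pre_lip (z w : ℂ) : |pre z - pre w| ≤ ‖z - w‖ := by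
  unfold pre
  refine (abs_max_sub_max_le_max _ _ _ _).trans ?_
  rw [sub_self, abs_zero, sub_sub_sub_cancel_left]
  refine max_le (norm_nonneg _) ?_
  rw [norm_sub_rev]
  exact abs_norm_sub_norm_le _ _

def ph : ℂ → ℝ := (∫ z, pre z)⁻¹ • pre

lemma ph_CC : CC 1 ph := pre_CC.smul _

lemma ph_int : ∫ z, ph z = 1 := by
  unfold ph; simp only [Pi.smul_apply, smul_eq_mul]
  rw [integral_const_mul, inv_mul_cancel₀ pre_int.ne']

/-- radial functions -/
def Rad (f : ℂ → ℝ) : Prop := ∀ u z : ℂ, ‖u‖ = 1 → f (u * z) = f z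

lemma ph_rad : Rad ph := fun u z hu => by simp [ph, pre, hu]

lemma Rad.even {f : ℂ → ℝ} (h : Rad f) (z : ℂ) : f (-z) = f z := by
  rw [← h (-1) z (by simp)]; congr 1; ring

lemma Rad.add {f g : ℂ → ℝ} (hf : Rad f) (hg : Rad g) : Rad (f + g) := fun u z hu => by simp [hf u z hu, hg u z hu]
lemma Rad.sub {f g : ℂ → ℝ} (hf : Rad f) (hg : Rad g) : Rad (f - g) := fun u z hu => by simp [hf u z hu, hg u z hu]
lemma Rad.smul {f : ℂ → ℝ} (hf : Rad f) (c : ℝ) : Rad (c • f) := fun u z hu => by simp [hf u z hu]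
lemma Rad.dl {f : ℂ → ℝ} (hf : Rad f) (m : ℤ) : Rad (dl m f) := fun u z hu => by
  unfold SM.dl; rw [← mul_smul_comm, hf u _ hu]
lemma Rad.cv {f g : ℂ → ℝ} (hf : Rad f) (hg : Rad g) : Rad (cv f g) := fun u z hu => by
  rw [cv_def, cv_def]
  let a : Circle := ⟨u, by simpa [Submonoid.unitSphere] using hu⟩
  have mp : MeasurePreserving (rotation a) (volume : Measure ℂ) volume := (rotation a).measurePreserving
  rw [← mp.integral_comp (rotation a).toHomeomorph.measurableEmbedding]
  congr 1; ext t
  rw [rotation_apply]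
  have e : (a : ℂ) = u := rfl
  rw [e, hf u t hu, ← mul_sub, hg u _ hu]

def ps : ℂ → ℝ := dl 1 ph - ph

lemma dl1_CC : CC 1 (dl 1 ph) := (ph_CC.dl 1).mono (by norm_num)
lemma ps_CC : CC 1 ps := dl1_CC.sub ph_CC
lemma ps_rad : Rad ps := (ph_rad.dl 1).sub ph_rad
lemma ps_int : ∫ z, ps z = 0 := by
  unfold ps; simp only [Pi.sub_apply]
  rw [integral_sub dl1_CC.int ph_CC.int, int_dl, sub_self]

def Lps : ℝ := 9 * (∫ z, pre z)⁻¹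

lemma Lps_pos : 0 < Lps := mul_pos (by norm_num) (inv_pos.2 pre_int)

lemma ps_lip (z w : ℂ) : |ps z - ps w| ≤ Lps * ‖z - w‖ := by
  have hc := inv_pos.2 pre_int
  have h1 := pre_lip z w
  have h2 := pre_lip ((2:ℝ) • z) ((2:ℝ) • w)
  rw [← smul_sub, norm_smul, Real.norm_eq_abs, abs_two] at h2
  have e : ps z - ps w = (∫ z, pre z)⁻¹ * (4 * (pre ((2:ℝ) • z) - pre ((2:ℝ) • w)) - (pre z - pre w)) := by
    simp only [ps, dl, ph, Pi.sub_apply, Pi.smul_apply, smul_eq_mul, zpow_one]; ring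
  rw [e, abs_mul, abs_of_pos hc, Lps]
  have h3 := abs_sub (4 * (pre ((2:ℝ) • z) - pre ((2:ℝ) • w))) (pre z - pre w)
  rw [abs_mul] at h3
  rw [abs_of_pos (by norm_num : (0:ℝ) < 4)] at h3
  have : |4 * (pre ((2:ℝ) • z) - pre ((2:ℝ) • w)) - (pre z - pre w)| ≤ 9 * ‖z - w‖ := by linarith
  calc _ ≤ (∫ z, pre z)⁻¹ * (9 * ‖z - w‖) := mul_le_mul_of_nonneg_left this hc.le
    _ = _ := by ring

def Kps : ℝ := volume.real (closedBall (0:ℂ) 2) * (Lps * ∫ z, |ps z|) + 1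

lemma Kps_pos : 0 < Kps := by
  have : 0 ≤ ∫ z, |ps z| := integral_nonneg fun _ => abs_nonneg _
  have := Lps_pos
  unfold Kps; positivity

lemma ps_cv (j : ℕ) : ∫ z, |cv (dl j ps) ps z| ≤ Kps * 2 ^ (-(j:ℤ)) := by
  have hCj := ps_CC.dl j
  rw [one_mul] at hCj
  have hp := p2 (-(j:ℤ))
  have hb : ∀ z, |cv (dl j ps) ps z| ≤ (Lps * ∫ z, |ps z|) * 2 ^ (-(j:ℤ)) := by
    intro z
    have e : cv (dl j ps) ps z = ∫ t, dl j ps t * (ps (z - t) - ps z) := by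
      simp_rw [mul_sub]
      rw [integral_sub (hCj.exi ps_CC.cont z) (hCj.int.mul_const _), integral_mul_const, int_dl, ps_int, zero_mul, sub_zero, cv_def]
    rw [e, ← int_abs_dl ps j]
    calc |∫ t, dl j ps t * (ps (z - t) - ps z)| ≤ ∫ t, |dl j ps t * (ps (z - t) - ps z)| := abs_integral_le_integral_abs
      _ ≤ ∫ t, |dl j ps t| * (Lps * 2 ^ (-(j:ℤ))) := by
          refine integral_mono (hCj.mul (by have := ps_CC.cont; fun_prop)).abs.int (hCj.abs.int.mul_const _) fun t => ?_
          simp only; rw [abs_mul]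
          by_cases h : dl j ps t = 0
          · simp [h]
          · refine mul_le_mul_of_nonneg_left ((ps_lip _ _).trans ?_) (abs_nonneg _)
            refine mul_le_mul_of_nonneg_left ?_ Lps_pos.le
            rw [sub_sub_cancel_left, norm_neg]
            exact hCj.supp t h
      _ = _ := by rw [integral_mul_const]; ring
  have h2 : CC 2 (cv (dl j ps) ps) := (hCj.cv ps_CC).mono (by
    have : (2:ℝ) ^ (-(j:ℤ)) ≤ 1 := zpow_le_one_of_nonpos₀ (by norm_num) (by simp)
    linarith)
  have e2 : ∫ z, |cv (dl j ps) ps z| = ∫ z in closedBall 0 2, |cv (dl j ps) ps z| := by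
    refine (setIntegral_eq_integral_of_forall_compl_eq_zero fun y hy => ?_).symm
    by_contra hne
    exact hy (by simpa using h2.abs.supp y hne)
  rw [e2]
  have h3 : ∫ z in closedBall (0:ℂ) 2, |cv (dl j ps) ps z| ≤ ∫ z in closedBall (0:ℂ) 2, (Lps * ∫ z, |ps z|) * 2 ^ (-(j:ℤ)) :=
    integral_mono h2.abs.int.integrableOn (integrable_const _) hb
  rw [setIntegral_const, smul_eq_mul] at h3
  refine h3.trans ?_
  unfold Kps
  nlinarith only [hp]

lemma ps_cv_ge {m n : ℤ} (h : n ≤ m) : ∫ z, |cv (dl m ps) (dl n ps) z| ≤ Kps * 2 ^ (-|m - n|) := by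
  obtain ⟨j, hj⟩ := Int.eq_ofNat_of_zero_le (sub_nonneg.2 h)
  have : m = n + j := by omega
  rw [this, ← dl_dl, ← dl_cv, int_abs_dl]
  simpa using ps_cv j

lemma ps_cv2 (m n : ℤ) : ∫ z, |cv (dl m ps) (dl n ps) z| ≤ Kps * 2 ^ (-|m - n|) := by
  rcases le_total n m with h | h
  · exact ps_cv_ge h
  · rw [cv_comm, abs_sub_comm]; exact ps_cv_ge h

/-- Littlewood-Paley piece -/
def dd (m : ℤ) (f : ℂ → ℝ) : ℂ → ℝ := cv (dl m ps) f

lemma geo_sum (F : Finset ℤ) (m : ℤ) : ∑ n ∈ F, (2:ℝ) ^ (-|m - n|) ≤ 4 := by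
  have h1 : ∀ N : ℕ, ∑ j ∈ Finset.range N, (2:ℝ) ^ (-(j:ℤ)) ≤ 2 := by
    intro N
    have : ∀ j : ℕ, (2:ℝ) ^ (-(j:ℤ)) = (1/2) ^ j := fun j => by simp
    simp_rw [this]
    exact sum_geometric_two_le N
  obtain ⟨N, hN⟩ : ∃ N : ℕ, ∀ n ∈ F, (|m - n|).toNat < N := 
    ⟨(F.sup fun n => (|m - n|).toNat) + 1, fun n hn => Nat.lt_succ_of_le (Finset.le_sup (f := fun n => (|m - n|).toNat) hn)⟩
  have hsub : F ⊆ (Finset.range N).image (fun j : ℕ => m + j) ∪ (Finset.range N).image (fun j : ℕ => m - j) := by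
    intro n hn
    have := hN n hn
    simp only [Finset.mem_union, Finset.mem_image, Finset.mem_range]
    rcases le_total m n with h | h
    · left; refine ⟨(|m - n|).toNat, this, ?_⟩
      rw [abs_of_nonpos (by omega)]; omega
    · right; refine ⟨(|m - n|).toNat, this, ?_⟩
      rw [abs_of_nonneg (by omega)]; omega
  calc ∑ n ∈ F, (2:ℝ) ^ (-|m - n|) ≤ ∑ n ∈ (Finset.range N).image (fun j : ℕ => m + j) ∪ (Finset.range N).image (fun j : ℕ => m - j), (2:ℝ) ^ (-|m - n|) := 
        Finset.sum_le_sum_of_subset_of_nonneg hsub fun _ _ _ => (p2 _).le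
    _ ≤ ∑ n ∈ (Finset.range N).image (fun j : ℕ => m + j), (2:ℝ) ^ (-|m - n|) + ∑ n ∈ (Finset.range N).image (fun j : ℕ => m - j), (2:ℝ) ^ (-|m - n|) := by
        rw [← Finset.sum_union_inter]
        exact le_add_of_nonneg_right (Finset.sum_nonneg fun _ _ => (p2 _).le)
    _ ≤ 2 + 2 := by
        refine add_le_add ?_ ?_
        · rw [Finset.sum_image (fun a _ b _ hab => by simpa using hab)]
          simpa using h1 N
        · rw [Finset.sum_image (fun a _ b _ hab => by simpa using hab)]
          simpa using h1 N
    _ = 4 := by norm_num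

lemma dd_CC {r : ℝ} {f : ℂ → ℝ} (hf : CC r f) (m : ℤ) : CC (1 * 2 ^ (-m) + r) (dd m f) := (ps_CC.dl m).cv hf

lemma ortho_fin {r : ℝ} {f : ℂ → ℝ} (hf : CC r f) (F : Finset ℤ) : ∑ m ∈ F, nn (dd m f) ≤ 4 * Kps * nn f := by
  set T := ∑ m ∈ F, nn (dd m f) with hT
  have hd := fun m => dd_CC hf m
  have hdd := fun m => dd_CC (hd m) m
  have hK := Kps_pos
  have hintg : ∀ m n, Integrable (fun x => dd m (dd m f) x * dd n (dd n f) x) := fun m n => ((hdd m).mul (hdd n).cont).int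
  let G : ℂ → ℝ := fun x => ∑ m ∈ F, dd m (dd m f) x
  have hTG : ∫ x, f x * G x = T := by
    simp only [G, Finset.mul_sum]
    rw [integral_finsetSum _ fun m _ => (hf.mul (hdd m).cont).int]
    refine Finset.sum_congr rfl fun m _ => ?_
    rw [show dd m (dd m f) = cv (dl m ps) (dd m f) from rfl, ← adj hf (hd m) (ps_CC.dl m) (ps_rad.dl m).even]
    unfold nn
    congr 1; ext x; rw [sq]; rfl
  have hGG : ∫ x, G x ^ 2 ≤ 4 * Kps * T := by
    have e : ∀ x, G x ^ 2 = ∑ m ∈ F, ∑ n ∈ F, dd m (dd m f) x * dd n (dd n f) x := fun x => by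
      rw [sq, Finset.sum_mul_sum]
    simp_rw [e]
    rw [integral_finsetSum _ fun m _ => integrable_finset_sum _ fun n _ => hintg m n]
    have : ∀ m n, ∫ x, dd m (dd m f) x * dd n (dd n f) x ≤ Kps * 2 ^ (-|m - n|) / 2 * (nn (dd m f) + nn (dd n f)) := by
      intro m n
      have hk : 0 < Kps * 2 ^ (-|m - n|) := mul_pos hK (p2 _)
      rw [show dd n (dd n f) = cv (dl n ps) (dd n f) from rfl, ← adj (hdd m) (hd n) (ps_CC.dl n) (ps_rad.dl n).even]
      rw [show cv (dl n ps) (dd m (dd m f)) = cv (cv (dl n ps) (dl m ps)) (dd m f) from (cv_assoc (ps_CC.dl n) (ps_CC.dl m) (hd m)).symm]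
      have hC := (ps_CC.dl n).cv (ps_CC.dl m)
      refine pair_le (hC.cv (hd m)) (hd n) hk ((young hC (hd m)).trans ?_)
      refine mul_le_mul_of_nonneg_right (pow_le_pow_left₀ (integral_nonneg fun _ => abs_nonneg _) ?_ 2) (nn_nonneg _)
      rw [abs_sub_comm]
      exact ps_cv2 n m
    calc ∑ m ∈ F, ∫ x, ∑ n ∈ F, dd m (dd m f) x * dd n (dd n f) x = ∑ m ∈ F, ∑ n ∈ F, ∫ x, dd m (dd m f) x * dd n (dd n f) x := by
          refine Finset.sum_congr rfl fun m _ => integral_finsetSum _ fun n _ => hintg m n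
      _ ≤ ∑ m ∈ F, ∑ n ∈ F, Kps * 2 ^ (-|m - n|) / 2 * (nn (dd m f) + nn (dd n f)) := Finset.sum_le_sum fun m _ => Finset.sum_le_sum fun n _ => this m n
      _ = ∑ m ∈ F, ∑ n ∈ F, Kps / 2 * (nn (dd m f) * 2 ^ (-|m - n|)) + ∑ m ∈ F, ∑ n ∈ F, Kps / 2 * (nn (dd n f) * 2 ^ (-|m - n|)) := by
          rw [← Finset.sum_add_distrib]; refine Finset.sum_congr rfl fun m _ => ?_
          rw [← Finset.sum_add_distrib]; refine Finset.sum_congr rfl fun n _ => ?_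
          ring
      _ = ∑ m ∈ F, ∑ n ∈ F, Kps / 2 * (nn (dd m f) * 2 ^ (-|m - n|)) + ∑ m ∈ F, ∑ n ∈ F, Kps / 2 * (nn (dd m f) * 2 ^ (-|m - n|)) := by
          congr 1
          rw [Finset.sum_comm]
          refine Finset.sum_congr rfl fun m _ => Finset.sum_congr rfl fun n _ => ?_
          rw [abs_sub_comm]
      _ = Kps * ∑ m ∈ F, nn (dd m f) * ∑ n ∈ F, 2 ^ (-|m - n|) := by
          rw [← two_mul, Finset.mul_sum, Finset.mul_sum]
          refine Finset.sum_congr rfl fun m _ => ?_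
          rw [Finset.mul_sum, Finset.mul_sum, Finset.mul_sum]
          refine Finset.sum_congr rfl fun n _ => ?_
          ring
      _ ≤ Kps * ∑ m ∈ F, nn (dd m f) * 4 := by
          refine mul_le_mul_of_nonneg_left (Finset.sum_le_sum fun m _ => ?_) hK.le
          exact mul_le_mul_of_nonneg_left (geo_sum F m) (nn_nonneg _)
      _ = _ := by rw [← Finset.sum_mul]; ring
  have hGc : Continuous G := continuous_finset_sum _ fun m _ => (hdd m).cont
  have hGi : Integrable (fun x => G x ^ 2) := by
    have e : (fun x => G x ^ 2) = fun x => ∑ m ∈ F, ∑ n ∈ F, dd m (dd m f) x * dd n (dd n f) x := by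
      ext x; rw [sq, Finset.sum_mul_sum]
    rw [e]
    exact integrable_finset_sum _ fun m _ => integrable_finset_sum _ fun n _ => hintg m n
  have h := cs_int hf.sq.int hGi (hf.mul hGc).int
  rw [hTG] at h
  have hT0 : 0 ≤ T := Finset.sum_nonneg fun m _ => nn_nonneg _
  have hn := nn_nonneg f
  rcases hT0.eq_or_lt with h0 | h0
  · rw [← h0]; positivity
  · have : T * T ≤ T * (4 * Kps * nn f) := by
      calc T * T = T ^ 2 := by ring
        _ ≤ nn f * ∫ x, G x ^ 2 := h
        _ ≤ nn f * (4 * Kps * T) := mul_le_mul_of_nonneg_left hGG hn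
        _ = _ := by ring
    exact le_of_mul_le_mul_left this h0

lemma N2_nn {r : ℝ} {f : ℂ → ℝ} (hf : CC r f) : N2 f = ENNReal.ofReal (nn f) := 
  (ofReal_integral_eq_lintegral_ofReal hf.sq.int (Filter.Eventually.of_forall fun _ => sq_nonneg _)).symm

lemma ortho {r : ℝ} {f : ℂ → ℝ} (hf : CC r f) : ∑' m : ℤ, N2 (dd m f) ≤ ENNReal.ofReal (4 * Kps) * N2 f := by
  rw [ENNReal.tsum_eq_iSup_sum]
  refine iSup_le fun F => ?_
  have hK := Kps_pos
  simp_rw [fun m => N2_nn (dd_CC hf m)]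
  rw [N2_nn hf, ← ENNReal.ofReal_mul (by positivity), ← ENNReal.ofReal_sum_of_nonneg fun m _ => nn_nonneg _]
  exact ENNReal.ofReal_le_ofReal (ortho_fin hf F)

end SM

namespace SM

/-- unit circle point -/
def ec (θ : ℝ) : ℂ := Complex.exp (θ * I)

@[fun_prop] lemma ec_cont : Continuous ec := by unfold ec; fun_prop
lemma ec_norm (θ : ℝ) : ‖ec θ‖ = 1 := by unfold ec; exact Complex.norm_exp_ofReal_mul_I θ

lemma tec_norm {t : ℝ} (ht : 0 ≤ t) (θ : ℝ) : ‖(t:ℂ) * ec θ‖ = t := by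
  rw [norm_mul, ec_norm, mul_one, Complex.norm_real, Real.norm_eq_abs, abs_of_nonneg ht]

/-- circular means -/
def SA (g : ℂ → ℝ) (t : ℝ) (x : ℂ) : ℝ := (2 * Real.pi)⁻¹ * ∫ θ in (-Real.pi)..Real.pi, g (x + t * ec θ)

/-- profile of a kernel -/
def AA (k : ℂ → ℝ) (t r : ℝ) : ℝ := SA k t (-(r:ℂ))

lemma pi_le : -Real.pi ≤ Real.pi := by linarith [Real.pi_pos]

lemma SA_mono {g k : ℂ → ℝ} (hg : Continuous g) (hk : Continuous k) {t : ℝ} {x : ℂ} (h : ∀ θ, g (x + t * ec θ) ≤ k (x + t * ec θ)) : SA g t x ≤ SA k t x := by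
  unfold SA
  refine mul_le_mul_of_nonneg_left ?_ (by positivity)
  refine intervalIntegral.integral_mono pi_le ?_ ?_ h
  · exact Continuous.intervalIntegrable (by fun_prop) _ _
  · exact Continuous.intervalIntegrable (by fun_prop) _ _

lemma SA_const (c t : ℝ) (x : ℂ) : SA (fun _ => c) t x = c := by
  unfold SA
  rw [intervalIntegral.integral_const, smul_eq_mul]
  have := Real.pi_pos
  field_simp; ring

lemma SA_le {g : ℂ → ℝ} (hg : Continuous g) {t c : ℝ} {x : ℂ} (h : ∀ θ, g (x + t * ec θ) ≤ c) : SA g t x ≤ c := 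
  (SA_mono hg continuous_const h).trans_eq (SA_const c t x)

lemma SA_add {g k : ℂ → ℝ} (hg : Continuous g) (hk : Continuous k) (t : ℝ) (x : ℂ) : SA (g + k) t x = SA g t x + SA k t x := by
  unfold SA
  rw [← mul_add, ← intervalIntegral.integral_add]
  · rfl
  · exact Continuous.intervalIntegrable (by fun_prop) _ _
  · exact Continuous.intervalIntegrable (by fun_prop) _ _

lemma AA_cont {k : ℂ → ℝ} (hk : Continuous k) : Continuous (Function.uncurry (AA k)) := by
  unfold AA SA Function.uncurry
  refine Continuous.mul continuous_const (intervalIntegral.continuous_parametric_intervalIntegral_of_continuous' ?_ _ _)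
  unfold Function.uncurry
  fun_prop

lemma AA_rot {k : ℂ → ℝ} (hk : Rad k) (t : ℝ) (w : ℂ) : SA k t (-w) = AA k t ‖w‖ := by
  unfold AA SA
  congr 1
  have hw : w = ‖w‖ * ec w.arg := (Complex.norm_mul_exp_arg_mul_I w).symm
  have h1 : ∀ θ : ℝ, k (-w + t * ec θ) = k (-(‖w‖:ℂ) + t * ec (θ - w.arg)) := by
    intro θ
    rw [← hk (ec w.arg) (-(‖w‖:ℂ) + t * ec (θ - w.arg)) (ec_norm _)]
    congr 1
    have : ec θ = ec w.arg * ec (θ - w.arg) := by unfold ec; rw [← Complex.exp_add]; congr 1; push_cast; ring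
    rw [this]; nth_rewrite 1 [hw]; ring
  simp_rw [h1]
  rw [intervalIntegral.integral_comp_sub_right (fun θ => k (-(‖w‖:ℂ) + t * ec θ))]
  have hper : Function.Periodic (fun θ => k (-(‖w‖:ℂ) + t * ec θ)) (2 * Real.pi) := by
    intro θ
    have : ec (θ + 2 * Real.pi) = ec θ := by
      unfold ec; push_cast; rw [add_mul, Complex.exp_add, Complex.exp_two_pi_mul_I, mul_one]
    simp only [this]
  have := hper.intervalIntegral_add_eq (-Real.pi - w.arg) (-Real.pi)
  convert this using 2 <;> ring

lemma SA_cv {k g : ℂ → ℝ} {r s : ℝ} (hk : CC r k) (hr : Rad k) (hg : CC s g) (t : ℝ) (x : ℂ) :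
    SA (cv k g) t x = ∫ y, g y * AA k t ‖y - x‖ := by
  obtain ⟨B, hB, hkB⟩ := hk.bdd
  have hkc := hk.cont
  have hgc := hg.cont
  have e1 : SA (cv k g) t x = ∫ θ in Ioc (-Real.pi) Real.pi, ∫ y, (2 * Real.pi)⁻¹ * (g y * k (x + t * ec θ - y)) := by
    unfold SA
    rw [intervalIntegral.integral_of_le pi_le, ← integral_const_mul]
    congr 1; ext θ; rw [cv_swap, integral_const_mul]
  rw [e1, integral_integral_swap]
  · congr 1; ext y
    rw [← AA_rot hr, integral_const_mul, integral_const_mul, SA, intervalIntegral.integral_of_le pi_le]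
    have : ∀ θ, -(y - x) + t * ec θ = x + t * ec θ - y := fun θ => by ring
    simp_rw [this]; ring
  · refine Integrable.const_mul ?_ _
    have h1 : Integrable (fun p : ℝ × ℂ => (1:ℝ) * g p.2) ((volume.restrict (Ioc (-Real.pi) Real.pi)).prod volume) := 
      (integrable_const (1:ℝ)).mul_prod hg.int
    simp_rw [one_mul] at h1
    refine h1.mul_bdd (c := B) (Continuous.aestronglyMeasurable (by fun_prop)) (Filter.Eventually.of_forall fun p => hkB _)

lemma AA_supp {k : ℂ → ℝ} {δ t r : ℝ} (hk : CC δ k) (ht : 0 ≤ t) (hr : 0 ≤ r) (h : AA k t r ≠ 0) : |r - t| ≤ δ := by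
  by_contra hc; push Not at hc
  apply h
  have : ∀ θ, k (-(r:ℂ) + t * ec θ) = 0 := by
    intro θ
    by_contra hne
    have h1 := hk.supp _ hne
    have h2 := abs_norm_sub_norm_le ((t:ℂ) * ec θ) (r:ℂ)
    rw [tec_norm ht, Complex.norm_real, Real.norm_eq_abs, abs_of_nonneg hr, abs_sub_comm, sub_eq_neg_add _ (r:ℂ)] at h2
    linarith
  unfold AA SA
  simp [this]

lemma AA_bd {k : ℂ → ℝ} {δ t r B : ℝ} (δ0 : 0 < δ) (hk : CC δ k) (hB : ∀ z, |k z| ≤ B) (ht : 1 ≤ t) (hr : 7/8 ≤ r) : |AA k t r| ≤ 2 * δ * B := by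
  have hB0 : 0 ≤ B := (abs_nonneg _).trans (hB 0)
  unfold AA SA
  rw [intervalIntegral.integral_of_le pi_le, integral_Ioc_eq_integral_Ioo, abs_mul, abs_of_pos (by have := Real.pi_pos; positivity)]
  obtain ⟨S, hS⟩ : ∃ S, S = {θ : ℝ | θ ∈ Ioo (-Real.pi) Real.pi ∧ Real.cos (θ - 0) ∈ Icc (1 - δ ^ 2) (1 - δ ^ 2 + δ ^ 2)} := ⟨_, rfl⟩
  have hvol : volume S ≤ ENNReal.ofReal (12 * δ) := by
    have := arc_cos (φ := 0) (a := 1 - δ ^ 2) (d := δ ^ 2) ⟨by linarith [Real.pi_pos], Real.pi_pos.le⟩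
    rwa [Real.sqrt_sq δ0.le, ← hS] at this
  have hSm : MeasurableSet S := by
    rw [hS]
    exact measurableSet_Ioo.inter (measurableSet_Icc.preimage (by fun_prop : Measurable fun θ : ℝ => Real.cos (θ - 0)))
  have h1 : ∫ θ in Ioo (-Real.pi) Real.pi, k (-(r:ℂ) + t * ec θ) = ∫ θ in S, k (-(r:ℂ) + t * ec θ) := by
    refine (setIntegral_eq_of_subset_of_forall_diff_eq_zero measurableSet_Ioo (by rw [hS]; exact fun θ h => h.1) fun θ hθ => ?_)
    by_contra hne
    have h1 := hk.supp _ hne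
    suffices hs : 1 - δ ^ 2 ≤ Real.cos (θ - 0) from hθ.2 (by rw [hS]; exact ⟨hθ.1, hs, by linarith [Real.cos_le_one (θ - 0)]⟩)
    have h2 : ‖-(r:ℂ) + t * ec θ‖ ^ 2 = r ^ 2 + t ^ 2 - 2 * r * t * Real.cos θ := by
      rw [← Complex.normSq_eq_norm_sq, ec, Complex.exp_mul_I, Complex.normSq_apply]
      simp [← Complex.ofReal_cos, ← Complex.ofReal_sin]
      linear_combination t ^ 2 * Real.sin_sq_add_cos_sq θ
    have h3 : ‖-(r:ℂ) + t * ec θ‖ ^ 2 ≤ δ ^ 2 := pow_le_pow_left₀ (norm_nonneg _) h1 2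
    rw [h2] at h3
    rw [sub_zero]
    have h4 : 1 ≤ 2 * (r * t) := by nlinarith only [hr, ht]
    have h5 := mul_le_mul_of_nonneg_right h4 (sub_nonneg.2 (Real.cos_le_one θ))
    linarith [sq_nonneg (r - t)]
  rw [h1]
  have hfin : volume S < ⊤ := hvol.trans_lt ENNReal.ofReal_lt_top
  have h2 : |∫ θ in S, k (-(r:ℂ) + t * ec θ)| ≤ B * volume.real S := by
    rw [← Real.norm_eq_abs]; exact norm_setIntegral_le_of_norm_le_const hfin fun θ _ => hB _
  have h3 : volume.real S ≤ 12 * δ := ENNReal.toReal_le_of_le_ofReal (by positivity) hvol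
  have h4 : (2 * Real.pi)⁻¹ ≤ 6⁻¹ := by gcongr; linarith [Real.pi_gt_three]
  calc _ ≤ 6⁻¹ * (B * (12 * δ)) := by gcongr; exact h2.trans (by gcongr)
    _ = _ := by ring

/-- cut off profile -/
def AC (k : ℂ → ℝ) (t r : ℝ) : ℝ := max 0 (min 1 (2 * r)) * AA k t r

lemma AC_eq {k : ℂ → ℝ} {δ t r : ℝ} (δ1 : δ ≤ 1/8) (hk : CC δ k) (ht : 1 ≤ t) (hr : 0 ≤ r) : AC k t r = AA k t r := by
  unfold AC
  by_cases h : AA k t r = 0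
  · rw [h, mul_zero]
  · have := abs_le.1 (AA_supp hk (by linarith) hr h)
    rw [min_eq_left (by linarith), max_eq_right zero_le_one, one_mul]

lemma AC_neg {k : ℂ → ℝ} {t r : ℝ} (hr : r ≤ 0) : AC k t r = 0 := by
  unfold AC
  rw [max_eq_left ((min_le_right _ _).trans (by linarith)), zero_mul]

def cut5 (y : ℂ) : ℝ := max 0 (min 1 (5 - ‖y‖))

lemma AC_mean {k : ℂ → ℝ} {δ t : ℝ} (δ1 : δ ≤ 1/8) (hk : CC δ k) (hrad : Rad k) (h0 : ∫ z, k z = 0) (ht : 1 ≤ t) (ht2 : t ≤ 2) :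
    ∫ r, r * AC k t r = 0 := by
  have hc : CC 5 cut5 := ⟨by unfold cut5; fun_prop, fun z hz => by
    by_contra h; push Not at h
    exact hz (max_eq_left ((min_le_right _ _).trans (by linarith)))⟩
  have hc1 : ∀ y, ‖y‖ ≤ 4 → cut5 y = 1 := fun y hy => by
    unfold cut5; rw [min_eq_left (by linarith), max_eq_right zero_le_one]
  have h1 := SA_cv hk hrad hc t 0
  have h2 : SA (cv k cut5) t 0 = 0 := by
    have : ∀ θ, cv k cut5 (0 + t * ec θ) = 0 := by
      intro θ
      rw [cv_def, ← h0]
      congr 1; ext z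
      by_cases hz : k z = 0
      · rw [hz, zero_mul]
      · have := hk.supp z hz
        rw [hc1, mul_one]
        have h3 := norm_sub_le ((t:ℂ) * ec θ) z
        rw [tec_norm (by linarith)] at h3
        rw [zero_add]; linarith
    unfold SA; simp_rw [this]; simp
  have h3 : ∫ y : ℂ, AC k t ‖y‖ = 0 := by
    rw [← h2, h1]
    congr 1; ext y
    rw [AC_eq δ1 hk ht (norm_nonneg _), sub_zero]
    by_cases h : AA k t ‖y‖ = 0
    · rw [h, mul_zero]
    · have := abs_le.1 (AA_supp hk (by linarith) (norm_nonneg _) h)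
      rw [hc1 y (by linarith), one_mul]
  rw [integral_fun_norm_addHaar, Complex.finrank_real_complex] at h3
  have h4 : ∫ r in Ioi (0:ℝ), r * AC k t r = 0 := by
    have hv : volume.real (ball (0:ℂ) 1) ≠ 0 := by
      rw [Measure.real, Complex.volume_ball]; simp
    simpa [hv] using h3
  rw [← h4]
  refine (setIntegral_eq_integral_of_forall_compl_eq_zero fun r hr => ?_).symm
  rw [AC_neg (by simpa using hr), mul_zero]

lemma AC_AP {k : ℂ → ℝ} {δ D : ℝ} (δ0 : 0 < δ) (δ1 : δ ≤ 1/8) (hk : CC δ k) (hrad : Rad k) (h0 : ∫ z, k z = 0) (D0 : 0 < D) (hB : ∀ z, |k z| ≤ D / (2 * δ ^ 2)) :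
    AP δ (fun t r => D⁻¹ * AC k t r) := by
  have hcont : Continuous (Function.uncurry (AC k)) := by
    have := AA_cont hk.cont
    unfold AC
    exact Continuous.mul (by fun_prop) this
  refine ⟨Continuous.mul continuous_const hcont, fun t ht ht2 => ⟨?_, ?_, ?_, ?_⟩⟩
  · exact Continuous.mul continuous_const (hcont.comp (by fun_prop : Continuous fun r : ℝ => (t, r)))
  · intro r hr
    have h1 : AC k t r ≠ 0 := right_ne_zero_of_mul hr
    have h2 : 0 ≤ r := by by_contra h; exact h1 (AC_neg (not_le.1 h).le)
    rw [AC_eq δ1 hk ht h2] at h1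
    exact AA_supp hk (by linarith) h2 h1
  · intro r
    rcases le_or_gt r 0 with h | h
    · rw [AC_neg h, mul_zero, abs_zero]; positivity
    · rw [AC_eq δ1 hk ht h.le]
      by_cases h1 : AA k t r = 0
      · rw [h1, mul_zero, abs_zero]; positivity
      · have h2 := abs_le.1 (AA_supp hk (by linarith) h.le h1)
        have h3 := AA_bd δ0 hk hB ht (by linarith : 7/8 ≤ r)
        rw [abs_mul, abs_of_pos (inv_pos.2 D0)]
        calc _ ≤ D⁻¹ * (2 * δ * (D / (2 * δ ^ 2))) := by gcongr
          _ = 1 / δ := by field_simp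
  · have := AC_mean δ1 hk hrad h0 ht ht2
    have e : ∀ r, r * (D⁻¹ * AC k t r) = D⁻¹ * (r * AC k t r) := fun r => by ring
    simp_rw [e]
    rw [integral_const_mul, this, mul_zero]

lemma SA_FG {k g : ℂ → ℝ} {δ s D t : ℝ} (δ1 : δ ≤ 1/8) (hk : CC δ k) (hrad : Rad k) (hg : CC s g) (D0 : 0 < D) (ht : 1 ≤ t) (x : ℂ) :
    SA (cv k g) t x = D * FG g (fun t r => D⁻¹ * AC k t r) t x := by
  rw [SA_cv hk hrad hg, FG, ← integral_const_mul]
  congr 1; ext y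
  rw [AC_eq δ1 hk ht (norm_nonneg _)]
  field_simp

end SM

namespace SM

def h0 : ℂ → ℝ := (3:ℝ) • (ph + dl 1 ph) - (2:ℝ) • (cv ph ph + cv ph (dl 1 ph) + cv (dl 1 ph) (dl 1 ph))
def P0 : ℂ → ℝ := (3:ℝ) • cv ph ph - (2:ℝ) • cv (cv ph ph) ph

lemma paa : CC 2 (cv ph ph) := (ph_CC.cv ph_CC).mono (by norm_num)
lemma pab : CC 2 (cv ph (dl 1 ph)) := (ph_CC.cv dl1_CC).mono (by norm_num)
lemma pbb : CC 2 (cv (dl 1 ph) (dl 1 ph)) := (dl1_CC.cv dl1_CC).mono (by norm_num)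

lemma h0_CC : CC 2 h0 := 
  (((ph_CC.add dl1_CC).smul 3).mono (by norm_num)).sub (((paa.add pab).add pbb).smul 2)

lemma P0_CC : CC 3 P0 := ((paa.smul 3).mono (by norm_num)).sub (((paa.cv ph_CC).smul 2).mono (by norm_num))

lemma h0_rad : Rad h0 := by
  have b := ph_rad.dl 1
  exact ((ph_rad.add b).smul 3).sub ((((ph_rad.cv ph_rad).add (ph_rad.cv b)).add (b.cv b)).smul 2)

lemma dl1_int : ∫ z, dl 1 ph z = 1 := by rw [int_dl, ph_int]

lemma h0_int : ∫ z, h0 z = 0 := by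
  unfold h0
  have e : ∀ z, ((3:ℝ) • (ph + dl 1 ph) - (2:ℝ) • (cv ph ph + cv ph (dl 1 ph) + cv (dl 1 ph) (dl 1 ph))) z 
      = 3 * (ph z + dl 1 ph z) - 2 * (cv ph ph z + cv ph (dl 1 ph) z + cv (dl 1 ph) (dl 1 ph) z) := fun z => rfl
  simp_rw [e]
  rw [integral_sub (f := fun z => 3 * (ph z + dl 1 ph z)) (g := fun z => 2 * (cv ph ph z + cv ph (dl 1 ph) z + cv (dl 1 ph) (dl 1 ph) z)) ((ph_CC.int.add dl1_CC.int).const_mul 3) (((paa.int.add pab.int).add pbb.int).const_mul 2), integral_const_mul, integral_const_mul,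
    integral_add (f := fun z => cv ph ph z + cv ph (dl 1 ph) z) (paa.int.add pab.int) pbb.int, integral_add paa.int pab.int, integral_add ph_CC.int dl1_CC.int, int_cv ph_CC ph_CC, int_cv ph_CC dl1_CC, int_cv dl1_CC dl1_CC, ph_int, dl1_int]
  norm_num

lemma P0_int : ∫ z, P0 z = 1 := by
  unfold P0
  have e : ∀ z, ((3:ℝ) • cv ph ph - (2:ℝ) • cv (cv ph ph) ph) z = 3 * cv ph ph z - 2 * cv (cv ph ph) ph z := fun z => rfl
  simp_rw [e]
  rw [integral_sub (paa.int.const_mul 3) ((paa.cv ph_CC).int.const_mul 2), integral_const_mul, integral_const_mul, int_cv paa ph_CC, int_cv ph_CC ph_CC, ph_int]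
  norm_num

lemma tele0 : dl 1 P0 - P0 = cv h0 ps := by
  have e1 : cv (cv ph (dl 1 ph)) ph = cv (cv ph ph) (dl 1 ph) := by
    rw [cv_assoc ph_CC dl1_CC ph_CC, cv_comm (dl 1 ph) ph, ← cv_assoc ph_CC ph_CC dl1_CC]
  have e2 : cv (cv (dl 1 ph) (dl 1 ph)) ph = cv (cv ph (dl 1 ph)) (dl 1 ph) := by
    rw [cv_assoc dl1_CC dl1_CC ph_CC, cv_comm (dl 1 ph) ph, cv_comm (dl 1 ph) (cv _ _)]
  have e3 := cv_comm (dl 1 ph) ph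
  unfold ps P0 h0
  rw [dl_sub, dl_smul, dl_smul, dl_cv, dl_cv, dl_cv,
    cv_sub (r := 2) (((ph_CC.add dl1_CC).smul 3).mono (by norm_num) |>.sub (((paa.add pab).add pbb).smul 2)) dl1_CC ph_CC,
    sub_cv ((ph_CC.add dl1_CC).smul 3) (((paa.add pab).add pbb).smul 2) dl1_CC, sub_cv ((ph_CC.add dl1_CC).smul 3) (((paa.add pab).add pbb).smul 2) ph_CC]
  simp only [smul_cv]
  rw [add_cv ph_CC dl1_CC dl1_CC, add_cv ph_CC dl1_CC ph_CC, add_cv (paa.add pab) pbb dl1_CC, add_cv (paa.add pab) pbb ph_CC, add_cv paa pab dl1_CC, add_cv paa pab ph_CC, e1, e2, e3]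
  ext z
  simp only [Pi.sub_apply, Pi.add_apply, Pi.smul_apply, smul_eq_mul]
  ring

lemma tele {g : ℂ → ℝ} {s : ℝ} (hg : CC s g) (m : ℤ) : cv (dl (m + 1) P0) g = cv (dl m P0) g + cv (dl m h0) (dd m g) := by
  have h : dl (m + 1) P0 = dl m P0 + cv (dl m h0) (dl m ps) := by
    rw [← dl_cv, ← tele0, dl_sub, dl_dl]; abel
  rw [h, add_cv (P0_CC.dl m) ((h0_CC.dl m).cv (ps_CC.dl m)) hg, cv_assoc (h0_CC.dl m) (ps_CC.dl m) hg, dd]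

lemma h0_bd : ∃ D : ℝ, 1 ≤ D ∧ ∀ z, |h0 z| ≤ D / 8 := by
  obtain ⟨B, hB, h⟩ := h0_CC.bdd
  exact ⟨8 * B + 1, by linarith, fun z => (h z).trans (by linarith)⟩

def DD : ℝ := Classical.choose h0_bd
lemma DD_one : 1 ≤ DD := (Classical.choose_spec h0_bd).1
lemma DD_bd (z : ℂ) : |h0 z| ≤ DD / 8 := (Classical.choose_spec h0_bd).2 z

def GG : ℝ := 1 + ∫ z, |ps z|
lemma GG_one : 1 ≤ GG := by
  have : 0 ≤ ∫ z, |ps z| := integral_nonneg fun _ => abs_nonneg _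
  unfold GG; linarith

lemma dd_bd {f : ℂ → ℝ} {s : ℝ} (hf : CC s f) (h1 : ∀ y, |f y| ≤ 1) (m : ℤ) (x : ℂ) : |dd m f x| ≤ GG := by
  rw [dd, cv_def]
  have h := ((ps_CC.dl m).abs).int
  calc |∫ t, dl m ps t * f (x - t)| ≤ ∫ t, |dl m ps t| := by
        rw [← Real.norm_eq_abs]
        refine norm_integral_le_of_norm_le h (Filter.Eventually.of_forall fun t => ?_)
        rw [norm_mul]; exact mul_le_of_le_one_right (norm_nonneg _) (h1 _)
    _ = ∫ t, |ps t| := int_abs_dl _ _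
    _ ≤ GG := by unfold GG; linarith

lemma cv_scale (m l : ℤ) (k g : ℂ → ℝ) (z : ℂ) : cv (dl m k) g ((2:ℝ) ^ l • z) = cv (dl (l + m) k) (fun z => g ((2:ℝ) ^ l • z)) z := by
  have h := congrFun (dl_cv (dl m k) g l) z
  rw [dl_dl] at h
  have e : dl l g = (((2:ℝ) ^ l) ^ 2) • (fun z => g ((2:ℝ) ^ l • z)) := by ext w; simp [dl]
  rw [e, cv_smul] at h
  simp only [dl, Pi.smul_apply, smul_eq_mul] at h
  exact mul_left_cancel₀ (pow_pos (p2 l) 2).ne' h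

lemma SA_scale (u : ℂ → ℝ) {c : ℝ} (hc : 0 < c) (t : ℝ) (x : ℂ) : SA u t x = SA (fun z => u (c • z)) (t / c) (c⁻¹ • x) := by
  unfold SA
  congr 2; ext θ; congr 1
  rw [smul_add, smul_smul, mul_inv_cancel₀ hc.ne', one_smul, Complex.real_smul, ← mul_assoc, ← Complex.ofReal_mul, mul_div_cancel₀ _ hc.ne']

def gsc (l m : ℤ) (f : ℂ → ℝ) (z : ℂ) : ℝ := GG⁻¹ * dd m f ((2:ℝ) ^ l • z)
def Anp (n : ℕ) (t r : ℝ) : ℝ := DD⁻¹ * AC (dl (n + 4) h0) t r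

lemma hn_CC (n : ℕ) : CC ((2:ℝ) ^ (-3 - (n:ℤ))) (dl (n + 4) h0) := by
  have := h0_CC.dl (n + 4)
  have e : (2:ℝ) * 2 ^ (-((n:ℤ) + 4)) = 2 ^ (-3 - (n:ℤ)) := by
    rw [← zpow_one_add₀ (by norm_num)]; congr 1; ring
  rwa [e] at this

lemma p2_le (n : ℕ) : (2:ℝ) ^ (-3 - (n:ℤ)) ≤ 1 / 8 := by
  calc (2:ℝ) ^ (-3 - (n:ℤ)) ≤ 2 ^ (-3:ℤ) := zpow_le_zpow_right₀ (by norm_num) (by omega)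
    _ = 1 / 8 := by norm_num

lemma Anp_AP (n : ℕ) : AP ((2:ℝ) ^ (-3 - (n:ℤ))) (Anp n) := by
  refine AC_AP (p2 _) (p2_le n) (hn_CC n) (h0_rad.dl _) (by rw [int_dl, h0_int]) (by linarith [DD_one]) fun z => ?_
  rw [dl, abs_mul, abs_of_pos (pow_pos (p2 _) 2)]
  calc _ ≤ ((2:ℝ) ^ ((n:ℤ) + 4)) ^ 2 * (DD / 8) := by gcongr; exact DD_bd _
    _ = _ := by
      rw [show (n:ℤ) + 4 = 1 - (-3 - (n:ℤ)) by ring, zpow_sub₀ (by norm_num), zpow_one]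
      have := (p2 (-3 - (n:ℤ))).ne'
      field_simp; ring

lemma gsc_CC {f : ℂ → ℝ} {s : ℝ} (hf : CC s f) (l m : ℤ) : Continuous (gsc l m f) ∧ ∃ r, CC r (gsc l m f) := by
  have h := dd_CC hf m
  have h1 : gsc l m f = (GG⁻¹ * (((2:ℝ) ^ l) ^ 2)⁻¹) • dl l (dd m f) := by
    ext z; simp only [gsc, dl, Pi.smul_apply, smul_eq_mul]
    have := (pow_pos (p2 l) 2).ne'
    field_simp
  have := (h.dl l).smul (GG⁻¹ * (((2:ℝ) ^ l) ^ 2)⁻¹)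
  rw [← h1] at this
  exact ⟨this.cont, _, this⟩

lemma gsc_N2 {f : ℂ → ℝ} {s : ℝ} (hf : CC s f) (l m : ℤ) : ENNReal.ofReal (((2:ℝ) ^ l) ^ 2) * N2 (gsc l m f) ≤ N2 (dd m f) := by
  obtain ⟨-, r, h⟩ := gsc_CC hf l m
  rw [N2_nn h, N2_nn (dd_CC hf m), ← ENNReal.ofReal_mul (pow_pos (p2 l) 2).le]
  refine ENNReal.ofReal_le_ofReal ?_
  have e : nn (gsc l m f) = (GG⁻¹) ^ 2 * ((((2:ℝ) ^ l) ^ 2)⁻¹ * nn (dd m f)) := by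
    unfold nn gsc
    simp_rw [mul_pow]
    rw [integral_const_mul, int_scale (fun z => dd m f z ^ 2)]
  rw [e]
  have hG := GG_one
  have hG1 : GG⁻¹ ^ 2 ≤ 1 := pow_le_one₀ (by positivity) (inv_le_one_of_one_le₀ hG)
  have := pow_pos (p2 l) 2
  calc _ = GG⁻¹ ^ 2 * nn (dd m f) := by field_simp
    _ ≤ _ := mul_le_of_le_one_left (nn_nonneg _) hG1

lemma scale_vol (l : ℤ) (S : Set ℂ) : volume ((fun x : ℂ => ((2:ℝ) ^ l)⁻¹ • x) ⁻¹' S) = ENNReal.ofReal (((2:ℝ) ^ l) ^ 2) * volume S := by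
  rw [Measure.addHaar_preimage_smul _ (inv_pos.2 (p2 l)).ne', Complex.finrank_real_complex, inv_pow, inv_inv, abs_of_pos (pow_pos (p2 l) 2)]

/-- frequency pieces -/
def FP (l : ℤ) (n : ℕ) (f : ℂ → ℝ) : ℝ → ℂ → ℝ := SA (cv (dl (n + 4 - l) h0) (dd (n + 4 - l) f))

lemma FP_eq {f : ℂ → ℝ} {s : ℝ} (hf : CC s f) (l : ℤ) (n : ℕ) {t : ℝ} (ht : (2:ℝ) ^ l ≤ t) (x : ℂ) :
    FP l n f t x = (DD * GG) * FG (gsc l (n + 4 - l) f) (Anp n) (t / 2 ^ l) (((2:ℝ) ^ l)⁻¹ • x) := by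
  obtain ⟨-, r, h⟩ := gsc_CC hf l (n + 4 - l)
  have hD := DD_one
  have hG := GG_one
  have e := SA_FG (D := DD) (t := t / 2 ^ l) (p2_le n) (hn_CC n) (h0_rad.dl _) h (by linarith) ((one_le_div₀ (p2 l)).2 ht) (((2:ℝ) ^ l)⁻¹ • x)
  have e2 : (fun z => cv (dl (n + 4 - l) h0) (dd (n + 4 - l) f) ((2:ℝ) ^ l • z)) = GG • cv (dl (n + 4) h0) (gsc l (n + 4 - l) f) := by
    ext z
    rw [cv_scale, ← cv_smul]
    congr 2
    · ring
    · ext w; simp only [gsc, Pi.smul_apply, smul_eq_mul]; field_simp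
  rw [FP, SA_scale _ (p2 l), e2]
  have e3 : ∀ (u : ℂ → ℝ) (t : ℝ) (x : ℂ), SA (GG • u) t x = GG * SA u t x := by
    intro u t x; simp only [SA, Pi.smul_apply, smul_eq_mul]; rw [intervalIntegral.integral_const_mul]; ring
  rw [e3, e]
  change _ = DD * GG * FG (gsc l (n + 4 - l) f) (fun t r => DD⁻¹ * AC (dl (n + 4) h0) t r) _ _
  ring

def CW : ℝ := (DD * GG) ^ 3 * (256 * (7 * KW + 108))

lemma CW_pos : 0 < CW := by
  have := DD_one; have := GG_one; have := KW_nonneg; unfold CW; positivity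

section
variable {f : ℂ → ℝ} {s lam η : ℝ} 

lemma lam_aux (l0 : 0 < lam) (η1 : η ≤ 1) : (lam / (DD * GG)) ^ (-2 - η) ≤ (DD * GG) ^ 3 * lam ^ (-2 - η) := by
  have h1 : 1 ≤ DD * GG := one_le_mul_of_one_le_of_one_le DD_one GG_one
  have h2 : 0 < DD * GG := by linarith
  rw [div_eq_mul_inv, Real.mul_rpow l0.le (by positivity), mul_comm, Real.inv_rpow h2.le, ← Real.rpow_neg h2.le]
  gcongr
  rw [← Real.rpow_natCast]
  exact Real.rpow_le_rpow_of_exponent_le h1 (by norm_num; linarith)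

lemma Wtrans (hf : CC s f) (l : ℤ) (n : ℕ) (Q : ℂ → Prop) {R : ℝ}  
    (h : volume {x | Q x ∧ ∃ τ ∈ Icc (1:ℝ) 2, lam / (DD * GG) < FG (gsc l (n + 4 - l) f) (Anp n) τ x} ≤ ENNReal.ofReal R * N2 (gsc l (n + 4 - l) f)) : 
    volume {x | Q (((2:ℝ) ^ l)⁻¹ • x) ∧ ∃ t ∈ Icc ((2:ℝ) ^ l) (2 ^ (l + 1)), lam < FP l n f t x} ≤ ENNReal.ofReal R * N2 (dd (n + 4 - l) f) := by
  have hDG : 0 < DD * GG := mul_pos (by linarith [DD_one]) (by linarith [GG_one])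
  calc _ ≤ volume ((fun x : ℂ => ((2:ℝ) ^ l)⁻¹ • x) ⁻¹' {x | Q x ∧ ∃ τ ∈ Icc (1:ℝ) 2, lam / (DD * GG) < FG (gsc l (n + 4 - l) f) (Anp n) τ x}) := by
        refine measure_mono ?_
        rintro x ⟨hQ, t, ⟨ht1, ht2⟩, h⟩
        refine ⟨hQ, t / 2 ^ l, ⟨(one_le_div₀ (p2 l)).2 ht1, ?_⟩, ?_⟩
        · rw [div_le_iff₀ (p2 l), ← zpow_one_add₀ (by norm_num), add_comm]; exact ht2
        · rw [FP_eq hf l n ht1] at h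
          rwa [div_lt_iff₀' hDG]
    _ = _ := scale_vol l _
    _ ≤ ENNReal.ofReal (((2:ℝ) ^ l) ^ 2) * (ENNReal.ofReal R * N2 (gsc l (n + 4 - l) f)) := by gcongr
    _ = ENNReal.ofReal R * (ENNReal.ofReal (((2:ℝ) ^ l) ^ 2) * N2 (gsc l (n + 4 - l) f)) := by ring
    _ ≤ _ := by gcongr; exact gsc_N2 hf l _

lemma gsc_bd (hf : CC s f) (h1 : ∀ y, |f y| ≤ 1) (l m : ℤ) (z : ℂ) : |gsc l m f z| ≤ 1 := by
  have hG := GG_one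
  rw [gsc, abs_mul, abs_of_pos (by positivity), inv_mul_le_iff₀ (by positivity), mul_one]
  exact dd_bd hf h1 _ _

lemma lam_le1 (l1 : lam ≤ 1) : lam / (DD * GG) ≤ 1 := by
  have h1 : 1 ≤ DD * GG := one_le_mul_of_one_le_of_one_le DD_one GG_one
  exact (div_le_one₀ (by linarith)).2 (by linarith)

lemma lam_pos (l0 : 0 < lam) : 0 < lam / (DD * GG) := div_pos l0 (mul_pos (by linarith [DD_one]) (by linarith [GG_one]))

lemma Wc (hf : CC s f) (h1 : ∀ y, |f y| ≤ 1) (l0 : 0 < lam) (l1 : lam ≤ 1) (η0 : 0 < η) (η1 : η ≤ 1) (l : ℤ) (n k : ℕ) :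
    volume {x : ℂ | ‖x‖ ≤ 2 ^ (l - 3 - k) ∧ ∃ t ∈ Icc ((2:ℝ) ^ l) (2 ^ (l + 1)), lam < FP l n f t x} ≤ 
      ENNReal.ofReal (CW * lam ^ (-2 - η) * 2 ^ (-(k:ℤ)) * gn η (2 ^ (-3 - (n:ℤ))) (2 ^ (-3 - (k:ℤ)))) * N2 (dd (n + 4 - l) f) := by
  have h := Wc0 (l := lam / (DD * GG)) (p2 _) (p2_le n) (p2 (-3 - (k:ℤ))) ((p2_le k).trans (by norm_num)) (Anp_AP n) (gsc_CC hf l (n + 4 - l)).1 (gsc_bd hf h1 l _) (lam_pos l0) (lam_le1 l1) η0 η1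
  have h' := Wtrans hf l n (fun x => x ∈ closedBall (0:ℂ) (2 ^ (-3 - (k:ℤ)))) h
  refine (measure_mono ?_).trans (h'.trans ?_)
  · rintro x ⟨hx, hr⟩
    refine ⟨?_, hr⟩
    rw [mem_closedBall_zero_iff, norm_smul, norm_inv, Real.norm_eq_abs, abs_of_pos (p2 l), inv_mul_le_iff₀ (p2 l), ← zpow_add₀ (by norm_num)]
    rwa [show l + (-3 - (k:ℤ)) = l - 3 - k by ring]
  · gcongr ENNReal.ofReal ?_ * _
    have hg : 0 ≤ gn η (2 ^ (-3 - (n:ℤ))) (2 ^ (-3 - (k:ℤ))) := by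
      have := p2 (-3 - (n:ℤ)); have := p2 (-3 - (k:ℤ)); unfold gn; split_ifs <;> positivity
    have hK := KW_nonneg
    have e : (2:ℝ) ^ (-3 - (k:ℤ)) = 2 ^ (-(k:ℤ)) / 8 := by rw [show -3 - (k:ℤ) = -(k:ℤ) - 3 by ring, zpow_sub₀ (by norm_num)]; norm_num
    have hp := p2 (-(k:ℤ))
    have hL : 0 < lam ^ (-2 - η) := Real.rpow_pos_of_pos l0 _
    calc _ ≤ (7 * KW + 108) * (((DD * GG) ^ 3 * lam ^ (-2 - η)) * 2 ^ (-(k:ℤ)) * gn η (2 ^ (-3 - (n:ℤ))) (2 ^ (-3 - (k:ℤ)))) := by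
          refine mul_le_mul_of_nonneg_left (mul_le_mul_of_nonneg_right (mul_le_mul (lam_aux l0 η1) (by rw [e]; linarith) (p2 _).le ?_) hg) (by positivity)
          have := lam_pos l0
          exact le_trans (by positivity) (lam_aux l0 η1)
      _ = (CW / 256) * lam ^ (-2 - η) * 2 ^ (-(k:ℤ)) * gn η (2 ^ (-3 - (n:ℤ))) (2 ^ (-3 - (k:ℤ))) := by unfold CW; ring
      _ ≤ _ := by gcongr; linarith [CW_pos]

lemma Wa (hf : CC s f) (h1 : ∀ y, |f y| ≤ 1) (l0 : 0 < lam) (l1 : lam ≤ 1) (η0 : 0 < η) (η1 : η ≤ 1) (l : ℤ) (n : ℕ) :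
    volume {x : ℂ | ∃ t ∈ Icc ((2:ℝ) ^ l) (2 ^ (l + 1)), lam < FP l n f t x} ≤ 
      ENNReal.ofReal (CW * lam ^ (-2 - η) * ((2:ℝ) ^ (-3 - (n:ℤ))) ^ (η / 7200)) * N2 (dd (n + 4 - l) f) := by
  have h := Wa0 (l := lam / (DD * GG)) (p2 _) (p2_le n) (Anp_AP n) (gsc_CC hf l (n + 4 - l)).1 (gsc_bd hf h1 l _) (lam_pos l0) (lam_le1 l1) η0 η1
  have h' := Wtrans hf l n (fun x => True) (by simpa using h)
  simp only [true_and] at h'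
  refine h'.trans ?_
  gcongr ENNReal.ofReal ?_ * _
  have hK := KW_nonneg
  have := p2 (-3 - (n:ℤ))
  have hL : 0 < lam ^ (-2 - η) := Real.rpow_pos_of_pos l0 _
  calc _ ≤ 256 * (7 * KW + 108) * (((DD * GG) ^ 3 * lam ^ (-2 - η)) * ((2:ℝ) ^ (-3 - (n:ℤ))) ^ (η / 7200)) := by
        gcongr
        exact lam_aux l0 η1
    _ = _ := by unfold CW; ring

end
end SM

namespace SM

lemma weak11 (ν : Measure ℂ) [IsFiniteMeasure ν] {S : Set ℂ} (hS : ∀ x ∈ S, ∃ r : ℝ, 0 < r ∧ ENNReal.ofReal (r ^ 2) ≤ ν (closedBall x r)) :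
    volume S ≤ 100 * ν univ := by
  classical
  choose! r hr hrS using hS
  obtain ⟨u, huS, hd, hcov⟩ := Vitali.exists_disjoint_subfamily_covering_enlargement_closedBall S (fun x => x) r (√(ν univ).toReal)
    (fun x hx => Real.le_sqrt_of_sq_le (by
      have := (hrS x hx).trans (measure_mono (subset_univ _))
      exact (ENNReal.ofReal_le_iff_le_toReal (measure_ne_top _ _)).1 this)) 5 (by norm_num)
  have hcu : u.Countable := hd.countable_of_nonempty_interior fun x hx => by
    refine ⟨x, ball_subset_interior_closedBall (mem_ball_self (hr x (huS hx)))⟩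
  calc volume S ≤ volume (⋃ b ∈ u, closedBall b (5 * r b)) := by
        refine measure_mono fun x hx => ?_
        obtain ⟨b, hb, h⟩ := hcov x hx
        exact mem_biUnion hb (h (mem_closedBall_self (hr x hx).le))
    _ ≤ ∑' b : u, volume (closedBall (b:ℂ) (5 * r b)) := measure_biUnion_le _ hcu _
    _ ≤ ∑' b : u, 100 * ν (closedBall (b:ℂ) (r b)) := by
        refine ENNReal.tsum_le_tsum fun b => ?_
        rw [Complex.volume_closedBall]
        have hb := huS b.2
        have hpi : ((NNReal.pi : ℝ≥0) : ℝ≥0∞) ≤ 4 := by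
          have : NNReal.pi ≤ 4 := Real.pi_le_four
          exact_mod_cast this
        calc ENNReal.ofReal (5 * r b) ^ 2 * NNReal.pi ≤ ENNReal.ofReal (5 * r b) ^ 2 * 4 := by gcongr
          _ = 100 * ENNReal.ofReal (r b ^ 2) := by
            rw [ENNReal.ofReal_mul (by norm_num), mul_pow, ← ENNReal.ofReal_pow (hr _ hb).le, ENNReal.ofReal_ofNat]
            ring
          _ ≤ _ := by gcongr; exact hrS _ hb
    _ = 100 * ν (⋃ b ∈ u, closedBall b (r b)) := by
        rw [ENNReal.tsum_mul_left, measure_biUnion hcu hd fun b _ => measurableSet_closedBall]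
    _ ≤ _ := by gcongr; exact subset_univ _

section
variable {g : ℂ → ℝ} {s lam : ℝ} 

lemma approx (hg : CC s g) {ε : ℝ} (hε : 0 < ε) : ∃ N0 : ℤ, ∀ M ≥ N0, ∀ x, |g x - cv (dl M P0) g x| ≤ ε := by
  have hu := hg.hcs.uniformContinuous_of_continuous hg.cont
  obtain ⟨I, hI⟩ : ∃ I, I = ∫ z, |P0 z| := ⟨_, rfl⟩
  have hI0 : 0 ≤ I := by rw [hI]; exact integral_nonneg fun _ => abs_nonneg _
  obtain ⟨δ, δ0, hδ⟩ := Metric.uniformContinuous_iff.1 hu (ε / (I + 1)) (by positivity)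
  obtain ⟨n, hn⟩ := exists_pow_lt_of_lt_one (div_pos δ0 (by norm_num : (0:ℝ) < 3)) (by norm_num : (1/2:ℝ) < 1)
  refine ⟨n, fun M hM x => ?_⟩
  have hP := P0_CC.dl M
  have hi : Integrable (fun t => dl M P0 t * g (x - t)) := hP.exi hg.cont x
  have e : g x - cv (dl M P0) g x = ∫ t, dl M P0 t * (g x - g (x - t)) := by
    simp_rw [mul_sub]
    rw [integral_sub (hP.int.mul_const _) hi, integral_mul_const, int_dl, P0_int, one_mul, cv_def]
  rw [e, ← Real.norm_eq_abs]
  have hb := norm_integral_le_of_norm_le (f := fun t => dl M P0 t * (g x - g (x - t))) (hP.abs.int.mul_const (ε / (I + 1))) (Filter.Eventually.of_forall fun t => ?_)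
  · refine hb.trans ?_
    rw [integral_mul_const, int_abs_dl, ← hI, ← mul_div_assoc, div_le_iff₀ (by positivity)]
    nlinarith only [hε]
  · rw [norm_mul, Real.norm_eq_abs, Real.norm_eq_abs]
    by_cases h0 : dl M P0 t = 0
    · rw [h0]; simp
    · have ht := hP.supp t h0
      have h2 : (2:ℝ) ^ (-M) ≤ (1/2) ^ n := by
        rw [one_div, inv_pow, ← zpow_natCast, ← zpow_neg]
        exact zpow_le_zpow_right₀ (by norm_num) (by omega)
      gcongr
      have h3 := hδ (a := x) (b := x - t) (by rw [dist_eq_norm, sub_sub_cancel]; linarith)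
      rw [Real.dist_eq] at h3
      exact h3.le

lemma FP_tele (hg : CC s g) (l : ℤ) (t : ℝ) (x : ℂ) (N : ℕ) : 
    SA (cv (dl (4 - l + N) P0) g) t x = SA (cv (dl (4 - l) P0) g) t x + ∑ n ∈ Finset.range N, FP l n g t x := by
  induction N with
  | zero => simp
  | succ N ih =>
    rw [Finset.sum_range_succ, ← add_assoc, ← ih]
    have h := tele hg (4 - l + N)
    have e : (4 - l + ((N + 1 : ℕ) : ℤ)) = 4 - l + N + 1 := by push_cast; ring
    rw [e, h, SA_add ((P0_CC.dl _).cv hg).cont ((h0_CC.dl _).cv (dd_CC hg _)).cont, FP]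
    rw [show 4 - l + (N:ℤ) = N + 4 - l by ring]

lemma split (hg : CC s g) (l0 : 0 < lam) {c : ℕ → ℝ} (hc : ∀ N, ∑ n ∈ Finset.range N, c n ≤ 1/2) {l : ℤ} {t : ℝ} {x : ℂ} (h : lam < SA g t x) :
    lam / 4 < SA (cv (dl (4 - l) P0) g) t x ∨ ∃ n, c n * lam < FP l n g t x := by
  by_contra hcon
  push Not at hcon
  obtain ⟨hc1, hc2⟩ := hcon
  obtain ⟨N0, hN⟩ := approx hg (by positivity : 0 < lam / 8)
  obtain ⟨N, hN2⟩ : ∃ N : ℕ, N0 ≤ 4 - l + N := ⟨(N0 - 4 + l).toNat, by omega⟩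
  have hcvc := ((P0_CC.dl (4 - l + N)).cv hg).cont
  have h1 : SA g t x ≤ SA (cv (dl (4 - l + N) P0) g + fun _ => lam / 8) t x := by
    refine SA_mono hg.cont (hcvc.add continuous_const) fun θ => ?_
    have := (abs_le.1 (hN _ hN2 (x + t * ec θ))).2
    simp only [Pi.add_apply]; linarith
  rw [SA_add hcvc continuous_const, SA_const, FP_tele hg] at h1
  have h2 : ∑ n ∈ Finset.range N, FP l n g t x ≤ lam / 2 := by
    calc _ ≤ ∑ n ∈ Finset.range N, c n * lam := Finset.sum_le_sum fun n _ => hc2 n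
      _ = (∑ n ∈ Finset.range N, c n) * lam := by rw [Finset.sum_mul]
      _ ≤ 1/2 * lam := by gcongr; exact hc N
      _ = _ := by ring
  linarith

lemma P0_bd : ∃ D : ℝ, 1 ≤ D ∧ ∀ z, |P0 z| ≤ D := by
  obtain ⟨B, hB, h⟩ := P0_CC.bdd
  exact ⟨B + 1, by linarith, fun z => (h z).trans (by linarith)⟩

def KL : ℝ := 1024 * Classical.choose P0_bd
lemma KL_one : 1 ≤ KL := by unfold KL; linarith [(Classical.choose_spec P0_bd).1]
lemma KL_bd (z : ℂ) : |P0 z| ≤ KL / 1024 := by unfold KL; linarith [(Classical.choose_spec P0_bd).2 z]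

lemma low (hg : CC s g) (hg0 : ∀ y, 0 ≤ g y) {l : ℤ} {t : ℝ} {x : ℂ} (h1 : (2:ℝ) ^ l ≤ t) (h2 : t ≤ 2 ^ (l + 1)) (h : lam / 4 < SA (cv (dl (4 - l) P0) g) t x) :
    ENNReal.ofReal (lam * (2 ^ l) ^ 2) ≤ ENNReal.ofReal KL * ∫⁻ y in closedBall x (2 ^ (l + 2)), ENNReal.ofReal (g y) := by
  have hl := p2 l
  have hK := KL_one
  have hP := P0_CC.dl (4 - l)
  have e4 : (2:ℝ) ^ (4 - l) = 16 / 2 ^ l := by rw [zpow_sub₀ (by norm_num)]; norm_num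
  have e5 : (2:ℝ) ^ (-(4 - l)) = 2 ^ l / 16 := by rw [zpow_neg, e4, inv_div]
  have e1 : (2:ℝ) ^ (l + 1) = 2 * 2 ^ l := by rw [zpow_add₀ (by norm_num)]; norm_num; ring
  have e2 : (2:ℝ) ^ (l + 2) = 4 * 2 ^ l := by rw [zpow_add₀ (by norm_num)]; norm_num; ring
  have hintg : Integrable g := hg.int
  have key : SA (cv (dl (4 - l) P0) g) t x ≤ (KL / 4 / (2 ^ l) ^ 2) * ∫ y in closedBall x (2 ^ (l + 2)), g y := by
    refine SA_le (hP.cv hg).cont fun θ => ?_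
    rw [cv_swap, ← integral_const_mul, ← integral_indicator measurableSet_closedBall]
    refine integral_mono ?_ ((hintg.const_mul _).indicator measurableSet_closedBall) fun y => ?_
    · obtain ⟨B, -, hB⟩ := hP.bdd
      have hc := hP.cont
      exact hintg.mul_bdd (c := B) (Continuous.aestronglyMeasurable (by fun_prop)) (Filter.Eventually.of_forall fun p => hB _)
    · by_cases h0 : dl (4 - l) P0 (x + t * ec θ - y) = 0
      · rw [h0, mul_zero]
        exact indicator_nonneg (fun y _ => mul_nonneg (by positivity) (hg0 y)) _
      · have h3 := hP.supp _ h0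
        have h4 : y ∈ closedBall x (2 ^ (l + 2)) := by
          rw [mem_closedBall, dist_eq_norm]
          have : y - x = t * ec θ - (x + t * ec θ - y) := by ring
          rw [this]
          refine (norm_sub_le _ _).trans ?_
          rw [tec_norm (by linarith), e2]
          rw [e5] at h3
          linarith
        rw [indicator_of_mem h4, mul_comm]
        gcongr
        · exact hg0 y
        refine (le_abs_self _).trans ?_
        rw [dl, abs_mul, abs_of_pos (by have := p2 (4 - l); positivity), e4]
        calc (16 / (2:ℝ) ^ l) ^ 2 * |P0 _| ≤ (16 / (2:ℝ) ^ l) ^ 2 * (KL / 1024) := by gcongr; exact KL_bd _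
          _ = _ := by field_simp; norm_num
  have h5 := h.trans_le key
  rw [← ofReal_integral_eq_lintegral_ofReal hintg.integrableOn (Filter.Eventually.of_forall hg0), ← ENNReal.ofReal_mul (by positivity)]
  refine ENNReal.ofReal_le_ofReal ?_
  rw [div_mul_eq_mul_div, lt_div_iff₀ (by positivity)] at h5
  linarith

/-- weak type of the low pass maximal function -/
lemma low_vol (hg : CC s g) (hg0 : ∀ y, 0 ≤ g y) (l0 : 0 < lam) : 
    volume {x : ℂ | ∃ l : ℤ, ∃ t ∈ Icc ((2:ℝ) ^ l) (2 ^ (l + 1)), lam / 4 < SA (cv (dl (4 - l) P0) g) t x} ≤ ENNReal.ofReal (1600 * KL / lam) * ∫⁻ y, ENNReal.ofReal (g y) := by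
  have hK := KL_one
  have hfin : ∫⁻ y, ENNReal.ofReal (g y) ≠ ⊤ := by
    rw [← ofReal_integral_eq_lintegral_ofReal hg.int (Filter.Eventually.of_forall hg0)]; exact ENNReal.ofReal_ne_top
  obtain ⟨c, hc⟩ : ∃ c : ℝ≥0, (c : ℝ≥0∞) = ENNReal.ofReal (16 * KL / lam) := ⟨_, rfl⟩
  obtain ⟨ν, hν⟩ : ∃ ν : Measure ℂ, ν = c • (volume.withDensity fun y => ENNReal.ofReal (g y)) := ⟨_, rfl⟩
  have : IsFiniteMeasure (volume.withDensity fun y => ENNReal.ofReal (g y)) := isFiniteMeasure_withDensity hfin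
  have : IsFiniteMeasure ν := by rw [hν]; infer_instance
  have h := weak11 ν (S := {x : ℂ | ∃ l : ℤ, ∃ t ∈ Icc ((2:ℝ) ^ l) (2 ^ (l + 1)), lam / 4 < SA (cv (dl (4 - l) P0) g) t x}) ?_
  · refine h.trans (le_of_eq ?_)
    rw [hν, Measure.smul_apply, ENNReal.smul_def, smul_eq_mul, withDensity_apply _ MeasurableSet.univ, Measure.restrict_univ, hc, ← mul_assoc]
    congr 1
    rw [show (100:ℝ≥0∞) = ENNReal.ofReal 100 by simp, ← ENNReal.ofReal_mul (by norm_num)]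
    congr 1; ring
  · rintro x ⟨l, t, ⟨h1, h2⟩, h⟩
    have h3 := low hg hg0 h1 h2 h
    refine ⟨2 ^ (l + 2), p2 _, ?_⟩
    rw [hν, Measure.smul_apply, ENNReal.smul_def, smul_eq_mul, withDensity_apply _ measurableSet_closedBall, hc]
    have e2 : ((2:ℝ) ^ (l + 2)) ^ 2 = 16 / lam * (lam * (2 ^ l) ^ 2) := by rw [zpow_add₀ (by norm_num)]; field_simp; norm_num
    rw [e2, ENNReal.ofReal_mul (by positivity), show 16 * KL / lam = 16 / lam * KL by ring, ENNReal.ofReal_mul (p := 16 / lam) (q := KL) (by positivity), mul_assoc]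
    gcongr

end
end SM

namespace SM

/-- decay ratio -/
def qq (η : ℝ) : ℝ := (2:ℝ) ^ (-(η / 28800))

section
variable {η : ℝ}

lemma qq_pos : 0 < qq η := Real.rpow_pos_of_pos (by norm_num) _
lemma qq_lt (η0 : 0 < η) : qq η < 1 := Real.rpow_lt_one_of_one_lt_of_neg (by norm_num) (by linarith)

lemma qq_pow4 (j : ℕ) : qq η ^ (4 * j) = ((2:ℝ) ^ (-(j:ℝ))) ^ (η / 7200) := by
  unfold qq
  rw [← Real.rpow_natCast, ← Real.rpow_mul (by norm_num), ← Real.rpow_mul (by norm_num)]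
  congr 1; push_cast; ring

lemma half_le (η1 : η ≤ 1) (j : ℕ) : (2:ℝ) ^ (-(j:ℝ)) ≤ qq η ^ (4 * j) := by
  rw [qq_pow4, ← Real.rpow_mul (by norm_num)]
  refine Real.rpow_le_rpow_of_exponent_le (by norm_num) ?_
  have : (0:ℝ) ≤ j := j.cast_nonneg
  nlinarith only [this, η1]

lemma z2_div (a b : ℤ) : (2:ℝ) ^ (-3 - a) / 2 ^ (-3 - b) = 2 ^ (-((a - b : ℤ):ℝ)) := by
  rw [← zpow_sub₀ (by norm_num), ← Int.cast_neg, Real.rpow_intCast]; congr 1; ring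

lemma gn_le (η1 : η ≤ 1) (n k : ℕ) : gn η (2 ^ (-3 - (n:ℤ))) (2 ^ (-3 - (k:ℤ))) ≤ qq η ^ (4 * ((n:ℤ) - k).natAbs) := by
  unfold gn
  split_ifs with h
  · have h1 : k ≤ n := by
      have := (zpow_le_zpow_iff_right₀ (by norm_num : (1:ℝ) < 2)).1 h; omega
    rw [qq_pow4, z2_div]
    have : (((n:ℤ) - k : ℤ) : ℝ) = ((((n:ℤ) - k).natAbs : ℕ) : ℝ) := by
      rw [Nat.cast_natAbs, abs_of_nonneg (by omega)]
    rw [this]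
  · have h1 : n < k := by
      rw [zpow_le_zpow_iff_right₀ (by norm_num : (1:ℝ) < 2)] at h; omega
    rw [z2_div]
    have : (((k:ℤ) - n : ℤ) : ℝ) = ((((n:ℤ) - k).natAbs : ℕ) : ℝ) := by
      rw [Nat.cast_natAbs, abs_sub_comm, abs_of_nonneg (by omega)]
    rw [this]
    exact half_le η1 _

lemma qsum (η0 : 0 < η) (k : ℕ) (F : Finset ℕ) : ∑ n ∈ F, qq η ^ ((n:ℤ) - k).natAbs ≤ 2 / (1 - qq η) := by
  have hq := qq_pos (η := η)
  have hq1 := qq_lt η0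
  have hs := summable_geometric_of_lt_one hq.le hq1
  have key : ∀ G : Finset ℕ, (∀ a ∈ G, ∀ b ∈ G, ((a:ℤ) - k).natAbs = ((b:ℤ) - k).natAbs → a = b) → ∑ n ∈ G, qq η ^ ((n:ℤ) - k).natAbs ≤ 1 / (1 - qq η) := by
    intro G hG
    rw [one_div, ← tsum_geometric_of_lt_one hq.le hq1, ← Finset.sum_image (f := fun j => qq η ^ j) (g := fun n : ℕ => ((n:ℤ) - k).natAbs) hG]
    exact hs.sum_le_tsum _ fun _ _ => by positivity
  rw [← Finset.sum_filter_add_sum_filter_not F (fun n => n ≤ k)]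
  have h1 := key (F.filter (fun n => n ≤ k)) (fun a ha b hb h => by rw [Finset.mem_filter] at ha hb; omega)
  have h2 := key (F.filter (fun n => ¬ n ≤ k)) (fun a ha b hb h => by rw [Finset.mem_filter] at ha hb; omega)
  calc _ ≤ 1 / (1 - qq η) + 1 / (1 - qq η) := add_le_add h1 h2
    _ = _ := by ring

lemma qsumE (η0 : 0 < η) (n : ℕ) : ∑' k : ℕ, ENNReal.ofReal (qq η ^ ((n:ℤ) - k).natAbs) ≤ ENNReal.ofReal (2 / (1 - qq η)) := by
  have hq := qq_pos (η := η)
  rw [ENNReal.tsum_eq_iSup_sum]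
  refine iSup_le fun F => ?_
  rw [← ENNReal.ofReal_sum_of_nonneg fun _ _ => by positivity]
  refine ENNReal.ofReal_le_ofReal (le_trans (le_of_eq ?_) (qsum η0 n F))
  refine Finset.sum_congr rfl fun k _ => ?_
  rw [← Int.natAbs_neg, neg_sub]

/-- threshold weights -/
def cw (η : ℝ) (j : ℕ) : ℝ := (1 - qq η) / 4 * qq η ^ j

lemma cw_pos (η0 : 0 < η) (j : ℕ) : 0 < cw η j := by
  have := qq_pos (η := η); have := qq_lt η0; unfold cw
  exact mul_pos (by linarith) (by positivity)

lemma cw_le (η0 : 0 < η) (j : ℕ) : cw η j ≤ 1 := by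
  have h := qq_pos (η := η); have h1 := qq_lt η0; unfold cw
  exact mul_le_one₀ (by linarith) (by positivity) (pow_le_one₀ h.le h1.le)

lemma cw_sum (η0 : 0 < η) (k : ℕ) (N : ℕ) : ∑ n ∈ Finset.range N, cw η ((n:ℤ) - k).natAbs ≤ 1/2 := by
  have h1 := qq_lt η0
  unfold cw
  rw [← Finset.mul_sum]
  calc _ ≤ (1 - qq η) / 4 * (2 / (1 - qq η)) := mul_le_mul_of_nonneg_left (qsum η0 k _) (by linarith)
    _ = _ := by have : 1 - qq η ≠ 0 := by linarith
                field_simp; norm_num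

def CQ (η : ℝ) : ℝ := CW * ((1 - qq η) / 4)⁻¹ ^ 3

lemma CQ_pos (η0 : 0 < η) : 0 < CQ η := by
  have h1 := qq_lt η0
  have := CW_pos
  unfold CQ
  have : 0 < (1 - qq η) / 4 := by linarith
  positivity

lemma cw_est {lam : ℝ} (η0 : 0 < η) (η1 : η ≤ 1) (l0 : 0 < lam) (j : ℕ) {u : ℝ} (hu : u ≤ qq η ^ (4 * j)) : 
    CW * (cw η j * lam) ^ (-2 - η) * u ≤ CQ η * lam ^ (-2 - η) * qq η ^ j := by
  have hc := cw_pos η0 j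
  have hCW := CW_pos
  have hq := qq_pos (η := η)
  have hl : 0 < lam ^ (-2 - η) := Real.rpow_pos_of_pos l0 _
  have h1 : cw η j ^ (-2 - η) ≤ (cw η j)⁻¹ ^ 3 := by
    calc cw η j ^ (-2 - η) ≤ cw η j ^ (-3:ℝ) := Real.rpow_le_rpow_of_exponent_ge hc (cw_le η0 j) (by linarith)
      _ = _ := by rw [Real.rpow_neg hc.le, inv_pow]; norm_num
  rw [Real.mul_rpow hc.le l0.le]
  calc _ ≤ CW * (cw η j ^ (-2 - η) * lam ^ (-2 - η)) * qq η ^ (4 * j) := by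
        have := Real.rpow_pos_of_pos hc (-2 - η)
        gcongr
    _ ≤ CW * ((cw η j)⁻¹ ^ 3 * lam ^ (-2 - η)) * qq η ^ (4 * j) := by gcongr
    _ = _ := by
      unfold CQ cw
      have h1 := qq_lt η0
      have : 1 - qq η ≠ 0 := by linarith
      field_simp; ring

section
variable {g : ℂ → ℝ} {s lam : ℝ} 

lemma N2_le (hg0 : ∀ y, 0 ≤ g y) (hg1 : ∀ y, g y ≤ 1) : N2 g ≤ ∫⁻ y, ENNReal.ofReal (g y) := by
  refine lintegral_mono fun y => ENNReal.ofReal_le_ofReal ?_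
  nlinarith only [hg0 y, hg1 y]

lemma abs1 (hg0 : ∀ y, 0 ≤ g y) (hg1 : ∀ y, g y ≤ 1) (y : ℂ) : |g y| ≤ 1 := by rw [abs_of_nonneg (hg0 y)]; exact hg1 y

lemma lam_inv (l0 : 0 < lam) (l1 : lam ≤ 1) (η0 : 0 < η) : 1 / lam ≤ lam ^ (-2 - η) := by
  calc 1 / lam = lam ^ (-1:ℝ) := by rw [Real.rpow_neg_one, one_div]
    _ ≤ _ := Real.rpow_le_rpow_of_exponent_ge l0 l1 (by linarith)

def KA (η : ℝ) : ℝ := 1600 * KL + CQ η * (2 / (1 - qq η)) * (4 * Kps)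

lemma KA_pos (η0 : 0 < η) : 0 < KA η := by
  have := KL_one; have := CQ_pos η0; have := Kps_pos
  have : 0 < 1 - qq η := by linarith [qq_lt η0]
  unfold KA; positivity

lemma volA (hg : CC s g) (hg0 : ∀ y, 0 ≤ g y) (hg1 : ∀ y, g y ≤ 1) (l0 : 0 < lam) (l1 : lam ≤ 1) (η0 : 0 < η) (η1 : η ≤ 1) :
    volume {x : ℂ | ∃ l : ℤ, ∃ t ∈ Icc ((2:ℝ) ^ l) (2 ^ (l + 1)), lam < SA g t x} ≤ ENNReal.ofReal (KA η * lam ^ (-2 - η)) * ∫⁻ y, ENNReal.ofReal (g y) := by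
  have hL : 0 < lam ^ (-2 - η) := Real.rpow_pos_of_pos l0 _
  have hCQ := CQ_pos η0
  have hq := qq_pos (η := η)
  have hK := Kps_pos
  have hKL := KL_one
  have hq1 : 0 < 1 - qq η := by linarith [qq_lt η0]
  obtain ⟨S, hS⟩ : ∃ S : ℤ → ℕ → Set ℂ, S = fun l n => {x : ℂ | ∃ t ∈ Icc ((2:ℝ) ^ l) (2 ^ (l + 1)), cw η n * lam < FP l n g t x} := ⟨_, rfl⟩
  have hSv : ∀ l n, volume (S l n) ≤ ENNReal.ofReal (CQ η * lam ^ (-2 - η)) * ENNReal.ofReal (qq η ^ n) * N2 (dd (n + 4 - l) g) := by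
    intro l n
    have hc := cw_pos η0 n
    rw [hS]
    refine (Wa hg (abs1 hg0 hg1) (mul_pos hc l0) (mul_le_one₀ (cw_le η0 n) l0.le l1) η0 η1 l n).trans ?_
    rw [← ENNReal.ofReal_mul (by positivity)]
    gcongr ENNReal.ofReal ?_ * _
    refine cw_est η0 η1 l0 n ?_
    rw [qq_pow4]
    refine Real.rpow_le_rpow (p2 _).le ?_ (by linarith)
    have e : (2:ℝ) ^ (-(n:ℝ)) = 2 ^ (-(n:ℤ)) := by rw [← Real.rpow_intCast]; push_cast; rfl
    rw [e]
    exact zpow_le_zpow_right₀ (by norm_num) (by omega)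
  have hsub : {x : ℂ | ∃ l : ℤ, ∃ t ∈ Icc ((2:ℝ) ^ l) (2 ^ (l + 1)), lam < SA g t x} ⊆ 
      {x : ℂ | ∃ l : ℤ, ∃ t ∈ Icc ((2:ℝ) ^ l) (2 ^ (l + 1)), lam / 4 < SA (cv (dl (4 - l) P0) g) t x} ∪ ⋃ n, ⋃ l, S l n := by
    rintro x ⟨l, t, ht, h⟩
    rcases split (l := l) hg l0 (cw_sum η0 0) h with h | ⟨n, h⟩
    · exact Or.inl ⟨l, t, ht, h⟩
    · refine Or.inr (mem_iUnion₂.2 ⟨n, l, ?_⟩)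
      rw [hS]
      exact ⟨t, ht, by simpa using h⟩
  calc _ ≤ _ := measure_mono hsub
    _ ≤ _ := measure_union_le _ _
    _ ≤ ENNReal.ofReal (1600 * KL / lam) * (∫⁻ y, ENNReal.ofReal (g y)) + ∑' n : ℕ, ∑' l : ℤ, ENNReal.ofReal (CQ η * lam ^ (-2 - η)) * ENNReal.ofReal (qq η ^ n) * N2 (dd (n + 4 - l) g) := by
        refine add_le_add (low_vol hg hg0 l0) ((measure_iUnion_le _).trans (ENNReal.tsum_le_tsum fun n => (measure_iUnion_le _).trans (ENNReal.tsum_le_tsum fun l => hSv l n)))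
    _ ≤ ENNReal.ofReal (1600 * KL / lam) * (∫⁻ y, ENNReal.ofReal (g y)) + ENNReal.ofReal (CQ η * lam ^ (-2 - η)) * ENNReal.ofReal (2 / (1 - qq η)) * (ENNReal.ofReal (4 * Kps) * ∫⁻ y, ENNReal.ofReal (g y)) := by
        gcongr
        simp_rw [ENNReal.tsum_mul_left]
        have : ∀ n : ℕ, ∑' l : ℤ, N2 (dd (n + 4 - l) g) ≤ ENNReal.ofReal (4 * Kps) * ∫⁻ y, ENNReal.ofReal (g y) := by
          intro n
          have e := (Equiv.subLeft ((n:ℤ) + 4)).tsum_eq (fun m => N2 (dd m g))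
          simp only [Equiv.subLeft_apply] at e
          rw [e]
          exact (ortho hg).trans (by gcongr; exact N2_le hg0 hg1)
        refine (ENNReal.tsum_le_tsum fun n => mul_le_mul_right (this n) _).trans ?_
        rw [ENNReal.tsum_mul_right, ENNReal.tsum_mul_left]
        gcongr
        have := qsumE η0 0
        simpa using this
    _ ≤ _ := by
        rw [← ENNReal.ofReal_mul (by positivity), ← mul_assoc, ← ENNReal.ofReal_mul (by positivity), ← add_mul, ← ENNReal.ofReal_add (by positivity) (by positivity)]
        gcongr
        have h1 := mul_le_mul_of_nonneg_left (lam_inv l0 l1 η0) (by positivity : 0 ≤ 1600 * KL)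
        unfold KA
        calc _ = 1600 * KL * (1 / lam) + CQ η * (2 / (1 - qq η)) * (4 * Kps) * lam ^ (-2 - η) := by ring
          _ ≤ _ := by linarith

lemma lowB (hg : CC s g) (hg0 : ∀ y, 0 ≤ g y) (l0 : 0 < lam) (l : ℤ) (k : ℕ) : 
    ENNReal.ofReal (2 ^ k) * volume {x : ℂ | ‖x‖ ≤ 2 ^ (l - 3 - k) ∧ ∃ t ∈ Icc ((2:ℝ) ^ l) (2 ^ (l + 1)), lam / 4 < SA (cv (dl (4 - l) P0) g) t x} ≤ ENNReal.ofReal (KL / lam * (1 / 2) ^ k) * ∫⁻ y, ENNReal.ofReal (g y) := by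
  have hK := KL_one
  have hl := p2 l
  rcases eq_empty_or_nonempty {x : ℂ | ‖x‖ ≤ 2 ^ (l - 3 - k) ∧ ∃ t ∈ Icc ((2:ℝ) ^ l) (2 ^ (l + 1)), lam / 4 < SA (cv (dl (4 - l) P0) g) t x} with h | ⟨x, -, t, ⟨h1, h2⟩, h⟩
  · rw [h, measure_empty, mul_zero]; exact zero_le
  · have h3 := low hg hg0 h1 h2 h
    have hpi : ((NNReal.pi : ℝ≥0) : ℝ≥0∞) ≤ ENNReal.ofReal 4 := by
      rw [ENNReal.ofReal_ofNat]
      have : NNReal.pi ≤ 4 := Real.pi_le_four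
      exact_mod_cast this
    calc _ ≤ ENNReal.ofReal (2 ^ k) * volume (closedBall (0:ℂ) (2 ^ (l - 3 - k))) := by
          gcongr; intro x hx; rw [mem_closedBall_zero_iff]; exact hx.1
      _ ≤ ENNReal.ofReal (2 ^ k) * (ENNReal.ofReal (2 ^ (l - 3 - k)) ^ 2 * ENNReal.ofReal 4) := by
          rw [Complex.volume_closedBall]; gcongr
      _ ≤ ENNReal.ofReal ((1/2) ^ k / lam) * ENNReal.ofReal (lam * (2 ^ l) ^ 2) := by
          rw [← ENNReal.ofReal_pow (p2 _).le, ← ENNReal.ofReal_mul (by positivity), ← ENNReal.ofReal_mul (by positivity), ← ENNReal.ofReal_mul (by positivity)]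
          refine ENNReal.ofReal_le_ofReal ?_
          have e : (2:ℝ) ^ (l - 3 - k) = 2 ^ l / 8 * (1/2) ^ k := by
            rw [zpow_sub₀ (by norm_num), zpow_sub₀ (by norm_num), zpow_natCast, one_div, inv_pow]; norm_num; rfl
          have e2 : (2:ℝ) ^ k * (1/2) ^ k = 1 := by rw [← mul_pow]; norm_num
          rw [e]
          calc (2:ℝ) ^ k * ((2 ^ l / 8 * (1/2) ^ k) ^ 2 * 4) = (2 ^ k * (1/2) ^ k) * ((2 ^ l) ^ 2 / 16 * (1/2) ^ k) := by ring
            _ = (1/2) ^ k * (2 ^ l) ^ 2 / 16 := by rw [e2]; ring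
            _ ≤ (1/2) ^ k * (2 ^ l) ^ 2 := by have : (0:ℝ) < (1/2) ^ k * (2 ^ l) ^ 2 := by positivity
                                              linarith
            _ = _ := by field_simp
      _ ≤ ENNReal.ofReal ((1/2) ^ k / lam) * (ENNReal.ofReal KL * ∫⁻ y, ENNReal.ofReal (g y)) := by
          gcongr; exact h3.trans (mul_le_mul_right (setLIntegral_le_lintegral _ _) _)
      _ = _ := by
          rw [← mul_assoc, ← ENNReal.ofReal_mul (by positivity)]; congr 2; ring

lemma volB (hg : CC s g) (hg0 : ∀ y, 0 ≤ g y) (hg1 : ∀ y, g y ≤ 1) (l0 : 0 < lam) (l1 : lam ≤ 1) (η0 : 0 < η) (η1 : η ≤ 1) (l : ℤ) :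
    ∑' k : ℕ, ENNReal.ofReal (2 ^ k) * volume {x : ℂ | ‖x‖ ≤ 2 ^ (l - 3 - k) ∧ ∃ t ∈ Icc ((2:ℝ) ^ l) (2 ^ (l + 1)), lam < SA g t x} ≤ ENNReal.ofReal (KA η * lam ^ (-2 - η)) * ∫⁻ y, ENNReal.ofReal (g y) := by
  have hL : 0 < lam ^ (-2 - η) := Real.rpow_pos_of_pos l0 _
  have hCQ := CQ_pos η0
  have hq := qq_pos (η := η)
  have hK := Kps_pos
  have hKL := KL_one
  have hq1 : 0 < 1 - qq η := by linarith [qq_lt η0]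
  obtain ⟨S, hS⟩ : ∃ S : ℕ → ℕ → Set ℂ, S = fun (k n : ℕ) => {x : ℂ | ‖x‖ ≤ 2 ^ (l - 3 - k) ∧ ∃ t ∈ Icc ((2:ℝ) ^ l) (2 ^ (l + 1)), cw η ((n:ℤ) - k).natAbs * lam < FP l n g t x} := ⟨_, rfl⟩
  have hSv : ∀ k n : ℕ, ENNReal.ofReal (2 ^ k) * volume (S k n) ≤ ENNReal.ofReal (CQ η * lam ^ (-2 - η)) * (ENNReal.ofReal (qq η ^ ((n:ℤ) - k).natAbs) * N2 (dd (n + 4 - l) g)) := by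
    intro k n
    have hc := cw_pos η0 ((n:ℤ) - k).natAbs
    rw [hS]
    refine (mul_le_mul_right (Wc hg (abs1 hg0 hg1) (mul_pos hc l0) (mul_le_one₀ (cw_le η0 _) l0.le l1) η0 η1 l n k) _).trans ?_
    rw [← mul_assoc, ← mul_assoc, ← ENNReal.ofReal_mul (by positivity), ← ENNReal.ofReal_mul (by positivity)]
    gcongr ENNReal.ofReal ?_ * _
    refine le_trans (le_of_eq ?_) (cw_est η0 η1 l0 _ (gn_le η1 n k))
    have : (2:ℝ) ^ k * 2 ^ (-(k:ℤ)) = 1 := by rw [zpow_neg, zpow_natCast]; exact mul_inv_cancel₀ (by positivity)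
    linear_combination (CW * (cw η ((n:ℤ) - k).natAbs * lam) ^ (-2 - η) * gn η (2 ^ (-3 - (n:ℤ))) (2 ^ (-3 - (k:ℤ)))) * this
  have hsub : ∀ k : ℕ, {x : ℂ | ‖x‖ ≤ 2 ^ (l - 3 - k) ∧ ∃ t ∈ Icc ((2:ℝ) ^ l) (2 ^ (l + 1)), lam < SA g t x} ⊆ 
      {x : ℂ | ‖x‖ ≤ 2 ^ (l - 3 - k) ∧ ∃ t ∈ Icc ((2:ℝ) ^ l) (2 ^ (l + 1)), lam / 4 < SA (cv (dl (4 - l) P0) g) t x} ∪ ⋃ n, S k n := by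
    rintro k x ⟨hx, t, ht, h⟩
    rcases split (l := l) hg l0 (cw_sum η0 k) h with h | ⟨n, h⟩
    · exact Or.inl ⟨hx, t, ht, h⟩
    · refine Or.inr (mem_iUnion.2 ⟨n, ?_⟩)
      rw [hS]
      exact ⟨hx, t, ht, h⟩
  calc _ ≤ ∑' k : ℕ, (ENNReal.ofReal (KL / lam * (1 / 2) ^ k) * (∫⁻ y, ENNReal.ofReal (g y)) + ∑' n : ℕ, ENNReal.ofReal (CQ η * lam ^ (-2 - η)) * (ENNReal.ofReal (qq η ^ ((n:ℤ) - k).natAbs) * N2 (dd (n + 4 - l) g))) := by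
        refine ENNReal.tsum_le_tsum fun k => ?_
        refine (mul_le_mul_right ((measure_mono (hsub k)).trans (measure_union_le _ _)) _).trans ?_
        rw [mul_add]
        refine add_le_add (lowB hg hg0 l0 l k) ?_
        refine (mul_le_mul_right (measure_iUnion_le _) _).trans ?_
        rw [← ENNReal.tsum_mul_left]
        exact ENNReal.tsum_le_tsum fun n => hSv k n
    _ ≤ ENNReal.ofReal (1600 * KL / lam) * (∫⁻ y, ENNReal.ofReal (g y)) + ENNReal.ofReal (CQ η * lam ^ (-2 - η)) * (ENNReal.ofReal (2 / (1 - qq η)) * (ENNReal.ofReal (4 * Kps) * ∫⁻ y, ENNReal.ofReal (g y))) := by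
        rw [ENNReal.tsum_add, ENNReal.tsum_mul_right, ENNReal.tsum_comm]
        refine add_le_add ?_ ?_
        · gcongr
          rw [← ENNReal.ofReal_tsum_of_nonneg (fun k => by positivity) (summable_geometric_two.mul_left _), tsum_mul_left, tsum_geometric_two]
          refine ENNReal.ofReal_le_ofReal ?_
          rw [div_mul_eq_mul_div]; exact div_le_div_of_nonneg_right (by linarith) l0.le
        · simp_rw [ENNReal.tsum_mul_left, ENNReal.tsum_mul_right]
          gcongr
          refine (ENNReal.tsum_le_tsum fun n => mul_le_mul_left (qsumE η0 n) _).trans ?_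
          rw [ENNReal.tsum_mul_left]
          gcongr
          have hinj : Function.Injective (fun n : ℕ => (n:ℤ) + 4 - l) := fun a b h => by simpa using h
          refine (ENNReal.tsum_comp_le_tsum_of_injective hinj (fun m => N2 (dd m g))).trans ?_
          exact (ortho hg).trans (by gcongr; exact N2_le hg0 hg1)
    _ ≤ _ := by
        rw [← mul_assoc (ENNReal.ofReal (2 / (1 - qq η))), ← ENNReal.ofReal_mul (by positivity), ← mul_assoc, ← ENNReal.ofReal_mul (by positivity), ← add_mul, ← ENNReal.ofReal_add (by positivity) (by positivity)]
        gcongr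
        have h1 := mul_le_mul_of_nonneg_left (lam_inv l0 l1 η0) (by positivity : 0 ≤ 1600 * KL)
        unfold KA
        calc _ = 1600 * KL * (1 / lam) + CQ η * (2 / (1 - qq η)) * (4 * Kps) * lam ^ (-2 - η) := by ring
          _ ≤ _ := by linarith

end
end
end SM

namespace SM

/-- the weighted measure -/
def mu : Measure ℂ := volume.withDensity (fun x : ℂ => ENNReal.ofReal (‖x‖⁻¹))

lemma mu_dens : Measurable (fun x : ℂ => ENNReal.ofReal (‖x‖⁻¹)) := by fun_prop

lemma mu_zero : mu {0} = 0 := withDensity_absolutelyContinuous _ _ (measure_singleton _)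

def Rg (i : ℤ) : Set ℂ := {x | 2 ^ i ≤ ‖x‖ ∧ ‖x‖ < 2 ^ (i + 1)}

lemma Rg_meas (i : ℤ) : MeasurableSet (Rg i) :=
  (measurableSet_le measurable_const measurable_norm).inter (measurableSet_lt measurable_norm measurable_const)

lemma mu_ring (Z : Set ℂ) (i : ℤ) : mu (Z ∩ Rg i) ≤ ENNReal.ofReal (2 ^ (-i)) * volume Z := by
  have hm : MeasurableSet (toMeasurable volume Z ∩ Rg i) := (measurableSet_toMeasurable _ _).inter (Rg_meas i)
  calc mu (Z ∩ Rg i) ≤ mu (toMeasurable volume Z ∩ Rg i) := measure_mono (inter_subset_inter_left _ (subset_toMeasurable _ _))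
    _ = ∫⁻ x in toMeasurable volume Z ∩ Rg i, ENNReal.ofReal (‖x‖⁻¹) := withDensity_apply _ hm
    _ ≤ ∫⁻ x in toMeasurable volume Z ∩ Rg i, ENNReal.ofReal (2 ^ (-i)) := by
        refine setLIntegral_mono measurable_const fun x hx => ENNReal.ofReal_le_ofReal ?_
        rw [zpow_neg]
        exact inv_anti₀ (p2 i) hx.2.1
    _ = ENNReal.ofReal (2 ^ (-i)) * volume (toMeasurable volume Z ∩ Rg i) := by rw [setLIntegral_const]
    _ ≤ _ := by
        refine mul_le_mul_right ((measure_mono inter_subset_left).trans (measure_toMeasurable Z).le) _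

/-- cut-off -/
def ct (j : ℤ) (y : ℂ) : ℝ := max 0 (min 1 (2 - ‖y‖ / 2 ^ j))

lemma ct_cont (j : ℤ) : Continuous (ct j) := by unfold ct; fun_prop
lemma ct_nn (j : ℤ) (y : ℂ) : 0 ≤ ct j y := le_max_left _ _
lemma ct_le (j : ℤ) (y : ℂ) : ct j y ≤ 1 := max_le zero_le_one (min_le_left _ _)
lemma ct_one {j : ℤ} {y : ℂ} (h : ‖y‖ ≤ 2 ^ j) : ct j y = 1 := by
  have : ‖y‖ / 2 ^ j ≤ 1 := by rw [div_le_one (p2 j)]; exact h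
  unfold ct; rw [min_eq_left (by linarith)]; norm_num
lemma ct_zero {j : ℤ} {y : ℂ} (h : 2 ^ (j + 1) ≤ ‖y‖) : ct j y = 0 := by
  have : 2 ≤ ‖y‖ / 2 ^ j := by rw [le_div_iff₀ (p2 j), mul_comm, ← zpow_add_one₀ (by norm_num)]; exact h
  unfold ct; exact max_eq_left ((min_le_right _ _).trans (by linarith))

lemma ct_sum (c : ℤ) (y : ℂ) (hy : y ≠ 0) : ∑' i : ℤ, ENNReal.ofReal (2 ^ (-i) * ct (i + c) y) ≤ ENNReal.ofReal (2 ^ (c + 4) * ‖y‖⁻¹) := by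
  have hn : 0 < ‖y‖ := norm_pos_iff.2 hy
  obtain ⟨a, h1, h2⟩ := exists_mem_Ico_zpow hn (by norm_num : (1:ℝ) < 2)
  rw [ENNReal.tsum_eq_iSup_sum]
  refine iSup_le fun F => ?_
  rw [← ENNReal.ofReal_sum_of_nonneg fun i _ => mul_nonneg (p2 _).le (ct_nn _ _)]
  refine ENNReal.ofReal_le_ofReal ?_
  have key : ∀ i : ℤ, (2:ℝ) ^ (-i) * ct (i + c) y ≤ 2 ^ (c + 1 - a) * 2 ^ (-|a - c - 1 - i|) := by
    intro i
    rcases le_or_gt a (i + c + 1) with h | h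
    · rw [abs_of_nonpos (by omega), ← zpow_add₀ (by norm_num)]
      calc _ ≤ (2:ℝ) ^ (-i) * 1 := mul_le_mul_of_nonneg_left (ct_le _ _) (p2 _).le
        _ = _ := by rw [mul_one]; congr 1; ring
    · rw [ct_zero ((zpow_le_zpow_right₀ (by norm_num) h.le).trans h1), mul_zero]
      exact (mul_pos (p2 _) (p2 _)).le
  calc _ ≤ ∑ i ∈ F, (2:ℝ) ^ (c + 1 - a) * 2 ^ (-|a - c - 1 - i|) := Finset.sum_le_sum fun i _ => key i
    _ ≤ 2 ^ (c + 1 - a) * 4 := by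
        rw [← Finset.mul_sum]; exact mul_le_mul_of_nonneg_left (geo_sum F _) (p2 _).le
    _ = 2 ^ (c + 4) * (2 ^ (a + 1))⁻¹ := by
        rw [← zpow_neg, ← zpow_add₀ (by norm_num), show (4:ℝ) = 2 ^ (2:ℤ) by norm_num, ← zpow_add₀ (by norm_num)]; congr 1; ring
    _ ≤ _ := mul_le_mul_of_nonneg_left (inv_anti₀ hn h2.le) (p2 _).le

section
variable {f : ℂ → ℝ} {s lam η : ℝ}

lemma cutsum (hf : CC s f) (hf0 : ∀ y, 0 ≤ f y) (c : ℤ) :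
    ∑' i : ℤ, ENNReal.ofReal (2 ^ (-i)) * ∫⁻ y, ENNReal.ofReal (f y * ct (i + c) y) ≤ ENNReal.ofReal (2 ^ (c + 4)) * ∫⁻ y, ENNReal.ofReal (f y) ∂mu := by
  have hc := hf.cont
  have hcm := hf.cont.measurable
  have hfm : Measurable (fun y => ENNReal.ofReal (f y)) := by fun_prop
  have e : ∀ i : ℤ, ENNReal.ofReal (2 ^ (-i)) * ∫⁻ y, ENNReal.ofReal (f y * ct (i + c) y) = ∫⁻ y, ENNReal.ofReal (f y) * ENNReal.ofReal (2 ^ (-i) * ct (i + c) y) := by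
    intro i
    have := (ct_cont (i + c)).measurable
    rw [← lintegral_const_mul _ (by fun_prop)]
    refine lintegral_congr fun y => ?_
    rw [← ENNReal.ofReal_mul (p2 _).le, ← ENNReal.ofReal_mul (hf0 y)]; congr 1; ring
  simp_rw [e]
  rw [← lintegral_tsum fun i => by have := (ct_cont (i + c)).measurable; exact (by fun_prop : Measurable _).aemeasurable]
  unfold mu
  rw [lintegral_withDensity_eq_lintegral_mul _ mu_dens hfm, ← lintegral_const_mul _ (mu_dens.mul hfm)]
  refine lintegral_mono_ae ?_
  have h0 : ∀ᵐ y : ℂ, y ≠ 0 := by rw [ae_iff]; simp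
  filter_upwards [h0] with y hy
  rw [ENNReal.tsum_mul_left, Pi.mul_apply]
  refine (mul_le_mul_right (ct_sum c y hy) _).trans (le_of_eq ?_)
  rw [ENNReal.ofReal_mul (p2 _).le]; ring

lemma SA_cut {t : ℝ} {x : ℂ} {j : ℤ} (ht : 0 ≤ t) (h : ‖x‖ + t ≤ 2 ^ j) : SA (fun y => f y * ct j y) t x = SA f t x := by
  unfold SA
  congr 1
  refine intervalIntegral.integral_congr fun θ _ => ?_
  show f _ * ct j _ = f _
  rw [ct_one, mul_one]
  refine (norm_add_le _ _).trans ?_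
  rw [tec_norm ht]; exact h

lemma cut_CC (hf : CC s f) (j : ℤ) : CC s (fun y => f y * ct j y) :=
  ⟨hf.cont.mul (ct_cont j), fun z hz => hf.supp z (left_ne_zero_of_mul hz)⟩

def KM (η : ℝ) : ℝ := (2 ^ 9 + 2 ^ 10) * KA η

lemma KM_pos (η0 : 0 < η) : 0 < KM η := by have := KA_pos η0; unfold KM; positivity

theorem weakCC (hf : CC s f) (hf0 : ∀ y, 0 ≤ f y) (hf1 : ∀ y, f y ≤ 1) (l0 : 0 < lam) (l1 : lam ≤ 1) (η0 : 0 < η) (η1 : η ≤ 1) :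
    mu {x | ∃ t, 0 < t ∧ lam < SA f t x} ≤ ENNReal.ofReal (KM η * lam ^ (-2 - η)) * ∫⁻ y, ENNReal.ofReal (f y) ∂mu := by
  have hL : 0 < lam ^ (-2 - η) := Real.rpow_pos_of_pos l0 _
  have hK := KA_pos η0
  obtain ⟨A, hA⟩ : ∃ A : ℤ → Set ℂ, A = fun i => {x : ℂ | ∃ l : ℤ, ∃ t ∈ Icc ((2:ℝ) ^ l) (2 ^ (l + 1)), lam < SA (fun y => f y * ct (i + 5) y) t x} := ⟨_, rfl⟩
  obtain ⟨B, hB⟩ : ∃ B : ℤ → ℕ → Set ℂ, B = fun (l : ℤ) (k : ℕ) => {x : ℂ | ‖x‖ ≤ 2 ^ (l - 3 - k) ∧ ∃ t ∈ Icc ((2:ℝ) ^ l) (2 ^ (l + 1)), lam < SA (fun y => f y * ct (l + 2) y) t x} := ⟨_, rfl⟩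
  have hg0 : ∀ j y, 0 ≤ f y * ct j y := fun j y => mul_nonneg (hf0 y) (ct_nn j y)
  have hg1 : ∀ j y, f y * ct j y ≤ 1 := fun j y => mul_le_one₀ (hf1 y) (ct_nn j y) (ct_le j y)
  have hsub : {x | ∃ t, 0 < t ∧ lam < SA f t x} ⊆ {0} ∪ ((⋃ i, A i ∩ Rg i) ∪ ⋃ l : ℤ, ⋃ k : ℕ, B l k ∩ Rg (l - 4 - k)) := by
    rintro x ⟨t, ht, h⟩
    rcases eq_or_ne x 0 with rfl | hx
    · exact Or.inl rfl
    refine Or.inr ?_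
    obtain ⟨i, h1, h2⟩ := exists_mem_Ico_zpow (norm_pos_iff.2 hx) (by norm_num : (1:ℝ) < 2)
    obtain ⟨l, h3, h4⟩ := exists_mem_Ico_zpow ht (by norm_num : (1:ℝ) < 2)
    rcases le_or_gt l (i + 3) with hl | hl
    · refine Or.inl (mem_iUnion.2 ⟨i, ?_, h1, h2⟩)
      rw [hA]
      refine ⟨l, t, ⟨h3, h4.le⟩, ?_⟩
      rw [SA_cut ht.le]; · exact h
      have e1 : (2:ℝ) ^ (l + 1) ≤ 2 ^ (i + 4) := zpow_le_zpow_right₀ (by norm_num) (by omega)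
      have e2 : (2:ℝ) ^ (i + 1) ≤ 2 ^ (i + 4) := zpow_le_zpow_right₀ (by norm_num) (by omega)
      have e3 : (2:ℝ) ^ (i + 5) = 2 ^ (i + 4) * 2 := by rw [← zpow_add_one₀ (by norm_num)]; congr 1; ring
      linarith
    · obtain ⟨k, hk⟩ := Int.eq_ofNat_of_zero_le (by omega : 0 ≤ l - 4 - i)
      have hi : l - 4 - (k:ℤ) = i := by omega
      refine Or.inr (mem_iUnion₂.2 ⟨l, k, ?_, ?_⟩)
      · rw [hB]
        refine ⟨?_, t, ⟨h3, h4.le⟩, ?_⟩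
        · rw [show l - 3 - (k:ℤ) = i + 1 by omega]; exact h2.le
        · rw [SA_cut ht.le]; · exact h
          have e2 : (2:ℝ) ^ (i + 1) ≤ 2 ^ (l + 1) := zpow_le_zpow_right₀ (by norm_num) (by omega)
          have e3 : (2:ℝ) ^ (l + 2) = 2 ^ (l + 1) * 2 := by rw [← zpow_add_one₀ (by norm_num)]; congr 1; ring
          linarith
      · rw [hi]; exact ⟨h1, h2⟩
  have hAs : ∑' i, mu (A i ∩ Rg i) ≤ ENNReal.ofReal (KA η * lam ^ (-2 - η)) * (ENNReal.ofReal (2 ^ (9:ℤ)) * ∫⁻ y, ENNReal.ofReal (f y) ∂mu) := by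
    calc _ ≤ ∑' i : ℤ, ENNReal.ofReal (KA η * lam ^ (-2 - η)) * (ENNReal.ofReal (2 ^ (-i)) * ∫⁻ y, ENNReal.ofReal (f y * ct (i + 5) y)) := by
          refine ENNReal.tsum_le_tsum fun i => (mu_ring _ _).trans ?_
          rw [mul_left_comm]
          refine mul_le_mul_right ?_ _
          rw [hA]
          exact volA (cut_CC hf _) (hg0 _) (hg1 _) l0 l1 η0 η1
      _ ≤ _ := by
          rw [ENNReal.tsum_mul_left]
          exact mul_le_mul_right (cutsum hf hf0 5) _
  have hBs : ∑' (l : ℤ) (k : ℕ), mu (B l k ∩ Rg (l - 4 - k)) ≤ ENNReal.ofReal (KA η * lam ^ (-2 - η)) * (ENNReal.ofReal (2 ^ 4) * (ENNReal.ofReal (2 ^ (6:ℤ)) * ∫⁻ y, ENNReal.ofReal (f y) ∂mu)) := by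
    calc _ ≤ ∑' l : ℤ, ENNReal.ofReal (KA η * lam ^ (-2 - η)) * (ENNReal.ofReal (2 ^ 4) * (ENNReal.ofReal (2 ^ (-l)) * ∫⁻ y, ENNReal.ofReal (f y * ct (l + 2) y))) := by
          refine ENNReal.tsum_le_tsum fun l => ?_
          calc _ ≤ ∑' k : ℕ, (ENNReal.ofReal (2 ^ 4) * ENNReal.ofReal (2 ^ (-l))) * (ENNReal.ofReal (2 ^ k) * volume (B l k)) := by
                refine ENNReal.tsum_le_tsum fun k => (mu_ring _ _).trans (le_of_eq ?_)
                rw [← mul_assoc, ← ENNReal.ofReal_mul (by positivity), ← ENNReal.ofReal_mul (by positivity)]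
                congr 2
                rw [← zpow_natCast, ← zpow_natCast, ← zpow_add₀ (by norm_num), ← zpow_add₀ (by norm_num)]
                congr 1; push_cast; ring
            _ ≤ (ENNReal.ofReal (2 ^ 4) * ENNReal.ofReal (2 ^ (-l))) * (ENNReal.ofReal (KA η * lam ^ (-2 - η)) * ∫⁻ y, ENNReal.ofReal (f y * ct (l + 2) y)) := by
                rw [ENNReal.tsum_mul_left, hB]
                refine mul_le_mul_right ?_ _
                exact volB (cut_CC hf _) (hg0 _) (hg1 _) l0 l1 η0 η1 l
            _ = _ := by ring
      _ ≤ _ := by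
          rw [ENNReal.tsum_mul_left, ENNReal.tsum_mul_left]
          refine mul_le_mul_right (mul_le_mul_right (cutsum hf hf0 2) _) _
  calc _ ≤ _ := measure_mono hsub
    _ ≤ mu {0} + (mu (⋃ i, A i ∩ Rg i) + mu (⋃ l : ℤ, ⋃ k : ℕ, B l k ∩ Rg (l - 4 - k))) := (measure_union_le _ _).trans (add_le_add le_rfl (measure_union_le _ _))
    _ ≤ 0 + (∑' i, mu (A i ∩ Rg i) + ∑' (l : ℤ) (k : ℕ), mu (B l k ∩ Rg (l - 4 - k))) := by
        refine add_le_add mu_zero.le (add_le_add (measure_iUnion_le _) ?_)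
        exact (measure_iUnion_le _).trans (ENNReal.tsum_le_tsum fun l => measure_iUnion_le _)
    _ ≤ _ := by
        rw [zero_add]
        refine (add_le_add hAs hBs).trans (le_of_eq ?_)
        rw [← mul_assoc, ← mul_assoc, ← mul_assoc, ← add_mul, ← ENNReal.ofReal_mul (by positivity), ← ENNReal.ofReal_mul (by positivity), ← ENNReal.ofReal_mul (by positivity), ← ENNReal.ofReal_add (by positivity) (by positivity)]
        congr 2
        unfold KM; norm_num; ring

end
end SM

namespace SM

lemma mu_rad {g : ℝ → ℝ≥0∞} (hg : Measurable g) : ∫⁻ x : ℂ, g ‖x‖ ∂mu = ENNReal.ofReal (2 * Real.pi) * ∫⁻ r in Ioi (0:ℝ), g r := by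
  unfold mu
  rw [lintegral_withDensity_eq_lintegral_mul _ mu_dens (by fun_prop), ← Complex.lintegral_comp_polarCoord_symm]
  have ht : _root_.polarCoord.target = Ioi (0:ℝ) ×ˢ Ioo (-Real.pi) Real.pi := polarCoord_target
  rw [ht]
  calc _ = ∫⁻ q in Ioi (0:ℝ) ×ˢ Ioo (-Real.pi) Real.pi, g q.1 * 1 := by
        refine setLIntegral_congr_fun (measurableSet_Ioi.prod measurableSet_Ioo) fun q hq => ?_
        have h0 : 0 < q.1 := hq.1
        simp only [Pi.mul_apply, Complex.norm_polarCoord_symm, abs_of_pos h0, smul_eq_mul, mul_one]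
        rw [← mul_assoc, ← ENNReal.ofReal_mul h0.le, mul_inv_cancel₀ h0.ne', ENNReal.ofReal_one, one_mul]
    _ = _ := by
        rw [Measure.volume_eq_prod, ← Measure.prod_restrict]
        rw [lintegral_prod_mul (f := g) (g := fun _ => 1) hg.aemeasurable measurable_const.aemeasurable, lintegral_one, Measure.restrict_apply_univ, Real.volume_Ioo, mul_comm]
        congr 2; ring

lemma mu_ball (R : ℝ) : mu (closedBall 0 R) < ∞ := by
  have e : mu (closedBall 0 R) = ∫⁻ x : ℂ, (Iic R).indicator (fun _ => (1:ℝ≥0∞)) ‖x‖ ∂mu := by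
    rw [← lintegral_indicator_one measurableSet_closedBall]
    refine lintegral_congr fun x => ?_
    classical
    simp only [indicator_apply, mem_closedBall_zero_iff, mem_Iic, Pi.one_apply]
  rw [e, mu_rad (measurable_const.indicator measurableSet_Iic), lintegral_indicator measurableSet_Iic, Measure.restrict_restrict measurableSet_Iic, lintegral_one, Measure.restrict_apply_univ, Iic_inter_Ioi, Real.volume_Ioc]
  exact ENNReal.mul_lt_top ENNReal.ofReal_lt_top ENNReal.ofReal_lt_top

instance mu_lf : IsLocallyFiniteMeasure mu := ⟨fun x => ⟨closedBall 0 (‖x‖ + 1), by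
  refine Filter.mem_of_superset (ball_mem_nhds x one_pos) fun y hy => ?_
  rw [mem_closedBall_zero_iff]
  have := norm_sub_norm_le y x
  rw [mem_ball, dist_eq_norm] at hy; linarith, mu_ball _⟩⟩

/-- lower integral averages -/
def LA (F : ℂ → ℝ≥0∞) (t : ℝ) (x : ℂ) : ℝ≥0∞ := ENNReal.ofReal ((2 * Real.pi)⁻¹) * ∫⁻ θ in Ioc (-Real.pi) Real.pi, F (x + t * ec θ)

lemma LA_mono {F G : ℂ → ℝ≥0∞} (h : ∀ y, F y ≤ G y) (t : ℝ) (x : ℂ) : LA F t x ≤ LA G t x :=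
  mul_le_mul_right (lintegral_mono fun _ => h _) _

lemma LA_SA {s : ℝ} {f : ℂ → ℝ} (hf : CC s f) (hf0 : ∀ y, 0 ≤ f y) (t : ℝ) (x : ℂ) : LA (fun y => ENNReal.ofReal (f y)) t x = ENNReal.ofReal (SA f t x) := by
  have hc : Continuous fun θ : ℝ => f (x + t * ec θ) := hf.cont.comp (by fun_prop)
  unfold LA SA
  rw [ENNReal.ofReal_mul (by positivity), intervalIntegral.integral_of_le (by linarith [Real.pi_pos])]
  rw [ofReal_integral_eq_lintegral_ofReal ((hc.intervalIntegrable _ _).1) (Filter.Eventually.of_forall fun _ => hf0 _)]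

section
variable {lam η : ℝ}

lemma weak_open {U : Set ℂ} (hU : IsOpen U) (l0 : 0 < lam) (l1 : lam ≤ 1) (η0 : 0 < η) (η1 : η ≤ 1) :
    mu {x | ∃ t, 0 < t ∧ ENNReal.ofReal lam < LA (U.indicator 1) t x} ≤ ENNReal.ofReal (KM η * lam ^ (-2 - η)) * mu U := by
  obtain ⟨V, hV⟩ : ∃ V : ℕ → Set ℂ, V = fun n : ℕ => (U ∩ ball 0 (n:ℝ))ᶜ := ⟨_, rfl⟩
  obtain ⟨f, hf⟩ : ∃ f : ℕ → ℂ → ℝ, f = fun n y => min 1 (n * infDist y (V n)) := ⟨_, rfl⟩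
  have hVc : ∀ n, IsClosed (V n) := fun n => by rw [hV]; exact (hU.inter isOpen_ball).isClosed_compl
  have hVn : ∀ n : ℕ, (V n).Nonempty := fun n => ⟨(n:ℂ), by rw [hV]; exact fun h => by simpa using h.2⟩
  have hf0 : ∀ n y, 0 ≤ f n y := fun n y => by rw [hf]; exact le_min zero_le_one (mul_nonneg n.cast_nonneg infDist_nonneg)
  have hf1 : ∀ n y, f n y ≤ 1 := fun n y => by rw [hf]; exact min_le_left _ _
  have hfz : ∀ n y, y ∈ V n → f n y = 0 := fun n y h => by
    rw [hf]; show min 1 _ = _; rw [infDist_zero_of_mem h, mul_zero]; norm_num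
  have hCC : ∀ n : ℕ, CC n (f n) := fun n => ⟨by rw [hf]; exact continuous_const.min (continuous_const.mul (continuous_infDist_pt _)), fun z hz => by
    by_contra h
    refine hz (hfz n z ?_)
    rw [hV]; exact fun h2 => h (by have := h2.2; rw [mem_ball_zero_iff] at this; exact this.le)⟩
  have hVm : ∀ n m : ℕ, n ≤ m → V m ⊆ V n := fun n m h => by
    rw [hV]; exact compl_subset_compl.2 (inter_subset_inter_right _ (ball_subset_ball (by exact_mod_cast h)))
  have hmono : ∀ y, Monotone fun n => f n y := fun y n m h => by
    rw [hf]
    refine min_le_min_left _ (mul_le_mul (by exact_mod_cast h) (infDist_le_infDist_of_subset (hVm n m h) (hVn m)) infDist_nonneg m.cast_nonneg)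
  have hle : ∀ n y, ENNReal.ofReal (f n y) ≤ U.indicator 1 y := fun n y => by
    by_cases hy : y ∈ U
    · rw [indicator_of_mem hy]; simpa using hf1 n y
    · rw [hfz n y (by rw [hV]; exact fun h => hy h.1)]; simp
  have hsup : ∀ y, (⨆ n, ENNReal.ofReal (f n y)) = U.indicator 1 y := fun y => by
    refine le_antisymm (iSup_le fun n => hle n y) ?_
    by_cases hy : y ∈ U
    · obtain ⟨N, hN⟩ := exists_nat_gt ‖y‖
      have hyV : y ∉ V N := by rw [hV]; exact fun h => h ⟨hy, by rw [mem_ball_zero_iff]; exact hN⟩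
      have hd : 0 < infDist y (V N) := ((hVc N).notMem_iff_infDist_pos (hVn N)).1 hyV
      obtain ⟨k, hk⟩ := exists_nat_gt (infDist y (V N))⁻¹
      refine le_iSup_of_le (max N k) ?_
      have h1 : f (max N k) y = 1 := by
        rw [hf]; refine min_eq_left ?_
        calc (1:ℝ) = (infDist y (V N))⁻¹ * infDist y (V N) := (inv_mul_cancel₀ hd.ne').symm
          _ ≤ (max N k : ℕ) * infDist y (V (max N k)) := by
              refine mul_le_mul (hk.le.trans (by exact_mod_cast le_max_right N k)) (infDist_le_infDist_of_subset (hVm _ _ (le_max_left _ _)) (hVn _)) infDist_nonneg (Nat.cast_nonneg _)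
      rw [h1, indicator_of_mem hy]; simp
    · rw [indicator_of_notMem hy]; exact zero_le
  obtain ⟨S, hS⟩ : ∃ S : ℕ → Set ℂ, S = fun n => {x | ∃ t, 0 < t ∧ lam < SA (f n) t x} := ⟨_, rfl⟩
  have hSm : Monotone S := fun n m h x hx => by
    rw [hS] at hx ⊢
    obtain ⟨t, ht, h1⟩ := hx
    exact ⟨t, ht, h1.trans_le (SA_mono (hCC n).cont (hCC m).cont fun _ => hmono _ h)⟩
  have hsub : {x | ∃ t, 0 < t ∧ ENNReal.ofReal lam < LA (U.indicator 1) t x} ⊆ ⋃ n, S n := by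
    rintro x ⟨t, ht, h⟩
    have e : LA (U.indicator 1) t x = ⨆ n, ENNReal.ofReal (SA (f n) t x) := by
      calc _ = LA (fun y => ⨆ n, ENNReal.ofReal (f n y)) t x := by congr 1; funext y; exact (hsup y).symm
        _ = ⨆ n, LA (fun y => ENNReal.ofReal (f n y)) t x := by
            unfold LA
            rw [lintegral_iSup, ENNReal.mul_iSup]
            · intro n
              have := (hCC n).cont
              have : Continuous fun θ : ℝ => f n (x + t * ec θ) := this.comp (by fun_prop)
              exact this.measurable.ennreal_ofReal
            · exact fun n m h θ => ENNReal.ofReal_le_ofReal (hmono _ h)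
        _ = _ := by congr 1; funext n; exact LA_SA (hCC n) (hf0 n) t x
    rw [e, lt_iSup_iff] at h
    obtain ⟨n, h⟩ := h
    refine mem_iUnion.2 ⟨n, ?_⟩
    rw [hS]
    exact ⟨t, ht, (ENNReal.ofReal_lt_ofReal_iff_of_nonneg l0.le).1 h⟩
  calc _ ≤ mu (⋃ n, S n) := measure_mono hsub
    _ = ⨆ n, mu (S n) := hSm.measure_iUnion
    _ ≤ _ := by
      refine iSup_le fun n => ?_
      rw [hS]
      refine (weakCC (hCC n) (hf0 n) (hf1 n) l0 l1 η0 η1).trans (mul_le_mul_right ?_ _)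
      rw [← lintegral_indicator_one hU.measurableSet]
      exact lintegral_mono (hle n)

lemma weak_set (E : Set ℂ) (l0 : 0 < lam) (l1 : lam ≤ 1) (η0 : 0 < η) (η1 : η ≤ 1) :
    mu {x | ∃ t, 0 < t ∧ ENNReal.ofReal lam < LA (E.indicator 1) t x} ≤ ENNReal.ofReal (KM η * lam ^ (-2 - η)) * mu E := by
  rw [E.measure_eq_iInf_isOpen]
  have h0 : ENNReal.ofReal (KM η * lam ^ (-2 - η)) ≠ 0 := by
    rw [Ne, ENNReal.ofReal_eq_zero, not_le]; exact mul_pos (KM_pos η0) (Real.rpow_pos_of_pos l0 _)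
  rw [mul_comm, ← ENNReal.div_le_iff h0 ENNReal.ofReal_ne_top]
  refine le_iInf₂ fun U hEU => le_iInf fun hU => ?_
  rw [ENNReal.div_le_iff h0 ENNReal.ofReal_ne_top, mul_comm]
  refine (measure_mono ?_).trans (weak_open hU l0 l1 η0 η1)
  rintro x ⟨t, ht, h⟩
  exact ⟨t, ht, h.trans_le (LA_mono (fun y => indicator_le_indicator_of_subset hEU (fun _ => zero_le) y) t x)⟩

end
end SM

namespace SM

lemma LA_const (c : ℝ≥0∞) (t : ℝ) (x : ℂ) : LA (fun _ => c) t x = c := by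
  unfold LA
  rw [setLIntegral_const, Real.volume_Ioc, mul_left_comm, ← ENNReal.ofReal_mul (by positivity)]
  rw [show (2 * Real.pi)⁻¹ * (Real.pi - -Real.pi) = 1 by have := Real.pi_ne_zero; field_simp; norm_num]
  simp

section
variable {F : ℂ → ℝ}

/-- superlevel sets -/
def Ev (F : ℂ → ℝ) (m : ℤ) : Set ℂ := {y | 2 ^ m < F y}

lemma Ev_meas (hF : Measurable F) (m : ℤ) : MeasurableSet (Ev F m) := measurableSet_lt measurable_const hF

lemma layer (m : ℤ) (y : ℂ) : ENNReal.ofReal (F y) ≤ ENNReal.ofReal (2 ^ (m - 1)) + ∑' l : ℕ, ENNReal.ofReal (2 ^ (m + l)) * (Ev F (m + l - 1)).indicator 1 y := by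
  rcases le_or_gt (F y) (2 ^ (m - 1)) with h | h
  · exact (ENNReal.ofReal_le_ofReal h).trans le_self_add
  · obtain ⟨n, h1, h2⟩ := exists_mem_Ioc_zpow ((p2 (m - 1)).trans h) (by norm_num : (1:ℝ) < 2)
    have h3 : m - 1 < n + 1 := (zpow_lt_zpow_iff_right₀ (by norm_num : (1:ℝ) < 2)).1 (h.trans_le h2)
    obtain ⟨l, hl⟩ := Int.eq_ofNat_of_zero_le (by omega : 0 ≤ n - m + 1)
    refine le_trans ?_ le_add_self
    refine le_trans ?_ (ENNReal.le_tsum l)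
    have hmem : y ∈ Ev F (m + l - 1) := by rw [show m + (l:ℤ) - 1 = n by omega]; exact h1
    rw [indicator_of_mem hmem, show m + (l:ℤ) = n + 1 by omega]
    simpa using ENNReal.ofReal_le_ofReal h2

lemma LA_layer (hF : Measurable F) (m : ℤ) (t : ℝ) (x : ℂ) : LA (fun y => ENNReal.ofReal (F y)) t x ≤ ENNReal.ofReal (2 ^ (m - 1)) + ∑' l : ℕ, ENNReal.ofReal (2 ^ (m + l)) * LA ((Ev F (m + l - 1)).indicator 1) t x := by
  refine (LA_mono (layer m) t x).trans (le_of_eq ?_)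
  have hm : ∀ n : ℤ, Measurable ((Ev F n).indicator (1 : ℂ → ℝ≥0∞)) := fun n => measurable_one.indicator (Ev_meas hF n)
  have hc : Measurable fun θ : ℝ => x + t * ec θ := by have := ec_cont; exact (by fun_prop : Continuous _).measurable
  have hm2 : ∀ n : ℤ, Measurable fun θ : ℝ => (Ev F n).indicator (1 : ℂ → ℝ≥0∞) (x + t * ec θ) := fun n => (hm n).comp hc
  conv_lhs => unfold LA
  rw [lintegral_add_left measurable_const, mul_add]
  congr 1
  · exact LA_const _ t x
  · rw [lintegral_tsum fun l => ((hm2 _).const_mul _).aemeasurable, ← ENNReal.tsum_mul_left]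
    congr 1; funext l
    rw [lintegral_const_mul _ (hm2 _), mul_left_comm]; rfl

/-- maximal function -/
def MA (F : ℂ → ℝ≥0∞) (x : ℂ) : ℝ≥0∞ := ⨆ (t : ℝ) (_ : 0 < t), LA F t x

variable {q η p : ℝ}

lemma level (hF : Measurable F) (q0 : 0 < q) (q1 : q < 1) (η0 : 0 < η) (η1 : η ≤ 1) (m : ℤ) :
    mu {x | ENNReal.ofReal (2 ^ m) < MA (fun y => ENNReal.ofReal (F y)) x} ≤ ∑' l : ℕ, ENNReal.ofReal (KM η * ((1 - q) / 4) ^ (-2 - η) * ((2 / q) ^ (2 + η)) ^ l) * mu (Ev F (m + l - 1)) := by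
  obtain ⟨la, hla⟩ : ∃ la : ℕ → ℝ, la = fun l => (1 - q) / 4 * (q / 2) ^ l := ⟨_, rfl⟩
  have c0 : 0 < (1 - q) / 4 := by linarith
  have la0 : ∀ l, 0 < la l := fun l => by rw [hla]; positivity
  have la1 : ∀ l, la l ≤ 1 := fun l => by
    rw [hla]; exact mul_le_one₀ (by linarith) (by positivity) (pow_le_one₀ (by positivity) (by linarith))
  have hsub : {x | ENNReal.ofReal (2 ^ m) < MA (fun y => ENNReal.ofReal (F y)) x} ⊆ ⋃ l : ℕ, {x | ∃ t, 0 < t ∧ ENNReal.ofReal (la l) < LA ((Ev F (m + l - 1)).indicator 1) t x} := by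
    intro x hx
    rw [Set.mem_ofPred_eq] at hx
    unfold MA at hx
    simp only [lt_iSup_iff] at hx
    obtain ⟨t, ht, h⟩ := hx
    by_contra hn
    simp only [mem_iUnion, Set.mem_ofPred_eq, not_exists, not_and, not_lt] at hn
    refine absurd h (not_lt.2 ((LA_layer hF m t x).trans ?_))
    have hs : Summable fun l : ℕ => (2:ℝ) ^ m * ((1 - q) / 4) * q ^ l := (summable_geometric_of_lt_one q0.le q1).mul_left _
    calc _ ≤ ENNReal.ofReal (2 ^ (m - 1)) + ∑' l : ℕ, ENNReal.ofReal (2 ^ m * ((1 - q) / 4) * q ^ l) := by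
          refine add_le_add le_rfl (ENNReal.tsum_le_tsum fun l => ?_)
          refine (mul_le_mul_right (hn l t ht) _).trans (le_of_eq ?_)
          rw [← ENNReal.ofReal_mul (p2 _).le, hla]
          congr 1
          show (2:ℝ) ^ (m + (l:ℤ)) * ((1 - q) / 4 * (q / 2) ^ l) = _
          rw [zpow_add₀ (by norm_num), zpow_natCast, div_pow]
          have : (2:ℝ) ^ l ≠ 0 := by positivity
          field_simp
      _ = ENNReal.ofReal (2 ^ (m - 1) + 2 ^ m * ((1 - q) / 4) * (1 - q)⁻¹) := by
          have h2 := p2 m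
          have h3 : 0 < (1 - q)⁻¹ := inv_pos.2 (by linarith)
          rw [← ENNReal.ofReal_tsum_of_nonneg (fun l => by positivity) hs, tsum_mul_left, tsum_geometric_of_lt_one q0.le q1, ENNReal.ofReal_add (p2 _).le (by positivity)]
      _ ≤ _ := by
          refine ENNReal.ofReal_le_ofReal ?_
          have h2 := p2 m
          have h3 : (1 - q) ≠ 0 := by linarith
          rw [zpow_sub_one₀ (by norm_num)]
          calc (2:ℝ) ^ m * 2⁻¹ + 2 ^ m * ((1 - q) / 4) * (1 - q)⁻¹ = 2 ^ m * (3 / 4) := by field_simp; norm_num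
            _ ≤ _ := by linarith
  refine (measure_mono hsub).trans ((measure_iUnion_le _).trans (ENNReal.tsum_le_tsum fun l => ?_))
  refine (weak_set _ (la0 l) (la1 l) η0 η1).trans (le_of_eq ?_)
  congr 2
  rw [hla]
  show KM η * ((1 - q) / 4 * (q / 2) ^ l) ^ (-2 - η) = _
  rw [Real.mul_rpow c0.le (by positivity), mul_assoc]
  congr 2
  rw [← Real.rpow_natCast, ← Real.rpow_mul (by positivity), ← Real.rpow_natCast, ← Real.rpow_mul (by positivity), ← inv_div, Real.inv_rpow (by positivity), ← Real.rpow_neg (by positivity)]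
  congr 1; ring

/-- dyadic weights -/
def W (p : ℝ) (m : ℤ) : ℝ := (2:ℝ) ^ ((m:ℝ) * p)

lemma W_pos (m : ℤ) : 0 < W p m := Real.rpow_pos_of_pos (by norm_num) _
lemma W_eq (m : ℤ) : W p m = ((2:ℝ) ^ m) ^ p := by
  unfold W; rw [Real.rpow_mul (by norm_num), Real.rpow_intCast]

lemma W_add (m n : ℤ) : W p (m + n) = W p m * W p n := by
  unfold W; rw [← Real.rpow_add (by norm_num)]; congr 1; push_cast; ring

lemma up (hp : 0 < p) (a : ℝ≥0∞) : a ^ p ≤ ∑' m : ℤ, ENNReal.ofReal (W p (m + 1)) * (if ENNReal.ofReal (2 ^ m) < a then 1 else 0) := by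
  rcases eq_or_ne a 0 with rfl | h0
  · rw [ENNReal.zero_rpow_of_pos hp]; exact zero_le
  rcases eq_or_ne a ∞ with rfl | ht
  · refine le_trans le_top (le_trans (ENNReal.tsum_const_eq_top_of_ne_zero (α := ℕ) one_ne_zero).ge ?_)
    refine le_trans ?_ (ENNReal.tsum_comp_le_tsum_of_injective (f := fun n : ℕ => (n:ℤ)) Nat.cast_injective _)
    refine ENNReal.tsum_le_tsum fun n => ?_
    rw [if_pos ENNReal.ofReal_lt_top, mul_one, ENNReal.one_le_ofReal]
    unfold W
    exact Real.one_le_rpow (by norm_num) (by push_cast; positivity)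
  · obtain ⟨b, rfl⟩ : ∃ b : ℝ≥0, a = b := ⟨a.toNNReal, (ENNReal.coe_toNNReal ht).symm⟩
    have hb : 0 < (b:ℝ) := by exact_mod_cast pos_iff_ne_zero.2 h0
    obtain ⟨n, h1, h2⟩ := exists_mem_Ioc_zpow hb (by norm_num : (1:ℝ) < 2)
    refine le_trans ?_ (ENNReal.le_tsum n)
    have e : (b:ℝ≥0∞) = ENNReal.ofReal b := (ENNReal.ofReal_coe_nnreal).symm
    rw [if_pos (by rw [e]; exact (ENNReal.ofReal_lt_ofReal_iff hb).2 h1), mul_one, W_eq, e, ENNReal.ofReal_rpow_of_pos hb]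
    exact ENNReal.ofReal_le_ofReal (Real.rpow_le_rpow hb.le h2 hp.le)

lemma down (hp : 1 ≤ p) (b : ℝ) : ∑' m : ℤ, ENNReal.ofReal (W p m) * (if 2 ^ m < b then 1 else 0) ≤ ENNReal.ofReal 4 * ENNReal.ofReal b ^ p := by
  rcases le_or_gt b 0 with h | hb
  · have : ∀ m : ℤ, ¬ ((2:ℝ) ^ m < b) := fun m => not_lt.2 (h.trans (p2 m).le)
    simp [this]
  obtain ⟨n, h1, h2⟩ := exists_mem_Ioc_zpow hb (by norm_num : (1:ℝ) < 2)
  rw [ENNReal.tsum_eq_iSup_sum]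
  refine iSup_le fun G => ?_
  calc _ ≤ ∑ m ∈ G, ENNReal.ofReal (W p n * 2 ^ (-|n - m|)) := by
        refine Finset.sum_le_sum fun m _ => ?_
        split_ifs with h
        · have hm : m < n + 1 := (zpow_lt_zpow_iff_right₀ (by norm_num : (1:ℝ) < 2)).1 (h.trans_le h2)
          rw [mul_one]
          refine ENNReal.ofReal_le_ofReal ?_
          rw [abs_of_nonneg (by omega), show m = n + -(n - m) by ring, W_add]
          rw [show n - (n + -(n - m)) = n - m by ring]
          refine mul_le_mul_of_nonneg_left ?_ (W_pos n).le
          unfold W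
          rw [← Real.rpow_intCast]
          refine Real.rpow_le_rpow_of_exponent_le (by norm_num) ?_
          have h3 : (0:ℝ) ≤ ((n - m : ℤ) : ℝ) := by exact_mod_cast (by omega : 0 ≤ n - m)
          rw [Int.cast_neg]
          nlinarith only [h3, hp]
        · rw [mul_zero]; exact zero_le
    _ = ENNReal.ofReal (W p n * ∑ m ∈ G, 2 ^ (-|n - m|)) := by
        rw [Finset.mul_sum, ENNReal.ofReal_sum_of_nonneg fun m _ => (mul_pos (W_pos n) (p2 _)).le]
    _ ≤ ENNReal.ofReal (4 * b ^ p) := by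
        refine ENNReal.ofReal_le_ofReal ?_
        rw [mul_comm 4]
        have hbp : 0 < b ^ p := Real.rpow_pos_of_pos hb _
        refine mul_le_mul ?_ (geo_sum G n) (Finset.sum_nonneg fun _ _ => (p2 _).le) hbp.le
        rw [W_eq]
        exact Real.rpow_le_rpow (p2 n).le h1.le (by linarith)
    _ = _ := by rw [ENNReal.ofReal_mul (by norm_num), ENNReal.ofReal_rpow_of_pos hb]

theorem strong0 (q0 : 0 < q) (q1 : q < 1) (η0 : 0 < η) (η1 : η ≤ 1) (hp : 1 ≤ p) (hb : (2 / q) ^ (2 + η) < 2 ^ p) :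
    ∃ C : ℝ, ∀ F : ℂ → ℝ, Measurable F → ∫⁻ x, MA (fun y => ENNReal.ofReal (F y)) x ^ p ∂mu ≤ ENNReal.ofReal C * ∫⁻ x, ENNReal.ofReal (F x) ^ p ∂mu := by
  obtain ⟨K, hK⟩ : ∃ K : ℝ, K = KM η * ((1 - q) / 4) ^ (-2 - η) := ⟨_, rfl⟩
  obtain ⟨β, hβ⟩ : ∃ β : ℝ, β = (2 / q) ^ (2 + η) := ⟨_, rfl⟩
  have K0 : 0 < K := by rw [hK]; exact mul_pos (KM_pos η0) (Real.rpow_pos_of_pos (by linarith) _)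
  have β0 : 0 < β := by rw [hβ]; exact Real.rpow_pos_of_pos (by positivity) _
  rw [← hβ] at hb
  have h2p : (0:ℝ) < 2 ^ p := Real.rpow_pos_of_pos (by norm_num) _
  have hr : β / 2 ^ p < 1 := (div_lt_one h2p).2 hb
  have hr0 : 0 < β / 2 ^ p := div_pos β0 h2p
  have hr1 : 0 < (1 - β / 2 ^ p)⁻¹ := inv_pos.2 (by linarith)
  refine ⟨K * W p 2 * (1 - β / 2 ^ p)⁻¹ * 4, fun F hF => ?_⟩
  obtain ⟨S, hS⟩ : ∃ S : ℤ → Set ℂ, S = fun m => {x | ENNReal.ofReal (2 ^ m) < MA (fun y => ENNReal.ofReal (F y)) x} := ⟨_, rfl⟩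
  obtain ⟨T, hT⟩ : ∃ T : ℝ≥0∞, T = ∑' m : ℤ, ENNReal.ofReal (W p m) * mu (Ev F m) := ⟨_, rfl⟩
  have hT4 : T ≤ ENNReal.ofReal 4 * ∫⁻ x, ENNReal.ofReal (F x) ^ p ∂mu := by
    have hm : Measurable fun x => ENNReal.ofReal (F x) ^ p := by fun_prop
    rw [← lintegral_const_mul _ hm, hT]
    calc _ = ∑' m : ℤ, ∫⁻ x, ENNReal.ofReal (W p m) * (Ev F m).indicator 1 x ∂mu := by
          congr 1; funext m
          rw [lintegral_const_mul _ (measurable_one.indicator (Ev_meas hF m)), lintegral_indicator_one (Ev_meas hF m)]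
      _ = ∫⁻ x, ∑' m : ℤ, ENNReal.ofReal (W p m) * (Ev F m).indicator 1 x ∂mu := by
          rw [lintegral_tsum fun m => ((measurable_one.indicator (Ev_meas hF m)).const_mul _).aemeasurable]
      _ ≤ _ := by
          refine lintegral_mono fun x => ?_
          refine le_trans (le_of_eq ?_) (down hp (F x))
          congr 1
  calc _ ≤ ∫⁻ x, ∑' m : ℤ, ENNReal.ofReal (W p (m + 1)) * (toMeasurable mu (S m)).indicator 1 x ∂mu := by
        refine lintegral_mono fun x => (up (by linarith) _).trans (ENNReal.tsum_le_tsum fun m => mul_le_mul_right ?_ _)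
        split_ifs with h
        · rw [indicator_of_mem (subset_toMeasurable _ _ (by rw [hS]; exact h))]; rfl
        · exact zero_le
    _ = ∑' m : ℤ, ENNReal.ofReal (W p (m + 1)) * mu (S m) := by
        rw [lintegral_tsum fun m => ((measurable_one.indicator (measurableSet_toMeasurable _ _)).const_mul _).aemeasurable]
        congr 1; funext m
        rw [lintegral_const_mul _ (measurable_one.indicator (measurableSet_toMeasurable _ _)), lintegral_indicator_one (measurableSet_toMeasurable _ _), measure_toMeasurable]
    _ ≤ ∑' m : ℤ, ∑' l : ℕ, ENNReal.ofReal (W p (m + 1)) * (ENNReal.ofReal (K * β ^ l) * mu (Ev F (m + l - 1))) := by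
        refine ENNReal.tsum_le_tsum fun m => ?_
        rw [ENNReal.tsum_mul_left, hS, hK, hβ]
        exact mul_le_mul_right (level hF q0 q1 η0 η1 m) _
    _ = ∑' l : ℕ, ENNReal.ofReal (K * W p 2 * (β / 2 ^ p) ^ l) * T := by
        rw [ENNReal.tsum_comm]
        congr 1; funext l
        rw [hT, ← ENNReal.tsum_mul_left]
        conv_rhs => rw [← (Equiv.addRight ((l:ℤ) - 1)).tsum_eq]
        congr 1; funext m
        simp only [Equiv.coe_addRight]
        rw [← mul_assoc, ← mul_assoc, ← ENNReal.ofReal_mul (W_pos _).le, ← ENNReal.ofReal_mul (mul_pos (mul_pos K0 (W_pos _)) (pow_pos hr0 _)).le, show m + ((l:ℤ) - 1) = m + l - 1 by ring]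
        congr 2
        have e1 : m + 1 + l = 2 + (m + (l:ℤ) - 1) := by ring
        have e2 : W p (m + 1) * W p l = W p 2 * W p (m + l - 1) := by rw [← W_add, ← W_add, e1]
        have e3 : W p (l:ℤ) = (2 ^ p) ^ l := by
          unfold W
          rw [← Real.rpow_natCast, ← Real.rpow_mul (by norm_num)]; congr 1; push_cast; ring
        rw [e3] at e2
        rw [div_pow]
        field_simp
        linear_combination e2
    _ = ENNReal.ofReal (K * W p 2 * (1 - β / 2 ^ p)⁻¹) * T := by
        have h2 := W_pos (p := p) 2
        rw [ENNReal.tsum_mul_right, ← ENNReal.ofReal_tsum_of_nonneg (fun l => by positivity) ((summable_geometric_of_lt_one hr0.le hr).mul_left _), tsum_mul_left, tsum_geometric_of_lt_one hr0.le hr]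
    _ ≤ _ := by
        have h2 := W_pos (p := p) 2
        refine (mul_le_mul_right hT4 _).trans (le_of_eq ?_)
        rw [← mul_assoc, ← ENNReal.ofReal_mul (by positivity)]

theorem strong (hp : 2 < p) :
    ∃ C : ℝ, ∀ F : ℂ → ℝ, Measurable F → ∫⁻ x, MA (fun y => ENNReal.ofReal (F y)) x ^ p ∂mu ≤ ENNReal.ofReal C * ∫⁻ x, ENNReal.ofReal (F x) ^ p ∂mu := by
  obtain ⟨η, hη⟩ : ∃ η : ℝ, η = (min p 3 - 2) / 4 := ⟨_, rfl⟩
  have h1 : min p 3 ≤ 3 := min_le_right _ _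
  have h2 : min p 3 ≤ p := min_le_left _ _
  have h3 : 2 < min p 3 := lt_min hp (by norm_num)
  have η0 : 0 < η := by linarith
  refine strong0 (q := 2 ^ (-(η / 4))) (η := η) (Real.rpow_pos_of_pos (by norm_num) _) (Real.rpow_lt_one_of_one_lt_of_neg (by norm_num) (by linarith)) η0 (by linarith) (by linarith) ?_
  have e : (2:ℝ) / 2 ^ (-(η / 4)) = 2 ^ (1 + η / 4) := by
    rw [Real.rpow_neg (by norm_num), div_inv_eq_mul, Real.rpow_add (by norm_num), Real.rpow_one]
  rw [e, ← Real.rpow_mul (by norm_num)]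
  refine Real.rpow_lt_rpow_of_exponent_lt (by norm_num) ?_
  nlinarith only [h1, h2, h3, hη, η0]

end
end SM

namespace SM

abbrev E2 := EuclideanSpace ℝ (Fin 2)

/-- parametrization of the circle -/
def phi (J : ℂ ≃ₗᵢ[ℝ] E2) (θ : ℝ) : sphere (0 : E2) 1 := ⟨J (ec θ), by rw [mem_sphere_zero_iff_norm, J.norm_map, ec_norm]⟩

lemma phi_cont (J : ℂ ≃ₗᵢ[ℝ] E2) : Continuous (phi J) := by
  have := ec_cont
  exact Continuous.subtype_mk (J.continuous.comp this) _

lemma ec_arg (z : ℂ) : z = ‖z‖ * ec z.arg := by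
  unfold ec; exact (Complex.norm_mul_exp_arg_mul_I z).symm

lemma half_int : ∫⁻ r in Ioo (0:ℝ) 1, ENNReal.ofReal r = ENNReal.ofReal (1/2) := by
  rw [← ofReal_integral_eq_lintegral_ofReal]
  · rw [← integral_Ioc_eq_integral_Ioo, ← intervalIntegral.integral_of_le zero_le_one, integral_id]; norm_num
  · exact ((continuous_id.intervalIntegrable 0 1).1).mono_set Ioo_subset_Ioc_self
  · exact (ae_restrict_iff' measurableSet_Ioo).2 (Filter.Eventually.of_forall fun r hr => hr.1.le)

lemma sph_map (J : ℂ ≃ₗᵢ[ℝ] E2) : sphereMeasure 2 = (volume.restrict (Ioc (-Real.pi) Real.pi)).map (phi J) := by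
  ext s hs
  have hφ := (phi_cont J).measurable
  have hpre : MeasurableSet (phi J ⁻¹' s) := hφ hs
  unfold sphereMeasure
  rw [Measure.toSphere_apply' _ hs, Measure.map_apply hφ hs, finrank_euclideanSpace_fin]
  obtain ⟨A, hA⟩ : ∃ A : Set ℂ, A = {z | ‖z‖ ∈ Ioo (0:ℝ) 1 ∧ phi J z.arg ∈ s} := ⟨_, rfl⟩
  have hAm : MeasurableSet A := by
    rw [hA]
    exact (measurable_norm measurableSet_Ioo).inter ((hφ.comp Complex.measurable_arg) hs)
  have hJ : J ⁻¹' (Ioo (0:ℝ) 1 • ((↑) '' s : Set E2)) = A := by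
    ext z
    rw [hA, mem_preimage, mem_smul]
    constructor
    · rintro ⟨r, hr, _, ⟨y, hy, rfl⟩, h⟩
      have hz : ‖z‖ = r := by
        rw [← J.norm_map, ← h, norm_smul, Real.norm_of_nonneg hr.1.le, mem_sphere_zero_iff_norm.1 y.2, mul_one]
      refine ⟨by rw [hz]; exact hr, ?_⟩
      convert hy
      refine Subtype.ext ?_
      show J (ec z.arg) = y
      have h2 : J z = r • J (ec z.arg) := by
        rw [← J.map_smul]; congr 1
        conv_lhs => rw [ec_arg z, hz]
        rw [Complex.real_smul]
      rw [h2] at h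
      exact (smul_right_injective _ hr.1.ne' h).symm
    · rintro ⟨h1, h2⟩
      refine ⟨‖z‖, h1, _, ⟨_, h2, rfl⟩, ?_⟩
      show ‖z‖ • J (ec z.arg) = J z
      rw [← J.map_smul]; congr 1
      rw [Complex.real_smul]; exact (ec_arg z).symm
  have hv : volume (Ioo (0:ℝ) 1 • ((↑) '' s : Set E2)) = volume A := by
    rw [← hJ]
    exact (J.measurePreserving.measure_preimage_emb J.toHomeomorph.measurableEmbedding _).symm
  have ht : _root_.polarCoord.target = Ioi (0:ℝ) ×ˢ Ioo (-Real.pi) Real.pi := polarCoord_target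
  rw [hv, ← lintegral_indicator_one hAm, ← Complex.lintegral_comp_polarCoord_symm, ht]
  calc _ = 2 * ∫⁻ q in Ioi (0:ℝ) ×ˢ Ioo (-Real.pi) Real.pi, (Ioo (0:ℝ) 1).indicator (fun r => ENNReal.ofReal r) q.1 * (phi J ⁻¹' s).indicator 1 q.2 := by
        congr 1
        refine setLIntegral_congr_fun (measurableSet_Ioi.prod measurableSet_Ioo) fun q hq => ?_
        have h0 : 0 < q.1 := hq.1
        have harg : (Complex.polarCoord.symm q).arg = q.2 := by
          have := Complex.polarCoord.right_inv (x := q) (by rw [Complex.polarCoord_target]; exact hq)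
          rw [Complex.polarCoord_apply] at this
          exact congrArg Prod.snd this
        have hmem : Complex.polarCoord.symm q ∈ A ↔ q.1 ∈ Ioo (0:ℝ) 1 ∧ q.2 ∈ phi J ⁻¹' s := by
          rw [hA, Set.mem_ofPred_eq, Complex.norm_polarCoord_symm, abs_of_pos h0, harg]; rfl
        classical
        simp only [indicator_apply, hmem, Pi.one_apply, smul_eq_mul]
        by_cases h1 : q.1 ∈ Ioo (0:ℝ) 1 <;> by_cases h2 : q.2 ∈ phi J ⁻¹' s <;> simp [h1, h2]
    _ = _ := by
        rw [Measure.volume_eq_prod, ← Measure.prod_restrict]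
        rw [lintegral_prod_mul (f := (Ioo (0:ℝ) 1).indicator (fun r => ENNReal.ofReal r)) (g := (phi J ⁻¹' s).indicator 1) (ENNReal.measurable_ofReal.indicator measurableSet_Ioo).aemeasurable (measurable_one.indicator hpre).aemeasurable]
        rw [lintegral_indicator_one hpre, lintegral_indicator measurableSet_Ioo, Measure.restrict_restrict measurableSet_Ioo, inter_eq_left.2 Ioo_subset_Ioi_self, half_int, ← mul_assoc, Measure.restrict_congr_set Ioo_ae_eq_Ioc]
        have e12 : (2:ℝ≥0∞) * ENNReal.ofReal (1/2) = 1 := by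
          rw [show (2:ℝ≥0∞) = ENNReal.ofReal 2 by simp, ← ENNReal.ofReal_mul (by norm_num)]; norm_num
        rw [e12, one_mul]

/-- the identification of the plane with the Euclidean space -/
def iso2 : ℂ ≃ₗᵢ[ℝ] E2 := Complex.orthonormalBasisOneI.repr

lemma sph_int (G : E2 → ℝ≥0∞) (hG : Measurable G) (t : ℝ) (z : ℂ) : 
    ∫⁻ y, G (iso2 z - t • (y : E2)) ∂(sphereMeasure 2) = ∫⁻ θ in Ioc (-Real.pi) Real.pi, G (iso2 (z + t * ec θ)) := by
  rw [sph_map (iso2.trans (LinearIsometryEquiv.neg ℝ)), lintegral_map (by fun_prop) (phi_cont _).measurable]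
  refine lintegral_congr fun θ => ?_
  congr 1
  show iso2 z - t • (-(iso2 (ec θ))) = _
  rw [smul_neg, sub_neg_eq_add, ← iso2.map_smul, ← iso2.map_add, Complex.real_smul]

lemma sph_univ : sphereMeasure 2 univ = ENNReal.ofReal (2 * Real.pi) := by
  rw [sph_map iso2, Measure.map_apply (phi_cont _).measurable MeasurableSet.univ, preimage_univ, Measure.restrict_apply_univ, Real.volume_Ioc]; congr 1; ring

lemma sph_real : (sphereMeasure 2).real univ = 2 * Real.pi := by
  rw [measureReal_def, sph_univ, ENNReal.toReal_ofReal (by positivity)]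

instance sph_fin : IsFiniteMeasure (sphereMeasure 2) := ⟨by rw [sph_univ]; exact ENNReal.ofReal_lt_top⟩

lemma sph_le {f : E2 → ℂ} (hf : Measurable f) (t : ℝ) (z : ℂ) : (‖sphAvg 2 f t (iso2 z)‖₊ : ℝ≥0∞) ≤ LA (fun y => ENNReal.ofReal ‖f (iso2 y)‖) t z := by
  unfold sphAvg
  rw [average_eq, sph_real, ← enorm_eq_nnnorm, enorm_smul]
  unfold LA
  rw [Real.enorm_eq_ofReal (by positivity)]
  refine mul_le_mul_right ((enorm_integral_le_lintegral_enorm _).trans (le_of_eq ?_)) _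
  rw [← sph_int (fun w => ENNReal.ofReal ‖f w‖) (by fun_prop)]
  simp_rw [ofReal_norm]

lemma sph_eq {F : E2 → ℝ} (hF : Measurable F) (h0 : ∀ y, 0 ≤ F y) (h1 : ∀ y, F y ≤ 1) (t : ℝ) (z : ℂ) : (‖sphAvg 2 (fun y => (F y : ℂ)) t (iso2 z)‖₊ : ℝ≥0∞) = LA (fun y => ENNReal.ofReal (F (iso2 y))) t z := by
  unfold sphAvg
  have hi : Integrable (fun y : sphere (0 : E2) 1 => F (iso2 z - t • (y : E2))) (sphereMeasure 2) := by
    refine Integrable.of_bound (hF.comp (by fun_prop)).aestronglyMeasurable 1 (Filter.Eventually.of_forall fun y => ?_)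
    rw [Real.norm_of_nonneg (h0 _)]; exact h1 _
  rw [average_eq, sph_real, ← enorm_eq_nnnorm, enorm_smul]
  unfold LA
  rw [Real.enorm_eq_ofReal (by positivity), ← sph_int (fun w => ENNReal.ofReal (F w)) (by fun_prop)]
  beta_reduce
  rw [integral_complex_ofReal]
  congr 1
  rw [← ofReal_norm, Complex.norm_real, Real.norm_of_nonneg (integral_nonneg fun _ => h0 _), ofReal_integral_eq_lintegral_ofReal hi (Filter.Eventually.of_forall fun _ => h0 _)]

lemma int_tr (G : E2 → ℝ≥0∞) : ∫⁻ x, G x * ENNReal.ofReal (‖x‖ ^ (-1 : ℝ)) = ∫⁻ z, G (iso2 z) ∂mu := by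
  unfold mu
  rw [lintegral_withDensity_eq_lintegral_mul_non_measurable _ mu_dens (Filter.Eventually.of_forall fun _ => ENNReal.ofReal_lt_top), ← iso2.measurePreserving.lintegral_comp_emb iso2.toHomeomorph.measurableEmbedding]
  refine lintegral_congr fun z => ?_
  rw [Pi.mul_apply, iso2.norm_map, Real.rpow_neg_one, mul_comm]

theorem suff {p : ℝ} (hp : 2 < p) : ∃ C : ℝ≥0, ∀ f : EuclideanSpace ℝ (Fin 2) → ℂ, Measurable f →
        ∫⁻ x, sphMax 2 f x ^ p * ENNReal.ofReal (‖x‖ ^ (-1 : ℝ)) ≤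
          C * ∫⁻ x, (‖f x‖₊ : ℝ≥0∞) ^ p * ENNReal.ofReal (‖x‖ ^ (-1 : ℝ)) := by
  obtain ⟨C, hC⟩ := strong hp
  refine ⟨C.toNNReal, fun f hf => ?_⟩
  rw [int_tr (fun x => sphMax 2 f x ^ p), int_tr (fun x => (‖f x‖₊ : ℝ≥0∞) ^ p)]
  have hm : Measurable fun z => ‖f (iso2 z)‖ := (hf.comp iso2.continuous.measurable).norm
  refine le_trans (lintegral_mono fun z => ?_) ((hC _ hm).trans (le_of_eq ?_))
  · refine ENNReal.rpow_le_rpow ?_ (by linarith)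
    exact iSup₂_mono fun t ht => sph_le hf t z
  · simp_rw [ofReal_norm]; rfl

end SM

namespace SM

lemma ec_sq (s t α θ : ℝ) : ‖(s:ℂ) * ec α + t * ec θ‖ ^ 2 = s ^ 2 + t ^ 2 + 2 * s * t * Real.cos (θ - α) := by
  unfold ec
  rw [Complex.exp_mul_I, Complex.exp_mul_I, ← Complex.ofReal_cos, ← Complex.ofReal_sin, ← Complex.ofReal_cos, ← Complex.ofReal_sin, ← Complex.normSq_eq_norm_sq, Complex.normSq_apply, Real.cos_sub]
  simp only [Complex.add_re, Complex.mul_re, Complex.ofReal_re, Complex.I_re, Complex.ofReal_im, Complex.I_im, Complex.add_im, Complex.mul_im]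
  have h1 := Real.sin_sq_add_cos_sq α
  have h2 := Real.sin_sq_add_cos_sq θ
  linear_combination s ^ 2 * h1 + t ^ 2 * h2

lemma nec_pt {δ s h α θ : ℝ} (δ0 : 0 < δ) (δ1 : δ ≤ 1) (s0 : 0 < s) (s1 : s ≤ 1) (hh : s * h ^ 2 = δ) (hθ : |θ - α| ≤ h) :
    ‖(s:ℂ) * ec α + (1 - s : ℝ) * ec θ‖ ∈ Icc (1 - δ) 1 := by
  have e := ec_sq s (1 - s) α θ
  have h1 := Real.one_sub_sq_div_two_le_cos (x := θ - α)
  have h2 := Real.cos_le_one (θ - α)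
  have h3 : (θ - α) ^ 2 ≤ h ^ 2 := by rw [← sq_abs]; exact pow_le_pow_left₀ (abs_nonneg _) hθ 2
  have h4 : 0 ≤ s * (1 - s) := mul_nonneg s0.le (by linarith)
  have h5 : s * (1 - s) * (θ - α) ^ 2 ≤ δ := by
    calc s * (1 - s) * (θ - α) ^ 2 ≤ s * 1 * h ^ 2 := by gcongr; linarith
      _ = δ := by rw [mul_one, hh]
  have h6 := mul_le_mul_of_nonneg_left h1 h4
  have h7 := mul_le_mul_of_nonneg_left h2 h4
  constructor
  · refine le_of_sq_le_sq ?_ (norm_nonneg _)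
    rw [e]
    nlinarith only [h5, h6, δ0, δ1]
  · refine le_of_sq_le_sq ?_ zero_le_one
    rw [e]
    nlinarith only [h7]

lemma nec_vol {h α : ℝ} (h0 : 0 ≤ h) (h1 : h ≤ 1) (hα : α ∈ Ioc (-Real.pi) Real.pi) : ENNReal.ofReal h ≤ volume ({θ | |θ - α| ≤ h} ∩ Ioc (-Real.pi) Real.pi) := by
  have hpi := Real.pi_gt_three
  rcases le_or_gt α 0 with ha | ha
  · have : Ioc α (α + h) ⊆ {θ | |θ - α| ≤ h} ∩ Ioc (-Real.pi) Real.pi := fun θ hθ =>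
      ⟨show |θ - α| ≤ h from abs_le.2 ⟨by linarith [hθ.1], by linarith [hθ.2]⟩, by linarith [hθ.1, hα.1], by linarith [hθ.2]⟩
    refine le_trans (le_of_eq ?_) (measure_mono this)
    rw [Real.volume_Ioc]; congr 1; ring
  · have : Ioc (α - h) α ⊆ {θ | |θ - α| ≤ h} ∩ Ioc (-Real.pi) Real.pi := fun θ hθ =>
      ⟨show |θ - α| ≤ h from abs_le.2 ⟨by linarith [hθ.1], by linarith [hθ.2]⟩, by linarith [hθ.1], by linarith [hθ.2, hα.2]⟩
    refine le_trans (le_of_eq ?_) (measure_mono this)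
    rw [Real.volume_Ioc]; congr 1; ring

/-- indicator of an annulus -/
def AF (δ : ℝ) (r : ℝ) : ℝ := (Icc (1 - δ) 1).indicator 1 r

lemma AF_meas (δ : ℝ) : Measurable (AF δ) := measurable_one.indicator measurableSet_Icc

lemma nec_LA {δ : ℝ} {z : ℂ} (δ0 : 0 < δ) (hz : ‖z‖ ∈ Ioo δ (1/2)) : 
    ENNReal.ofReal ((2 * Real.pi)⁻¹ * Real.sqrt (δ / ‖z‖)) ≤ LA (fun y => ENNReal.ofReal (AF δ ‖y‖)) (1 - ‖z‖) z := by
  obtain ⟨h1, h2⟩ := hz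
  have s0 : 0 < ‖z‖ := δ0.trans h1
  have hd : δ / ‖z‖ ≤ 1 := (div_le_one s0).2 h1.le
  have hsq : Real.sqrt (δ / ‖z‖) ^ 2 = δ / ‖z‖ := Real.sq_sqrt (by positivity)
  have hmeas : MeasurableSet {θ : ℝ | |θ - z.arg| ≤ Real.sqrt (δ / ‖z‖)} :=
    measurableSet_le (f := fun θ : ℝ => |θ - z.arg|) (g := fun _ => Real.sqrt (δ / ‖z‖)) (by fun_prop) (by fun_prop)
  unfold LA
  rw [ENNReal.ofReal_mul (by positivity)]
  refine mul_le_mul_right ?_ _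
  refine (nec_vol (Real.sqrt_nonneg _) (Real.sqrt_le_one.2 hd) ⟨Complex.neg_pi_lt_arg z, Complex.arg_le_pi z⟩).trans ?_
  rw [← Measure.restrict_apply hmeas, ← lintegral_indicator_one hmeas]
  refine lintegral_mono fun θ => ?_
  by_cases hθ : |θ - z.arg| ≤ Real.sqrt (δ / ‖z‖)
  · have hm := nec_pt (α := z.arg) (θ := θ) δ0 (by linarith) s0 (by linarith) (by rw [hsq]; field_simp) hθ
    rw [← ec_arg z] at hm
    rw [indicator_of_mem (show θ ∈ {θ : ℝ | |θ - z.arg| ≤ Real.sqrt (δ / ‖z‖)} from hθ)]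
    beta_reduce
    unfold AF
    rw [indicator_of_mem hm]; simp
  · rw [indicator_of_notMem (show θ ∉ {θ : ℝ | |θ - z.arg| ≤ Real.sqrt (δ / ‖z‖)} from hθ)]; exact zero_le

lemma nec_log {δ c : ℝ} (δ0 : 0 < δ) (c0 : 0 ≤ c) (δ1 : δ ≤ 1/2) : ∫⁻ r in Ioo δ (1/2), ENNReal.ofReal (c * r⁻¹) = ENNReal.ofReal (c * Real.log (1/2 / δ)) := by
  have hc : ContinuousOn (fun r : ℝ => c * r⁻¹) (uIcc δ (1/2)) := by
    rw [uIcc_of_le δ1]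
    exact continuousOn_const.mul (continuousOn_id.inv₀ fun r hr => (δ0.trans_le hr.1).ne')
  rw [← ofReal_integral_eq_lintegral_ofReal]
  · rw [← integral_Ioc_eq_integral_Ioo, ← intervalIntegral.integral_of_le δ1, intervalIntegral.integral_const_mul, integral_inv_of_pos δ0 (by norm_num)]
  · exact (hc.intervalIntegrable.1).mono_set Ioo_subset_Ioc_self
  · exact (ae_restrict_iff' measurableSet_Ioo).2 (Filter.Eventually.of_forall fun r hr => mul_nonneg c0 (inv_nonneg.2 (δ0.trans hr.1).le))

theorem nec {p : ℝ} (hp : 1 ≤ p) (h : ∃ C : ℝ≥0, ∀ f : EuclideanSpace ℝ (Fin 2) → ℂ, Measurable f →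
        ∫⁻ x, sphMax 2 f x ^ p * ENNReal.ofReal (‖x‖ ^ (-1 : ℝ)) ≤
          C * ∫⁻ x, (‖f x‖₊ : ℝ≥0∞) ^ p * ENNReal.ofReal (‖x‖ ^ (-1 : ℝ))) : 2 < p := by
  by_contra hp2
  rw [not_lt] at hp2
  obtain ⟨C, hC⟩ := h
  have hpi := Real.pi_pos
  obtain ⟨c, hc⟩ : ∃ c : ℝ, c = (2 * Real.pi)⁻¹ := ⟨_, rfl⟩
  have c0 : 0 < c := by rw [hc]; positivity
  have c1 : c ≤ 1 := by rw [hc]; exact inv_le_one_of_one_le₀ (by linarith [Real.pi_gt_three])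
  obtain ⟨L, hL⟩ : ∃ L : ℝ, L = ((C:ℝ) + 1) / c ^ 2 := ⟨_, rfl⟩
  have L0 : 0 < L := by rw [hL]; have := C.2; positivity
  obtain ⟨δ, hδ⟩ : ∃ δ : ℝ, δ = 1/2 * Real.exp (-L) := ⟨_, rfl⟩
  have δ0 : 0 < δ := by rw [hδ]; positivity
  have δ1 : δ ≤ 1/2 := by
    have := Real.exp_le_one_iff.2 (by linarith : -L ≤ 0)
    linarith
  have hlog : Real.log (1/2 / δ) = L := by
    rw [hδ, Real.exp_neg, show (1:ℝ)/2 / (1/2 * (Real.exp L)⁻¹) = Real.exp L by field_simp, Real.log_exp]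
  have hAE : Measurable fun y : E2 => AF δ ‖y‖ := (AF_meas δ).comp measurable_norm
  have hA0 : ∀ r, 0 ≤ AF δ r := fun r => indicator_nonneg (fun _ _ => zero_le_one) r
  have hA1 : ∀ r, AF δ r ≤ 1 := fun r => indicator_le_self' (fun _ _ => zero_le_one) r
  have key := hC (fun y => ((AF δ ‖y‖ : ℝ) : ℂ)) (Complex.measurable_ofReal.comp hAE)
  rw [int_tr (fun x => sphMax 2 (fun y => ((AF δ ‖y‖ : ℝ) : ℂ)) x ^ p), int_tr (fun x => (‖((AF δ ‖x‖ : ℝ) : ℂ)‖₊ : ℝ≥0∞) ^ p)] at key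
  have hR : ∫⁻ z, (‖((AF δ ‖iso2 z‖ : ℝ) : ℂ)‖₊ : ℝ≥0∞) ^ p ∂mu ≤ ENNReal.ofReal (2 * Real.pi) * ENNReal.ofReal δ := by
    calc _ = ∫⁻ z : ℂ, (Icc (1 - δ) 1).indicator 1 ‖z‖ ∂mu := by
          refine lintegral_congr fun z => ?_
          rw [iso2.norm_map]
          unfold AF
          by_cases hz : ‖z‖ ∈ Icc (1 - δ) 1
          · rw [indicator_of_mem hz, indicator_of_mem hz]; simp
          · rw [indicator_of_notMem hz, indicator_of_notMem hz]
            simp; linarith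
      _ ≤ _ := by
          rw [mu_rad (measurable_one.indicator measurableSet_Icc)]
          refine mul_le_mul_right ?_ _
          rw [lintegral_indicator_one measurableSet_Icc]
          refine (Measure.restrict_apply_le _ _).trans (le_of_eq ?_)
          rw [Real.volume_Icc]; congr 1; ring
  have hLHS : ENNReal.ofReal (2 * Real.pi) * ENNReal.ofReal (c ^ 2 * δ * L) ≤ ∫⁻ z, sphMax 2 (fun y => ((AF δ ‖y‖ : ℝ) : ℂ)) (iso2 z) ^ p ∂mu := by
    rw [← hlog, ← nec_log δ0 (by positivity) δ1]
    have hm : Measurable fun r : ℝ => ENNReal.ofReal (c ^ 2 * δ * r⁻¹) := by fun_prop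
    calc _ = ENNReal.ofReal (2 * Real.pi) * ∫⁻ r in Ioi (0:ℝ), (Ioo δ (1/2)).indicator (fun r : ℝ => ENNReal.ofReal (c ^ 2 * δ * r⁻¹)) r := by
          have hsub : Ioo δ (1/2) ⊆ Ioi (0:ℝ) := fun r hr => mem_Ioi.2 (δ0.trans hr.1)
          rw [lintegral_indicator measurableSet_Ioo, Measure.restrict_restrict measurableSet_Ioo, inter_eq_left.2 hsub]
      _ = ∫⁻ z : ℂ, (Ioo δ (1/2)).indicator (fun r : ℝ => ENNReal.ofReal (c ^ 2 * δ * r⁻¹)) ‖z‖ ∂mu := (mu_rad (hm.indicator measurableSet_Ioo)).symm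
      _ ≤ _ := by
          refine lintegral_mono fun z => ?_
          by_cases hz : ‖z‖ ∈ Ioo δ (1/2)
          · have s0 : 0 < ‖z‖ := δ0.trans hz.1
            have hd : δ / ‖z‖ ≤ 1 := (div_le_one s0).2 hz.1.le
            have h1 := nec_LA δ0 hz
            have h2 : ENNReal.ofReal (c * Real.sqrt (δ / ‖z‖)) ≤ sphMax 2 (fun y => ((AF δ ‖y‖ : ℝ) : ℂ)) (iso2 z) := by
              rw [hc]
              refine h1.trans ?_
              have e := sph_eq hAE (fun y => hA0 _) (fun y => hA1 _) (1 - ‖z‖) z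
              simp only [iso2.norm_map] at e
              rw [← e]
              unfold sphMax
              exact le_iSup₂_of_le (1 - ‖z‖) (by linarith [hz.2]) le_rfl
            rw [indicator_of_mem hz]
            have hle : ENNReal.ofReal (c * Real.sqrt (δ / ‖z‖)) ≤ 1 := by
              rw [ENNReal.ofReal_le_one]
              exact mul_le_one₀ c1 (Real.sqrt_nonneg _) (Real.sqrt_le_one.2 hd)
            calc _ = ENNReal.ofReal (c * Real.sqrt (δ / ‖z‖)) ^ (2:ℝ) := by
                  rw [ENNReal.ofReal_rpow_of_nonneg (by positivity) (by norm_num), Real.rpow_two, mul_pow, Real.sq_sqrt (by positivity)]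
                  congr 1; ring
              _ ≤ ENNReal.ofReal (c * Real.sqrt (δ / ‖z‖)) ^ p := ENNReal.rpow_le_rpow_of_exponent_ge hle hp2
              _ ≤ _ := ENNReal.rpow_le_rpow h2 (by linarith)
          · rw [indicator_of_notMem hz]; exact zero_le
  have hfin := (hLHS.trans key).trans (mul_le_mul_right hR _)
  rw [← ENNReal.ofReal_mul (by positivity), ← ENNReal.ofReal_mul (by positivity), ← ENNReal.ofReal_coe_nnreal, ← ENNReal.ofReal_mul C.coe_nonneg, ENNReal.ofReal_le_ofReal_iff (by have := C.2; positivity)] at hfin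
  have e : c ^ 2 * δ * L = (C + 1) * δ := by rw [hL]; field_simp
  rw [e] at hfin
  have : 0 < 2 * Real.pi * δ := by positivity
  linarith

end SM

/-- For `d = 2`, the global spherical maximal function `M` is bounded on
`L^p(|x|^{-1})` if and only if `p > 2`. -/
theorem spherical_maximal_weighted_iff_d2 (p : ℝ) (hp : 1 ≤ p) :
    (∃ C : ℝ≥0, ∀ f : EuclideanSpace ℝ (Fin 2) → ℂ, Measurable f →
        ∫⁻ x, sphMax 2 f x ^ p * ENNReal.ofReal (‖x‖ ^ (-1 : ℝ)) ≤
          C * ∫⁻ x, (‖f x‖₊ : ℝ≥0∞) ^ p * ENNReal.ofReal (‖x‖ ^ (-1 : ℝ))) ↔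
      2 < p := by
  exact ⟨SM.nec hp, SM.suff⟩

end
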